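/- Let M > 0 be fixed. There exists a constant C > 0 (depending on K and M) such that for all x ≥ 2, every integer q with 1 ≤ q ≤ (log x)^{M+1}, and every Dirichlet character χ modulo q, one has |ψ'_K(x, χ∘N)| ≪ x·exp(−C·√(log x)), where the implied constant depends only on K and M. -/

import Mathlib

/-!
Setting: `K` is a number field, Galois over `ℚ`, with ring of integers `𝓞 K`.
We formalize the objects from Smith, "A generalization of the
Barban-Davenport-Halberstam Theorem to number fields".
-/

open NumberField Ideal
open scoped Classical BigOperators

noncomputable section

/-- `𝔞` is a (positive) power of a nonzero prime ideal of `𝓞 K`. -/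
def IsPrimeIdealPower {K : Type*} [Field K] [NumberField K] (𝔞 : Ideal (𝓞 K)) : Prop :=
  ∃ (𝔭 : Ideal (𝓞 K)) (m : ℕ), 𝔭.IsPrime ∧ 𝔭 ≠ ⊥ ∧ 1 ≤ m ∧ 𝔞 = 𝔭 ^ m

/-- The von Mangoldt function on ideals of `𝓞 K`: `Λ_K(𝔭^m) = log N𝔭`, and `0` otherwise.
(For `𝔞 = 𝔭^m` with `𝔭` prime, the radical of `𝔞` is `𝔭`.) -/
def LambdaK (K : Type*) [Field K] [NumberField K] (𝔞 : Ideal (𝓞 K)) : ℝ :=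
  if IsPrimeIdealPower 𝔞 then Real.log (absNorm 𝔞.radical) else 0

/-- `ψ_K(x; q, a) = ∑_{N𝔭^m ≤ x, N𝔭^m ≡ a (mod q)} log N𝔭`. -/
def psiK (K : Type*) [Field K] [NumberField K] (x : ℝ) (q : ℕ) (a : ZMod q) : ℝ :=
  ∑' 𝔞 : Ideal (𝓞 K),
    if (absNorm 𝔞 : ℝ) ≤ x ∧ ((absNorm 𝔞 : ZMod q) = a) then LambdaK K 𝔞 else 0

/-- `G_q`: the image of `Gal(K(ζ_q)/K)` in `(ℤ/qℤ)ˣ` under restriction to `ℚ(ζ_q)` followed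
by the canonical isomorphism `Gal(ℚ(ζ_q)/ℚ) ≅ (ℤ/qℤ)ˣ`; concretely, the range of the map
sending `σ ∈ Gal(K(ζ_q)/K)` to the exponent `a ∈ (ℤ/qℤ)ˣ` with `σ(ζ_q) = ζ_q^a`. -/
def Gq (K : Type*) [Field K] [NumberField K] (q : ℕ) : Subgroup (ZMod q)ˣ :=
  if h : 0 < q then
    haveI : NeZero q := ⟨h.ne'⟩
    haveI : NeZero (((⟨q, h⟩ : ℕ+) : ℕ) : K) := ⟨Nat.cast_ne_zero.mpr h.ne'⟩
    ((IsCyclotomicExtension.zeta_spec (⟨q, h⟩ : ℕ+) K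
        (CyclotomicField (⟨q, h⟩ : ℕ+) K)).autToPow K).range
  else ⊥

/-- `φ_K(q) = |G_q|`. -/
def phiK (K : Type*) [Field K] [NumberField K] (q : ℕ) : ℕ :=
  Nat.card (Gq K q)

/-- `ψ_K(x, χ∘N) = ∑_{N𝔞 ≤ x} χ(N𝔞) Λ_K(𝔞)`. -/
def psiKChi (K : Type*) [Field K] [NumberField K] (x : ℝ) {q : ℕ}
    (χ : DirichletCharacter ℂ q) : ℂ :=
  ∑' 𝔞 : Ideal (𝓞 K),
    if (absNorm 𝔞 : ℝ) ≤ x then χ (absNorm 𝔞 : ZMod q) * (LambdaK K 𝔞 : ℂ) else 0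

/-- `ψ'_K(x, χ∘N)`: equals `ψ_K(x, χ∘N) − x` when `χ` is trivial on `G_q`,
and `ψ_K(x, χ∘N)` otherwise. -/
def psiKChi' (K : Type*) [Field K] [NumberField K] (x : ℝ) {q : ℕ}
    (χ : DirichletCharacter ℂ q) : ℂ :=
  if ∀ a ∈ Gq K q, χ (a : ZMod q) = 1 then psiKChi K x χ - x else psiKChi K x χ

/-- The common residue degree `f(K/ℚ; p)` of the primes of `K` above `p`
(well-defined when `K/ℚ` is Galois): any prime `𝔭` above `p` has `N𝔭 = p^f`. -/
def resDeg (K : Type*) [Field K] [NumberField K] (p : ℕ) : ℕ :=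
  if h : ∃ 𝔭 : Ideal (𝓞 K), 𝔭.IsPrime ∧ 𝔭 ≠ ⊥ ∧ (p : 𝓞 K) ∈ 𝔭 then
    (absNorm h.choose).factorization p
  else 0

/-- `D_K(n)`: the number of prime ideal powers `𝔭^m` of `𝓞 K` with `N𝔭^m = n`. -/
def DK (K : Type*) [Field K] [NumberField K] (n : ℕ) : ℕ :=
  Nat.card {𝔞 : Ideal (𝓞 K) // IsPrimeIdealPower 𝔞 ∧ absNorm 𝔞 = n}

/-- `Λ_K^*(n) = f(K/ℚ; p) · log p` if `n = p^k` is a prime power, and `0` otherwise. -/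
def LambdaStarK (K : Type*) [Field K] [NumberField K] (n : ℕ) : ℝ :=
  if IsPrimePow n then (resDeg K n.minFac : ℝ) * Real.log n.minFac else 0

end

section LatticeCount
open MeasureTheory Set Metric Module Submodule
open scoped Pointwise

/-- A set whose frontier is covered by `C N^k` balls of radius `C/N` for each `N`. -/
def SmallFrontier {E : Type*} [NormedAddCommGroup E] (k : ℕ) (F : Set E) : Prop :=
  ∃ C : ℝ, 0 ≤ C ∧ ∀ N : ℕ, 1 ≤ N → ∃ T : Finset E,
    (T.card : ℝ) ≤ C * (N : ℝ) ^ k ∧ F ⊆ ⋃ c ∈ T, closedBall c (C / N)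

/-- A segment joining a point of `S` to a point outside `S` meets the frontier of `S`. -/
lemma exists_frontier_mem_segment {E : Type*} [NormedAddCommGroup E] [NormedSpace ℝ E]
    {S : Set E} {x y : E} (hx : x ∈ S) (hy : y ∉ S) :
    ∃ z ∈ frontier S, z ∈ segment ℝ x y := by
  by_contra! h
  have hpre : IsPreconnected (segment ℝ x y) := (convex_segment x y).isPreconnected
  have hcov : segment ℝ x y ⊆ interior S ∪ (closure S)ᶜ := by
    intro z hz
    by_cases hz' : z ∈ closure S
    · left
      by_contra hi
      exact h z ⟨hz', hi⟩ hz
    · exact Or.inr hz'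
  obtain ⟨z, hz, hz1, hz2⟩ := hpre _ _ isOpen_interior isClosed_closure.isOpen_compl hcov
    ⟨x, left_mem_segment ℝ x y, by
      by_contra hi
      exact h x ⟨subset_closure hx, hi⟩ (left_mem_segment ℝ x y)⟩
    ⟨y, right_mem_segment ℝ x y, by
      intro hc
      exact h y ⟨hc, fun hi => hy (interior_subset hi)⟩ (right_mem_segment ℝ x y)⟩
  exact hz2 (interior_subset_closure hz1)

lemma dist_le_of_mem_segment {E : Type*} [NormedAddCommGroup E] [NormedSpace ℝ E]
    {x y z : E} (h : z ∈ segment ℝ x y) : dist x z ≤ dist x y ∧ dist y z ≤ dist x y := by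
  have := dist_add_dist_of_mem_segment h
  constructor
  · linarith [dist_nonneg (x := z) (y := y)]
  · rw [dist_comm y z]; linarith [dist_nonneg (x := x) (y := z)]

variable {E : Type*} [NormedAddCommGroup E] [NormedSpace ℝ E] [FiniteDimensional ℝ E]
  [MeasurableSpace E] [BorelSpace E]

/-- Lattice point counting in dilates of a set with a small frontier, uniformly in
translations. -/
theorem lattice_count {ι : Type*} [Fintype ι] (b : Basis ι ℝ E) (μ : Measure E)
    [μ.IsAddHaarMeasure] {S : Set E} (hSb : Bornology.IsBounded S)
    {k : ℕ} (hS : SmallFrontier k (frontier S)) :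
    ∃ C : ℝ, 0 ≤ C ∧ ∀ (v : E) (t : ℝ), 0 < t →
      |({ℓ : E | ℓ ∈ span ℤ (range b) ∧ v + ℓ ∈ t • S}.ncard : ℝ) *
        μ.real (ZSpan.fundamentalDomain b) - t ^ (finrank ℝ E) * μ.real S| ≤ C * (t + 1) ^ k := by
  obtain ⟨C, hC, hT⟩ := hS
  set d : ℝ := ∑ i, ‖b i‖ with hd
  have hd0 : 0 ≤ d := Finset.sum_nonneg fun i _ => norm_nonneg _
  set B : ℝ := μ.real (closedBall (0 : E) (C + d)) with hB
  refine ⟨C * 2 ^ k * B, by positivity, fun v t ht => ?_⟩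
  set P := ZSpan.fundamentalDomain b with hP
  have hPm : MeasurableSet P := ZSpan.fundamentalDomain_measurableSet b
  have hPfin : μ P ≠ ⊤ := (ZSpan.fundamentalDomain_isBounded b).measure_lt_top.ne
  have hdP : ∀ p ∈ P, ‖p‖ ≤ d := fun p hp => by
    rw [← (ZSpan.fract_eq_self (b := b)).2 hp]; exact ZSpan.norm_fract_le b p
  have htS : Bornology.IsBounded (t • S) := hSb.smul₀ t
  set A : Set E := {ℓ : E | ℓ ∈ span ℤ (range b) ∧ v + ℓ ∈ t • S} with hA
  have hAfin : A.Finite := by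
    have h1 : Bornology.IsBounded ((fun x => -v + x) '' (t • S)) := by
      have : ((fun x => -v + x) '' (t • S)) = {-v} + t • S := by simp
      rw [this]
      exact Bornology.isBounded_singleton.add htS
    refine (ZSpan.setFinite_inter b h1).subset ?_
    rintro ℓ ⟨h1, h2⟩
    exact ⟨⟨v + ℓ, h2, by simp⟩, h1⟩
  set U : Set E := ⋃ ℓ ∈ hAfin.toFinset, (fun x => (v + ℓ) + x) '' P with hU
  have hUm : MeasurableSet U :=
    Finset.measurableSet_biUnion _ fun ℓ _ => by
      rw [Set.image_add_left]; exact hPm.preimage (measurable_const_add _)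
  have hμim : ∀ w : E, μ ((fun x => w + x) '' P) = μ P := fun w => by
    rw [Set.image_add_left]; exact measure_preimage_add μ _ _
  have hdisj : (hAfin.toFinset : Set E).PairwiseDisjoint (fun ℓ => (fun x => (v + ℓ) + x) '' P) := by
    intro ℓ hℓ ℓ' hℓ' hne
    rw [Function.onFun, Set.disjoint_left]
    rintro _ ⟨p, hp, rfl⟩ ⟨p', hp', h⟩
    apply hne
    simp only [Finite.coe_toFinset] at hℓ hℓ'
    have hpp : p = p' + (ℓ' - ℓ) := by
      simp only [add_assoc] at h
      have := add_left_cancel h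
      rw [show p' + (ℓ' - ℓ) = (ℓ' + p') - ℓ by abel, this]; abel
    have h2 : ZSpan.fract b p = ZSpan.fract b p' := by
      rw [hpp]; exact ZSpan.fract_add_ZSpan b _ (sub_mem hℓ'.1 hℓ.1)
    rw [(ZSpan.fract_eq_self (b := b)).2 hp, (ZSpan.fract_eq_self (b := b)).2 hp'] at h2
    rw [← h2] at hpp
    have h3 : ℓ' - ℓ = 0 := by simpa using hpp.symm
    exact (sub_eq_zero.1 h3).symm
  have hμU : μ.real U = (A.ncard : ℝ) * μ.real P := by
    rw [hU, measureReal_biUnion_finset hdisj (fun ℓ _ => by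
        rw [Set.image_add_left]; exact hPm.preimage (measurable_const_add _))
        (fun ℓ _ => by rw [hμim]; exact hPfin)]
    simp only [Measure.real, hμim, Finset.sum_const, nsmul_eq_mul]
    rw [Set.ncard_eq_toFinset_card A hAfin]
  have hμS : μ.real (t • S) = t ^ (finrank ℝ E) * μ.real S := by
    rw [Measure.real, Measure.addHaar_smul, ENNReal.toReal_mul, ENNReal.toReal_ofReal (by positivity),
      abs_of_nonneg (by positivity)]
    rfl
  have hN1 : 1 ≤ ⌈t⌉₊ := Nat.one_le_iff_ne_zero.2 (Nat.ceil_pos.2 ht).ne'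
  obtain ⟨T, hTc, hTf⟩ := hT ⌈t⌉₊ hN1
  have hfr : frontier (t • S) = t • frontier S := by
    have := (Homeomorph.smulOfNeZero t ht.ne' (α := E)).image_frontier S
    simpa [Set.image_smul] using this.symm
  set V : Set E := ⋃ c ∈ T, closedBall (t • c) (C + d) with hV
  have key : ∀ x y z : E, x ∈ t • S → y ∉ t • S → dist x y ≤ d → (z = x ∨ z = y) → z ∈ V := by
    intro x y z hx hy hxy hz
    obtain ⟨w, hw, hws⟩ := exists_frontier_mem_segment hx hy
    have hzw : dist z w ≤ d := by
      rcases hz with rfl | rfl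
      · exact (dist_le_of_mem_segment hws).1.trans hxy
      · exact (dist_le_of_mem_segment hws).2.trans hxy
    rw [hfr] at hw
    obtain ⟨u, hu, rfl⟩ := hw
    obtain ⟨c, hc, huc⟩ := mem_iUnion₂.1 (hTf hu)
    refine mem_iUnion₂.2 ⟨c, hc, ?_⟩
    rw [mem_closedBall] at huc ⊢
    have h1 : dist (t • u) (t • c) ≤ C := by
      rw [dist_smul₀, Real.norm_of_nonneg ht.le]
      calc t * dist u c ≤ t * (C / ⌈t⌉₊) := by gcongr
        _ = C * (t / ⌈t⌉₊) := by ring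
        _ ≤ C * 1 := by
          gcongr
          exact div_le_one_of_le₀ (Nat.le_ceil t) (by positivity)
        _ = C := mul_one C
    calc dist z (t • c) ≤ dist z (t • u) + dist (t • u) (t • c) := dist_triangle _ _ _
      _ ≤ d + C := add_le_add hzw h1
      _ = C + d := add_comm _ _
  have hUS : U \ (t • S) ⊆ V := by
    rintro x ⟨hx, hxS⟩
    obtain ⟨ℓ, hℓ, p, hp, rfl⟩ := mem_iUnion₂.1 hx
    have hℓ' : ℓ ∈ A := by simpa using hℓ
    refine key (v + ℓ) (v + ℓ + p) _ hℓ'.2 hxS ?_ (Or.inr rfl)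
    simpa using hdP p hp
  have hSU : (t • S) \ U ⊆ V := by
    rintro x ⟨hx, hxU⟩
    have hxe : x = v + (ZSpan.floor b (x - v) : E) + ZSpan.fract b (x - v) := by
      rw [ZSpan.fract_apply]; abel
    refine key x (v + (ZSpan.floor b (x - v) : E)) _ hx (fun h => hxU ?_) ?_ (Or.inl rfl)
    · refine mem_iUnion₂.2 ⟨(ZSpan.floor b (x - v) : E), ?_, _,
        ZSpan.fract_mem_fundamentalDomain b (x - v), hxe.symm⟩
      simp only [Finite.mem_toFinset]
      exact ⟨SetLike.coe_mem _, h⟩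
    · rw [dist_eq_norm]
      nth_rewrite 1 [hxe]
      rw [add_sub_cancel_left]
      exact ZSpan.norm_fract_le b _
  have hVfin : μ V ≠ ⊤ := by
    refine ((measure_biUnion_finset_le T _).trans_lt ?_).ne
    exact ENNReal.sum_lt_top.2 fun c _ => measure_closedBall_lt_top
  have hUfin : μ U ≠ ⊤ := by
    refine ((measure_biUnion_finset_le _ _).trans_lt ?_).ne
    exact ENNReal.sum_lt_top.2 fun c _ => by rw [hμim]; exact hPfin.lt_top
  have hSfin : μ (t • S) ≠ ⊤ := htS.measure_lt_top.ne
  have hμV : μ.real V ≤ C * 2 ^ k * B * (t + 1) ^ k := by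
    calc μ.real V ≤ ∑ c ∈ T, μ.real (closedBall (t • c) (C + d)) :=
          measureReal_biUnion_finset_le _ _
      _ = T.card * B := by
          simp only [Measure.real, Measure.addHaar_closedBall_center, Finset.sum_const, nsmul_eq_mul, hB]
      _ ≤ (C * (⌈t⌉₊ : ℝ) ^ k) * B := by gcongr
      _ ≤ (C * (2 * (t + 1)) ^ k) * B := by
          gcongr
          have := (Nat.ceil_lt_add_one ht.le).le
          linarith
      _ = C * 2 ^ k * B * (t + 1) ^ k := by rw [mul_pow]; ring
  rw [← hμU, ← hμS, abs_le]
  have e1 : μ.real U ≤ μ.real (t • S) + μ.real V := by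
    calc μ.real U ≤ μ.real ((t • S) ∪ V) := measureReal_mono (fun x hx => by
          by_cases h : x ∈ t • S
          · exact Or.inl h
          · exact Or.inr (hUS ⟨hx, h⟩)) (by finiteness)
      _ ≤ _ := measureReal_union_le _ _
  have e2 : μ.real (t • S) ≤ μ.real U + μ.real V := by
    calc μ.real (t • S) ≤ μ.real (U ∪ V) := measureReal_mono (fun x hx => by
          by_cases h : x ∈ U
          · exact Or.inl h
          · exact Or.inr (hSU ⟨hx, h⟩)) (by finiteness)
      _ ≤ _ := measureReal_union_le _ _
  constructor <;> linarith

end LatticeCount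

section SmallFrontier
open MeasureTheory Set Metric Module Submodule

lemma SmallFrontier.mono {E : Type*} [NormedAddCommGroup E] {k : ℕ} {F G : Set E}
    (hG : SmallFrontier k G) (h : F ⊆ G) : SmallFrontier k F := by
  obtain ⟨C, hC, hT⟩ := hG
  refine ⟨C, hC, fun N hN => ?_⟩
  obtain ⟨T, h1, h2⟩ := hT N hN
  exact ⟨T, h1, h.trans h2⟩

lemma SmallFrontier.iUnion {E : Type*} [NormedAddCommGroup E] {k : ℕ} {ι : Type*} [Fintype ι]
    {F : ι → Set E} (hF : ∀ i, SmallFrontier k (F i)) : SmallFrontier k (⋃ i, F i) := by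
  choose C hC T hT hFT using hF
  refine ⟨∑ i, C i, Finset.sum_nonneg fun i _ => hC i, fun N hN =>
    ⟨Finset.univ.biUnion fun i => T i N hN, ?_, ?_⟩⟩
  · calc ((Finset.univ.biUnion fun i => T i N hN).card : ℝ) ≤ ∑ i, ((T i N hN).card : ℝ) := by
          exact_mod_cast Finset.card_biUnion_le
      _ ≤ ∑ i, C i * (N : ℝ) ^ k := Finset.sum_le_sum fun i _ => hT i N hN
      _ = _ := (Finset.sum_mul _ _ _).symm
  · refine iUnion_subset fun i x hx => ?_
    obtain ⟨c, hc, hxc⟩ := mem_iUnion₂.1 (hFT i N hN hx)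
    refine mem_iUnion₂.2 ⟨c, Finset.mem_biUnion.2 ⟨i, Finset.mem_univ i, hc⟩, ?_⟩
    refine closedBall_subset_closedBall ?_ hxc
    gcongr
    exact Finset.single_le_sum (fun j _ => hC j) (Finset.mem_univ i)

/-- The Lipschitz image of the boundary of a cube has a small frontier. -/
lemma smallFrontier_lipschitz_image {E : Type*} [NormedAddCommGroup E] {ι : Type*} [Fintype ι]
    {Φ : (ι → ℝ) → E} {L : NNReal} (hΦ : LipschitzOnWith L Φ (Icc 0 1)) :
    SmallFrontier (Fintype.card ι - 1) (Φ '' {p | p ∈ Icc 0 1 ∧ ∃ i, p i = 0 ∨ p i = 1}) := by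
  set n := Fintype.card ι
  refine ⟨max L (n * (2 * 2 ^ (n - 1))), by positivity, fun N hN => ?_⟩
  have hN0 : (0 : ℝ) < N := by exact_mod_cast hN
  let G : ι → Fin (N + 1) → Finset (ι → Fin (N + 1)) := fun i a =>
    Fintype.piFinset fun j => if j = i then {a} else Finset.univ
  have hG : ∀ i a, (G i a).card = (N + 1) ^ (n - 1) := fun i a => by
    simp only [G, Fintype.card_piFinset, apply_ite Finset.card, Finset.card_singleton,
      Finset.card_univ, Fintype.card_fin]
    rw [Finset.prod_ite, Finset.prod_const_one, Finset.prod_const, one_mul, Finset.filter_ne',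
      Finset.card_erase_of_mem (Finset.mem_univ i), Finset.card_univ]
  let pt : (ι → Fin (N + 1)) → E := fun g => Φ fun i => (g i : ℝ) / N
  refine ⟨(Finset.univ.biUnion fun i => G i 0 ∪ G i (Fin.last N)).image pt, ?_, ?_⟩
  · calc (((Finset.univ.biUnion fun i => G i 0 ∪ G i (Fin.last N)).image pt).card : ℝ)
        ≤ ((∑ _i : ι, ((N + 1) ^ (n - 1) + (N + 1) ^ (n - 1)) : ℕ) : ℝ) := by
          norm_cast
          refine Finset.card_image_le.trans (Finset.card_biUnion_le.trans ?_)
          refine Finset.sum_le_sum fun i _ => (Finset.card_union_le _ _).trans ?_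
          rw [hG, hG]
      _ = n * (2 * ((N : ℝ) + 1) ^ (n - 1)) := by
          push_cast; rw [Finset.sum_const, Finset.card_univ, nsmul_eq_mul]; ring
      _ ≤ n * (2 * (2 * (N : ℝ)) ^ (n - 1)) := by
          have : (1 : ℝ) ≤ N := by exact_mod_cast hN
          gcongr; linarith
      _ = (n * (2 * 2 ^ (n - 1))) * (N : ℝ) ^ (n - 1) := by rw [mul_pow]; ring
      _ ≤ _ := by gcongr; exact le_max_right _ _
  · rintro _ ⟨p, ⟨hp, i, hi⟩, rfl⟩
    have hpi : ∀ j, 0 ≤ p j ∧ p j ≤ 1 := fun j => ⟨hp.1 j, hp.2 j⟩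
    let g : ι → Fin (N + 1) := fun j => ⟨⌊p j * N⌋₊, by
      have h1 : p j * N ≤ N := by nlinarith [(hpi j).2]
      have := Nat.floor_le_of_le h1
      omega⟩
    refine mem_iUnion₂.2 ⟨pt g, Finset.mem_image.2 ⟨g, Finset.mem_biUnion.2 ⟨i, Finset.mem_univ i, ?_⟩,
      rfl⟩, ?_⟩
    · rw [Finset.mem_union]
      rcases hi with hi | hi
      · left
        refine Fintype.mem_piFinset.2 fun j => ?_
        split_ifs with hj
        · subst hj; simp [g, hi]
        · exact Finset.mem_univ _
      · right
        refine Fintype.mem_piFinset.2 fun j => ?_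
        split_ifs with hj
        · subst hj; simp [g, hi, Fin.ext_iff]
        · exact Finset.mem_univ _
    · have hg : (fun j => (g j : ℝ) / N) ∈ Icc (0 : ι → ℝ) 1 := by
        constructor
        · intro j; simp only [Pi.zero_apply]; positivity
        · intro j
          have := (g j).is_le
          simp only [Pi.one_apply]
          exact div_le_one_of_le₀ (by exact_mod_cast this) hN0.le
      rw [mem_closedBall]
      have hpg : dist p (fun j => (g j : ℝ) / N) ≤ 1 / N := by
        rw [dist_pi_le_iff (by positivity)]
        intro j
        have h1 := Nat.floor_le (mul_nonneg (hpi j).1 hN0.le)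
        have h2 := (Nat.lt_floor_add_one (p j * N)).le
        rw [Real.dist_eq, abs_le]
        simp only [g]
        constructor
        · have : (⌊p j * N⌋₊ : ℝ) / N ≤ p j := by rw [div_le_iff₀ hN0]; exact h1
          have h3 : 0 ≤ 1 / (N : ℝ) := by positivity
          linarith
        · rw [tsub_le_iff_right, ← add_div, le_div_iff₀ hN0]; linarith
      calc dist (Φ p) (pt g) ≤ L * dist p (fun j => (g j : ℝ) / N) := hΦ.dist_le_mul _ hp _ hg
        _ ≤ L * (1 / N) := by gcongr
        _ = L / N := by ring
        _ ≤ _ := by gcongr; exact le_max_left _ _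

/-- `C¹` version of `smallFrontier_lipschitz_image`. -/
lemma smallFrontier_contDiff_image {E : Type*} [NormedAddCommGroup E] [NormedSpace ℝ E] {ι : Type*}
    [Fintype ι] {Φ : (ι → ℝ) → E} (hΦ : ContDiff ℝ 1 Φ) :
    SmallFrontier (Fintype.card ι - 1) (Φ '' {p | p ∈ Icc 0 1 ∧ ∃ i, p i = 0 ∨ p i = 1}) := by
  obtain ⟨L, hL⟩ := LocallyLipschitzOn.exists_lipschitzOnWith_of_compact
    (isCompact_Icc (a := (0 : ι → ℝ)) (b := 1)) hΦ.locallyLipschitz.locallyLipschitzOn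
  exact smallFrontier_lipschitz_image hL

end SmallFrontier

section NormLeOne
open MeasureTheory Set Metric Module NumberField NumberField.mixedEmbedding
  NumberField.mixedEmbedding.fundamentalCone NumberField.InfinitePlace
  NumberField.Units.dirichletUnitTheorem

variable (K : Type*) [Field K] [NumberField K]

/-- The index set of the `n` real coordinates used to parametrize `normLeOne K`. -/
abbrev ParamIndex := InfinitePlace K ⊕ {w : InfinitePlace K // IsComplex w}

lemma card_paramIndex : Fintype.card (ParamIndex K) = finrank ℚ K := by
  rw [← card_add_two_mul_card_eq_rank, Fintype.card_sum, card_eq_nrRealPlaces_add_nrComplexPlaces,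
    nrComplexPlaces]
  ring

/-- The radial part of the parametrization of `normLeOne K`. -/
noncomputable def radialParam (a : InfinitePlace K → ℝ) (w : InfinitePlace K) : ℝ :=
  a w₀ * expMapBasis (fun i => if i = w₀ then 0 else a i) w

/-- The parametrization of `normLeOne K`, for a choice of signs at the real places. -/
noncomputable def boxParam (ε : {w : InfinitePlace K // IsReal w} → Bool) (p : ParamIndex K → ℝ) :
    mixedSpace K :=
  (fun w => (if ε w then 1 else -1) * radialParam K (fun i => p (Sum.inl i)) w,
   fun w => (radialParam K (fun i => p (Sum.inl i)) w : ℂ) *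
    Complex.exp ((((2 * p (Sum.inr w) - 1) * Real.pi : ℝ) : ℂ) * Complex.I))

lemma contDiff_radialParam (w : InfinitePlace K) :
    ContDiff ℝ 1 (fun p : ParamIndex K → ℝ => radialParam K (fun i => p (Sum.inl i)) w) := by
  unfold radialParam
  simp only [expMapBasis_apply', Pi.smul_apply, if_true, Real.exp_zero, one_smul]
  refine ContDiff.mul (by fun_prop) (contDiff_prod fun i _ => ?_)
  have hpos : 0 < w (Units.fundSystem K (equivFinRank.symm i)) := by
    rw [InfinitePlace.pos_iff]
    exact_mod_cast (Units.coe_ne_zero _)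
  simp only [if_neg i.2, Real.rpow_def_of_pos hpos]
  fun_prop

lemma contDiff_boxParam (ε : {w : InfinitePlace K // IsReal w} → Bool) :
    ContDiff ℝ 1 (boxParam K ε) := by
  unfold boxParam
  refine ContDiff.prodMk (contDiff_pi.2 fun w => ?_) (contDiff_pi.2 fun w => ?_)
  · exact contDiff_const.mul (contDiff_radialParam K w)
  · refine ContDiff.mul (Complex.ofRealCLM.contDiff.comp (contDiff_radialParam K w)) ?_
    refine ContDiff.cexp (ContDiff.mul (Complex.ofRealCLM.contDiff.comp ?_) contDiff_const)
    exact ((contDiff_const.mul (by fun_prop)).sub contDiff_const).mul contDiff_const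

/-- Points whose absolute values are parametrized are themselves parametrized. -/
lemma exists_boxParam_eq {x : mixedSpace K} {a : InfinitePlace K → ℝ} (ha : a ∈ Icc 0 1)
    (h : normAtAllPlaces x = radialParam K a) :
    ∃ ε p, p ∈ Icc 0 1 ∧ (∀ i, p (Sum.inl i) = a i) ∧ boxParam K ε p = x := by
  refine ⟨fun w => decide (0 ≤ x.1 w), Sum.elim a fun w => ((x.2 w).arg / Real.pi + 1) / 2,
    ⟨?_, ?_⟩, fun i => rfl, ?_⟩
  · rintro (i | w)
    · exact ha.1 i
    · have := Complex.neg_pi_lt_arg (x.2 w)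
      have h2 : -1 ≤ (x.2 w).arg / Real.pi := by
        rw [le_div_iff₀ Real.pi_pos]; linarith
      simp only [Pi.zero_apply, Sum.elim_inr]; linarith
  · rintro (i | w)
    · exact ha.2 i
    · have := Complex.arg_le_pi (x.2 w)
      have h2 : (x.2 w).arg / Real.pi ≤ 1 := div_le_one_of_le₀ this Real.pi_pos.le
      simp only [Pi.one_apply, Sum.elim_inr]; linarith
  · refine Prod.ext (funext fun w => ?_) (funext fun w => ?_)
    · have hw := congrFun h w.1
      simp only [boxParam, Sum.elim_inl]
      rw [show (fun i => a i) = a from rfl, ← hw, normAtAllPlaces_apply,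
        normAtPlace_apply_of_isReal w.2]
      by_cases h0 : 0 ≤ x.1 w
      · simp [h0]
      · simp [h0, Real.norm_of_nonpos (le_of_not_ge h0)]
    · have hw := congrFun h w.1
      simp only [boxParam, Sum.elim_inl, Sum.elim_inr]
      rw [show (fun i => a i) = a from rfl, ← hw, normAtAllPlaces_apply,
        normAtPlace_apply_of_isComplex w.2]
      rw [show (2 * (((x.2 w).arg / Real.pi + 1) / 2) - 1) * Real.pi = (x.2 w).arg by
        field_simp; ring]
      exact Complex.norm_mul_exp_arg_mul_I _

/-- The points of `normLeOne K` whose real coordinates have a product of given sign. -/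
def normLeOneSign (s : ℝ) : Set (mixedSpace K) :=
  {x | x ∈ normLeOne K ∧ 0 < s * ∏ w, x.1 w}

lemma isBounded_normLeOneSign (s : ℝ) : Bornology.IsBounded (normLeOneSign K s) :=
  (isBounded_normLeOne K).subset fun _ hx => hx.1

lemma smallFrontier_normLeOneSign (s : ℝ) :
    SmallFrontier (finrank ℚ K - 1) (frontier (normLeOneSign K s)) := by
  rw [← card_paramIndex]
  refine (SmallFrontier.iUnion fun ε => smallFrontier_contDiff_image (contDiff_boxParam K ε)).mono ?_
  intro x hx
  have hcl : x ∈ closure (normLeOne K) := closure_mono (fun y hy => hy.1) hx.1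
  obtain ⟨c, hc, _, ⟨y, hy, rfl⟩, hxy⟩ := closure_normLeOne_subset K hcl
  have hy' : ∀ w, w ≠ w₀ → y w ∈ Icc (0 : ℝ) 1 := fun w hw => by
    simpa [hw] using hy w (Set.mem_univ _)
  have hy0 : y w₀ = 0 := by simpa using hy w₀ (Set.mem_univ _)
  let a : InfinitePlace K → ℝ := fun i => if i = w₀ then c else y i
  have haI : a ∈ Icc (0 : InfinitePlace K → ℝ) 1 := by
    constructor <;> intro i <;> by_cases hi : i = w₀
    · simpa [a, hi] using hc.1
    · simpa [a, hi] using (hy' i hi).1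
    · simpa [a, hi] using hc.2
    · simpa [a, hi] using (hy' i hi).2
  have harg : (fun i => if i = w₀ then 0 else a i) = y := by
    funext i
    by_cases hi : i = w₀
    · simp [hi, hy0]
    · simp [a, hi]
  have hrad : normAtAllPlaces x = radialParam K a := by
    rw [← hxy]
    funext w
    simp only [radialParam, harg, a, if_true, Pi.smul_apply, smul_eq_mul]
  obtain ⟨ε, p, hp, hpa, hpx⟩ := exists_boxParam_eq K haI hrad
  refine mem_iUnion.2 ⟨ε, p, ⟨hp, ?_⟩, hpx⟩
  by_contra! hne
  have hc0 : 0 < c := lt_of_le_of_ne hc.1 (by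
    have := (hne (Sum.inl w₀)).1; rw [hpa] at this; simpa [a] using this.symm)
  have hc1 : c < 1 := lt_of_le_of_ne hc.2 (by
    have := (hne (Sum.inl w₀)).2; rw [hpa] at this; simpa [a] using this)
  have hx_int : x ∈ interior (normLeOne K) := by
    refine subset_interior_normLeOne K ⟨fun i => if i = w₀ then Real.log c else y i, ?_, ?_⟩
    · rw [interior_paramSet, Set.mem_univ_pi]
      intro w
      split_ifs with hw
      · exact Real.log_neg hc0 hc1
      · have h1 := hne (Sum.inl w)
        rw [hpa] at h1
        simp only [a, if_neg hw] at h1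
        exact ⟨lt_of_le_of_ne (hy' w hw).1 h1.1.symm, lt_of_le_of_ne (hy' w hw).2 h1.2⟩
    · rw [expMapBasis_apply'', if_pos rfl, Real.exp_log hc0, ← hxy]
      congr 2
      funext i
      by_cases hi : i = w₀
      · simp [hi, hy0]
      · simp [hi]
  have hne0 : ∏ w, x.1 w ≠ 0 := by
    rw [Finset.prod_ne_zero_iff]
    intro w _ h0
    have hw := congrFun hrad w.1
    rw [normAtAllPlaces_apply, normAtPlace_apply_of_isReal w.2, h0, norm_zero] at hw
    have : 0 < radialParam K a w.1 := by
      simp only [radialParam, a, if_true]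
      exact mul_pos hc0 (expMapBasis_pos _ _)
    linarith
  have hcont : Continuous fun z : mixedSpace K => s * ∏ w, z.1 w := by fun_prop
  have hnn : 0 ≤ s * ∏ w, x.1 w := by
    have : closure (normLeOneSign K s) ⊆ {z | 0 ≤ s * ∏ w, z.1 w} :=
      closure_minimal (fun z hz => hz.2.le) (isClosed_le continuous_const hcont)
    exact this hx.1
  by_cases hs : s = 0
  · have hemp : normLeOneSign K s = ∅ := by
      ext z; simp [normLeOneSign, hs]
    rw [hemp] at hx
    simp at hx
  · apply hx.2
    have hpos : 0 < s * ∏ w, x.1 w := lt_of_le_of_ne hnn (mul_ne_zero hs hne0).symm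
    have : interior (normLeOne K) ∩ {z | 0 < s * ∏ w, z.1 w} ⊆ normLeOneSign K s :=
      fun z hz => ⟨interior_subset hz.1, hz.2⟩
    exact interior_maximal this
      (isOpen_interior.inter (isOpen_lt continuous_const hcont)) ⟨hx_int, hpos⟩

end NormLeOne

section WeightedCount
open MeasureTheory Set Metric Module
open scoped Pointwise

/-- Lattice points with coordinates in a fixed residue class, as a translated lattice. -/
lemma card_residue_class {E : Type*} [NormedAddCommGroup E] [NormedSpace ℝ E] {ι : Type*} [Fintype ι] (b : Basis ι ℝ E) {S : Set E} {m : ℕ} [NeZero m]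
    {t : ℝ} (Z : Finset (ι → ℤ)) (hZ : ∀ z, z ∈ Z ↔ ∑ i, (z i : ℝ) • b i ∈ t • S)
    (k : ι → ZMod m) :
    ((Z.filter fun z => (fun i => (z i : ZMod m)) = k).card : ℝ) =
      {ℓ : E | ℓ ∈ Submodule.span ℤ (range b) ∧
        (m : ℝ)⁻¹ • (∑ i, ((k i).val : ℝ) • b i) + ℓ ∈ (t / m) • S}.ncard := by
  have hm : (m : ℝ) ≠ 0 := Nat.cast_ne_zero.2 (NeZero.ne m)
  have hinj : Function.Injective fun z : ι → ℤ => ∑ i, (z i : ℝ) • b i := by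
    intro z z' h
    funext i
    have := congrArg (fun y => b.repr y i) h
    simpa [Finsupp.single_apply] using this
  set Y : Set (ι → ℤ) := {y | (fun i => ((k i).val : ℤ) + m * y i) ∈ Z} with hY
  have h1 : {ℓ : E | ℓ ∈ Submodule.span ℤ (range b) ∧
      (m : ℝ)⁻¹ • (∑ i, ((k i).val : ℝ) • b i) + ℓ ∈ (t / m) • S} =
      (fun z : ι → ℤ => ∑ i, (z i : ℝ) • b i) '' Y := by
    have hiff : ∀ y : ι → ℤ, y ∈ Y ↔ (m : ℝ)⁻¹ • (∑ i, ((k i).val : ℝ) • b i) +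
        ∑ i, (y i : ℝ) • b i ∈ (t / m) • S := by
      intro y
      rw [hY, Set.mem_ofPred_eq, hZ]
      have : ∑ i, (((((k i).val : ℤ) + m * y i : ℤ)) : ℝ) • b i = (m : ℝ) •
          ((m : ℝ)⁻¹ • (∑ i, ((k i).val : ℝ) • b i) + ∑ i, (y i : ℝ) • b i) := by
        rw [smul_add, smul_smul, mul_inv_cancel₀ hm, one_smul, Finset.smul_sum,
          ← Finset.sum_add_distrib]
        refine Finset.sum_congr rfl fun i _ => ?_
        push_cast
        rw [add_smul, mul_smul]
      rw [this, show t • S = (m : ℝ) • ((t / m) • S) by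
        rw [smul_smul, mul_div_cancel₀ _ hm], Set.smul_mem_smul_set_iff₀ hm]
    ext ℓ
    constructor
    · rintro ⟨hℓ, h⟩
      obtain ⟨y, rfl⟩ := (Submodule.mem_span_range_iff_exists_fun ℤ).1 hℓ
      refine ⟨y, (hiff y).2 ?_, ?_⟩
      · simpa [← Int.cast_smul_eq_zsmul ℝ] using h
      · simp [← Int.cast_smul_eq_zsmul ℝ]
    · rintro ⟨y, hy, rfl⟩
      refine ⟨(Submodule.mem_span_range_iff_exists_fun ℤ).2 ⟨y, ?_⟩, (hiff y).1 hy⟩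
      simp [← Int.cast_smul_eq_zsmul ℝ]
  have hinj2 : Function.Injective fun (y : ι → ℤ) (i : ι) => ((k i).val : ℤ) + m * y i := by
    intro y y' h
    funext i
    have := congrFun h i
    simpa [NeZero.ne m] using this
  have h2 : ((Z.filter fun z => (fun i => (z i : ZMod m)) = k : Finset (ι → ℤ)) : Set (ι → ℤ)) =
      (fun (y : ι → ℤ) (i : ι) => ((k i).val : ℤ) + m * y i) '' Y := by
    ext z
    simp only [Finset.coe_filter, Set.mem_ofPred_eq]
    constructor
    · rintro ⟨hz, hk⟩
      have hdiv : ∀ i, ∃ y, z i = ((k i).val : ℤ) + m * y := by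
        intro i
        have h3 : ((z i - (k i).val : ℤ) : ZMod m) = 0 := by
          have := congrFun hk i
          simp [← this]
        obtain ⟨y, hy⟩ := (ZMod.intCast_zmod_eq_zero_iff_dvd _ m).1 h3
        exact ⟨y, by linarith⟩
      choose y hy using hdiv
      have hzy : (fun i => ((k i).val : ℤ) + m * y i) = z := funext fun i => (hy i).symm
      exact ⟨y, by rw [hY, Set.mem_ofPred_eq, hzy]; exact hz, hzy⟩
    · rintro ⟨y, hy, rfl⟩
      exact ⟨hy, by funext i; simp⟩
  rw [h1, Set.ncard_image_of_injective _ hinj, ← Set.ncard_coe_finset, h2,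
    Set.ncard_image_of_injective _ hinj2]

/-- Counting lattice points in dilates, weighted by a function of the coordinates mod `m`. -/
theorem weighted_lattice_count {E : Type*} [NormedAddCommGroup E] [NormedSpace ℝ E]
    [FiniteDimensional ℝ E] [MeasurableSpace E] [BorelSpace E] {ι : Type*} [Fintype ι] (b : Basis ι ℝ E)
    {S : Set E} (hSb : Bornology.IsBounded S)
    (hS : SmallFrontier (finrank ℝ E - 1) (frontier S)) :
    ∃ C : ℝ, 0 ≤ C ∧ ∀ (m : ℕ) [NeZero m] (g : (ι → ZMod m) → ℂ), (∀ k, ‖g k‖ ≤ 1) →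
      ∃ c : ℂ, ‖c‖ ≤ C ∧ ∀ t : ℝ, 0 < t → ∀ Z : Finset (ι → ℤ),
        (∀ z, z ∈ Z ↔ ∑ i, (z i : ℝ) • b i ∈ t • S) →
        ‖∑ z ∈ Z, g (fun i => (z i : ZMod m)) - c * (t : ℂ) ^ (finrank ℝ E)‖ ≤
          C * (m : ℝ) ^ (finrank ℝ E) * (t / m + 1) ^ (finrank ℝ E - 1) := by
  set n := finrank ℝ E with hn
  let μ : Measure E := Measure.addHaar
  obtain ⟨C0, hC0, hcount⟩ := lattice_count b μ hSb hS
  set p := μ.real (ZSpan.fundamentalDomain b) with hp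
  have hp0 : 0 < p := ENNReal.toReal_pos (ZSpan.measure_fundamentalDomain_ne_zero b)
    (ZSpan.fundamentalDomain_isBounded b).measure_lt_top.ne
  have hcard : Fintype.card ι = n := (finrank_eq_card_basis b).symm
  refine ⟨max (C0 / p) (μ.real S / p), le_max_of_le_left (by positivity), fun m _ g hg => ?_⟩
  have hm : (0 : ℝ) < m := Nat.cast_pos.2 (Nat.pos_of_ne_zero (NeZero.ne m))
  have hK : (Fintype.card (ι → ZMod m) : ℝ) = (m : ℝ) ^ n := by
    simp [ZMod.card, hcard]
  refine ⟨∑ k : ι → ZMod m, g k * ((μ.real S / p / (m : ℝ) ^ n : ℝ) : ℂ), ?_, fun t ht Z hZ => ?_⟩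
  · calc ‖∑ k : ι → ZMod m, g k * ((μ.real S / p / (m : ℝ) ^ n : ℝ) : ℂ)‖
        ≤ ∑ k : ι → ZMod m, 1 * (μ.real S / p / (m : ℝ) ^ n) := by
          refine norm_sum_le_of_le _ fun k _ => ?_
          rw [norm_mul, Complex.norm_real, Real.norm_of_nonneg (by positivity)]
          gcongr
          exact hg k
      _ = μ.real S / p := by
          rw [Finset.sum_const, Finset.card_univ, nsmul_eq_mul, hK]; field_simp
      _ ≤ _ := le_max_right _ _
  · have hsum : ∑ z ∈ Z, g (fun i => (z i : ZMod m)) = ∑ k : ι → ZMod m, g k *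
        ((Z.filter fun z => (fun i => (z i : ZMod m)) = k).card : ℂ) := by
      rw [← Finset.sum_fiberwise Z fun (z : ι → ℤ) (i : ι) => (z i : ZMod m)]
      refine Finset.sum_congr rfl fun k _ => ?_
      rw [Finset.sum_congr rfl (g := fun _ => g k) (fun z hz => by rw [(Finset.mem_filter.1 hz).2]),
        Finset.sum_const, nsmul_eq_mul, mul_comm]
    rw [hsum, Finset.sum_mul, ← Finset.sum_sub_distrib]
    calc _ ≤ ∑ k : ι → ZMod m, C0 / p * (t / m + 1) ^ (n - 1) := by
          refine norm_sum_le_of_le _ fun k _ => ?_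
          rw [mul_assoc, ← mul_sub, norm_mul]
          refine (mul_le_of_le_one_left (norm_nonneg _) (hg k)).trans ?_
          have h1 := hcount ((m : ℝ)⁻¹ • (∑ i, ((k i).val : ℝ) • b i)) (t / m) (by positivity)
          rw [← card_residue_class b Z hZ k] at h1
          rw [show (((Z.filter fun z => (fun i => (z i : ZMod m)) = k).card : ℂ) -
            ((μ.real S / p / (m : ℝ) ^ n : ℝ) : ℂ) * (t : ℂ) ^ n) =
            ((((Z.filter fun z => (fun i => (z i : ZMod m)) = k).card * p -
              (t / m) ^ n * μ.real S) / p : ℝ) : ℂ) by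
              push_cast
              have : (p : ℂ) ≠ 0 := by exact_mod_cast hp0.ne'
              have : (m : ℂ) ≠ 0 := by exact_mod_cast hm.ne'
              rw [div_pow]
              field_simp]
          rw [Complex.norm_real, norm_div, Real.norm_of_nonneg hp0.le, Real.norm_eq_abs,
            div_mul_eq_mul_div]
          gcongr
      _ = C0 / p * (m : ℝ) ^ n * (t / m + 1) ^ (n - 1) := by
          rw [Finset.sum_const, Finset.card_univ, nsmul_eq_mul, hK]; ring
      _ ≤ _ := by gcongr; exact le_max_left _ _

end WeightedCount

section NormLemmas
open Module NumberField NumberField.mixedEmbedding NumberField.InfinitePlace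
variable (K : Type*) [Field K] [NumberField K]

/-- The norm form is periodic modulo `m`. -/
lemma norm_add_mul_cast (m : ℕ) (α β : 𝓞 K) :
    ((Algebra.norm ℤ (α + m * β) : ℤ) : ZMod m) = ((Algebra.norm ℤ α : ℤ) : ZMod m) := by
  have b := RingOfIntegers.basis K
  rw [Algebra.norm_eq_matrix_det b, Algebra.norm_eq_matrix_det b]
  have h : ∀ M : Matrix (Free.ChooseBasisIndex ℤ (𝓞 K)) (Free.ChooseBasisIndex ℤ (𝓞 K)) ℤ,
      ((M.det : ℤ) : ZMod m) = (M.map (Int.castRingHom (ZMod m))).det := fun M => by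
    have := RingHom.map_det (Int.castRingHom (ZMod m)) M
    simpa using this
  rw [h, h]
  congr 1
  ext i j
  rw [← nsmul_eq_mul, map_add, map_nsmul]
  simp [Matrix.smul_apply, -nsmul_eq_mul]

/-- The norm as the product of the real coordinates and the squared moduli of the complex
coordinates of the mixed embedding. -/
lemma norm_eq_prod_real_mul_prod_complex (x : K) :
    ((Algebra.norm ℚ x : ℚ) : ℝ) = (∏ w, (mixedEmbedding K x).1 w) *
      ∏ w, ‖(mixedEmbedding K x).2 w‖ ^ 2 := by
  have h := Algebra.norm_eq_prod_embeddings ℚ ℂ x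
  rw [← Fintype.prod_equiv (RingHom.equivRatAlgHom K ℂ) (fun f => f x)
      (fun φ => φ x) fun _ => by simp [RingHom.equivRatAlgHom_apply],
    ← Finset.prod_fiberwise Finset.univ InfinitePlace.mk (fun φ => φ x),
    ← Fintype.prod_subtype_mul_prod_subtype (fun w : InfinitePlace K => IsReal w)] at h
  have hreal : ∀ w : {w : InfinitePlace K // IsReal w},
      (∏ φ : K →+* ℂ with InfinitePlace.mk φ = w.1, φ x) = (((mixedEmbedding K x).1 w : ℝ) : ℂ) := by
    intro w
    have hset : (Finset.univ.filter fun φ : K →+* ℂ => InfinitePlace.mk φ = w.1) = {w.1.embedding} := by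
      ext φ
      simp only [Finset.mem_filter, Finset.mem_univ, true_and, Finset.mem_singleton]
      constructor
      · intro hφ
        rw [← mk_embedding w.1, mk_eq_iff] at hφ
        rcases hφ with hφ | hφ
        · exact hφ
        · rw [← (conjugate_embedding_eq_of_isReal w.2)]
          have := congrArg ComplexEmbedding.conjugate hφ
          simpa using this
      · rintro rfl; exact mk_embedding _
    rw [hset, Finset.prod_singleton]
    simp [mixedEmbedding_apply_isReal, embedding_of_isReal_apply]
  have hcomplex : ∀ w : {w : InfinitePlace K // ¬ IsReal w},
      (∏ φ : K →+* ℂ with InfinitePlace.mk φ = w.1, φ x) =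
        ((‖(mixedEmbedding K x).2 ⟨w.1, not_isReal_iff_isComplex.1 w.2⟩‖ ^ 2 : ℝ) : ℂ) := by
    intro w
    have hw := not_isReal_iff_isComplex.1 w.2
    have hne : w.1.embedding ≠ ComplexEmbedding.conjugate w.1.embedding := by
      have := (isComplex_iff.1 hw)
      rw [ComplexEmbedding.isReal_iff] at this
      exact fun h => this h.symm
    have hset : (Finset.univ.filter fun φ : K →+* ℂ => InfinitePlace.mk φ = w.1) =
        {w.1.embedding, ComplexEmbedding.conjugate w.1.embedding} := by
      ext φ
      simp only [Finset.mem_filter, Finset.mem_univ, true_and, Finset.mem_insert,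
        Finset.mem_singleton]
      constructor
      · intro hφ
        rw [← mk_embedding w.1, mk_eq_iff] at hφ
        rcases hφ with hφ | hφ
        · exact Or.inl hφ
        · right
          have := congrArg ComplexEmbedding.conjugate hφ
          simpa using this
      · rintro (rfl | rfl)
        · exact mk_embedding _
        · rw [mk_conjugate_eq, mk_embedding]
    rw [hset, Finset.prod_pair hne, mixedEmbedding_apply_isComplex, ComplexEmbedding.conjugate_coe_eq,
      Complex.mul_conj, Complex.normSq_eq_norm_sq]
  rw [Finset.prod_congr rfl (fun w _ => hreal w), Finset.prod_congr rfl (fun w _ => hcomplex w)] at h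
  have h2 : (∏ w : {w : InfinitePlace K // ¬ IsReal w},
      (((‖(mixedEmbedding K x).2 ⟨w.1, not_isReal_iff_isComplex.1 w.2⟩‖ ^ 2 : ℝ)) : ℂ)) =
      ∏ w, ((‖(mixedEmbedding K x).2 w‖ ^ 2 : ℝ) : ℂ) :=
    Fintype.prod_equiv (Equiv.subtypeEquivRight fun w => not_isReal_iff_isComplex) _ _ fun w => rfl
  rw [h2, eq_ratCast] at h
  exact_mod_cast h

/-- The sign of the norm is the sign of the product of the real coordinates. -/
lemma norm_pos_iff_prod_real_pos {α : 𝓞 K} (s : ℤ) (hα : α ≠ 0) :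
    0 < (s : ℝ) * ∏ w, (mixedEmbedding K (α : K)).1 w ↔ 0 < s * Algebra.norm ℤ α := by
  have h := norm_eq_prod_real_mul_prod_complex K (α : K)
  have hc : 0 < ∏ w, ‖(mixedEmbedding K (α : K)).2 w‖ ^ 2 := by
    refine Finset.prod_pos fun w _ => ?_
    rw [mixedEmbedding_apply_isComplex]
    have : w.1.embedding (α : K) ≠ 0 := by
      rw [map_ne_zero]; exact_mod_cast hα
    positivity
  rw [← Algebra.coe_norm_int] at h
  push_cast at h
  rw [← @Int.cast_pos ℝ]
  push_cast
  rw [h, ← mul_assoc]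
  exact (mul_pos_iff_of_pos_right hc).symm

end NormLemmas

section ClassCount
open Module NumberField NumberField.mixedEmbedding NumberField.InfinitePlace
  NumberField.mixedEmbedding.fundamentalCone NumberField.Units
open scoped nonZeroDivisors Pointwise
variable (K : Type*) [Field K] [NumberField K]

/-- Number of ideals of norm `n` in a given ideal class. -/
noncomputable def classCount (C : ClassGroup (𝓞 K)) (n : ℕ) : ℕ :=
  Nat.card {I : (Ideal (𝓞 K))⁰ // absNorm (I : Ideal (𝓞 K)) = n ∧ ClassGroup.mk0 I = C}

variable {K}

lemma classCount_eq {C : ClassGroup (𝓞 K)} {J : (Ideal (𝓞 K))⁰} (hJ : ClassGroup.mk0 J = C⁻¹)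
    (n : ℕ) :
    classCount K C n = Nat.card {I : (Ideal (𝓞 K))⁰ // (J : Ideal (𝓞 K)) ∣ I ∧
      Submodule.IsPrincipal (I : Ideal (𝓞 K)) ∧
        absNorm (I : Ideal (𝓞 K)) = n * absNorm (J : Ideal (𝓞 K))} := by
  unfold classCount
  simp_rw [← nonZeroDivisors_dvd_iff_dvd_coe]
  refine Nat.card_congr ?_
  refine ((Equiv.dvd J).subtypeEquiv fun I ↦ ?_).trans
    (Equiv.subtypeSubtypeEquivSubtypeInter (fun I : (Ideal (𝓞 K))⁰ ↦ J ∣ I) _)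
  rw [← ClassGroup.mk0_eq_one_iff (SetLike.coe_mem _)]
  simp_rw [Equiv.dvd_apply, Submonoid.coe_mul, ← Submonoid.mul_def, _root_.map_mul, hJ,
    inv_mul_eq_one, mul_comm n, eq_comm (a := C), and_comm, and_congr_left_iff]
  exact fun _ ↦ (Nat.mul_right_inj (absNorm_ne_zero_of_nonZeroDivisors J)).symm

/-- A `ℤ`-basis of an ideal whose image is a real basis of the mixed space. -/
lemma exists_ideal_basis (J : (Ideal (𝓞 K))⁰) : ∃ (ι : Type) (_ : Fintype ι)
    (b : Basis ι ℝ (mixedSpace K)) (β : ι → 𝓞 K), (∀ i, β i ∈ (J : Ideal (𝓞 K))) ∧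
      (∀ i, b i = mixedEmbedding K (β i : K)) ∧
      (∀ α ∈ (J : Ideal (𝓞 K)), ∃ z : ι → ℤ, α = ∑ i, (z i : 𝓞 K) * β i) := by
  let I := FractionalIdeal.mk0 K J
  let b := fractionalIdealLatticeBasis K I
  have hmem : ∀ y ∈ (I : FractionalIdeal (𝓞 K)⁰ K), ∃ a : 𝓞 K, a ∈ (J : Ideal (𝓞 K)) ∧ (a : K) = y := by
    intro y hy
    rw [FractionalIdeal.coe_mk0, FractionalIdeal.mem_coeIdeal] at hy
    exact hy
  have hmem' : ∀ a ∈ (J : Ideal (𝓞 K)), (a : K) ∈ (I : FractionalIdeal (𝓞 K)⁰ K) := by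
    intro a ha
    rw [FractionalIdeal.coe_mk0, FractionalIdeal.mem_coeIdeal]
    exact ⟨a, ha, rfl⟩
  have hB : ∀ i, ∃ a : 𝓞 K, a ∈ (J : Ideal (𝓞 K)) ∧ (a : K) = basisOfFractionalIdeal K I i := by
    intro i
    refine hmem _ ?_
    have := (mem_span_basisOfFractionalIdeal K (I := I)).1 (Submodule.subset_span ⟨i, rfl⟩)
    exact this
  choose β hβ hβe using hB
  let e := Fintype.equivFin (Free.ChooseBasisIndex ℤ (I : FractionalIdeal (𝓞 K)⁰ K))
  refine ⟨Fin (Fintype.card (Free.ChooseBasisIndex ℤ (I : FractionalIdeal (𝓞 K)⁰ K))), inferInstance,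
    b.reindex e, fun i => β (e.symm i), fun i => hβ _, fun i => ?_, fun α hα => ?_⟩
  · rw [Basis.reindex_apply, fractionalIdealLatticeBasis_apply, hβe]
  · have := (mem_span_basisOfFractionalIdeal K (I := I)).2 (hmem' α hα)
    obtain ⟨z, hz⟩ := (Submodule.mem_span_range_iff_exists_fun ℤ).1 this
    refine ⟨fun i => z (e.symm i), ?_⟩
    apply RingOfIntegers.ext
    rw [← hz, Equiv.sum_comp e.symm (fun i => (z i : 𝓞 K) * β i)]
    simp [hβe]

lemma mem_smul_normLeOneSign {t : ℝ} (ht : 0 < t) (s : ℝ) (y : mixedSpace K) :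
    y ∈ t • normLeOneSign K s ↔ y ∈ fundamentalCone K ∧
      mixedEmbedding.norm y ≤ t ^ finrank ℚ K ∧ 0 < s * ∏ w, y.1 w := by
  rw [Set.mem_smul_set_iff_inv_smul_mem₀ ht.ne', normLeOneSign, Set.mem_ofPred_eq, mem_normLeOne,
    smul_mem_iff_mem (inv_ne_zero ht.ne'), mixedEmbedding.norm_smul, abs_of_pos (inv_pos.2 ht),
    inv_pow, inv_mul_le_iff₀ (by positivity), mul_one, and_assoc]
  have : s * ∏ w, (t⁻¹ • y).1 w = (∏ _w : {w : InfinitePlace K // IsReal w}, t⁻¹) *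
      (s * ∏ w, y.1 w) := by
    simp only [Prod.smul_fst, Pi.smul_apply, smul_eq_mul, Finset.prod_mul_distrib]
    ring
  rw [this, mul_pos_iff_of_pos_left (Finset.prod_pos fun _ _ => inv_pos.2 ht)]

lemma ncard_cone_norm_eq {C : ClassGroup (𝓞 K)} {J : (Ideal (𝓞 K))⁰}
    (hJ : ClassGroup.mk0 J = C⁻¹) {ι : Type} [Fintype ι]
    {b : Basis ι ℝ (mixedSpace K)} {β : ι → 𝓞 K} (hβ : ∀ i, β i ∈ (J : Ideal (𝓞 K)))
    (hb : ∀ i, b i = mixedEmbedding K (β i : K))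
    (hspan : ∀ α ∈ (J : Ideal (𝓞 K)), ∃ z : ι → ℤ, α = ∑ i, (z i : 𝓞 K) * β i) (n : ℕ) :
    {z : ι → ℤ | mixedEmbedding K ((∑ i, (z i : 𝓞 K) * β i : 𝓞 K) : K) ∈ fundamentalCone K ∧
      (Algebra.norm ℤ (∑ i, (z i : 𝓞 K) * β i)).natAbs = n * absNorm (J : Ideal (𝓞 K))}.ncard =
      classCount K C n * torsionOrder K := by
  rw [classCount_eq hJ, torsionOrder, ← Nat.card_prod,
    ← Nat.card_congr (idealSetEquivNorm K J (n * absNorm (J : Ideal (𝓞 K)))), ← Nat.card_coe_set_eq]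
  have hemb : ∀ z : ι → ℤ, mixedEmbedding K ((∑ i, (z i : 𝓞 K) * β i : 𝓞 K) : K) =
      ∑ i, (z i : ℝ) • b i := by
    intro z
    simp [hb, map_sum, Int.cast_smul_eq_zsmul]
  have hnorm : ∀ α : 𝓞 K, mixedEmbedding.norm (mixedEmbedding K (α : K)) =
      ((Algebra.norm ℤ α).natAbs : ℝ) := by
    intro α
    rw [norm_eq_norm, ← Algebra.coe_norm_int]
    rw [Rat.cast_abs, Rat.cast_intCast, Nat.cast_natAbs, Int.cast_abs]
  refine Nat.card_congr (Equiv.ofBijective (fun z => ⟨⟨mixedEmbedding K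
    ((∑ i, (z.1 i : 𝓞 K) * β i : 𝓞 K) : K), mem_idealSet.2 ⟨z.2.1, _,
      sum_mem fun i _ => Ideal.mul_mem_left _ _ (hβ i), rfl⟩⟩, ?_⟩) ⟨?_, ?_⟩)
  · rw [hnorm, z.2.2]
  · rintro ⟨z, hz⟩ ⟨z', hz'⟩ h
    simp only [Subtype.mk.injEq] at h ⊢
    rw [hemb, hemb] at h
    funext i
    have := congrArg (fun y => b.repr y i) h
    simpa [Finsupp.single_apply] using this
  · rintro ⟨⟨a, ha⟩, han⟩
    obtain ⟨hc, α, hα, rfl⟩ := mem_idealSet.1 ha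
    obtain ⟨z, rfl⟩ := hspan α hα
    refine ⟨⟨z, hc, ?_⟩, rfl⟩
    have h2 := han
    simp only at h2
    rw [hnorm] at h2
    exact_mod_cast h2

end ClassCount

section ClassSum
open Module NumberField NumberField.mixedEmbedding NumberField.InfinitePlace
  NumberField.mixedEmbedding.fundamentalCone NumberField.Units
open scoped nonZeroDivisors Pointwise
variable {K : Type*} [Field K] [NumberField K]

lemma natAbs_norm_eq_norm (α : 𝓞 K) : mixedEmbedding.norm (mixedEmbedding K (α : K)) =
    ((Algebra.norm ℤ α).natAbs : ℝ) := by
  rw [norm_eq_norm, ← Algebra.coe_norm_int, Rat.cast_abs, Rat.cast_intCast, Nat.cast_natAbs,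
    Int.cast_abs]

lemma finite_lattice_coords {ι E : Type*} [NormedAddCommGroup E] [NormedSpace ℝ E]
    [FiniteDimensional ℝ E] [Fintype ι] (b : Basis ι ℝ E) {S : Set E}
    (hS : Bornology.IsBounded S) : {z : ι → ℤ | ∑ i, (z i : ℝ) • b i ∈ S}.Finite := by
  have hinj : Function.Injective fun z : ι → ℤ => ∑ i, (z i : ℝ) • b i := by
    intro z z' h
    funext i
    have := congrArg (fun y => b.repr y i) h
    simpa [Finsupp.single_apply] using this
  refine ((ZSpan.setFinite_inter b hS).preimage hinj.injOn).subset fun z hz => ⟨hz, ?_⟩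
  refine (Submodule.mem_span_range_iff_exists_fun ℤ).2 ⟨z, ?_⟩
  simp [← Int.cast_smul_eq_zsmul ℝ]

/-- Norms of congruent elements of `J` have congruent cofactors. -/
lemma norm_div_cast_eq {ι : Type*} [Fintype ι] {β : ι → 𝓞 K} {N q : ℕ} [NeZero (q * N)] (hN : N ≠ 0)
    (hdvd : ∀ z : ι → ℤ, (N : ℤ) ∣ Algebra.norm ℤ (∑ i, (z i : 𝓞 K) * β i)) (z : ι → ℤ) :
    (((Algebra.norm ℤ (∑ i, (z i : 𝓞 K) * β i) / N : ℤ)) : ZMod q) =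
      ((Algebra.norm ℤ (∑ i, ((((z i : ZMod (q * N)).val : ℤ)) : 𝓞 K) * β i) / N : ℤ) : ZMod q) := by
  have hex : ∀ i, ∃ y : ℤ, z i = ((z i : ZMod (q * N)).val : ℤ) + (q * N : ℕ) * y := by
    intro i
    have h3 : ((z i - (z i : ZMod (q * N)).val : ℤ) : ZMod (q * N)) = 0 := by simp
    obtain ⟨y, hy⟩ := (ZMod.intCast_zmod_eq_zero_iff_dvd _ (q * N)).1 h3
    exact ⟨y, by linarith⟩
  choose y hy using hex
  set k : ι → ℤ := fun i => ((z i : ZMod (q * N)).val : ℤ) with hk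
  have hsum : ∑ i, (z i : 𝓞 K) * β i = ∑ i, (k i : 𝓞 K) * β i +
      ((q * N : ℕ) : 𝓞 K) * ∑ i, (y i : 𝓞 K) * β i := by
    rw [Finset.mul_sum, ← Finset.sum_add_distrib]
    refine Finset.sum_congr rfl fun i _ => ?_
    conv_lhs => rw [hy i]
    simp only [hk]
    push_cast
    ring
  have h := norm_add_mul_cast K (q * N) (∑ i, (k i : 𝓞 K) * β i) (∑ i, (y i : 𝓞 K) * β i)
  rw [← hsum, ZMod.intCast_eq_intCast_iff_dvd_sub] at h
  obtain ⟨u, hu⟩ := hdvd z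
  obtain ⟨v, hv⟩ := hdvd k
  have hN' : (N : ℤ) ≠ 0 := by exact_mod_cast hN
  rw [ZMod.intCast_eq_intCast_iff_dvd_sub]
  rw [hu, hv] at h ⊢
  rw [Int.mul_ediv_cancel_left _ hN', Int.mul_ediv_cancel_left _ hN']
  rw [← mul_sub, Nat.cast_mul, mul_comm (q : ℤ)] at h
  exact Int.dvd_of_mul_dvd_mul_left hN' h

theorem class_sum (C : ClassGroup (𝓞 K)) :
    ∃ A : ℝ, 0 ≤ A ∧ ∀ (q : ℕ) [NeZero q] (f : ZMod q → ℂ), (∀ a, ‖f a‖ ≤ 1) →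
      ∃ c : ℂ, ‖c‖ ≤ A ∧ ∀ x : ℝ, 1 ≤ x →
        ‖∑ n ∈ Finset.Icc 1 ⌊x⌋₊, f n * classCount K C n - c * x‖ ≤
          A * (q : ℝ) ^ finrank ℚ K *
            (x ^ (1 / (finrank ℚ K : ℝ)) / q + 1) ^ (finrank ℚ K - 1) := by
  obtain ⟨J, hJ⟩ := ClassGroup.mk0_surjective C⁻¹
  obtain ⟨ι, _, b, β, hβ, hb, hspan⟩ := exists_ideal_basis J
  set d := finrank ℚ K with hd
  have hd0 : d ≠ 0 := finrank_pos.ne'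
  have hfr : finrank ℝ (mixedSpace K) = d := mixedEmbedding.finrank K
  have hcnt := fun s : ℝ => weighted_lattice_count b (isBounded_normLeOneSign K s)
    (by rw [hfr]; exact smallFrontier_normLeOneSign K s)
  rw [hfr] at hcnt
  obtain ⟨A₁, hA₁, h₁⟩ := hcnt 1
  obtain ⟨A₂, hA₂, h₂⟩ := hcnt (-1)
  set N := absNorm (J : Ideal (𝓞 K)) with hN
  have hN0 : N ≠ 0 := absNorm_ne_zero_of_nonZeroDivisors J
  have hNpos : (0 : ℝ) < N := by exact_mod_cast Nat.pos_of_ne_zero hN0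
  have hN1 : (1 : ℝ) ≤ N := by exact_mod_cast Nat.one_le_iff_ne_zero.2 hN0
  have hw0 : (0 : ℝ) < torsionOrder K := by exact_mod_cast Nat.pos_of_ne_zero (torsionOrder_ne_zero K)
  have hw1 : (1 : ℝ) ≤ torsionOrder K := by
    exact_mod_cast Nat.one_le_iff_ne_zero.2 (torsionOrder_ne_zero K)
  refine ⟨(A₁ + A₂) * (N : ℝ) ^ d, by positivity, fun q _ f hf => ?_⟩
  have hq0 : (0 : ℝ) < q := by exact_mod_cast Nat.pos_of_ne_zero (NeZero.ne q)
  have : NeZero (q * N) := ⟨mul_ne_zero (NeZero.ne q) hN0⟩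
  let α : (ι → ℤ) → 𝓞 K := fun z => ∑ i, (z i : 𝓞 K) * β i
  have hαJ : ∀ z, α z ∈ (J : Ideal (𝓞 K)) := fun z =>
    sum_mem fun i _ => Ideal.mul_mem_left _ _ (hβ i)
  have hdvd : ∀ z, (N : ℤ) ∣ Algebra.norm ℤ (α z) := fun z => absNorm_dvd_norm_of_mem (hαJ z)
  have hemb : ∀ z : ι → ℤ, ∑ i, (z i : ℝ) • b i = mixedEmbedding K (α z : K) := by
    intro z
    simp [α, hb, map_sum, Int.cast_smul_eq_zsmul]
  let g : ℤ → (ι → ZMod (q * N)) → ℂ := fun s k =>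
    f ((s * (Algebra.norm ℤ (α fun i => ((k i).val : ℤ)) / N) : ℤ) : ZMod q)
  obtain ⟨c₁, hc₁, e₁⟩ := h₁ (q * N) (g 1) (fun k => hf _)
  obtain ⟨c₂, hc₂, e₂⟩ := h₂ (q * N) (g (-1)) (fun k => hf _)
  refine ⟨(c₁ + c₂) * N / torsionOrder K, ?_, fun x hx => ?_⟩
  · rw [norm_div, norm_mul, Complex.norm_natCast, Complex.norm_natCast]
    calc ‖c₁ + c₂‖ * N / torsionOrder K ≤ ‖c₁ + c₂‖ * N := div_le_self (by positivity) hw1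
      _ ≤ (A₁ + A₂) * (N : ℝ) ^ d := by
        gcongr
        · exact (norm_add_le _ _).trans (add_le_add hc₁ hc₂)
        · exact le_self_pow₀ hN1 hd0
  set t : ℝ := (x * N) ^ (1 / (d : ℝ)) with ht
  have hxN : 0 < x * N := by positivity
  have ht0 : 0 < t := Real.rpow_pos_of_pos hxN _
  have htd : t ^ d = x * N := by
    rw [ht, ← Real.rpow_natCast, ← Real.rpow_mul hxN.le, one_div,
      inv_mul_cancel₀ (by exact_mod_cast hd0), Real.rpow_one]
  have hfin : ∀ s : ℝ, {z : ι → ℤ | ∑ i, (z i : ℝ) • b i ∈ t • normLeOneSign K s}.Finite :=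
    fun s => finite_lattice_coords b ((isBounded_normLeOneSign K s).smul₀ t)
  let Z : ℤ → Finset (ι → ℤ) := fun s => (hfin s).toFinset
  have hZ : ∀ (s : ℤ) z, z ∈ Z s ↔ mixedEmbedding K (α z : K) ∈ fundamentalCone K ∧
      ((Algebra.norm ℤ (α z)).natAbs : ℝ) ≤ x * N ∧ 0 < s * Algebra.norm ℤ (α z) := by
    intro s z
    simp only [Z, Set.Finite.mem_toFinset, Set.mem_ofPred_eq]
    rw [hemb, mem_smul_normLeOneSign ht0, natAbs_norm_eq_norm, ← hd, htd]
    refine and_congr_right fun hcone => and_congr_right fun _ => ?_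
    refine norm_pos_iff_prod_real_pos K s fun h0 => ?_
    have := norm_pos_of_mem hcone
    rw [h0] at this
    simp at this
  let ν : (ι → ℤ) → ℕ := fun z => (Algebra.norm ℤ (α z)).natAbs / N
  have hνN : ∀ z, (Algebra.norm ℤ (α z)).natAbs = ν z * N := fun z =>
    (Nat.div_mul_cancel (Int.natCast_dvd.1 (hdvd z))).symm
  have hmaps : ∀ s : ℤ, ∀ z ∈ Z s, ν z ∈ Finset.Icc 1 ⌊x⌋₊ := by
    intro s z hz
    obtain ⟨_, h1, h2⟩ := (hZ s z).1 hz
    rw [Finset.mem_Icc]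
    constructor
    · rw [Nat.one_le_iff_ne_zero]
      intro h0
      have := hνN z
      rw [h0, zero_mul, Int.natAbs_eq_zero] at this
      rw [this, mul_zero] at h2
      exact lt_irrefl _ h2
    · refine Nat.le_floor ?_
      rw [hνN z] at h1
      push_cast at h1
      exact le_of_mul_le_mul_right h1 hNpos
  have hgf : ∀ s : ℤ, (s = 1 ∨ s = -1) → ∀ z ∈ Z s, f (ν z) = g s fun i => (z i : ZMod (q * N)) := by
    intro s hs z hz
    obtain ⟨_, _, h2⟩ := (hZ s z).1 hz
    have hkey := norm_div_cast_eq (q := q) hN0 hdvd z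
    have h3 : ((ν z : ℕ) : ℤ) = s * (Algebra.norm ℤ (α z) / N) := by
      have h4 : (((Algebra.norm ℤ (α z)).natAbs : ℕ) : ℤ) = s * Algebra.norm ℤ (α z) := by
        rcases hs with rfl | rfl
        · rw [one_mul] at h2 ⊢; exact Int.natAbs_of_nonneg h2.le
        · omega
      have : (ν z : ℤ) = s * Algebra.norm ℤ (α z) / N := by rw [← h4]; simp [ν]
      rw [this, Int.mul_ediv_assoc _ (hdvd z)]
    simp only [g]
    congr 1
    rw [← Int.cast_natCast (R := ZMod q), h3, Int.cast_mul, hkey, Int.cast_mul]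
  have hcount : ∀ n ∈ Finset.Icc 1 ⌊x⌋₊, ((Z 1).filter fun z => ν z = n).card +
      ((Z (-1)).filter fun z => ν z = n).card = classCount K C n * torsionOrder K := by
    intro n hn
    rw [Finset.mem_Icc] at hn
    have hnx : (n : ℝ) ≤ x := (Nat.le_floor_iff (by linarith)).1 hn.2
    rw [← ncard_cone_norm_eq hJ hβ hb hspan n, ← Finset.card_union_of_disjoint]
    · rw [← Set.ncard_coe_finset]
      congr 1
      ext z
      simp only [Finset.coe_union, Finset.coe_filter, Set.mem_union, Set.mem_ofPred_eq, hZ]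
      change _ ↔ mixedEmbedding K (α z : K) ∈ fundamentalCone K ∧
        (Algebra.norm ℤ (α z)).natAbs = n * N
      constructor
      · rintro (⟨⟨h1, -, -⟩, h2⟩ | ⟨⟨h1, -, -⟩, h2⟩) <;> exact ⟨h1, by rw [hνN, h2]⟩
      · rintro ⟨h1, h2⟩
        have h3 : ν z = n := by
          have := hνN z
          rw [h2] at this
          exact (Nat.eq_of_mul_eq_mul_right (Nat.pos_of_ne_zero hN0) this).symm
        have h4 : ((Algebra.norm ℤ (α z)).natAbs : ℝ) ≤ x * N := by
          rw [h2]; push_cast; gcongr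
        have h5 : Algebra.norm ℤ (α z) ≠ 0 := by
          intro h0
          rw [h0] at h2
          have : n * N ≠ 0 := mul_ne_zero (by omega) hN0
          exact this h2.symm
        rcases lt_or_gt_of_ne h5 with h6 | h6
        · exact Or.inr ⟨⟨h1, h4, by omega⟩, h3⟩
        · exact Or.inl ⟨⟨h1, h4, by omega⟩, h3⟩
    · rw [Finset.disjoint_left]
      intro z hz hz'
      have h1 := ((hZ _ _).1 (Finset.mem_filter.1 hz).1).2.2
      have h2 := ((hZ _ _).1 (Finset.mem_filter.1 hz').1).2.2
      omega
  have hsums : ∀ s : ℤ, (s = 1 ∨ s = -1) → ∑ z ∈ Z s, g s (fun i => (z i : ZMod (q * N))) =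
      ∑ n ∈ Finset.Icc 1 ⌊x⌋₊, f n * (((Z s).filter fun z => ν z = n).card : ℂ) := by
    intro s hs
    rw [Finset.sum_congr rfl fun z hz => (hgf s hs z hz).symm,
      ← Finset.sum_fiberwise_of_maps_to (hmaps s)]
    refine Finset.sum_congr rfl fun n _ => ?_
    rw [Finset.sum_congr rfl (g := fun _ => f n) (fun z hz => by rw [(Finset.mem_filter.1 hz).2]),
      Finset.sum_const, nsmul_eq_mul, mul_comm]
  have htot : ∑ n ∈ Finset.Icc 1 ⌊x⌋₊, f n * classCount K C n =
      (∑ z ∈ Z 1, g 1 (fun i => (z i : ZMod (q * N))) +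
        ∑ z ∈ Z (-1), g (-1) (fun i => (z i : ZMod (q * N)))) / torsionOrder K := by
    rw [hsums 1 (Or.inl rfl), hsums (-1) (Or.inr rfl), ← Finset.sum_add_distrib, Finset.sum_div]
    refine Finset.sum_congr rfl fun n hn => ?_
    rw [← mul_add, ← Nat.cast_add, hcount n hn]
    have : (torsionOrder K : ℂ) ≠ 0 := by exact_mod_cast hw0.ne'
    push_cast
    field_simp
  have E₁ := e₁ t ht0 (Z 1) (fun z => by simp [Z])
  have E₂ := e₂ t ht0 (Z (-1)) (fun z => by simp [Z])
  have htdC : (t : ℂ) ^ d = x * N := by exact_mod_cast htd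
  rw [htdC] at E₁ E₂
  have htm : t / ((q * N : ℕ) : ℝ) ≤ x ^ (1 / (d : ℝ)) / q := by
    rw [ht, Real.mul_rpow (by linarith) hNpos.le]
    have : (N : ℝ) ^ (1 / (d : ℝ)) ≤ N := by
      conv_rhs => rw [← Real.rpow_one (N : ℝ)]
      refine Real.rpow_le_rpow_of_exponent_le hN1 ?_
      rw [div_le_one (by exact_mod_cast Nat.pos_of_ne_zero hd0)]
      exact_mod_cast Nat.one_le_iff_ne_zero.2 hd0
    calc x ^ (1 / (d : ℝ)) * (N : ℝ) ^ (1 / (d : ℝ)) / ((q * N : ℕ) : ℝ)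
        ≤ x ^ (1 / (d : ℝ)) * (N : ℝ) / ((q * N : ℕ) : ℝ) := by gcongr
      _ = _ := by push_cast; field_simp
  have hwC : (torsionOrder K : ℂ) ≠ 0 := by exact_mod_cast hw0.ne'
  rw [htot, show (∑ z ∈ Z 1, g 1 (fun i => (z i : ZMod (q * N))) +
        ∑ z ∈ Z (-1), g (-1) (fun i => (z i : ZMod (q * N)))) / torsionOrder K -
        (c₁ + c₂) * N / torsionOrder K * x =
      ((∑ z ∈ Z 1, g 1 (fun i => (z i : ZMod (q * N))) - c₁ * (x * N)) +
        (∑ z ∈ Z (-1), g (-1) (fun i => (z i : ZMod (q * N))) - c₂ * (x * N))) / torsionOrder K by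
      ring, norm_div, Complex.norm_natCast]
  refine (div_le_self (norm_nonneg _) hw1).trans ((norm_add_le_of_le E₁ E₂).trans ?_)
  rw [← add_mul, ← add_mul]
  calc (A₁ + A₂) * ((q * N : ℕ) : ℝ) ^ d * (t / ((q * N : ℕ) : ℝ) + 1) ^ (d - 1)
      ≤ (A₁ + A₂) * ((q * N : ℕ) : ℝ) ^ d * (x ^ (1 / (d : ℝ)) / q + 1) ^ (d - 1) := by gcongr
    _ = _ := by push_cast; rw [mul_pow]; ring

end ClassSum

section IdealCount
open Module NumberField Filter Topology
open scoped nonZeroDivisors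
variable (K : Type*) [Field K] [NumberField K]

/-- Number of nonzero ideals of norm `n`. -/
noncomputable def idealCount (n : ℕ) : ℕ :=
  Nat.card {I : (Ideal (𝓞 K))⁰ // absNorm (I : Ideal (𝓞 K)) = n}

lemma finite_nonZeroDivisors_absNorm_eq (n : ℕ) :
    Finite {I : (Ideal (𝓞 K))⁰ // absNorm (I : Ideal (𝓞 K)) = n} := by
  have := Ideal.finite_setOfPred_absNorm_le₀ (S := 𝓞 K) n
  exact Set.Finite.subset this fun I hI => le_of_eq hI

lemma idealCount_eq_sum_classCount (n : ℕ) :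
    idealCount K n = ∑ C : ClassGroup (𝓞 K), classCount K C n := by
  have := finite_nonZeroDivisors_absNorm_eq K n
  rw [idealCount, ← Nat.card_congr (Equiv.sigmaFiberEquiv
    (fun I : {I : (Ideal (𝓞 K))⁰ // absNorm (I : Ideal (𝓞 K)) = n} => ClassGroup.mk0 I.1)),
    Nat.card_sigma]
  refine Finset.sum_congr rfl fun C _ => ?_
  exact Nat.card_congr (Equiv.subtypeSubtypeEquivSubtypeInter
    (fun I : (Ideal (𝓞 K))⁰ => absNorm (I : Ideal (𝓞 K)) = n)
    (fun I => ClassGroup.mk0 I = C))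

lemma sum_idealCount (N : ℕ) : ∑ n ∈ Finset.Icc 1 N, idealCount K n =
    Nat.card {I : (Ideal (𝓞 K))⁰ // absNorm (I : Ideal (𝓞 K)) ≤ N} := by
  have hfin : Finite {I : (Ideal (𝓞 K))⁰ // absNorm (I : Ideal (𝓞 K)) ≤ N} :=
    Ideal.finite_setOfPred_absNorm_le₀ (S := 𝓞 K) N
  let φ : {I : (Ideal (𝓞 K))⁰ // absNorm (I : Ideal (𝓞 K)) ≤ N} → Finset.Icc 1 N := fun I =>
    ⟨absNorm (I.1 : Ideal (𝓞 K)), Finset.mem_Icc.2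
      ⟨Nat.one_le_iff_ne_zero.2 (absNorm_ne_zero_of_nonZeroDivisors I.1), I.2⟩⟩
  rw [← Nat.card_congr (Equiv.sigmaFiberEquiv φ), Nat.card_sigma, ← Finset.sum_coe_sort]
  refine Finset.sum_congr rfl fun n _ => ?_
  refine Nat.card_congr ⟨fun I => ⟨⟨I.1, I.2.trans_le (Finset.mem_Icc.1 n.2).2⟩,
    Subtype.ext I.2⟩, fun I => ⟨I.1.1, congrArg Subtype.val I.2⟩, fun _ => rfl, fun _ => rfl⟩

lemma exists_idealCount_sum : ∃ A : ℝ, 0 ≤ A ∧ ∀ (q : ℕ) [NeZero q] (f : ZMod q → ℂ),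
    (∀ a, ‖f a‖ ≤ 1) → ∃ c : ℂ, ‖c‖ ≤ A ∧ ∀ x : ℝ, 1 ≤ x →
        ‖∑ n ∈ Finset.Icc 1 ⌊x⌋₊, f n * idealCount K n - c * x‖ ≤
          A * (q : ℝ) ^ finrank ℚ K *
            (x ^ (1 / (finrank ℚ K : ℝ)) / q + 1) ^ (finrank ℚ K - 1) := by
  choose A hA h using fun C : ClassGroup (𝓞 K) => class_sum C
  refine ⟨∑ C, A C, Finset.sum_nonneg fun C _ => hA C, fun q _ f hf => ?_⟩
  choose c hc e using fun C => h C q f hf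
  refine ⟨∑ C, c C, (norm_sum_le _ _).trans (Finset.sum_le_sum fun C _ => hc C), fun x hx => ?_⟩
  have : ∑ n ∈ Finset.Icc 1 ⌊x⌋₊, f n * idealCount K n - (∑ C, c C) * x =
      ∑ C, (∑ n ∈ Finset.Icc 1 ⌊x⌋₊, f n * classCount K C n - c C * x) := by
    rw [Finset.sum_sub_distrib, Finset.sum_comm, Finset.sum_mul]
    congr 1
    refine Finset.sum_congr rfl fun n _ => ?_
    rw [idealCount_eq_sum_classCount, Nat.cast_sum, Finset.mul_sum]
  rw [this, Finset.sum_mul, Finset.sum_mul]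
  exact (norm_sum_le _ _).trans (Finset.sum_le_sum fun C _ => e C x hx)

theorem exists_idealCount_asymp : ∃ A > (0 : ℝ), ∃ κ > (0 : ℝ),
    (∀ x : ℝ, 1 ≤ x → |∑ n ∈ Finset.Icc 1 ⌊x⌋₊, (idealCount K n : ℝ) - κ * x| ≤
      A * x ^ (1 - 1 / (finrank ℚ K : ℝ))) ∧
    ∀ (q : ℕ) [NeZero q] (f : ZMod q → ℂ), (∀ a, ‖f a‖ ≤ 1) → ∃ c : ℂ, ‖c‖ ≤ A ∧
      ∀ x : ℝ, 1 ≤ x → ‖∑ n ∈ Finset.Icc 1 ⌊x⌋₊, f n * idealCount K n - c * x‖ ≤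
        A * q * x ^ (1 - 1 / (finrank ℚ K : ℝ)) := by
  obtain ⟨A, hA, h⟩ := exists_idealCount_sum K
  set d := finrank ℚ K with hd
  have hd0 : 0 < d := finrank_pos
  have hdR : (0 : ℝ) < d := by exact_mod_cast hd0
  have hpow : ∀ x : ℝ, 1 ≤ x → (x ^ (1 / (d : ℝ))) ^ (d - 1) = x ^ (1 - 1 / (d : ℝ)) := by
    intro x hx
    rw [← Real.rpow_natCast, ← Real.rpow_mul (by linarith), Nat.cast_sub hd0]
    congr 1
    field_simp
    simp
  have hmul : ∀ x : ℝ, 1 ≤ x → x ^ (1 - 1 / (d : ℝ)) * x ^ (1 / (d : ℝ)) = x := by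
    intro x hx
    rw [← Real.rpow_add (by linarith)]
    simp
  have hbig : ∀ (q : ℕ) [NeZero q] (x : ℝ), 1 ≤ x → (q : ℝ) ≤ x ^ (1 / (d : ℝ)) →
      A * (q : ℝ) ^ d * (x ^ (1 / (d : ℝ)) / q + 1) ^ (d - 1) ≤
        A * 2 ^ d * q * x ^ (1 - 1 / (d : ℝ)) := by
    intro q _ x hx hq
    have hq0 : (0 : ℝ) < q := by exact_mod_cast Nat.pos_of_ne_zero (NeZero.ne q)
    have h1 : x ^ (1 / (d : ℝ)) / q + 1 ≤ 2 * x ^ (1 / (d : ℝ)) / q := by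
      rw [div_add_one hq0.ne']
      gcongr
      linarith
    calc A * (q : ℝ) ^ d * (x ^ (1 / (d : ℝ)) / q + 1) ^ (d - 1)
        ≤ A * (q : ℝ) ^ d * (2 * x ^ (1 / (d : ℝ)) / q) ^ (d - 1) := by gcongr
      _ = A * 2 ^ (d - 1) * q * x ^ (1 - 1 / (d : ℝ)) := by
        rw [← hpow x hx, div_pow, mul_pow]
        obtain ⟨k, hk⟩ := Nat.exists_eq_succ_of_ne_zero hd0.ne'
        rw [hk, Nat.succ_sub_one]
        field_simp
        rw [pow_succ]
        ring
      _ ≤ A * 2 ^ d * q * x ^ (1 - 1 / (d : ℝ)) := by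
        gcongr
        · norm_num
        · omega
  obtain ⟨c₁, hc₁, e₁⟩ := h 1 (fun _ => 1) (by simp)
  have e₁' : ∀ x : ℝ, 1 ≤ x → ‖((∑ n ∈ Finset.Icc 1 ⌊x⌋₊, (idealCount K n : ℝ) : ℝ) : ℂ)
      - c₁ * x‖ ≤ A * 2 ^ d * x ^ (1 - 1 / (d : ℝ)) := by
    intro x hx
    have := (e₁ x hx).trans (hbig 1 x hx (by simpa using Real.one_le_rpow hx (by positivity)))
    simpa using this
  set κ := (2 ^ InfinitePlace.nrRealPlaces K * (2 * Real.pi) ^ InfinitePlace.nrComplexPlaces K *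
    Units.regulator K * classNumber K) / (Units.torsionOrder K * Real.sqrt |discr K|) with hκ
  have hκ0 : 0 < κ := dedekindZeta_residue_pos K
  have hlim : Tendsto (fun x : ℝ => (∑ n ∈ Finset.Icc 1 ⌊x⌋₊, (idealCount K n : ℝ)) / x) atTop
      (𝓝 κ) := by
    refine (NumberField.Ideal.tendsto_norm_le_div_atTop₀ K).congr' ?_
    filter_upwards [eventually_ge_atTop 0] with x hx
    simp_rw [← Nat.le_floor_iff hx]
    rw [← sum_idealCount]
    push_cast
    rfl
  have hc₁κ : c₁ = κ := by
    have hlimC : Tendsto (fun x : ℝ => ((∑ n ∈ Finset.Icc 1 ⌊x⌋₊, (idealCount K n : ℝ) : ℝ) : ℂ)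
        / x) atTop (𝓝 (κ : ℂ)) := by
      have := (Complex.continuous_ofReal.tendsto κ).comp hlim
      refine this.congr fun x => ?_
      simp
    refine tendsto_nhds_unique ?_ hlimC
    rw [tendsto_iff_norm_sub_tendsto_zero]
    have h0 : Tendsto (fun x : ℝ => A * 2 ^ d * x ^ (-(1 / (d : ℝ)))) atTop (𝓝 0) := by
      simpa using (tendsto_rpow_neg_atTop (y := 1 / (d : ℝ)) (by positivity)).const_mul (A * 2 ^ d)
    refine squeeze_zero' (Eventually.of_forall fun _ => norm_nonneg _) ?_ h0
    filter_upwards [eventually_ge_atTop 1] with x hx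
    have hx0 : (0 : ℝ) < x := by linarith
    have hxC : (x : ℂ) ≠ 0 := by exact_mod_cast hx0.ne'
    rw [div_sub' hxC, norm_div, Complex.norm_real, Real.norm_of_nonneg hx0.le, div_le_iff₀ hx0,
      mul_comm (x : ℂ), mul_assoc, ← Real.rpow_add_one hx0.ne']
    rw [show -(1 / (d : ℝ)) + 1 = 1 - 1 / (d : ℝ) by ring]
    exact e₁' x hx
  have hreal : ∀ x : ℝ, 1 ≤ x → |∑ n ∈ Finset.Icc 1 ⌊x⌋₊, (idealCount K n : ℝ) - κ * x| ≤
      A * 2 ^ d * x ^ (1 - 1 / (d : ℝ)) := by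
    intro x hx
    have := e₁' x hx
    rwa [hc₁κ, ← Complex.ofReal_mul, ← Complex.ofReal_sub, Complex.norm_real] at this
  have htriv : ∀ x : ℝ, 1 ≤ x → ∑ n ∈ Finset.Icc 1 ⌊x⌋₊, (idealCount K n : ℝ) ≤
      (κ + A * 2 ^ d) * x := by
    intro x hx
    have h1 := (abs_le.1 (hreal x hx)).2
    have h2 : x ^ (1 - 1 / (d : ℝ)) ≤ x := by
      conv_rhs => rw [← Real.rpow_one x]
      exact Real.rpow_le_rpow_of_exponent_le hx (by simp)
    have : A * 2 ^ d * x ^ (1 - 1 / (d : ℝ)) ≤ A * 2 ^ d * x := by gcongr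
    linarith
  have h2d : (1 : ℝ) ≤ 2 ^ d := one_le_pow₀ (by norm_num)
  have hA2 : A ≤ A * 2 ^ d := le_mul_of_one_le_right hA h2d
  refine ⟨κ + A * 2 ^ d + A, by positivity, κ, hκ0, fun x hx => ?_, fun q _ f hf => ?_⟩
  · refine (hreal x hx).trans ?_
    gcongr
    linarith
  · have hq1 : (1 : ℝ) ≤ q := by exact_mod_cast Nat.pos_of_ne_zero (NeZero.ne q)
    obtain ⟨c, hc, e⟩ := h q f hf
    refine ⟨c, by linarith, fun x hx => ?_⟩
    have hx0 : (0 : ℝ) < x := by linarith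
    rcases le_total (q : ℝ) (x ^ (1 / (d : ℝ))) with hqx | hqx
    · refine ((e x hx).trans (hbig q x hx hqx)).trans ?_
      gcongr
      linarith
    · have h1 : ‖∑ n ∈ Finset.Icc 1 ⌊x⌋₊, f n * idealCount K n‖ ≤ (κ + A * 2 ^ d) * x := by
        refine (norm_sum_le _ _).trans (le_trans (Finset.sum_le_sum fun n _ => ?_) (htriv x hx))
        rw [norm_mul, Complex.norm_natCast]
        exact mul_le_of_le_one_left (by positivity) (hf _)
      have h2 : ‖c * x‖ ≤ A * x := by
        rw [norm_mul, Complex.norm_real, Real.norm_of_nonneg hx0.le]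
        gcongr
      have h3 : x ≤ q * x ^ (1 - 1 / (d : ℝ)) := by
        conv_lhs => rw [← hmul x hx, mul_comm]
        gcongr
      calc _ ≤ (κ + A * 2 ^ d) * x + A * x := (norm_sub_le _ _).trans (add_le_add h1 h2)
        _ = (κ + A * 2 ^ d + A) * x := by ring
        _ ≤ (κ + A * 2 ^ d + A) * (q * x ^ (1 - 1 / (d : ℝ))) := by gcongr
        _ = _ := by ring

end IdealCount

section Mangoldt
open Module NumberField Filter Topology
open scoped nonZeroDivisors
variable {K : Type*} [Field K] [NumberField K]

lemma LambdaK_prime_pow {P : Ideal (𝓞 K)} (hP : P.IsPrime) (hP0 : P ≠ ⊥) {m : ℕ} (hm : m ≠ 0) :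
    LambdaK K (P ^ m) = Real.log (absNorm P) := by
  rw [LambdaK, if_pos ⟨P, m, hP, hP0, Nat.one_le_iff_ne_zero.2 hm, rfl⟩,
    Ideal.radical_pow _ hm, hP.radical]

lemma LambdaK_nonneg (I : Ideal (𝓞 K)) : 0 ≤ LambdaK K I := by
  rw [LambdaK]
  split_ifs
  · exact Real.log_natCast_nonneg _
  · exact le_rfl

lemma LambdaK_bot : LambdaK K ⊥ = 0 := by
  rw [LambdaK, if_neg]
  rintro ⟨P, m, -, hP, -, h⟩
  exact pow_ne_zero m (show P ≠ 0 from hP) h.symm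

lemma LambdaK_top : LambdaK K ⊤ = 0 := by
  rw [LambdaK, Ideal.radical_top]
  simp

variable (K) in
/-- The finset of ideals of norm at most `n`. -/
noncomputable def idealsNormLE (n : ℕ) : Finset (Ideal (𝓞 K)) :=
  (Ideal.finite_setOfPred_absNorm_le (S := 𝓞 K) n).toFinset

@[simp] lemma mem_idealsNormLE {n : ℕ} {I : Ideal (𝓞 K)} :
    I ∈ idealsNormLE K n ↔ absNorm I ≤ n := by
  simp [idealsNormLE]

lemma absNorm_le_of_dvd {I J : Ideal (𝓞 K)} (hI : I ≠ ⊥) (h : J ∣ I) : absNorm J ≤ absNorm I :=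
  Nat.le_of_dvd (Nat.pos_of_ne_zero (absNorm_eq_zero_iff.not.2 hI)) (map_dvd absNorm h)

/-- The logarithm of the norm is the divisor sum of the von Mangoldt function. -/
lemma sum_LambdaK_dvd {I : Ideal (𝓞 K)} (hI : I ≠ ⊥) {n : ℕ} (hn : absNorm I ≤ n) :
    ∑ J ∈ idealsNormLE K n with J ∣ I, LambdaK K J = Real.log (absNorm I) := by
  induction I using UniqueFactorizationMonoid.induction_on_prime with
  | h₁ => exact absurd rfl hI
  | h₂ I hu =>
    obtain rfl : I = ⊤ := Ideal.isUnit_iff.1 hu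
    simp only [absNorm_top, Nat.cast_one, Real.log_one]
    refine Finset.sum_eq_zero fun J hJ => ?_
    have : J = ⊤ := Ideal.isUnit_iff.1 (isUnit_of_dvd_unit (Finset.mem_filter.1 hJ).2 hu)
    rw [this, LambdaK_top]
  | h₃ I P hI0 hP ih =>
    have hI0' : I ≠ ⊥ := hI0
    have hP0 : P ≠ ⊥ := hP.ne_zero
    have hPp : P.IsPrime := Ideal.isPrime_of_prime hP
    have hle : absNorm I ≤ n := (absNorm_le_of_dvd hI (dvd_mul_left I P)).trans hn
    obtain ⟨v, b, hb, hIb⟩ : ∃ v b, I = P ^ v * b ∧ ¬ P ∣ b :=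
      ⟨_, (FiniteMultiplicity.of_prime_left hP hI0').exists_eq_pow_mul_and_not_dvd⟩
    have hdvd : P ^ (v + 1) ∣ P * I := by
      rw [hb, pow_succ']
      exact ⟨b, by ring⟩
    have hndvd : ¬ P ^ (v + 1) ∣ I := by
      rw [hb, pow_succ]
      exact fun h => hIb ((mul_dvd_mul_iff_left (pow_ne_zero _ hP.ne_zero)).1 h)
    have key : ∑ J ∈ idealsNormLE K n with J ∣ P * I, LambdaK K J =
        ∑ J ∈ insert (P ^ (v + 1)) {J ∈ idealsNormLE K n | J ∣ I}, LambdaK K J := by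
      symm
      refine Finset.sum_subset ?_ ?_
      · intro J hJ
        rw [Finset.mem_insert, Finset.mem_filter] at hJ
        rw [Finset.mem_filter, mem_idealsNormLE]
        rcases hJ with rfl | ⟨h1, h2⟩
        · exact ⟨(absNorm_le_of_dvd hI hdvd).trans hn, hdvd⟩
        · exact ⟨mem_idealsNormLE.1 h1, h2.mul_left P⟩
      · intro J hJ hJ'
        rw [Finset.mem_filter, mem_idealsNormLE] at hJ
        rw [Finset.mem_insert, Finset.mem_filter, mem_idealsNormLE, not_or] at hJ'
        rw [LambdaK, if_neg]
        rintro ⟨Q, m, hQ, hQ0, hm, rfl⟩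
        have hQp : Prime Q := Ideal.prime_of_isPrime hQ0 hQ
        have hnd : ¬ Q ^ m ∣ I := fun h => hJ'.2 ⟨hJ.1, h⟩
        by_cases hQP : Q = P
        · subst hQP
          have h1 : v < m := by
            by_contra h
            exact hnd ((pow_dvd_pow Q (not_lt.1 h)).trans (Dvd.intro _ hb.symm))
          have h2 : m ≤ v + 1 := by
            by_contra h
            have h3 : Q ^ (v + 2) ∣ Q * I := (pow_dvd_pow Q (by omega)).trans hJ.2
            rw [pow_succ', mul_dvd_mul_iff_left hP.ne_zero] at h3
            exact hndvd h3
          exact hJ'.1 (by rw [show m = v + 1 by omega])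
        · refine hnd (hQp.pow_dvd_of_dvd_mul_left m (fun h => hQP ?_) hJ.2)
          exact associated_iff_eq.1 ((hQp.dvd_prime_iff_associated hP).1 h)
    rw [key, Finset.sum_insert (by simp [hndvd]), ih hI0' hle, LambdaK_prime_pow hPp hP0 (by simp),
      map_mul, Nat.cast_mul, Real.log_mul]
    · exact_mod_cast absNorm_eq_zero_iff.not.2 hP0
    · exact_mod_cast absNorm_eq_zero_iff.not.2 hI0'

variable (K) in
/-- The finset of ideals of norm `n`. -/
noncomputable def idealsNormEq (n : ℕ) : Finset (Ideal (𝓞 K)) :=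
  {I ∈ idealsNormLE K n | absNorm I = n}

@[simp] lemma mem_idealsNormEq {n : ℕ} {I : Ideal (𝓞 K)} :
    I ∈ idealsNormEq K n ↔ absNorm I = n := by
  simp +contextual [idealsNormEq]

variable (K) in
/-- The sum of the von Mangoldt function over the ideals of norm `n`. -/
noncomputable def idealLambda (n : ℕ) : ℝ := ∑ I ∈ idealsNormEq K n, LambdaK K I

lemma idealLambda_nonneg (n : ℕ) : 0 ≤ idealLambda K n :=
  Finset.sum_nonneg fun I _ => LambdaK_nonneg I

lemma idealCount_eq_card {n : ℕ} (hn : n ≠ 0) : idealCount K n = (idealsNormEq K n).card := by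
  rw [idealCount, ← Nat.card_eq_finsetCard (idealsNormEq K n)]
  refine Nat.card_congr ⟨fun I => ⟨I.1, by simpa using I.2⟩, fun I => ⟨⟨I.1, ?_⟩, ?_⟩, ?_, ?_⟩
  · rw [mem_nonZeroDivisors_iff_ne_zero]
    intro h
    have := I.2
    simp only [mem_idealsNormEq, h] at this
    exact hn (by simpa using this.symm)
  · exact mem_idealsNormEq.1 I.2
  · exact fun _ => rfl
  · exact fun _ => rfl

lemma idealCount_one : idealCount K 1 = 1 := by
  rw [idealCount_eq_card one_ne_zero, Finset.card_eq_one]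
  exact ⟨⊤, by ext I; simp [absNorm_eq_one_iff]⟩

/-- `r(n) log n = ∑_{ab = n} Λ(a) r(b)`. -/
lemma idealCount_mul_log {n : ℕ} (hn : n ≠ 0) : idealCount K n * Real.log n =
    ∑ p ∈ n.divisorsAntidiagonal, idealLambda K p.1 * idealCount K p.2 := by
  have h1 : idealCount K n * Real.log n =
      ∑ I ∈ idealsNormEq K n, ∑ J ∈ idealsNormLE K n with J ∣ I, LambdaK K J := by
    rw [idealCount_eq_card hn, ← nsmul_eq_mul]
    refine (Finset.sum_eq_card_nsmul fun I hI => ?_).symm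
    rw [mem_idealsNormEq] at hI
    rw [sum_LambdaK_dvd _ hI.le, hI]
    rintro rfl
    exact hn (by simpa using hI.symm)
  have h2 : ∀ p ∈ n.divisorsAntidiagonal, idealLambda K p.1 * idealCount K p.2 =
      ∑ x ∈ idealsNormEq K p.1 ×ˢ idealsNormEq K p.2, LambdaK K x.1 := by
    intro p hp
    have hp2 : p.2 ≠ 0 := (Nat.ne_zero_of_mem_divisorsAntidiagonal hp).2
    rw [idealLambda, idealCount_eq_card hp2, Finset.sum_product, Finset.sum_mul]
    exact Finset.sum_congr rfl fun I _ => by simp [mul_comm]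
  rw [h1, Finset.sum_congr rfl h2, Finset.sum_sigma', Finset.sum_sigma']
  symm
  refine Finset.sum_bij' (fun x _ => (⟨x.2.1 * x.2.2, x.2.1⟩ : Σ _ : Ideal (𝓞 K), Ideal (𝓞 K)))
    (fun y hy => ⟨(absNorm y.2, absNorm (Classical.choose (Finset.mem_filter.1
      (Finset.mem_sigma.1 hy).2).2)), y.2, Classical.choose (Finset.mem_filter.1
      (Finset.mem_sigma.1 hy).2).2⟩) ?_ ?_ ?_ ?_ ?_
  · rintro ⟨⟨a, b⟩, I, J⟩ h
    simp only [Finset.mem_sigma, Nat.mem_divisorsAntidiagonal, Finset.mem_product,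
      mem_idealsNormEq, Finset.mem_filter, mem_idealsNormLE] at h ⊢
    obtain ⟨⟨h1, h2⟩, h3, h4⟩ := h
    refine ⟨by rw [map_mul, h3, h4, h1], ?_, dvd_mul_right _ _⟩
    rw [h3, ← h1]
    exact Nat.le_mul_of_pos_right _ (Nat.pos_of_ne_zero (by rintro rfl; simp at h1; exact h2 h1.symm))
  · rintro ⟨I, J⟩ h
    have hs := Classical.choose_spec (Finset.mem_filter.1 (Finset.mem_sigma.1 h).2).2
    simp only [Finset.mem_sigma, Nat.mem_divisorsAntidiagonal, Finset.mem_product,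
      mem_idealsNormEq, and_true] at h ⊢
    refine ⟨?_, hn⟩
    rw [← map_mul, ← hs]
    exact h.1
  · rintro ⟨⟨a, b⟩, I, J⟩ h
    have hm : (⟨I * J, I⟩ : Σ _ : Ideal (𝓞 K), Ideal (𝓞 K)).2 ∣ I * J := dvd_mul_right _ _
    have hs := Classical.choose_spec hm
    simp only [Finset.mem_sigma, Nat.mem_divisorsAntidiagonal, Finset.mem_product,
      mem_idealsNormEq] at h
    obtain ⟨⟨h1, h2⟩, h3, h4⟩ := h
    have hI0 : I ≠ 0 := by
      rintro rfl
      simp at h3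
      subst h3
      simp at h1
      exact h2 h1.symm
    have : Classical.choose hm = J := (mul_left_cancel₀ hI0 hs).symm
    simp only [this, h3, h4]
  · rintro ⟨I, J⟩ h
    have hs := Classical.choose_spec (Finset.mem_filter.1 (Finset.mem_sigma.1 h).2).2
    simp only [← hs]
  · rintro ⟨⟨a, b⟩, I, J⟩ h
    rfl

lemma psiKChi_eq_sum {x : ℝ} (hx : 0 ≤ x) {q : ℕ} (χ : DirichletCharacter ℂ q) :
    psiKChi K x χ = ∑ n ∈ Finset.Icc 1 ⌊x⌋₊, χ n * (idealLambda K n : ℂ) := by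
  rw [psiKChi, tsum_eq_sum (s := {I ∈ idealsNormLE K ⌊x⌋₊ | I ≠ ⊥})]
  · rw [← Finset.sum_fiberwise_of_maps_to (t := Finset.Icc 1 ⌊x⌋₊) (g := fun I => absNorm I)]
    · refine Finset.sum_congr rfl fun n hn => ?_
      rw [Finset.mem_Icc] at hn
      rw [idealLambda, Complex.ofReal_sum, Finset.mul_sum]
      refine Finset.sum_congr ?_ fun I hI => ?_
      · ext I
        simp only [Finset.mem_filter, mem_idealsNormLE, mem_idealsNormEq]
        refine ⟨fun h => h.2, fun h => ⟨⟨h ▸ hn.2, ?_⟩, h⟩⟩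
        rintro rfl
        simp at h
        omega
      · rw [mem_idealsNormEq] at hI
        rw [hI, if_pos]
        exact (Nat.le_floor_iff hx).1 hn.2
    · intro I hI
      simp only [Finset.mem_filter, mem_idealsNormLE] at hI
      exact Finset.mem_Icc.2 ⟨Nat.pos_of_ne_zero (absNorm_eq_zero_iff.not.2 hI.2), hI.1⟩
  · intro I hI
    simp only [Finset.mem_filter, mem_idealsNormLE, Nat.le_floor_iff hx, not_and_or, not_not] at hI
    rcases hI with hI | rfl
    · rw [if_neg hI]
    · simp [LambdaK_bot]

lemma absNorm_prime_two_le {P : Ideal (𝓞 K)} (hP : P.IsPrime) (hP0 : P ≠ ⊥) : 2 ≤ absNorm P := by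
  have h1 : absNorm P ≠ 0 := absNorm_eq_zero_iff.not.2 hP0
  have h2 : absNorm P ≠ 1 := absNorm_eq_one_iff.not.2 hP.ne_top
  omega

lemma natCast_mem_of_not_coprime {P : Ideal (𝓞 K)} (hP : P.IsPrime) (hP0 : P ≠ ⊥) {q : ℕ}
    (h : ¬ (absNorm P).Coprime q) : (q : 𝓞 K) ∈ P := by
  obtain ⟨p, hp, hpP, hpq⟩ := Nat.Prime.not_coprime_iff_dvd.1 h
  obtain ⟨Q, hQ, hQp, hQP⟩ := Ideal.exists_isMaximal_dvd_of_dvd_absNorm' hp P hpP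
  have hQP' : P ≤ Q := Ideal.dvd_iff_le.1 hQP
  have : P = Q := (hP.isMaximal hP0).eq_of_le hQ.ne_top hQP'
  subst this
  obtain ⟨k, rfl⟩ := hpq
  have hpm : (p : ℤ) ∈ P.under ℤ := hQp ▸ mem_span_singleton_self _
  rw [Ideal.mem_comap] at hpm
  push_cast
  exact P.mul_mem_right _ (by simpa using hpm)

lemma sum_LambdaK_not_coprime {q : ℕ} (hq : q ≠ 0) (N : ℕ) :
    ∑ I ∈ idealsNormLE K N with I ≠ ⊥ ∧ ¬ (absNorm I).Coprime q, LambdaK K I ≤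
      Nat.log 2 N * (finrank ℚ K * Real.log q) := by
  set Q : Ideal (𝓞 K) := span {(q : 𝓞 K)} with hQ
  have hQ0 : Q ≠ ⊥ := by simpa [hQ] using hq
  have hQn : absNorm Q = q ^ finrank ℚ K := by
    rw [hQ, absNorm_span_natCast, RingOfIntegers.rank]
  set T := {P ∈ idealsNormLE K (absNorm Q) | P ∣ Q} with hT
  have hsub : {I ∈ {I ∈ idealsNormLE K N | I ≠ ⊥ ∧ ¬ (absNorm I).Coprime q} | LambdaK K I ≠ 0} ⊆
      ((T.filter fun P => P.IsPrime ∧ P ≠ ⊥) ×ˢ Finset.Icc 1 (Nat.log 2 N)).image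
        fun x => x.1 ^ x.2 := by
    intro I hI
    simp only [Finset.mem_filter, mem_idealsNormLE] at hI
    obtain ⟨⟨h1, h2, h3⟩, h4⟩ := hI
    have h5 : IsPrimeIdealPower I := by
      by_contra h
      exact h4 (by rw [LambdaK, if_neg h])
    obtain ⟨P, m, hP, hP0, hm, rfl⟩ := h5
    have hPq : P ∣ Q := by
      rw [Ideal.dvd_iff_le, hQ, span_singleton_le_iff_mem]
      refine natCast_mem_of_not_coprime hP hP0 fun h => h3 ?_
      rw [map_pow]
      exact h.pow_left m
    simp only [Finset.mem_filter, Finset.mem_image, Finset.mem_product, Finset.mem_Icc, hT,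
      mem_idealsNormLE]
    refine ⟨(P, m), ⟨⟨⟨absNorm_le_of_dvd hQ0 hPq, hPq⟩, hP, hP0⟩, hm, ?_⟩, rfl⟩
    rw [map_pow] at h1
    exact Nat.le_log_of_pow_le one_lt_two
      ((Nat.pow_le_pow_left (absNorm_prime_two_le hP hP0) m).trans h1)
  rw [← Finset.sum_filter_ne_zero]
  refine (Finset.sum_le_sum_of_subset_of_nonneg hsub fun _ _ _ => LambdaK_nonneg _).trans ?_
  refine (Finset.sum_image_le_of_nonneg fun _ _ => LambdaK_nonneg _).trans ?_
  have hle : ∑ P ∈ T with P.IsPrime ∧ P ≠ ⊥, LambdaK K P ≤ finrank ℚ K * Real.log q := by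
    rw [← Real.log_pow, ← Nat.cast_pow, ← hQn, ← sum_LambdaK_dvd hQ0 le_rfl]
    exact Finset.sum_le_sum_of_subset_of_nonneg (Finset.filter_subset _ _)
      fun _ _ _ => LambdaK_nonneg _
  rw [Finset.sum_product_right, ← nsmul_eq_mul]
  refine (Finset.sum_le_card_nsmul _ _ (finrank ℚ K * Real.log q) fun m hm => ?_).trans
    (by simp)
  refine le_trans (le_of_eq (Finset.sum_congr rfl fun P hP => ?_)) hle
  obtain ⟨h1, h2⟩ := (Finset.mem_filter.1 hP).2
  rw [LambdaK_prime_pow h1 h2 (by have := (Finset.mem_Icc.1 hm).1; omega)]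
  conv_rhs => rw [← pow_one P, LambdaK_prime_pow h1 h2 one_ne_zero]

lemma sum_idealLambda_not_coprime {q : ℕ} (hq : q ≠ 0) (N : ℕ) :
    ∑ n ∈ Finset.Icc 1 N with ¬ n.Coprime q, idealLambda K n ≤
      Nat.log 2 N * (finrank ℚ K * Real.log q) := by
  refine le_trans (le_of_eq ?_) (sum_LambdaK_not_coprime (K := K) hq N)
  rw [← Finset.sum_fiberwise_of_maps_to (t := {n ∈ Finset.Icc 1 N | ¬ n.Coprime q})
    (g := fun I => absNorm I)]
  · refine Finset.sum_congr rfl fun n hn => ?_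
    rw [Finset.mem_filter, Finset.mem_Icc] at hn
    rw [idealLambda]
    refine Finset.sum_congr ?_ fun I hI => rfl
    ext I
    simp only [Finset.mem_filter, mem_idealsNormLE, mem_idealsNormEq]
    refine ⟨fun h => ⟨⟨h ▸ hn.1.2, ?_, h ▸ hn.2⟩, h⟩, fun h => h.2⟩
    rintro rfl
    simp at h
    omega
  · intro I hI
    simp only [Finset.mem_filter, mem_idealsNormLE, Finset.mem_Icc] at hI ⊢
    exact ⟨⟨Nat.pos_of_ne_zero (absNorm_eq_zero_iff.not.2 hI.2.1), hI.1⟩, hI.2.2⟩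

end Mangoldt

section Continuation
open MeasureTheory Filter Topology Set

/-- The summatory function of an arithmetic function. -/
noncomputable def summatory (a : ℕ → ℂ) (x : ℝ) : ℂ := ∑ n ∈ Finset.Icc 1 ⌊x⌋₊, a n

/-- The Mellin-type integral of the error term in `∑_{n ≤ x} a n ≈ c x`. -/
noncomputable def restInt (a : ℕ → ℂ) (c s : ℂ) : ℂ :=
  ∫ t in Ioi (1 : ℝ), (summatory a t - c * t) * (t : ℂ) ^ (-(s + 1))

/-- `∑_{n ≤ x} a n = c x + O(Q x^{1-δ})`. -/
def SumBound (a : ℕ → ℂ) (c : ℂ) (Q δ : ℝ) : Prop :=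
  ∀ x : ℝ, 1 ≤ x → ‖summatory a x - c * x‖ ≤ Q * x ^ (1 - δ)

variable {a : ℕ → ℂ} {c : ℂ} {Q δ : ℝ}

lemma SumBound.nonneg (h : SumBound a c Q δ) : 0 ≤ Q := by
  have := (norm_nonneg _).trans (h 1 le_rfl)
  simpa using this

lemma measurable_summatory (a : ℕ → ℂ) : Measurable (summatory a) := by
  have : summatory a = (fun m : ℕ => ∑ n ∈ Finset.Icc 1 m, a n) ∘ fun x : ℝ => ⌊x⌋₊ := rfl
  rw [this]
  exact (measurable_from_nat).comp Nat.measurable_floor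

lemma measurable_summatory_sub (a : ℕ → ℂ) (c : ℂ) :
    Measurable fun t : ℝ => summatory a t - c * t :=
  (measurable_summatory a).sub (by fun_prop)

lemma norm_restInt_integrand_le (h : SumBound a c Q δ) (s : ℂ) {t : ℝ} (ht : 1 < t) :
    ‖(summatory a t - c * t) * (t : ℂ) ^ (-(s + 1))‖ ≤ Q * t ^ (-s.re - δ) := by
  have ht0 : 0 < t := by linarith
  rw [norm_mul, Complex.norm_cpow_eq_rpow_re_of_pos ht0]
  calc _ ≤ Q * t ^ (1 - δ) * t ^ (-(s + 1)).re := by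
        gcongr
        exact h t ht.le
    _ = _ := by
        rw [mul_assoc, ← Real.rpow_add ht0]
        simp
        left
        congr 1
        ring

lemma restInt_integrable (h : SumBound a c Q δ) {s : ℂ} (hs : 1 - δ < s.re) :
    IntegrableOn (fun t : ℝ => (summatory a t - c * t) * (t : ℂ) ^ (-(s + 1))) (Ioi 1) := by
  have h1 : IntegrableOn (fun t : ℝ => Q * t ^ (-s.re - δ)) (Ioi 1) :=
    (integrableOn_Ioi_rpow_of_lt (by linarith) zero_lt_one).const_mul Q
  refine h1.mono' ?_ ?_
  · refine ((measurable_summatory_sub a c).mul ?_).aestronglyMeasurable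
    fun_prop
  · exact (ae_restrict_mem measurableSet_Ioi).mono fun t ht => norm_restInt_integrand_le h s ht

lemma norm_restInt_le (h : SumBound a c Q δ) {s : ℂ} (hs : 1 - δ < s.re) :
    ‖restInt a c s‖ ≤ Q / (s.re - 1 + δ) := by
  have h1 : IntegrableOn (fun t : ℝ => Q * t ^ (-s.re - δ)) (Ioi 1) :=
    (integrableOn_Ioi_rpow_of_lt (by linarith) zero_lt_one).const_mul Q
  refine (norm_integral_le_of_norm_le h1 ((ae_restrict_mem measurableSet_Ioi).mono fun t ht =>
    norm_restInt_integrand_le h s ht)).trans (le_of_eq ?_)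
  rw [integral_const_mul, integral_Ioi_rpow_of_lt (by linarith) zero_lt_one, Real.one_rpow,
    div_eq_mul_inv Q, neg_div, ← div_neg, one_div]
  congr 2
  ring

lemma differentiableAt_restInt (h : SumBound a c Q δ) (hδ : δ ≤ 1) {s : ℂ} (hs : 1 - δ < s.re) :
    DifferentiableAt ℂ (restInt a c) s := by
  set f : ℝ → ℂ := (Ioi (1 : ℝ)).indicator fun t => summatory a t - c * t with hf
  have hQ := h.nonneg
  have hmeas : Measurable f := (measurable_summatory_sub a c).indicator measurableSet_Ioi
  have hmel : restInt a c = fun s => mellin f (-s) := by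
    ext s
    rw [restInt, mellin, ← integral_indicator measurableSet_Ioi, ← integral_indicator
      measurableSet_Ioi]
    refine integral_congr_ae (Eventually.of_forall fun t => ?_)
    by_cases ht : 1 < t
    · have ht0 : 0 < t := by linarith
      simp only [hf, indicator, mem_Ioi, ht, ht0, if_true, smul_eq_mul]
      rw [mul_comm]
      congr 2
      ring
    · simp [hf, indicator, ht]
  have hloc : LocallyIntegrable f := by
    have hg : Continuous fun t : ℝ => Q * |t| ^ (1 - δ) :=
      continuous_const.mul (continuous_abs.rpow_const fun _ => Or.inr (by linarith))
    refine hg.locallyIntegrable.mono hmeas.aestronglyMeasurable (Eventually.of_forall fun t => ?_)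
    by_cases ht : 1 < t
    · simp only [hf, indicator, mem_Ioi, ht, if_true]
      refine (h t ht.le).trans (le_trans (le_of_eq ?_) (Real.le_norm_self _))
      rw [abs_of_pos (by linarith)]
    · simp only [hf, indicator, mem_Ioi, ht, if_false, norm_zero]
      exact norm_nonneg _
  rw [hmel]
  have hd : DifferentiableAt ℂ (mellin f) (-s) := by
    refine mellin_differentiableAt_of_isBigO_rpow (a := δ - 1) (b := (-s).re - 1)
      (hloc.locallyIntegrableOn _) ?_ ?_ ?_ (by linarith)
    · refine Asymptotics.IsBigO.of_bound Q ?_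
      filter_upwards [eventually_gt_atTop 1] with t ht
      simp only [hf, indicator, mem_Ioi, ht, if_true]
      refine (h t ht.le).trans (le_of_eq ?_)
      rw [Real.norm_of_nonneg (Real.rpow_nonneg (by linarith) _), neg_sub]
    · simp only [Complex.neg_re]
      linarith
    · refine (Asymptotics.isBigO_zero (E' := ℂ) _ _).congr' ?_ EventuallyEq.rfl
      filter_upwards [Ioo_mem_nhdsGT (zero_lt_one' ℝ)] with t ht
      simp only [hf, indicator, mem_Ioi, not_lt.2 ht.2.le, if_false]
  exact hd.comp s differentiableAt_id.neg

lemma LSeries_eq_restInt (h : SumBound a c Q δ) (hδ : 0 < δ) {s : ℂ} (hs : 1 < s.re)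
    (hsum : LSeriesSummable a s) :
    LSeries a s = c * (s / (s - 1)) + s * restInt a c s := by
  have hQ := h.nonneg
  have hs1 : s - 1 ≠ 0 := by
    intro h0
    have := congrArg Complex.re h0
    simp at this
    linarith
  have hO : (fun n : ℕ => ∑ k ∈ Finset.Icc 1 n, a k) =O[atTop] fun n : ℕ => (n : ℝ) ^ (1 : ℝ) := by
    refine Asymptotics.IsBigO.of_bound (Q + ‖c‖) ?_
    filter_upwards [eventually_ge_atTop 1] with n hn
    have hn1 : (1 : ℝ) ≤ n := by exact_mod_cast hn
    have h1 := h n hn1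
    rw [summatory, Nat.floor_natCast] at h1
    have h2 : (n : ℝ) ^ (1 - δ) ≤ n := by
      conv_rhs => rw [← Real.rpow_one (n : ℝ)]
      exact Real.rpow_le_rpow_of_exponent_le hn1 (by linarith)
    rw [Real.rpow_one, Real.norm_of_nonneg (by linarith)]
    have h3 : ‖∑ k ∈ Finset.Icc 1 n, a k‖ ≤
        ‖∑ k ∈ Finset.Icc 1 n, a k - c * ((n : ℝ) : ℂ)‖ + ‖c * ((n : ℝ) : ℂ)‖ := by
      simpa using norm_add_le (∑ k ∈ Finset.Icc 1 n, a k - c * ((n : ℝ) : ℂ)) (c * ((n : ℝ) : ℂ))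
    have h4 : ‖c * ((n : ℝ) : ℂ)‖ = ‖c‖ * n := by simp
    have h5 : Q * (n : ℝ) ^ (1 - δ) ≤ Q * n := by gcongr
    linarith
  rw [LSeries_eq_mul_integral a zero_le_one hs hsum hO, restInt]
  have hI := restInt_integrable h (s := s) (by linarith)
  have hre : (-s).re < -1 := by simpa using hs
  have hJ : IntegrableOn (fun t : ℝ => c * (t : ℂ) ^ (-s)) (Ioi 1) :=
    (integrableOn_Ioi_cpow_of_lt hre zero_lt_one).const_mul c
  have hsplit : ∫ t in Ioi (1 : ℝ), (∑ k ∈ Finset.Icc 1 ⌊t⌋₊, a k) * (t : ℂ) ^ (-(s + 1)) =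
      ∫ t in Ioi (1 : ℝ), ((summatory a t - c * t) * (t : ℂ) ^ (-(s + 1)) +
        c * (t : ℂ) ^ (-s)) := by
    refine setIntegral_congr_fun measurableSet_Ioi fun t ht => ?_
    have ht0 : (t : ℂ) ≠ 0 := by
      have : (0 : ℝ) < t := lt_trans zero_lt_one ht
      exact_mod_cast this.ne'
    have : (t : ℂ) ^ (-s) = t * (t : ℂ) ^ (-(s + 1)) := by
      rw [show -s = 1 + -(s + 1) by ring, Complex.cpow_add _ _ ht0, Complex.cpow_one]
    simp only [this, summatory]
    ring
  rw [hsplit, integral_add hI hJ, integral_const_mul, integral_Ioi_cpow_of_lt hre zero_lt_one,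
    Complex.ofReal_one, Complex.one_cpow]
  have : -s + 1 ≠ 0 := by
    rw [show -s + 1 = -(s - 1) by ring]
    exact neg_ne_zero.2 hs1
  field_simp
  ring

lemma restInt_im_eq_zero (ha : ∀ n, n ≠ 0 → (a n).im = 0) (hc : c.im = 0) (σ : ℝ) :
    (restInt a c σ).im = 0 := by
  have : restInt a c σ = ((∫ t in Ioi (1 : ℝ), ((∑ n ∈ Finset.Icc 1 ⌊t⌋₊, (a n).re) - c.re * t) *
      t ^ (-(σ + 1)) : ℝ) : ℂ) := by
    rw [restInt, ← integral_complex_ofReal]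
    refine setIntegral_congr_fun measurableSet_Ioi fun t ht => ?_
    have ht0 : (0 : ℝ) ≤ t := (lt_trans zero_lt_one ht).le
    have h1 : ∑ n ∈ Finset.Icc 1 ⌊t⌋₊, ((a n).re : ℂ) = ∑ n ∈ Finset.Icc 1 ⌊t⌋₊, a n :=
      Finset.sum_congr rfl fun n hn => Complex.ext rfl (by
        rw [Complex.ofReal_im, ha n (by have := (Finset.mem_Icc.mp hn).1; omega)])
    have h2 : c = (c.re : ℂ) := Complex.ext rfl (by simp [hc])
    push_cast [Complex.ofReal_cpow ht0]
    rw [← h2, summatory, h1]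
  rw [this, Complex.ofReal_im]

end Continuation

section LogPairs
open Finset LSeries
open scoped ComplexOrder

/-- `(a, D)` satisfies `a · log = D * a` (Dirichlet convolution), so that formally `D` has
Dirichlet series minus the logarithmic derivative of that of `a`. -/
def LogPair (a D : ℕ → ℂ) : Prop :=
  ∀ n : ℕ, n ≠ 0 → a n * Real.log n = ∑ p ∈ n.divisorsAntidiagonal, D p.1 * a p.2

/-- The arithmetic function `a` with `a 1 = 1` for which `(a, D)` is a `LogPair`. -/
noncomputable def logPairExp (D : ℕ → ℂ) (n : ℕ) : ℂ :=
  if n = 1 then 1 else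
    (∑ p ∈ n.divisorsAntidiagonal.attach,
      if _h : p.1.2 < n then D p.1.1 * logPairExp D p.1.2 else 0) / Real.log n

lemma logPairExp_one (D : ℕ → ℂ) : logPairExp D 1 = 1 := by
  rw [logPairExp]; simp

lemma log_natCast_ne_zero {n : ℕ} (h0 : n ≠ 0) (h1 : n ≠ 1) : ((Real.log n : ℝ) : ℂ) ≠ 0 := by
  rw [Ne, Complex.ofReal_eq_zero]
  exact (Real.log_pos (by exact_mod_cast (show 1 < n by omega))).ne'

lemma logPair_logPairExp {D : ℕ → ℂ} (hD : D 1 = 0) : LogPair (logPairExp D) D := by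
  intro n hn
  rcases eq_or_ne n 1 with rfl | h1
  · simp [hD]
  rw [logPairExp, if_neg h1, div_mul_cancel₀ _ (log_natCast_ne_zero hn h1)]
  rw [← Finset.sum_attach n.divisorsAntidiagonal (fun p => D p.1 * logPairExp D p.2)]
  refine Finset.sum_congr rfl fun p _ => ?_
  have hp := Nat.mem_divisorsAntidiagonal.mp p.2
  split_ifs with h
  · rfl
  · have h2 : 0 < p.1.1 := Nat.pos_of_ne_zero fun h => hn (by rw [← hp.1, h, zero_mul])
    have h3 : p.1.1 = 1 := by
      by_contra h4
      have h2' : 2 ≤ p.1.1 := by omega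
      have h5 : 0 < p.1.2 := Nat.pos_of_ne_zero fun h => hn (by rw [← hp.1, h, mul_zero])
      have := hp.1
      nlinarith
    rw [h3, hD, zero_mul]

/-- Strong induction along a `LogPair`. -/
lemma LogPair.induction {a D : ℕ → ℂ} (h : LogPair a D) (hD : D 1 = 0) {P : ℕ → Prop}
    (h1 : P 1) (ih : ∀ n : ℕ, 1 < n → (∀ m, m ≠ 0 → m < n → P m) →
      (a n = (∑ p ∈ n.divisorsAntidiagonal with p.2 < n, D p.1 * a p.2) / Real.log n) → P n)
    (n : ℕ) (hn : n ≠ 0) : P n := by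
  induction n using Nat.strong_induction_on with
  | _ n IH =>
    rcases eq_or_ne n 1 with rfl | hn1
    · exact h1
    refine ih n (by omega) (fun m hm hmn => IH m hmn hm) ?_
    rw [eq_div_iff (log_natCast_ne_zero hn hn1), h n hn, Finset.sum_filter]
    refine Finset.sum_congr rfl fun p hp => ?_
    have hp := Nat.mem_divisorsAntidiagonal.mp hp
    split_ifs with h
    · rfl
    · have h2 : 0 < p.1 := Nat.pos_of_ne_zero fun h => hn (by rw [← hp.1, h, zero_mul])
      have h3 : p.1 = 1 := by
        by_contra h4
        have h2' : 2 ≤ p.1 := by omega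
        have h5 : 0 < p.2 := Nat.pos_of_ne_zero fun h => hn (by rw [← hp.1, h, mul_zero])
        have := hp.1
        nlinarith
      rw [h3, hD, zero_mul]

lemma snd_ne_zero_of_mem_divisorsAntidiagonal {n : ℕ} {p : ℕ × ℕ}
    (hp : p ∈ n.divisorsAntidiagonal) : p.2 ≠ 0 := by
  have hp := Nat.mem_divisorsAntidiagonal.mp hp
  exact fun h => hp.2 (by rw [← hp.1, h, mul_zero])

lemma LogPair.norm_le {a D : ℕ → ℂ} (h : LogPair a D) (hD : D 1 = 0) {r Λ : ℕ → ℝ}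
    (hr : LogPair (fun n => (r n : ℂ)) (fun n => (Λ n : ℂ))) (hΛ : ∀ n, ‖D n‖ ≤ Λ n)
    (hr0 : ∀ n, 0 ≤ r n) (h1 : ‖a 1‖ ≤ r 1) (n : ℕ) (hn : n ≠ 0) : ‖a n‖ ≤ r n := by
  refine h.induction hD (P := fun n => ‖a n‖ ≤ r n) h1 (fun n hn IH han => ?_) n hn
  have hlog : 0 < Real.log n := Real.log_pos (by exact_mod_cast hn)
  have h2 : r n * Real.log n = ∑ p ∈ n.divisorsAntidiagonal, Λ p.1 * r p.2 := by
    have := hr n (by omega)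
    dsimp only at this
    exact_mod_cast this
  rw [han, norm_div, Complex.norm_real, Real.norm_of_nonneg hlog.le, div_le_iff₀ hlog, h2]
  refine (norm_sum_le _ _).trans ?_
  refine (Finset.sum_le_sum (g := fun p => Λ p.1 * r p.2) fun p hp => ?_).trans
    (Finset.sum_le_sum_of_subset_of_nonneg (Finset.filter_subset _ _) fun p _ _ => ?_)
  · rw [Finset.mem_filter] at hp
    rw [norm_mul]
    exact mul_le_mul (hΛ _) (IH _ (snd_ne_zero_of_mem_divisorsAntidiagonal hp.1) hp.2)
      (norm_nonneg _) ((norm_nonneg _).trans (hΛ _))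
  · exact mul_nonneg ((norm_nonneg _).trans (hΛ _)) (hr0 _)

lemma LogPair.nonneg {a D : ℕ → ℂ} (h : LogPair a D) (hD : D 1 = 0) (hD0 : ∀ n, 0 ≤ D n)
    (h1 : 0 ≤ a 1) (n : ℕ) (hn : n ≠ 0) : 0 ≤ a n := by
  refine h.induction hD (P := fun n => 0 ≤ a n) h1 (fun n hn IH han => ?_) n hn
  have hlog : 0 < Real.log n := Real.log_pos (by exact_mod_cast hn)
  rw [han, div_eq_mul_inv, ← Complex.ofReal_inv]
  refine mul_nonneg (Finset.sum_nonneg fun p hp => ?_) ?_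
  · rw [Finset.mem_filter] at hp
    exact mul_nonneg (hD0 _) (IH _ (snd_ne_zero_of_mem_divisorsAntidiagonal hp.1) hp.2)
  · exact_mod_cast (inv_pos.mpr hlog).le

lemma LogPair.im_eq_zero {a D : ℕ → ℂ} (h : LogPair a D) (hD : D 1 = 0)
    (hD0 : ∀ n, (D n).im = 0) (h1 : (a 1).im = 0) (n : ℕ) (hn : n ≠ 0) : (a n).im = 0 := by
  refine h.induction hD (P := fun n => (a n).im = 0) h1 (fun n hn IH han => ?_) n hn
  rw [han, Complex.div_ofReal_im, Complex.im_sum, Finset.sum_eq_zero, zero_div]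
  intro p hp
  rw [Finset.mem_filter] at hp
  rw [Complex.mul_im, hD0, IH _ (snd_ne_zero_of_mem_divisorsAntidiagonal hp.1) hp.2]
  simp

lemma LogPair.twist {a D f : ℕ → ℂ} (h : LogPair a D) (hf : ∀ m n, f (m * n) = f m * f n) :
    LogPair (fun n => f n * a n) (fun n => f n * D n) := by
  intro n hn
  dsimp only
  rw [mul_assoc, h n hn, Finset.mul_sum]
  refine Finset.sum_congr rfl fun p hp => ?_
  rw [← (Nat.mem_divisorsAntidiagonal.mp hp).1, hf]
  ring

lemma LogPair.logMul_eq {a D : ℕ → ℂ} (h : LogPair a D) {n : ℕ} (hn : n ≠ 0) :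
    logMul a n = LSeries.convolution D a n := by
  rw [LSeries.convolution_def]
  have := h n hn
  simp only [logMul]
  rw [← this, mul_comm, ← Complex.natCast_log]

lemma LogPair.convolution {a b D E : ℕ → ℂ} (ha : LogPair a D) (hb : LogPair b E) :
    LogPair (LSeries.convolution a b) (fun n => D n + E n) := by
  intro n hn
  have h1 : LSeries.convolution a b n * Real.log n =
      LSeries.convolution (logMul a) b n + LSeries.convolution a (logMul b) n := by
    simp only [LSeries.convolution_def, Finset.sum_mul, ← Finset.sum_add_distrib]
    refine Finset.sum_congr rfl fun p hp => ?_
    have hp := Nat.mem_divisorsAntidiagonal.mp hp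
    have h2 : p.1 ≠ 0 := fun h => hn (by rw [← hp.1, h, zero_mul])
    have h3 : p.2 ≠ 0 := fun h => hn (by rw [← hp.1, h, mul_zero])
    rw [← hp.1]
    push_cast
    rw [Real.log_mul (by exact_mod_cast h2) (by exact_mod_cast h3)]
    simp only [logMul, ← Complex.natCast_log]
    push_cast
    ring
  have h2 : LSeries.convolution (logMul a) b = LSeries.convolution (LSeries.convolution D a) b :=
    LSeries.convolution_congr (fun hn => ha.logMul_eq hn) fun _ => rfl
  have h3 : LSeries.convolution a (logMul b) = LSeries.convolution a (LSeries.convolution E b) :=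
    LSeries.convolution_congr (fun _ => rfl) fun hn => hb.logMul_eq hn
  have h4 : ∑ p ∈ n.divisorsAntidiagonal, (D p.1 + E p.1) * (LSeries.convolution a b) p.2 =
      LSeries.convolution D (LSeries.convolution a b) n +
        LSeries.convolution E (LSeries.convolution a b) n := by
    simp only [LSeries.convolution_def, ← Finset.sum_add_distrib, add_mul]
  rw [h4, h1, h2, h3]
  have h5 : LSeries.convolution (LSeries.convolution D a) b =
      LSeries.convolution D (LSeries.convolution a b) := by
    simp only [LSeries.convolution, ArithmeticFunction.toArithmeticFunction_eq_self, mul_assoc]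
  have h6 : LSeries.convolution a (LSeries.convolution E b) =
      LSeries.convolution E (LSeries.convolution a b) := by
    simp only [LSeries.convolution, ArithmeticFunction.toArithmeticFunction_eq_self]
    rw [mul_left_comm]
  rw [h5, h6]

lemma convolution_one {a b : ℕ → ℂ} : (LSeries.convolution a b) 1 = a 1 * b 1 := by
  simp [LSeries.convolution_def]

/-- The twisted inverse of a Dirichlet series. -/
lemma LogPair.convolution_inverse {a D : ℕ → ℂ} (h : LogPair a D) (hD : D 1 = 0)
    (h1 : a 1 = 1) {n : ℕ} (hn : n ≠ 0) :
    (LSeries.convolution a (logPairExp (fun n => -D n))) n = LSeries.delta n := by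
  have h2 := (h.convolution (logPair_logPairExp (D := fun n => -D n) (by simp [hD]))) n hn
  rcases eq_or_ne n 1 with rfl | hn1
  · rw [convolution_one, h1, logPairExp_one]; simp [LSeries.delta]
  · simp only [add_neg_cancel, zero_mul, Finset.sum_const_zero, mul_eq_zero,
      log_natCast_ne_zero hn hn1, or_false] at h2
    rw [h2]; simp [LSeries.delta, hn1]

lemma LogPair.hasDerivAt {a D : ℕ → ℂ} (h : LogPair a D) {s : ℂ}
    (ha : abscissaOfAbsConv a < s.re) (hD : LSeriesSummable D s) :
    HasDerivAt (LSeries a) (-(LSeries D s * LSeries a s)) s := by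
  have h1 := LSeries_hasDerivAt ha
  have h2 : LSeries (logMul a) s = LSeries (LSeries.convolution D a) s :=
    LSeries_congr (fun hn => h.logMul_eq hn) s
  rwa [h2, LSeries_convolution' hD (LSeriesSummable_of_abscissaOfAbsConv_lt_re ha)] at h1

end LogPairs

section NormSystems
open Finset LSeries Filter Topology

/-- The abstract data needed for the prime number theorem with characters: counting functions
`r` (of ideals of given norm) and `Λ` (von Mangoldt weights of ideals of given norm). -/
structure NormSystem (r Λ : ℕ → ℝ) (A δ κ : ℝ) : Prop where
  r_nonneg : ∀ n, 0 ≤ r n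
  r_one : r 1 = 1
  lam_nonneg : ∀ n, 0 ≤ Λ n
  pair : LogPair (fun n => (r n : ℂ)) (fun n => (Λ n : ℂ))
  δ_pos : 0 < δ
  δ_le : δ ≤ 1
  one_le : 1 ≤ A
  κ_pos : 0 < κ
  count : SumBound (fun n => (r n : ℂ)) κ A δ
  twist : ∀ (q : ℕ) [NeZero q] (χ : DirichletCharacter ℂ q), ∃ c : ℂ, ‖c‖ ≤ A ∧
    SumBound (fun n => χ n * (r n : ℂ)) c (A * q) δ
  bad : ∀ (q : ℕ), q ≠ 0 → ∀ N : ℕ,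
    ∑ n ∈ Finset.Icc 1 N with ¬ n.Coprime q, Λ n ≤ Nat.log 2 N * (A * Real.log q)

/-- A normalised `LogPair` whose logarithmic part is dominated by `Λ`. -/
structure TwistPair (Λ : ℕ → ℝ) (a D : ℕ → ℂ) : Prop where
  pair : LogPair a D
  one : a 1 = 1
  le : ∀ n, ‖D n‖ ≤ Λ n

/-- The analytic continuation of `(s - 1) * LSeries a s`. -/
noncomputable def lfun (a : ℕ → ℂ) (c s : ℂ) : ℂ := c * s + s * (s - 1) * restInt a c s

theorem exists_normSystem (K : Type*) [Field K] [NumberField K] :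
    ∃ A δ κ : ℝ, NormSystem (fun n => idealCount K n) (idealLambda K) A δ κ := by
  obtain ⟨A, hA, κ, hκ, h1, h2⟩ := exists_idealCount_asymp K
  have hd : (1 : ℝ) ≤ Module.finrank ℚ K := by exact_mod_cast Module.finrank_pos
  have hd1 : (1 : ℝ) / Module.finrank ℚ K ≤ 1 := by
    rw [div_le_one (by linarith)]; exact hd
  refine ⟨max A (Module.finrank ℚ K), 1 / Module.finrank ℚ K, κ,
    fun n => Nat.cast_nonneg _, by simp [idealCount_one], idealLambda_nonneg, ?_, by positivity,
    hd1, hd.trans (le_max_right _ _), hκ, ?_, ?_, ?_⟩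
  · intro n hn
    have := idealCount_mul_log (K := K) hn
    dsimp only
    exact_mod_cast this
  · intro x hx
    have h := h1 x hx
    have h3 : summatory (fun n => ((idealCount K n : ℝ) : ℂ)) x - κ * x =
        ((∑ n ∈ Finset.Icc 1 ⌊x⌋₊, (idealCount K n : ℝ) - κ * x : ℝ) : ℂ) := by
      simp [summatory]
    rw [h3, Complex.norm_real, Real.norm_eq_abs]
    exact h.trans (by gcongr; exact le_max_left _ _)
  · intro q _ χ
    obtain ⟨c, hc, h⟩ := h2 q (fun a => χ a) (fun a => χ.norm_le_one a)
    refine ⟨c, hc.trans (le_max_left _ _), fun x hx => ?_⟩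
    simp only [summatory, Complex.ofReal_natCast]
    exact (h x hx).trans (by gcongr; exact le_max_left _ _)
  · intro q hq N
    refine (sum_idealLambda_not_coprime hq N).trans ?_
    gcongr
    exact le_max_right _ _

variable {r Λ : ℕ → ℝ} {A δ κ : ℝ}

lemma NormSystem.lam_one (h : NormSystem r Λ A δ κ) : Λ 1 = 0 := by
  have := h.pair 1 one_ne_zero
  simp [h.r_one] at this
  exact_mod_cast this.symm

lemma NormSystem.sum_r_le (h : NormSystem r Λ A δ κ) {x : ℝ} (hx : 1 ≤ x) :
    ∑ n ∈ Finset.Icc 1 ⌊x⌋₊, r n ≤ (κ + A) * x := by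
  have h1 := h.count x hx
  have h3 : summatory (fun n => (r n : ℂ)) x - κ * x =
      ((∑ n ∈ Finset.Icc 1 ⌊x⌋₊, r n - κ * x : ℝ) : ℂ) := by simp [summatory]
  rw [h3, Complex.norm_real, Real.norm_eq_abs] at h1
  have h4 : x ^ (1 - δ) ≤ x := by
    calc x ^ (1 - δ) ≤ x ^ (1 : ℝ) := Real.rpow_le_rpow_of_exponent_le hx (by linarith [h.δ_pos])
      _ = x := Real.rpow_one x
  have := le_abs_self (∑ n ∈ Finset.Icc 1 ⌊x⌋₊, r n - κ * x)
  nlinarith [h.one_le]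

lemma NormSystem.summable_r (h : NormSystem r Λ A δ κ) {s : ℂ} (hs : 1 < s.re) :
    LSeriesSummable (fun n => (r n : ℂ)) s := by
  refine LSeriesSummable_of_sum_norm_bigO_and_nonneg (r := 1) ?_ h.r_nonneg zero_le_one hs
  refine Asymptotics.IsBigO.of_bound (κ + A) ?_
  filter_upwards [eventually_ge_atTop 1] with n hn
  have h1 : (1 : ℝ) ≤ n := by exact_mod_cast hn
  have := h.sum_r_le h1
  rw [Nat.floor_natCast] at this
  rw [Real.rpow_one, Real.norm_of_nonneg (Finset.sum_nonneg fun n _ => h.r_nonneg n),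
    Real.norm_of_nonneg (by linarith)]
  exact this

lemma abscissa_lt_of_forall {a : ℕ → ℂ} (h : ∀ s : ℂ, 1 < s.re → LSeriesSummable a s)
    {s : ℂ} (hs : 1 < s.re) : abscissaOfAbsConv a < s.re := by
  refine (LSeries.abscissaOfAbsConv_le_of_forall_lt_LSeriesSummable (x := 1)
    fun y hy => h y (by simpa using hy)).trans_lt ?_
  exact_mod_cast hs

lemma summable_of_norm_le {a : ℕ → ℂ} {b : ℕ → ℝ} {s : ℂ} (hab : ∀ n, n ≠ 0 → ‖a n‖ ≤ b n)
    (hb : LSeriesSummable (fun n => (b n : ℂ)) s) : LSeriesSummable a s := by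
  refine Summable.of_norm_bounded hb.norm fun n => ?_
  rcases eq_or_ne n 0 with rfl | hn
  · simp
  · exact norm_term_le s ((hab n hn).trans (by simpa using le_abs_self _))

lemma NormSystem.lam_le (h : NormSystem r Λ A δ κ) {n : ℕ} (hn : n ≠ 0) :
    Λ n ≤ r n * Real.log n := by
  have h1 : r n * Real.log n = ∑ p ∈ n.divisorsAntidiagonal, Λ p.1 * r p.2 := by
    have := h.pair n hn
    dsimp only at this
    exact_mod_cast this
  rw [h1]
  have := Finset.single_le_sum (f := fun p : ℕ × ℕ => Λ p.1 * r p.2)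
    (fun p _ => mul_nonneg (h.lam_nonneg _) (h.r_nonneg _))
    (Nat.mem_divisorsAntidiagonal.mpr (⟨mul_one n, hn⟩ : (n, 1).1 * (n, 1).2 = n ∧ n ≠ 0))
  simpa [h.r_one] using this

lemma NormSystem.summable_lam (h : NormSystem r Λ A δ κ) {s : ℂ} (hs : 1 < s.re) :
    LSeriesSummable (fun n => (Λ n : ℂ)) s := by
  refine Summable.of_norm_bounded (LSeriesSummable_logMul_of_lt_re
    (abscissa_lt_of_forall (fun s hs => h.summable_r hs) hs)).norm fun n => ?_
  rcases eq_or_ne n 0 with rfl | hn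
  · simp
  refine norm_term_le s ?_
  simp only [logMul, norm_mul, Complex.norm_real, ← Complex.natCast_log]
  rw [Real.norm_of_nonneg (h.lam_nonneg n), Real.norm_of_nonneg (h.r_nonneg n),
    Real.norm_of_nonneg (Real.log_natCast_nonneg n), mul_comm]
  exact h.lam_le hn

lemma TwistPair.D_one {a D : ℕ → ℂ} (h : NormSystem r Λ A δ κ) (ht : TwistPair Λ a D) :
    D 1 = 0 := by
  have := ht.le 1
  rw [h.lam_one] at this
  exact norm_le_zero_iff.mp this

lemma TwistPair.norm_le {a D : ℕ → ℂ} (h : NormSystem r Λ A δ κ) (ht : TwistPair Λ a D)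
    {n : ℕ} (hn : n ≠ 0) : ‖a n‖ ≤ r n :=
  ht.pair.norm_le (ht.D_one h) h.pair ht.le h.r_nonneg (by simp [ht.one, h.r_one]) n hn

lemma TwistPair.summable_a {a D : ℕ → ℂ} (h : NormSystem r Λ A δ κ) (ht : TwistPair Λ a D)
    {s : ℂ} (hs : 1 < s.re) : LSeriesSummable a s :=
  summable_of_norm_le (fun _ hn => ht.norm_le h hn) (h.summable_r hs)

lemma TwistPair.summable_D {a D : ℕ → ℂ} (h : NormSystem r Λ A δ κ) (ht : TwistPair Λ a D)
    {s : ℂ} (hs : 1 < s.re) : LSeriesSummable D s :=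
  summable_of_norm_le (fun n _ => ht.le n) (h.summable_lam hs)

lemma TwistPair.abscissa_lt {a D : ℕ → ℂ} (h : NormSystem r Λ A δ κ) (ht : TwistPair Λ a D)
    {s : ℂ} (hs : 1 < s.re) : abscissaOfAbsConv a < s.re :=
  abscissa_lt_of_forall (fun _ hs => ht.summable_a h hs) hs

lemma TwistPair.hasDerivAt {a D : ℕ → ℂ} (h : NormSystem r Λ A δ κ) (ht : TwistPair Λ a D)
    {s : ℂ} (hs : 1 < s.re) :
    HasDerivAt (LSeries a) (-(LSeries D s * LSeries a s)) s :=
  ht.pair.hasDerivAt (ht.abscissa_lt h hs) (ht.summable_D h hs)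

lemma norm_LSeries_le {a : ℕ → ℂ} {b : ℕ → ℝ} {s : ℂ} (hab : ∀ n, n ≠ 0 → ‖a n‖ ≤ b n)
    (hb : LSeriesSummable (fun n => (b n : ℂ)) s) :
    ‖LSeries a s‖ ≤ (LSeries (fun n => (b n : ℂ)) s.re).re := by
  have hb' : LSeriesSummable (fun n => (b n : ℂ)) s.re :=
    (LSeriesSummable_iff_of_re_eq_re (by simp)).mp hb
  have h1 : ∀ n, ‖term a s n‖ ≤ (term (fun n => (b n : ℂ)) s.re n).re := by
    intro n
    rcases eq_or_ne n 0 with rfl | hn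
    · simp
    · rw [norm_term_eq, if_neg hn, term_of_ne_zero hn, ← Complex.ofReal_natCast,
        ← Complex.ofReal_cpow (Nat.cast_nonneg n), ← Complex.ofReal_div, Complex.ofReal_re]
      gcongr
      exact hab n hn
  rw [LSeries, LSeries, Complex.re_tsum hb']
  have h2 : Summable fun n => (term (fun n => (b n : ℂ)) s.re n).re :=
    (Complex.hasSum_re hb'.hasSum).summable
  exact tsum_of_norm_bounded h2.hasSum h1

lemma NormSystem.zeta_le (h : NormSystem r Λ A δ κ) {σ : ℝ} (hσ : 1 < σ) :
    (LSeries (fun n => (r n : ℂ)) σ).re ≤ (κ + A) * σ / (σ - 1) := by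
  refine (Complex.re_le_norm _).trans ?_
  have hs : (1 : ℝ) < (σ : ℂ).re := by simpa
  have hδ := h.δ_pos
  have hκ := h.κ_pos
  rw [LSeries_eq_restInt h.count h.δ_pos hs (h.summable_r hs)]
  have h1 := norm_restInt_le h.count (s := σ) (by simp; linarith)
  refine (norm_add_le _ _).trans ?_
  rw [norm_mul, norm_mul, norm_div, Complex.norm_real, Complex.norm_real,
    Real.norm_of_nonneg h.κ_pos.le, Real.norm_of_nonneg (by linarith : 0 ≤ σ),
    show (σ : ℂ) - 1 = ((σ - 1 : ℝ) : ℂ) by push_cast; rfl, Complex.norm_real,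
    Real.norm_of_nonneg (by linarith)]
  rw [Complex.ofReal_re] at h1
  have h2 : A / (σ - 1 + δ) ≤ A / (σ - 1) :=
    div_le_div_of_nonneg_left (by linarith [h.one_le]) (by linarith) (by linarith)
  calc _ ≤ κ * (σ / (σ - 1)) + σ * (A / (σ - 1)) := by gcongr; exact h1.trans h2
    _ = _ := by ring

lemma TwistPair.one_le_norm_mul {a D : ℕ → ℂ} (h : NormSystem r Λ A δ κ) (ht : TwistPair Λ a D)
    {s : ℂ} (hs : 1 < s.re) : 1 ≤ ‖LSeries a s‖ * ((κ + A) * s.re / (s.re - 1)) := by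
  set b := logPairExp (fun n => -D n) with hb
  have htb : TwistPair Λ b (fun n => -D n) :=
    ⟨logPair_logPairExp (by simp [ht.D_one h]), logPairExp_one _, fun n => by simpa using ht.le n⟩
  have h1 : LSeries (LSeries.convolution a b) s = 1 := by
    rw [LSeries_congr (g := LSeries.delta)
      (fun hn => ht.pair.convolution_inverse (ht.D_one h) ht.one hn), LSeries_delta]
    rfl
  rw [LSeries_convolution' (ht.summable_a h hs) (htb.summable_a h hs)] at h1
  have h2 := congrArg norm h1
  rw [norm_mul, norm_one] at h2
  refine h2.symm.le.trans (mul_le_mul_of_nonneg_left ?_ (norm_nonneg _))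
  exact (norm_LSeries_le (fun _ hn => htb.norm_le h hn) (h.summable_r hs)).trans (h.zeta_le hs)

lemma TwistPair.LSeries_ne_zero {a D : ℕ → ℂ} (h : NormSystem r Λ A δ κ)
    (ht : TwistPair Λ a D) {s : ℂ} (hs : 1 < s.re) : LSeries a s ≠ 0 := by
  intro h0
  have := ht.one_le_norm_mul h hs
  rw [h0] at this
  simp at this
  linarith

lemma lfun_eq {a : ℕ → ℂ} {c : ℂ} {Q δ : ℝ} (hb : SumBound a c Q δ) (hδ : 0 < δ) {s : ℂ}
    (hs : 1 < s.re) (ha : LSeriesSummable a s) : lfun a c s = (s - 1) * LSeries a s := by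
  rw [LSeries_eq_restInt hb hδ hs ha, lfun]
  have : s - 1 ≠ 0 := fun h0 => by
    have : s.re = 1 := by rw [sub_eq_zero.mp h0]; simp
    linarith
  field_simp

lemma differentiableAt_lfun {a : ℕ → ℂ} {c : ℂ} {Q δ : ℝ} (hb : SumBound a c Q δ) (hδ : δ ≤ 1)
    {s : ℂ} (hs : 1 - δ < s.re) : DifferentiableAt ℂ (lfun a c) s := by
  have := differentiableAt_restInt hb hδ hs
  unfold lfun
  fun_prop

lemma norm_lfun_le {a : ℕ → ℂ} {c : ℂ} {Q δ : ℝ} (hb : SumBound a c Q δ) {s : ℂ}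
    (hs : 1 - δ < s.re) :
    ‖lfun a c s‖ ≤ ‖s‖ * (‖c‖ + ‖s - 1‖ * (Q / (s.re - 1 + δ))) := by
  unfold lfun
  refine (norm_add_le _ _).trans ?_
  rw [norm_mul, norm_mul, norm_mul]
  have := norm_restInt_le hb hs
  calc _ ≤ ‖c‖ * ‖s‖ + ‖s‖ * ‖s - 1‖ * (Q / (s.re - 1 + δ)) := by gcongr
    _ = _ := by ring

lemma lfun_one (a : ℕ → ℂ) (c : ℂ) : lfun a c 1 = c := by simp [lfun]

lemma TwistPair.lfun_ne_zero {a D : ℕ → ℂ} {c : ℂ} {Q δ' : ℝ} (h : NormSystem r Λ A δ κ)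
    (ht : TwistPair Λ a D) (hb : SumBound a c Q δ') (hδ : 0 < δ') {s : ℂ} (hs : 1 < s.re) :
    lfun a c s ≠ 0 := by
  rw [lfun_eq hb hδ hs (ht.summable_a h hs)]
  refine mul_ne_zero (fun h0 => ?_) (ht.LSeries_ne_zero h hs)
  have : s.re = 1 := by rw [sub_eq_zero.mp h0]; simp
  linarith

lemma TwistPair.logDeriv_lfun {a D : ℕ → ℂ} {c : ℂ} {Q δ' : ℝ} (h : NormSystem r Λ A δ κ)
    (ht : TwistPair Λ a D) (hb : SumBound a c Q δ') (hδ : 0 < δ') {s : ℂ} (hs : 1 < s.re) :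
    logDeriv (lfun a c) s = 1 / (s - 1) - LSeries D s := by
  have hev : lfun a c =ᶠ[𝓝 s] fun s => (s - 1) * LSeries a s := by
    filter_upwards [(isOpen_lt continuous_const Complex.continuous_re).mem_nhds hs] with z hz
    exact lfun_eq hb hδ hz (ht.summable_a h hz)
  have hne : s - 1 ≠ 0 := fun h0 => by
    have : s.re = 1 := by rw [sub_eq_zero.mp h0]; simp
    linarith
  have hL := ht.LSeries_ne_zero h hs
  have hd : HasDerivAt (fun s => (s - 1) * LSeries a s)
      (1 * LSeries a s + (s - 1) * -(LSeries D s * LSeries a s)) s :=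
    ((hasDerivAt_id s).sub_const 1).mul (ht.hasDerivAt h hs)
  rw [logDeriv_apply, hev.deriv_eq, hev.eq_of_nhds, hd.deriv]
  field_simp
  ring

end NormSystems

section ComplexLemmas
open Metric Filter Topology

lemma exists_log_of_ne_zero {f : ℂ → ℂ} {R B : ℝ} (hR : 0 < R) (hB : 0 < B)
    (hf : DifferentiableOn ℂ f (ball 0 R)) (h0 : ∀ z ∈ ball (0 : ℂ) R, f z ≠ 0)
    (hM : ∀ z ∈ ball (0 : ℂ) R, ‖f z‖ ≤ Real.exp B * ‖f 0‖) :
    ∃ h : ℂ → ℂ, (∀ z ∈ ball (0 : ℂ) R, HasDerivAt h (logDeriv f z) z) ∧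
      ∀ z ∈ ball (0 : ℂ) R, ‖h z‖ ≤ 2 * B * ‖z‖ / (R - ‖z‖) := by
  have hmem : (0 : ℂ) ∈ ball (0 : ℂ) R := mem_ball_self hR
  have hd : DifferentiableOn ℂ (logDeriv f) (ball 0 R) :=
    (hf.deriv isOpen_ball).div hf h0
  obtain ⟨h, hh0, hh⟩ := hd.isExactOn_ball.with_val_at 0 0
  have hconst : ∀ z ∈ ball (0 : ℂ) R, f z * Complex.exp (-h z) = f 0 := by
    have hder : ∀ z ∈ ball (0 : ℂ) R, HasDerivAt (fun z => f z * Complex.exp (-h z)) 0 z := by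
      intro z hz
      have h1 := (hf.differentiableAt (isOpen_ball.mem_nhds hz)).hasDerivAt
      have h2 := h1.mul ((hh z hz).neg.cexp)
      refine h2.congr_deriv ?_
      have := h0 z hz
      simp only [logDeriv_apply]
      field_simp
      ring
    intro z hz
    have h3 := (convex_ball (0 : ℂ) R).is_const_of_fderivWithin_eq_zero (𝕜 := ℂ)
      (f := fun z => f z * Complex.exp (-h z))
      (fun z hz => (hder z hz).differentiableAt.differentiableWithinAt)
      (fun z hz => by
        rw [fderivWithin_of_isOpen isOpen_ball hz]
        have := (hder z hz).hasFDerivAt.fderiv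
        rw [this]; ext; simp) hz hmem
    simpa [hh0] using h3
  refine ⟨h, hh, fun z hz => ?_⟩
  refine Complex.borelCaratheodory_zero hB
    (fun z hz => (hh z hz).differentiableAt.differentiableWithinAt) (fun w hw => ?_) hR hz hh0
  have h1 := hM w hw
  have h2 := congrArg norm (hconst w hw)
  rw [norm_mul, Complex.norm_exp, Complex.neg_re] at h2
  have hf0 : 0 < ‖f 0‖ := norm_pos_iff.mpr (h0 0 hmem)
  rw [Set.mem_ofPred_eq]
  by_contra! hc
  have h3 : Real.exp B * Real.exp (-(h w).re) < 1 := by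
    rw [← Real.exp_add, Real.exp_lt_one_iff]; linarith
  nlinarith [Real.exp_pos (-(h w).re)]

lemma norm_logDeriv_zero_le {f : ℂ → ℂ} {R B : ℝ} (hR : 0 < R) (hB : 0 < B)
    (hf : DifferentiableOn ℂ f (ball 0 R)) (h0 : ∀ z ∈ ball (0 : ℂ) R, f z ≠ 0)
    (hM : ∀ z ∈ ball (0 : ℂ) R, ‖f z‖ ≤ Real.exp B * ‖f 0‖) :
    ‖logDeriv f 0‖ ≤ 2 * B / R := by
  obtain ⟨h, hh, hb⟩ := exists_log_of_ne_zero hR hB hf h0 hM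
  have key : ∀ ρ ∈ Set.Ioo 0 R, ‖logDeriv f 0‖ ≤ 2 * B / (R - ρ) := by
    intro ρ hρ
    have h1 : ‖deriv h 0‖ ≤ (2 * B * ρ / (R - ρ)) / ρ := by
      refine Complex.norm_deriv_le_of_forall_mem_sphere_norm_le hρ.1 ?_ fun z hz => ?_
      · refine DifferentiableOn.diffContOnCl_ball (U := ball 0 R)
          (fun z hz => (hh z hz).differentiableAt.differentiableWithinAt) ?_
        exact closedBall_subset_ball hρ.2
      · have hz' : ‖z‖ = ρ := by simpa using hz
        have := hb z (by simpa [hz'] using hρ.2)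
        rwa [hz'] at this
    rw [(hh 0 (mem_ball_self hR)).deriv] at h1
    refine h1.trans_eq ?_
    have := hρ.1.ne'
    field_simp
  have htend : Tendsto (fun ρ : ℝ => 2 * B / (R - ρ)) (𝓝[>] 0) (𝓝 (2 * B / (R - 0))) := by
    refine tendsto_nhdsWithin_of_tendsto_nhds (ContinuousAt.tendsto ?_)
    refine ContinuousAt.div (by fun_prop) (by fun_prop) (by simpa using hR.ne')
  rw [sub_zero] at htend
  refine ge_of_tendsto htend ?_
  filter_upwards [Ioo_mem_nhdsGT hR] with ρ hρ using key ρ hρ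

lemma norm_logDeriv_le_of_ne_zero {f : ℂ → ℂ} {s₀ z : ℂ} {R B : ℝ} (hR : 0 < R) (hB : 0 < B)
    (hf : DifferentiableOn ℂ f (ball s₀ R)) (h0 : ∀ z ∈ ball s₀ R, f z ≠ 0)
    (hM : ∀ z ∈ ball s₀ R, ‖f z‖ ≤ Real.exp B * ‖f s₀‖) (hz : ‖z - s₀‖ ≤ R / 2) :
    ‖logDeriv f z‖ ≤ 24 * B / R := by
  have hmaps : ∀ w ∈ ball (0 : ℂ) R, w + s₀ ∈ ball s₀ R := fun w hw => by
    simpa using hw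
  obtain ⟨h, hh, hb⟩ := exists_log_of_ne_zero (f := fun w => f (w + s₀)) hR hB
    (fun w hw => ((hf.differentiableAt (isOpen_ball.mem_nhds (hmaps w hw))).comp w
      (by fun_prop)).differentiableWithinAt)
    (fun w hw => h0 _ (hmaps w hw)) (fun w hw => by simpa using hM _ (hmaps w hw))
  have hsub : closedBall (z - s₀) (R / 4) ⊆ ball (0 : ℂ) R := by
    intro w hw
    rw [mem_closedBall, dist_eq_norm] at hw
    rw [mem_ball_zero_iff]
    have := norm_add_le (w - (z - s₀)) (z - s₀)
    rw [sub_add_cancel] at this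
    linarith
  have h1 : ‖deriv h (z - s₀)‖ ≤ (6 * B) / (R / 4) := by
    refine Complex.norm_deriv_le_of_forall_mem_sphere_norm_le (by positivity) ?_ fun w hw => ?_
    · exact DifferentiableOn.diffContOnCl_ball (U := ball 0 R)
        (fun z hz => (hh z hz).differentiableAt.differentiableWithinAt) hsub
    · have hw' := hsub (sphere_subset_closedBall hw)
      have h2 := hb w hw'
      have h3 : ‖w‖ ≤ 3 / 4 * R := by
        rw [mem_sphere, dist_eq_norm] at hw
        have := norm_add_le (w - (z - s₀)) (z - s₀)
        rw [sub_add_cancel] at this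
        linarith
      refine h2.trans ?_
      rw [div_le_iff₀ (by linarith)]
      nlinarith
  have hmem : z - s₀ ∈ ball (0 : ℂ) R := hsub (mem_closedBall_self (by positivity))
  rw [(hh _ hmem).deriv] at h1
  have h4 : logDeriv (fun w => f (w + s₀)) (z - s₀) = logDeriv f z := by
    simp only [logDeriv_apply, deriv_comp_add_const, sub_add_cancel]
  rw [h4] at h1
  refine h1.trans_eq (by ring)

/-- Removing a zero by a Blaschke factor. -/
lemma exists_blaschke {f : ℂ → ℂ} {R M : ℝ} {ρ : ℂ} (hR : 0 < R)
    (hf : DiffContOnCl ℂ f (ball 0 R)) (hM : ∀ z ∈ ball (0 : ℂ) R, ‖f z‖ ≤ M)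
    (hρ : ρ ∈ ball (0 : ℂ) R) (hfρ : f ρ = 0) (h0 : f 0 ≠ 0) :
    ∃ g : ℂ → ℂ, DiffContOnCl ℂ g (ball 0 R) ∧ (∀ z ∈ ball (0 : ℂ) R, ‖g z‖ ≤ M) ∧
      (∀ z ∈ ball (0 : ℂ) R, g z = 0 → f z = 0) ∧ ‖g 0‖ * ‖ρ‖ = ‖f 0‖ * R ∧
      logDeriv f 0 = logDeriv g 0 + (-ρ)⁻¹ * (1 - ‖ρ‖ ^ 2 / R ^ 2 : ℝ) := by
  have hρ' : ‖ρ‖ < R := by simpa using hρ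
  have hρ0 : ρ ≠ 0 := fun h => h0 (h ▸ hfρ)
  have hnhds : ball (0 : ℂ) R ∈ 𝓝 ρ := isOpen_ball.mem_nhds hρ
  have hRc : (R : ℂ) ≠ 0 := by exact_mod_cast hR.ne'
  set m : ℂ → ℂ := fun z => (R ^ 2 - z * (starRingEnd ℂ) ρ) / R with hm
  have hmd : Differentiable ℂ m := by fun_prop
  set F := dslope f ρ with hF
  have hfF : ∀ z, f z = (z - ρ) * F z := fun z => by
    have := sub_smul_dslope f ρ z
    rw [hfρ, sub_zero, smul_eq_mul] at this
    exact this.symm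
  have hFd : DiffContOnCl ℂ F (ball 0 R) := by
    refine ⟨(Complex.differentiableOn_dslope hnhds).mpr hf.differentiableOn, ?_⟩
    exact (continuousOn_dslope (mem_of_superset hnhds subset_closure)).mpr
      ⟨hf.continuousOn, hf.differentiableOn.differentiableAt hnhds⟩
  have hgd : DiffContOnCl ℂ (fun z => m z * F z) (ball 0 R) := hmd.diffContOnCl.smul hFd
  have hMf : ∀ z ∈ closure (ball (0 : ℂ) R), ‖f z‖ ≤ M := fun z hz =>
    closure_minimal (s := ball (0:ℂ) R) (t := closure (ball (0 : ℂ) R) ∩ {z | ‖f z‖ ≤ M})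
      (fun z hz => ⟨subset_closure hz, hM z hz⟩)
      (hf.continuousOn.norm.preimage_isClosed_of_isClosed isClosed_closure isClosed_Iic) hz |>.2
  have hmne : ∀ z ∈ ball (0 : ℂ) R, m z ≠ 0 := by
    intro z hz h1
    rw [hm] at h1
    simp only [div_eq_zero_iff, hRc, or_false, sub_eq_zero] at h1
    have h2 := congrArg norm h1
    rw [norm_mul, RCLike.norm_conj, norm_pow, Complex.norm_real, Real.norm_of_nonneg hR.le] at h2
    have hz' : ‖z‖ < R := by simpa using hz
    nlinarith [norm_nonneg z, norm_nonneg ρ]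
  refine ⟨fun z => m z * F z, hgd, fun z hz => ?_, fun z hz hgz => ?_, ?_, ?_⟩
  · refine Complex.norm_le_of_forall_mem_frontier_norm_le isBounded_ball hgd (fun w hw => ?_)
      (subset_closure hz)
    have hw1 : ‖w‖ = R := by
      rw [frontier_ball _ hR.ne'] at hw
      simpa using hw
    have h1 : ‖m w‖ = ‖w - ρ‖ := by
      have h2 : m w * R = w * (starRingEnd ℂ) (w - ρ) := by
        simp only [hm, map_sub, mul_sub, Complex.mul_conj, Complex.normSq_eq_norm_sq, hw1]
        field_simp
        push_cast
        ring
      have h3 := congrArg norm h2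
      rw [norm_mul, norm_mul, RCLike.norm_conj, hw1, Complex.norm_real,
        Real.norm_of_nonneg hR.le, mul_comm] at h3
      exact mul_left_cancel₀ hR.ne' h3
    rw [norm_mul, h1, ← norm_mul, ← hfF]
    exact hMf w (frontier_subset_closure hw)
  · rw [hfF]
    rcases mul_eq_zero.mp hgz with h | h
    · exact absurd h (hmne z hz)
    · rw [h, mul_zero]
  · have h1 : m 0 = R := by simp only [hm]; field_simp; simp
    dsimp only
    rw [h1, norm_mul, hfF 0, norm_mul, Complex.norm_real, Real.norm_of_nonneg hR.le, zero_sub,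
      norm_neg]
    ring
  · have hz : (0 : ℂ) ∈ ball (0 : ℂ) R := mem_ball_self hR
    have hF0 : F 0 ≠ 0 := fun h => h0 (by rw [hfF, h, mul_zero])
    have hFdiff : DifferentiableAt ℂ F 0 :=
      hFd.differentiableOn.differentiableAt (isOpen_ball.mem_nhds hz)
    have e1 : f = fun z => (z - ρ) * F z := funext hfF
    have h1 : logDeriv f 0 = logDeriv (fun z => z - ρ) 0 + logDeriv F 0 := by
      conv_lhs => rw [e1]
      exact logDeriv_mul 0 (by simpa using hρ0) hF0 (by fun_prop) hFdiff
    rw [h1, logDeriv_mul (f := m) (g := F) 0 (hmne 0 hz) hF0 hmd.differentiableAt hFdiff]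
    have h2 : logDeriv (fun z => z - ρ) 0 = (-ρ)⁻¹ := by
      simp [logDeriv_apply]
    have h3 : logDeriv m 0 = -(starRingEnd ℂ) ρ / R ^ 2 := by
      have : HasDerivAt m (-(starRingEnd ℂ) ρ / R) 0 := by
        have := (((hasDerivAt_id (0:ℂ)).mul_const ((starRingEnd ℂ) ρ)).const_sub
          ((R:ℂ)^2)).div_const (R:ℂ)
        simpa using this
      rw [logDeriv_apply, this.deriv]
      simp only [hm, zero_mul, sub_zero]
      field_simp
    rw [h2, h3]
    push_cast
    rw [← Complex.mul_conj']
    field_simp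
    ring

/-- If `f` has no zeros to the right of the centre, then its logarithmic derivative at the centre
has real part bounded below. -/
lemma neg_le_re_logDeriv_zero {f : ℂ → ℂ} {R R' B : ℝ} (hR' : 0 < R') (hR : R' < R) (hB : 0 < B)
    (hf : DiffContOnCl ℂ f (ball 0 R)) (h0 : f 0 ≠ 0)
    (hM : ∀ z ∈ ball (0 : ℂ) R, ‖f z‖ ≤ Real.exp B * ‖f 0‖)
    (hz : ∀ z ∈ ball (0 : ℂ) R, f z = 0 → z.re ≤ 0) :
    -(2 * B / R') ≤ (logDeriv f 0).re := by
  have hR0 : 0 < R := hR'.trans hR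
  have key : ∀ N : ℕ, ∀ f : ℂ → ℂ, ∀ M : ℝ, DiffContOnCl ℂ f (ball 0 R) → f 0 ≠ 0 →
      (∀ z ∈ ball (0 : ℂ) R, ‖f z‖ ≤ M) → M ≤ Real.exp B * ‖f 0‖ →
      (∀ z ∈ ball (0 : ℂ) R, f z = 0 → z.re ≤ 0) → M < ‖f 0‖ * (R / R') ^ N →
      -(2 * B / R') ≤ (logDeriv f 0).re := by
    intro N
    induction N with
    | zero =>
      intro f M _ _ hM _ _ hN
      rw [pow_zero, mul_one] at hN
      exact absurd (hM 0 (mem_ball_self hR0)) (not_le.mpr hN)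
    | succ N ih =>
      intro f M hf h0 hM hMB hz hN
      by_cases hne : ∀ z ∈ ball (0 : ℂ) R', f z ≠ 0
      · have h1 := norm_logDeriv_zero_le hR' hB
          (hf.differentiableOn.mono (ball_subset_ball hR.le)) hne
          (fun z hz => (hM z (ball_subset_ball hR.le hz)).trans hMB)
        have := Complex.abs_re_le_norm (logDeriv f 0)
        have := neg_abs_le (logDeriv f 0).re
        linarith
      · push Not at hne
        obtain ⟨ρ, hρ, hfρ⟩ := hne
        have hρR := ball_subset_ball hR.le hρ
        obtain ⟨g, hg, hgM, hgz, hg0, hlog⟩ := exists_blaschke hR0 hf hM hρR hfρ h0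
        have hρ' : ‖ρ‖ < R' := by simpa using hρ
        have hf0 : 0 < ‖f 0‖ := norm_pos_iff.mpr h0
        have hg0' : g 0 ≠ 0 := fun h => by
          rw [h, norm_zero, zero_mul] at hg0
          exact (mul_pos hf0 hR0).ne hg0
        have hgf : ‖f 0‖ * (R / R') ≤ ‖g 0‖ := by
          rw [← mul_div_assoc, ← hg0, div_le_iff₀ hR']
          gcongr
        have hterm : 0 ≤ ((-ρ)⁻¹ * (1 - ‖ρ‖ ^ 2 / R ^ 2 : ℝ)).re := by
          rw [Complex.re_mul_ofReal]
          refine mul_nonneg ?_ ?_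
          · rw [Complex.inv_re]
            have := hz ρ hρR hfρ
            exact div_nonneg (by simpa using this) (Complex.normSq_nonneg _)
          · rw [sub_nonneg, div_le_one (by positivity)]
            gcongr
            linarith
        have hlog' : (logDeriv g 0).re ≤ (logDeriv f 0).re := by
          rw [hlog, Complex.add_re]; linarith
        have hq : 1 < R / R' := (one_lt_div hR').mpr hR
        have hfg : ‖f 0‖ ≤ ‖g 0‖ := by nlinarith
        refine (ih g M hg hg0' hgM (hMB.trans (by gcongr)) (fun z hz' h => hz z hz' (hgz z hz' h))
          (hN.trans_le ?_)).trans hlog'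
        calc ‖f 0‖ * (R / R') ^ (N + 1) = ‖f 0‖ * (R / R') * (R / R') ^ N := by ring
          _ ≤ _ := by gcongr
  obtain ⟨N, hN⟩ := pow_unbounded_of_one_lt (Real.exp B) ((one_lt_div hR').mpr hR)
  refine key N f _ hf h0 hM le_rfl hz ?_
  rw [mul_comm]
  exact mul_lt_mul_of_pos_left hN (norm_pos_iff.mpr h0)

/-- Lower bound for the real part of the logarithmic derivative, keeping one zero. -/
lemma re_logDeriv_ge_of_zero {f : ℂ → ℂ} {s₀ ρ : ℂ} {R R' B : ℝ} (hR' : 0 < R') (hR : R' < R)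
    (hB : 0 < B) (hf : DifferentiableOn ℂ f (closedBall s₀ R)) (h0 : f s₀ ≠ 0)
    (hM : ∀ z ∈ ball s₀ R, ‖f z‖ ≤ Real.exp B * ‖f s₀‖)
    (hz : ∀ z ∈ ball s₀ R, f z = 0 → z.re ≤ s₀.re) (hρ : ρ ∈ ball s₀ R) (hfρ : f ρ = 0) :
    -(2 * B / R') + (s₀ - ρ)⁻¹.re * (1 - ‖s₀ - ρ‖ ^ 2 / R ^ 2) ≤ (logDeriv f s₀).re := by
  have hR0 : 0 < R := hR'.trans hR
  have hmaps : ∀ w ∈ ball (0 : ℂ) R, w + s₀ ∈ ball s₀ R := fun w hw => by simpa using hw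
  have hcont : DiffContOnCl ℂ (fun w => f (w + s₀)) (ball 0 R) := by
    have : DifferentiableOn ℂ (fun w => f (w + s₀)) (closedBall 0 R) := by
      refine hf.comp (by fun_prop) fun w hw => ?_
      simpa using hw
    exact DifferentiableOn.diffContOnCl (this.mono closure_ball_subset_closedBall)
  have hlog : logDeriv (fun w => f (w + s₀)) 0 = logDeriv f s₀ := by
    simp only [logDeriv_apply, deriv_comp_add_const, zero_add]
  obtain ⟨g, hg, hgM, hgz, hg0, hl⟩ := exists_blaschke (ρ := ρ - s₀) hR0 hcont
    (fun z hz => hM _ (hmaps z hz)) (by simpa [dist_eq_norm] using hρ) (by simpa using hfρ)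
    (by simpa using h0)
  have hρ' : ‖ρ - s₀‖ < R := by simpa [dist_eq_norm] using hρ
  have hf0 : 0 < ‖f s₀‖ := norm_pos_iff.mpr h0
  rw [zero_add] at hg0
  have hfg : ‖f s₀‖ ≤ ‖g 0‖ := by
    have : ‖g 0‖ * ‖ρ - s₀‖ ≤ ‖g 0‖ * R := by gcongr
    rw [hg0] at this
    exact le_of_mul_le_mul_right this hR0
  have h1 := neg_le_re_logDeriv_zero hR' hR hB hg (norm_pos_iff.mp (hf0.trans_le hfg))
    (fun z hz => (hgM z hz).trans (by gcongr)) (fun z hz' h => by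
      have := hz _ (hmaps z hz') (hgz z hz' h)
      simpa using this)
  rw [← hlog, hl, Complex.add_re, Complex.re_mul_ofReal, neg_sub, norm_sub_rev s₀ ρ]
  linarith

lemma re_logDeriv_ge {f : ℂ → ℂ} {s₀ : ℂ} {R R' B : ℝ} (hR' : 0 < R') (hR : R' < R)
    (hB : 0 < B) (hf : DifferentiableOn ℂ f (closedBall s₀ R)) (h0 : f s₀ ≠ 0)
    (hM : ∀ z ∈ ball s₀ R, ‖f z‖ ≤ Real.exp B * ‖f s₀‖)
    (hz : ∀ z ∈ ball s₀ R, f z = 0 → z.re ≤ s₀.re) :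
    -(2 * B / R') ≤ (logDeriv f s₀).re := by
  have hmaps : ∀ w ∈ ball (0 : ℂ) R, w + s₀ ∈ ball s₀ R := fun w hw => by simpa using hw
  have hcont : DiffContOnCl ℂ (fun w => f (w + s₀)) (ball 0 R) := by
    have : DifferentiableOn ℂ (fun w => f (w + s₀)) (closedBall 0 R) := by
      refine hf.comp (by fun_prop) fun w hw => ?_
      simpa using hw
    exact DifferentiableOn.diffContOnCl (this.mono closure_ball_subset_closedBall)
  have hlog : logDeriv (fun w => f (w + s₀)) 0 = logDeriv f s₀ := by
    simp only [logDeriv_apply, deriv_comp_add_const, zero_add]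
  rw [← hlog]
  exact neg_le_re_logDeriv_zero hR' hR hB hcont (by simpa using h0)
    (fun z hz => by simpa using hM _ (hmaps z hz))
    (fun z hz' h => by simpa using hz _ (hmaps z hz') h)

end ComplexLemmas

section Estermann
open Metric Filter Topology
open scoped ComplexOrder

lemma iteratedDeriv_sub_one_inv (k : ℕ) {s : ℂ} :
    iteratedDeriv k (fun s : ℂ => (s - 1)⁻¹) s = (-1) ^ k * k.factorial / (s - 1) ^ (k + 1) := by
  have := congrFun (iteratedDeriv_comp_sub_const (𝕜 := ℂ) k (fun s : ℂ => s⁻¹) 1) s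
  rw [this, iteratedDeriv_eq_iterate]
  have h2 := iter_deriv_inv (𝕜 := ℂ) k (s - 1)
  rw [h2, div_eq_mul_inv]
  congr 1
  rw [show (-1 - k : ℤ) = -((k + 1 : ℕ) : ℤ) by push_cast; ring, zpow_neg, zpow_natCast]

lemma one_le_re_LSeries {b : ℕ → ℂ} (hb : ∀ n, 0 ≤ b n) (hb1 : b 1 = 1) {x : ℝ}
    (hs : LSeriesSummable b x) : 1 ≤ (LSeries b x).re := by
  rw [LSeries, Complex.re_tsum hs]
  have h1 : ∀ n, 0 ≤ (LSeries.term b x n).re := fun n =>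
    (Complex.le_def.mp (LSeries.term_nonneg (hb n) x)).1
  have h2 := (Complex.hasSum_re hs.hasSum).summable.le_tsum 1 fun n _ => h1 n
  simpa [LSeries.term_of_ne_zero, hb1] using h2

/-- Estermann's lower bound for the residue of a Dirichlet series with nonnegative
coefficients. -/
lemma estermann_lower_bound {b : ℕ → ℂ} (hb : ∀ n, 0 ≤ b n) (hb1 : b 1 = 1)
    (hsum : ∀ s : ℂ, 1 < s.re → LSeriesSummable b s) {G : ℂ → ℂ} {d Q ρ β : ℝ} (hd : 0 < d)
    (hG : DifferentiableOn ℂ G (closedBall ((1 + d : ℝ) : ℂ) (2 * d)))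
    (hGF : ∀ s : ℂ, 1 < s.re → G s = (s - 1) * LSeries b s)
    (hGb : ∀ z ∈ closedBall ((1 + d : ℝ) : ℂ) (2 * d), ‖G z‖ ≤ Q)
    (hρ : G 1 = (ρ : ℂ)) (hβ : 1 - d / 2 ≤ β) (hβ1 : β < 1) (hGβ : 0 ≤ (G β).re) {m : ℕ}
    (hm0 : 0 < m) (hm : 16 * Q / d * (3 / 4) ^ m ≤ 1) :
    (1 - β) / 2 ≤ ρ * (1 + (1 - β) / d) ^ m := by
  set s₀ : ℂ := ((1 + d : ℝ) : ℂ) with hs₀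
  have hd2 : 0 < 2 * d := by linarith
  have hs₀re : s₀.re = 1 + d := by simp [hs₀]
  have h1mem : (1 : ℂ) ∈ ball s₀ (2 * d) := by
    rw [mem_ball, dist_eq_norm, hs₀, show (1 : ℂ) - ((1 + d : ℝ) : ℂ) = ((-d : ℝ) : ℂ) by
      push_cast; ring, Complex.norm_real, norm_neg, Real.norm_of_nonneg hd.le]
    linarith
  have hnhds : closedBall s₀ (2 * d) ∈ 𝓝 (1 : ℂ) :=
    mem_of_superset (isOpen_ball.mem_nhds h1mem) ball_subset_closedBall
  set H := dslope G 1 with hH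
  have hHd : DifferentiableOn ℂ H (closedBall s₀ (2 * d)) :=
    (Complex.differentiableOn_dslope hnhds).mpr hG
  have hHeq : ∀ z, z ≠ 1 → H z = (G z - ρ) / (z - 1) := fun z hz => by
    rw [hH, dslope_of_ne _ hz, slope_def_field, hρ]
  have hQ : 0 ≤ Q := (norm_nonneg _).trans (hGb 1 (ball_subset_closedBall h1mem))
  have hHb : ∀ z ∈ sphere s₀ (2 * d), ‖H z‖ ≤ 2 * Q / d := by
    intro z hz
    have hz1 : d ≤ ‖z - 1‖ := by
      have h1 : ‖z - s₀‖ = 2 * d := by rwa [mem_sphere, dist_eq_norm] at hz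
      have h2 : ‖(1 : ℂ) - s₀‖ = d := by
        rw [hs₀, show (1 : ℂ) - ((1 + d : ℝ) : ℂ) = ((-d : ℝ) : ℂ) by
          push_cast; ring, Complex.norm_real, norm_neg, Real.norm_of_nonneg hd.le]
      have h3 := norm_sub_le (z - s₀) (1 - s₀)
      have h4 := norm_add_le (z - 1) (1 - s₀)
      rw [show z - 1 + (1 - s₀) = z - s₀ by ring] at h4
      linarith
    have hne : z ≠ 1 := fun h => by rw [h, sub_self, norm_zero] at hz1; linarith
    rw [hHeq z hne, norm_div]
    have h5 : ‖G z - ρ‖ ≤ 2 * Q := by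
      rw [← hρ]
      refine (norm_sub_le _ _).trans ?_
      linarith [hGb z (sphere_subset_closedBall hz), hGb 1 (ball_subset_closedBall h1mem)]
    exact div_le_div₀ (by linarith) h5 hd hz1
  have hcl : DiffContOnCl ℂ H (ball s₀ (2 * d)) :=
    (hHd.mono closure_ball_subset_closedBall).diffContOnCl
  set y := 1 + d - β with hy
  have hy0 : 0 < y := by linarith
  have hyd : y ≤ 3 / 2 * d := by linarith
  have hβs : (β : ℂ) - s₀ = ((-y : ℝ) : ℂ) := by rw [hs₀, hy]; push_cast; ring
  have hβmem : (β : ℂ) ∈ ball s₀ (2 * d) := by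
    rw [mem_ball, dist_eq_norm, hβs, Complex.norm_real, norm_neg, Real.norm_of_nonneg hy0.le]
    linarith
  have hT := Complex.hasSum_taylorSeries_on_ball hcl.differentiableOn hβmem
  set T : ℕ → ℂ := fun n => (n.factorial : ℂ)⁻¹ • ((β : ℂ) - s₀) ^ n • iteratedDeriv n H s₀
    with hTdef
  have hTn : ∀ k, ‖T k‖ ≤ 2 * Q / d * (3 / 4) ^ k := by
    intro k
    have h1 := Complex.norm_iteratedDeriv_le_of_forall_mem_sphere_norm_le k hd2 hcl hHb
    simp only [hTdef, norm_smul, norm_inv, norm_pow, hβs, Complex.norm_natCast]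
    rw [Complex.norm_real, norm_neg, Real.norm_of_nonneg hy0.le]
    calc (k.factorial : ℝ)⁻¹ * (y ^ k * ‖iteratedDeriv k H s₀‖)
        ≤ (k.factorial : ℝ)⁻¹ * ((3 / 2 * d) ^ k *
          (k.factorial * (2 * Q / d) / (2 * d) ^ k)) := by gcongr
      _ = 2 * Q / d * ((3 / 2 * d) ^ k / (2 * d) ^ k) := by
          have : (k.factorial : ℝ) ≠ 0 := by positivity
          field_simp
      _ = _ := by
          rw [← div_pow]
          congr 2
          field_simp
          norm_num
  have habs : LSeries.abscissaOfAbsConv b < ((1 + d : ℝ) : EReal) := by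
    have := abscissa_lt_of_forall hsum (s := s₀) (by rw [hs₀re]; linarith)
    rwa [hs₀re] at this
  have hopen : IsOpen {s : ℂ | 1 < s.re} := isOpen_lt continuous_const Complex.continuous_re
  have hTk : ∀ k, T k = ((y ^ k / k.factorial : ℝ) : ℂ) *
      ((-1) ^ k * iteratedDeriv k (LSeries b) s₀) - ((ρ * y ^ k / d ^ (k + 1) : ℝ) : ℂ) := by
    intro k
    have hev : H =ᶠ[𝓝 s₀] fun s => LSeries b s - ρ * (s - 1)⁻¹ := by
      filter_upwards [hopen.mem_nhds (show 1 < s₀.re by rw [hs₀re]; linarith)] with z hz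
      have hz1 : z - 1 ≠ 0 := fun h => by
        have : z.re = 1 := by rw [sub_eq_zero.mp h]; simp
        linarith [show (1 : ℝ) < z.re from hz]
      rw [hHeq z (sub_ne_zero.mp hz1), hGF z hz]
      field_simp
    have hs1 : s₀ - 1 = (d : ℂ) := by rw [hs₀]; push_cast; ring
    have hdc : (d : ℂ) ≠ 0 := by exact_mod_cast hd.ne'
    have hLa : AnalyticAt ℂ (LSeries b) s₀ :=
      LSeries_analyticOnNhd b s₀ (by simpa [hs₀re] using habs)
    have hinv : AnalyticAt ℂ (fun s : ℂ => (s - 1)⁻¹) s₀ :=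
      (analyticAt_id.sub analyticAt_const).inv (by simpa [hs1] using hdc)
    have h1 : iteratedDeriv k H s₀ = iteratedDeriv k (LSeries b) s₀ -
        ρ * ((-1) ^ k * k.factorial / d ^ (k + 1)) := by
      rw [hev.iteratedDeriv_eq k]
      have h2 := iteratedDeriv_fun_sub (n := k) (x := s₀) (f := LSeries b)
        (g := fun s => ρ * (s - 1)⁻¹) hLa.contDiffAt (analyticAt_const.mul hinv).contDiffAt
      rw [h2, iteratedDeriv_const_mul_field, iteratedDeriv_sub_one_inv, hs1]
    simp only [hTdef, smul_eq_mul, hβs, h1]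
    have hk : (k.factorial : ℂ) ≠ 0 := by exact_mod_cast k.factorial_ne_zero
    push_cast
    rw [neg_pow]
    have hsq : ((-1 : ℂ) ^ k) * (-1) ^ k = 1 := by rw [← mul_pow]; simp
    field_simp
    linear_combination (-(k.factorial : ℂ) * ρ) * hsq
  have hTre : ∀ k, -(ρ * y ^ k / d ^ (k + 1)) + (if k = 0 then 1 else 0) ≤ (T k).re := by
    intro k
    rw [hTk, Complex.sub_re, Complex.ofReal_re, Complex.re_ofReal_mul]
    have h1 : (if k = 0 then 1 else 0) ≤
        y ^ k / k.factorial * ((-1) ^ k * iteratedDeriv k (LSeries b) s₀).re := by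
      split_ifs with hk
      · subst hk
        have h0 := one_le_re_LSeries hb hb1 (hsum s₀ (by rw [hs₀re]; linarith))
        rw [pow_zero, pow_zero, Nat.factorial_zero, Nat.cast_one, iteratedDeriv_zero, one_mul,
          div_one, one_mul]
        exact h0
      · have := LSeries.iteratedDeriv_alternating (a := b) hb (x := 1 + d) habs k
        have h2 := (Complex.le_def.mp this).1
        exact mul_nonneg (by positivity) h2
    linarith
  have hTsum := hT.summable
  have hresum := (Complex.hasSum_re hT)
  have hsplit := hresum.summable.sum_add_tsum_nat_add m
  rw [hresum.tsum_eq] at hsplit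
  have hgeo : HasSum (fun k : ℕ => 2 * Q / d * (3 / 4 : ℝ) ^ (k + m))
      (8 * Q / d * (3 / 4) ^ m) := by
    have h1 := (hasSum_geometric_of_lt_one (r := (3 / 4 : ℝ)) (by norm_num)
      (by norm_num)).mul_left (2 * Q / d * (3 / 4) ^ m)
    have h2 : (fun k : ℕ => 2 * Q / d * (3 / 4 : ℝ) ^ (k + m)) =
        fun k => 2 * Q / d * (3 / 4) ^ m * (3 / 4) ^ k := by
      ext k; rw [pow_add]; ring
    have h3 : 8 * Q / d * (3 / 4) ^ m = 2 * Q / d * (3 / 4) ^ m * (1 - 3 / 4)⁻¹ := by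
      rw [show ((1 : ℝ) - 3 / 4)⁻¹ = 4 by norm_num]; ring
    rw [h2, h3]
    exact h1
  have htail : -(8 * Q / d * (3 / 4) ^ m) ≤ ∑' k, (T (k + m)).re := by
    have h1 : ‖∑' k, (T (k + m)).re‖ ≤ 8 * Q / d * (3 / 4) ^ m :=
      tsum_of_norm_bounded hgeo fun k =>
        (Complex.abs_re_le_norm _).trans (hTn (k + m))
    exact (abs_le.mp h1).1
  have hhead : 1 - ρ * ((y / d) ^ m - 1) / (1 - β) ≤ ∑ k ∈ Finset.range m, (T k).re := by
    refine le_trans ?_ (Finset.sum_le_sum fun k _ => hTre k)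
    rw [Finset.sum_add_distrib, Finset.sum_ite_eq' (Finset.range m) 0,
      if_pos (Finset.mem_range.mpr hm0)]
    have h1 : ∑ k ∈ Finset.range m, -(ρ * y ^ k / d ^ (k + 1)) =
        -(ρ / d * ∑ k ∈ Finset.range m, (y / d) ^ k) := by
      rw [Finset.mul_sum, ← Finset.sum_neg_distrib]
      refine Finset.sum_congr rfl fun k _ => ?_
      rw [div_pow, pow_succ]
      field_simp
    have hne : y / d ≠ 1 := by
      rw [Ne, div_eq_one_iff_eq hd.ne']
      intro h; linarith
    rw [h1, geom_sum_eq hne]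
    have h2 : y / d - 1 = (1 - β) / d := by rw [hy]; field_simp; ring
    rw [h2]
    have h3 : 1 - β ≠ 0 := by linarith
    apply le_of_eq
    field_simp
    ring
  have hHβ : (H β).re ≤ ρ / (1 - β) := by
    have hne : (β : ℂ) ≠ 1 := by
      intro h
      have : β = 1 := by exact_mod_cast h
      linarith
    rw [hHeq _ hne, show (β : ℂ) - 1 = ((β - 1 : ℝ) : ℂ) by push_cast; rfl,
      Complex.div_ofReal_re, Complex.sub_re, Complex.ofReal_re,
      ← neg_div_neg_eq, neg_sub, neg_sub]
    have : 0 < 1 - β := by linarith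
    gcongr
    linarith
  have hyy : y / d = 1 + (1 - β) / d := by rw [hy]; field_simp; ring
  rw [← hyy]
  have h1β : 0 < 1 - β := by linarith
  have hfin : 1 / 2 ≤ ρ * (y / d) ^ m / (1 - β) := by
    have h1 : 8 * Q / d * (3 / 4) ^ m ≤ 1 / 2 := by
      have : 16 * Q / d * (3 / 4) ^ m = 2 * (8 * Q / d * (3 / 4) ^ m) := by ring
      linarith
    have h2 : ρ * ((y / d) ^ m - 1) / (1 - β) + ρ / (1 - β) = ρ * (y / d) ^ m / (1 - β) := by
      ring
    linarith
  rw [le_div_iff₀ h1β] at hfin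
  linarith

end Estermann

section Twist
open Metric Filter Topology

variable {r Λ : ℕ → ℝ} {A δ κ : ℝ}

/-- The arithmetic function `f` twisted by a Dirichlet character. -/
noncomputable def twistBy (f : ℕ → ℝ) {q : ℕ} (χ : DirichletCharacter ℂ q) (n : ℕ) : ℂ :=
  χ n * (f n : ℂ)

/-- The product of two Dirichlet characters, to the product of the levels. -/
noncomputable def mulLevel {q₁ q₂ : ℕ} (χ : DirichletCharacter ℂ q₁)
    (ψ : DirichletCharacter ℂ q₂) : DirichletCharacter ℂ (q₁ * q₂) :=
  χ.changeLevel (Dvd.intro _ rfl) * ψ.changeLevel (Dvd.intro_left _ rfl)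

lemma dirichletCharacter_natCast_eq_zero {q n : ℕ} (χ : DirichletCharacter ℂ q)
    (h : ¬ n.Coprime q) : χ n = 0 :=
  χ.map_nonunit fun hu => h ((ZMod.isUnit_iff_coprime n q).mp hu)

lemma mulLevel_apply {q₁ q₂ : ℕ} (χ : DirichletCharacter ℂ q₁)
    (ψ : DirichletCharacter ℂ q₂) (n : ℕ) :
    mulLevel χ ψ (n : ZMod (q₁ * q₂)) = χ n * ψ n := by
  by_cases h : n.Coprime (q₁ * q₂)
  · have hu : IsUnit ((n : ZMod (q₁ * q₂))) := (ZMod.isUnit_iff_coprime n _).mpr h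
    have h1 := DirichletCharacter.changeLevel_eq_cast_of_dvd χ (Dvd.intro q₂ rfl) hu.unit
    have h2 := DirichletCharacter.changeLevel_eq_cast_of_dvd ψ (Dvd.intro_left q₁ rfl) hu.unit
    rw [hu.unit_spec, ZMod.cast_natCast (Dvd.intro q₂ rfl)] at h1
    rw [hu.unit_spec, ZMod.cast_natCast (Dvd.intro_left q₁ rfl)] at h2
    rw [mulLevel, MulChar.mul_apply, h1, h2]
  · rw [dirichletCharacter_natCast_eq_zero _ h]
    rw [Nat.coprime_mul_iff_right, not_and_or] at h
    rcases h with h | h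
    · rw [dirichletCharacter_natCast_eq_zero χ h, zero_mul]
    · rw [dirichletCharacter_natCast_eq_zero ψ h, mul_zero]

lemma NormSystem.twistPair (h : NormSystem r Λ A δ κ) {q : ℕ} (χ : DirichletCharacter ℂ q) :
    TwistPair Λ (twistBy r χ) (twistBy Λ χ) where
  pair := h.pair.twist (f := fun n => χ n) fun m n => by simp
  one := by simp [twistBy, h.r_one]
  le n := by
    rw [twistBy, norm_mul, Complex.norm_real, Real.norm_of_nonneg (h.lam_nonneg n)]
    exact mul_le_of_le_one_left (h.lam_nonneg n) (χ.norm_le_one _)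

lemma NormSystem.twistPair_self (h : NormSystem r Λ A δ κ) :
    TwistPair Λ (fun n => (r n : ℂ)) (fun n => (Λ n : ℂ)) :=
  ⟨h.pair, by simp [h.r_one], fun n => by simp [abs_of_nonneg (h.lam_nonneg n)]⟩

/-- The analytic continuation of `LSeries a s` when `∑_{n ≤ x} a n` has no main term. -/
noncomputable def gfun (a : ℕ → ℂ) (s : ℂ) : ℂ := s * restInt a 0 s

lemma lfun_zero_eq (a : ℕ → ℂ) (s : ℂ) : lfun a 0 s = (s - 1) * gfun a s := by
  rw [lfun, gfun]; ring

lemma differentiableAt_gfun {a : ℕ → ℂ} {Q δ : ℝ} (hb : SumBound a 0 Q δ) (hδ : δ ≤ 1)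
    {s : ℂ} (hs : 1 - δ < s.re) : DifferentiableAt ℂ (gfun a) s := by
  have := differentiableAt_restInt hb hδ hs
  unfold gfun
  fun_prop

lemma analyticAt_gfun {a : ℕ → ℂ} {Q δ : ℝ} (hb : SumBound a 0 Q δ) (hδ : δ ≤ 1)
    {s : ℂ} (hs : 1 - δ < s.re) : AnalyticAt ℂ (gfun a) s := by
  refine DifferentiableOn.analyticAt (s := {z : ℂ | 1 - δ < z.re})
    (fun z hz => (differentiableAt_gfun hb hδ hz).differentiableWithinAt) ?_
  exact (isOpen_lt continuous_const Complex.continuous_re).mem_nhds hs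

lemma norm_gfun_le {a : ℕ → ℂ} {Q δ : ℝ} (hb : SumBound a 0 Q δ) {s : ℂ}
    (hs : 1 - δ < s.re) : ‖gfun a s‖ ≤ ‖s‖ * (Q / (s.re - 1 + δ)) := by
  rw [gfun, norm_mul]
  exact mul_le_mul_of_nonneg_left (norm_restInt_le hb hs) (norm_nonneg _)

lemma gfun_eq {a : ℕ → ℂ} {Q δ : ℝ} (hb : SumBound a 0 Q δ) (hδ : 0 < δ) {s : ℂ}
    (hs : 1 < s.re) (ha : LSeriesSummable a s) : gfun a s = LSeries a s := by
  rw [LSeries_eq_restInt hb hδ hs ha, gfun]; ring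

lemma gfun_im_eq_zero {a : ℕ → ℂ} (ha : ∀ n, n ≠ 0 → (a n).im = 0) (σ : ℝ) :
    (gfun a σ).im = 0 := by
  rw [gfun, Complex.im_ofReal_mul, restInt_im_eq_zero ha (by simp), mul_zero]

/-- Interpolation between the trivial bound and a power saving. -/
lemma SumBound.interpolate {a : ℕ → ℂ} {c : ℂ} {C q δ ε : ℝ} (h : SumBound a c (C * q) δ)
    (hC : 0 ≤ C) (hq : 0 ≤ q) (h1 : ∀ x : ℝ, 1 ≤ x → ‖summatory a x - c * x‖ ≤ C * x)
    (hε : 0 ≤ ε) (hε1 : ε ≤ 1) : SumBound a c (C * q ^ ε) (δ * ε) := by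
  intro x hx
  have hx0 : 0 < x := by linarith
  set y := ‖summatory a x - c * x‖
  have hy : 0 ≤ y := norm_nonneg _
  calc y = y ^ (1 - ε) * y ^ ε := by
        rw [← Real.rpow_add_of_nonneg hy (by linarith) hε, sub_add_cancel, Real.rpow_one]
    _ ≤ (C * x) ^ (1 - ε) * (C * q * x ^ (1 - δ)) ^ ε :=
        mul_le_mul (Real.rpow_le_rpow hy (h1 x hx) (by linarith))
          (Real.rpow_le_rpow hy (h x hx) hε) (by positivity) (by positivity)
    _ = (C ^ (1 - ε) * C ^ ε) * q ^ ε * (x ^ (1 - ε) * x ^ ((1 - δ) * ε)) := by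
        rw [Real.mul_rpow hC hx0.le, Real.mul_rpow (by positivity) (by positivity),
          Real.mul_rpow hC hq, ← Real.rpow_mul hx0.le]
        ring
    _ = C * q ^ ε * x ^ (1 - δ * ε) := by
        rw [← Real.rpow_add_of_nonneg hC (by linarith) hε, ← Real.rpow_add hx0, sub_add_cancel,
          Real.rpow_one]
        congr 2
        ring

lemma SumBound.mono {a : ℕ → ℂ} {c : ℂ} {Q Q' δ : ℝ} (h : SumBound a c Q δ) (hQ : Q ≤ Q') :
    SumBound a c Q' δ := fun x hx =>
  (h x hx).trans (mul_le_mul_of_nonneg_right hQ (Real.rpow_nonneg (by linarith) _))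

lemma NormSystem.norm_summatory_le (h : NormSystem r Λ A δ κ) {a D : ℕ → ℂ}
    (ht : TwistPair Λ a D) {x : ℝ} (hx : 1 ≤ x) : ‖summatory a x‖ ≤ (κ + A) * x := by
  refine le_trans ?_ (h.sum_r_le hx)
  refine (norm_sum_le _ _).trans (Finset.sum_le_sum fun n hn => ?_)
  exact ht.norm_le h (by have := (Finset.mem_Icc.mp hn).1; omega)

lemma NormSystem.interpolate (h : NormSystem r Λ A δ κ) {a D : ℕ → ℂ} (ht : TwistPair Λ a D)
    {c : ℂ} (hc : ‖c‖ ≤ A) {q : ℝ} (hq : 0 ≤ q) (hb : SumBound a c (A * q) δ)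
    {ε : ℝ} (hε : 0 ≤ ε) (hε1 : ε ≤ 1) : SumBound a c ((κ + 2 * A) * q ^ ε) (δ * ε) := by
  have hκ := h.κ_pos
  have hA := h.one_le
  refine SumBound.interpolate (hb.mono ?_) (by linarith) hq (fun x hx => ?_) hε hε1
  · exact mul_le_mul_of_nonneg_right (by linarith) hq
  · have h1 := h.norm_summatory_le ht hx
    have h2 : ‖c * (x : ℂ)‖ ≤ A * x := by
      rw [norm_mul, Complex.norm_real, Real.norm_of_nonneg (by linarith)]
      exact mul_le_mul_of_nonneg_right hc (by linarith)
    calc _ ≤ ‖summatory a x‖ + ‖c * (x : ℂ)‖ := norm_sub_le _ _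
      _ ≤ _ := by linarith

/-- The Dirichlet series supported on integers not coprime to a modulus converge for `Re s > 0`. -/
lemma NormSystem.summable_of_not_coprime (h : NormSystem r Λ A δ κ) {q : ℕ} (hq : q ≠ 0)
    {E : ℕ → ℂ} {B : ℝ} (hE : ∀ n, ‖E n‖ ≤ B * Λ n) (hE0 : ∀ n, n.Coprime q → E n = 0) {s : ℂ}
    (hs : 0 < s.re) : LSeriesSummable E s := by
  have hB : ∀ n, ‖E n‖ ≤ |B| * Λ n := fun n =>
    (hE n).trans (mul_le_mul_of_nonneg_right (le_abs_self B) (h.lam_nonneg n))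
  have hlogq : 0 ≤ Real.log q := Real.log_natCast_nonneg q
  have hA := h.one_le
  have hl2 := Real.log_pos (show (1 : ℝ) < 2 by norm_num)
  refine LSeriesSummable_of_sum_norm_bigO (r := s.re / 2) ?_ (by linarith) (by linarith)
  have hlog : (fun n : ℕ => Real.log n) =O[atTop] fun n : ℕ => (n : ℝ) ^ (s.re / 2) :=
    ((isLittleO_log_rpow_atTop (by linarith : 0 < s.re / 2)).isBigO).comp_tendsto
      tendsto_natCast_atTop_atTop
  refine Asymptotics.IsBigO.trans (Asymptotics.IsBigO.of_bound
    (|B| * (A * Real.log q) / Real.log 2) ?_) hlog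
  filter_upwards [eventually_ge_atTop 1] with N hN
  rw [Real.norm_of_nonneg (Finset.sum_nonneg fun n _ => norm_nonneg _),
    Real.norm_of_nonneg (Real.log_natCast_nonneg N)]
  have h1 : ∑ n ∈ Finset.Icc 1 N, ‖E n‖ ≤
      |B| * ∑ n ∈ Finset.Icc 1 N with ¬ n.Coprime q, Λ n := by
    rw [Finset.mul_sum, Finset.sum_filter]
    refine Finset.sum_le_sum fun n _ => ?_
    split_ifs with hc
    · rw [hE0 n hc, norm_zero]
    · exact hB n
  have h2 : (Nat.log 2 N : ℝ) ≤ Real.log N / Real.log 2 := by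
    rw [le_div_iff₀ hl2, ← Real.log_pow]
    refine Real.log_le_log (by positivity) ?_
    exact_mod_cast Nat.pow_log_le_self 2 (by omega)
  calc _ ≤ |B| * (Nat.log 2 N * (A * Real.log q)) :=
        h1.trans (mul_le_mul_of_nonneg_left (h.bad q hq N) (abs_nonneg B))
    _ ≤ |B| * (Real.log N / Real.log 2 * (A * Real.log q)) := by gcongr
    _ = _ := by ring

/-- A character which is trivial on the support of `Λ`. -/
def TrivChar (Λ : ℕ → ℝ) {q : ℕ} (χ : DirichletCharacter ℂ q) : Prop :=
  ∀ n, Λ n ≠ 0 → χ n ≠ 0 → χ n = 1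

/-- A character whose `L`-function is entire and does not vanish at `1`. -/
structure GoodChar (r : ℕ → ℝ) (A δ : ℝ) {q : ℕ} (χ : DirichletCharacter ℂ q) : Prop where
  bound : SumBound (twistBy r χ) 0 (A * q) δ
  ne_zero : gfun (twistBy r χ) 1 ≠ 0

/-- A `NormSystem` for which the nontrivial characters have nonvanishing `L`-values at `1`. -/
structure CharSystem (r Λ : ℕ → ℝ) (A δ κ : ℝ) : Prop extends NormSystem r Λ A δ κ where
  dichotomy : ∀ (q : ℕ) [NeZero q] (χ : DirichletCharacter ℂ q), TrivChar Λ χ ∨ GoodChar r A δ χ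

end Twist

section RealChar
open Metric Filter Topology
open scoped ComplexOrder

variable {r Λ : ℕ → ℝ} {A δ κ : ℝ}

lemma TrivChar.exists_real {q : ℕ} {χ : DirichletCharacter ℂ q} (h : TrivChar Λ (χ ^ 2)) (n : ℕ) :
    ∃ e : ℝ, |e| ≤ 1 ∧ (Λ n ≠ 0 → χ n = e) := by
  by_cases hn : Λ n = 0
  · exact ⟨0, by simp, fun h => absurd hn h⟩
  by_cases h0 : χ n = 0
  · exact ⟨0, by simp, fun _ => by simp [h0]⟩
  have h1 := h n hn (by rw [MulChar.pow_apply' χ two_ne_zero]; exact pow_ne_zero 2 h0)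
  rw [MulChar.pow_apply' χ two_ne_zero, sq_eq_one_iff] at h1
  rcases h1 with h1 | h1
  · exact ⟨1, by simp, fun _ => by simp [h1]⟩
  · exact ⟨-1, by simp, fun _ => by simp [h1]⟩

lemma TrivChar.twistBy_im {q : ℕ} {χ : DirichletCharacter ℂ q} (h : TrivChar Λ (χ ^ 2)) (n : ℕ) :
    (twistBy Λ χ n).im = 0 := by
  obtain ⟨e, -, he⟩ := h.exists_real n
  by_cases hn : Λ n = 0
  · simp [twistBy, hn]
  · simp [twistBy, he hn]

lemma NormSystem.twistBy_im (hs : NormSystem r Λ A δ κ) {q : ℕ} {χ : DirichletCharacter ℂ q}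
    (h : TrivChar Λ (χ ^ 2)) {n : ℕ} (hn : n ≠ 0) : (twistBy r χ n).im = 0 :=
  (hs.twistPair χ).pair.im_eq_zero ((hs.twistPair χ).D_one hs) h.twistBy_im
    (by rw [(hs.twistPair χ).one]; simp) n hn

lemma isPreconnected_re_gt (x : ℝ) : IsPreconnected {s : ℂ | x < s.re} :=
  (convex_halfSpace_re_gt x).isPreconnected

/-- If two real characters agree up to finitely many Euler factors, their `L`-functions have
the same zeros in `Re s > 0`. -/
lemma NormSystem.zero_transfer (hs : NormSystem r Λ A δ κ) {q₁ q₂ : ℕ} [NeZero q₁] [NeZero q₂]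
    {χ : DirichletCharacter ℂ q₁} {ψ : DirichletCharacter ℂ q₂} {B₁ B₂ : ℝ}
    (hχ : SumBound (twistBy r χ) 0 B₁ δ) (hψ : SumBound (twistBy r ψ) 0 B₂ δ)
    (hψ2 : TrivChar Λ (ψ ^ 2)) (hT : TrivChar Λ (mulLevel χ ψ)) {s : ℂ} (hs1 : 1 - δ < s.re)
    (h0 : gfun (twistBy r ψ) s = 0) : gfun (twistBy r χ) s = 0 := by
  by_contra hne
  have hδ := hs.δ_pos
  have hδ1 := hs.δ_le
  set E : ℕ → ℂ := fun n => twistBy Λ χ n - twistBy Λ ψ n with hE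
  have hEs : ∀ z : ℂ, 0 < z.re → LSeriesSummable E z := by
    intro z hz
    refine hs.summable_of_not_coprime (q := q₁ * q₂) (B := 2)
      (mul_ne_zero (NeZero.ne q₁) (NeZero.ne q₂)) (fun n => ?_) (fun n hn => ?_) hz
    · refine (norm_sub_le _ _).trans ?_
      linarith [(hs.twistPair χ).le n, (hs.twistPair ψ).le n]
    · by_cases hΛ : Λ n = 0
      · simp [hE, twistBy, hΛ]
      have hne : mulLevel χ ψ (n : ZMod (q₁ * q₂)) ≠ 0 :=
        ((((ZMod.isUnit_iff_coprime n _).mpr hn).map (mulLevel χ ψ))).ne_zero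
      have h1 := hT n hΛ hne
      rw [mulLevel_apply] at h1 hne
      have h2 := hψ2 n hΛ (by
        rw [MulChar.pow_apply' ψ two_ne_zero]; exact pow_ne_zero 2 (right_ne_zero_of_mul hne))
      rw [MulChar.pow_apply' ψ two_ne_zero] at h2
      have h3 : χ n = ψ n := by linear_combination (ψ n) * h1 - χ n * h2
      simp [hE, twistBy, h3]
  set U : Set ℂ := {z : ℂ | 1 - δ < z.re}
  have hχa : AnalyticOnNhd ℂ (gfun (twistBy r χ)) U := fun z hz => analyticAt_gfun hχ hδ1 hz
  have hψa : AnalyticOnNhd ℂ (gfun (twistBy r ψ)) U := fun z hz => analyticAt_gfun hψ hδ1 hz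
  have hEa : AnalyticOnNhd ℂ (LSeries E) U := fun z hz => by
    refine LSeries_analyticOnNhd E z ?_
    have hz0 : 0 < z.re := lt_of_le_of_lt (by linarith) (show 1 - δ < z.re from hz)
    refine (LSeries.abscissaOfAbsConv_le_of_forall_lt_LSeriesSummable (x := 0)
      fun y hy => hEs y (by simpa using hy)).trans_lt ?_
    exact_mod_cast hz0
  have hderiv : ∀ {q : ℕ} (φ : DirichletCharacter ℂ q) {B : ℝ} (_ : SumBound (twistBy r φ) 0 B δ)
      {z : ℂ} (_ : 1 < z.re), deriv (gfun (twistBy r φ)) z =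
        -(LSeries (twistBy Λ φ) z * gfun (twistBy r φ) z) := by
    intro q φ B hφ z hz
    have ht := hs.twistPair φ
    have hev : gfun (twistBy r φ) =ᶠ[𝓝 z] LSeries (twistBy r φ) := by
      filter_upwards [(isOpen_lt continuous_const Complex.continuous_re).mem_nhds hz] with w hw
      exact gfun_eq hφ hδ hw (ht.summable_a hs hw)
    rw [hev.deriv_eq, hev.eq_of_nhds, (ht.hasDerivAt hs hz).deriv]
  have h2U : (2 : ℂ) ∈ U := by simp [U]; linarith
  have hident : Set.EqOn
      (fun z => deriv (gfun (twistBy r ψ)) z * gfun (twistBy r χ) z)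
      (fun z => gfun (twistBy r ψ) z * (deriv (gfun (twistBy r χ)) z +
        LSeries E z * gfun (twistBy r χ) z)) U := by
    refine AnalyticOnNhd.eqOn_of_preconnected_of_eventuallyEq
      (fun z hz => (hψa z hz).deriv.mul (hχa z hz))
      (fun z hz => (hψa z hz).mul ((hχa z hz).deriv.add ((hEa z hz).mul (hχa z hz))))
      (isPreconnected_re_gt _) h2U ?_
    filter_upwards [(isOpen_lt continuous_const Complex.continuous_re).mem_nhds
      (show (1 : ℝ) < (2 : ℂ).re by simp)] with z hz
    have hEz : LSeries E z = LSeries (twistBy Λ χ) z - LSeries (twistBy Λ ψ) z :=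
      LSeries_sub ((hs.twistPair χ).summable_D hs hz) ((hs.twistPair ψ).summable_D hs hz)
    rw [hderiv χ hχ hz, hderiv ψ hψ hz, hEz]
    ring
  have hord2 : analyticOrderAt (gfun (twistBy r ψ)) 2 ≠ ⊤ := by
    have h2 : (1 : ℝ) < (2 : ℂ).re := by simp
    rw [(hψa 2 h2U).analyticOrderAt_eq_zero.mpr]
    · simp
    rw [gfun_eq hψ hδ h2 ((hs.twistPair ψ).summable_a hs h2)]
    exact (hs.twistPair ψ).LSeries_ne_zero hs h2
  have hords := hψa.analyticOrderAt_ne_top_of_isPreconnected (isPreconnected_re_gt _) h2U hs1 hord2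
  have hpos : analyticOrderAt (gfun (twistBy r ψ)) s ≠ 0 :=
    (hψa s hs1).analyticOrderAt_ne_zero.mpr h0
  obtain ⟨k, hk⟩ := ENat.ne_top_iff_exists.mp hords
  obtain ⟨m, rfl⟩ : ∃ m, k = m + 1 := Nat.exists_eq_succ_of_ne_zero (by
    rintro rfl; exact hpos (by rw [← hk]; rfl))
  have hd := analyticOrderAt_deriv_of_pos (hψa s hs1) (n := m) (by rw [← hk]; push_cast; rfl)
  have hev : (fun z => deriv (gfun (twistBy r ψ)) z * gfun (twistBy r χ) z) =ᶠ[𝓝 s]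
      (fun z => gfun (twistBy r ψ) z * (deriv (gfun (twistBy r χ)) z +
        LSeries E z * gfun (twistBy r χ) z)) := by
    filter_upwards [(isOpen_lt continuous_const Complex.continuous_re).mem_nhds hs1] with z hz
    exact hident hz
  have hcong := analyticOrderAt_congr hev
  have hL := analyticOrderAt_mul (hψa s hs1).deriv (hχa s hs1)
  have hR := analyticOrderAt_mul (hψa s hs1)
    ((hχa s hs1).deriv.add ((hEa s hs1).mul (hχa s hs1)))
  rw [(hχa s hs1).analyticOrderAt_eq_zero.mpr hne, hd, add_zero] at hL
  have : ((m + 1 : ℕ) : ℕ∞) ≤ m := by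
    rw [← hL, hk]
    exact le_self_add.trans (hR.symm.trans hcong.symm).le
  have := Nat.cast_le.mp this
  omega

end RealChar

section Siegel
open Metric Filter Topology
open scoped ComplexOrder

variable {r Λ : ℕ → ℝ} {A δ κ : ℝ}

/-- A form of Estermann's bound which is uniform in the size `B * q ^ 2` of the function. -/
lemma estermann_uniform {d B ε β : ℝ} (hd : 0 < d) (hB : d ≤ B) (hβ : 1 - d / 2 ≤ β)
    (hβ1 : β < 1) (hε : 8 * ((1 - β) / d) ≤ ε) :
    ∃ c : ℝ, 0 < c ∧ ∀ (q : ℝ) (b : ℕ → ℂ) (G : ℂ → ℂ) (ρ : ℝ), 1 ≤ q → (∀ n, 0 ≤ b n) →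
      b 1 = 1 → (∀ s : ℂ, 1 < s.re → LSeriesSummable b s) →
      DifferentiableOn ℂ G (closedBall ((1 + d : ℝ) : ℂ) (2 * d)) →
      (∀ s : ℂ, 1 < s.re → G s = (s - 1) * LSeries b s) →
      (∀ z ∈ closedBall ((1 + d : ℝ) : ℂ) (2 * d), ‖G z‖ ≤ B * q ^ 2) →
      G 1 = (ρ : ℂ) → 0 ≤ (G β).re → c * q ^ (-ε) ≤ ρ := by
  set θ := (1 - β) / d with hθ
  have hθ0 : 0 < θ := div_pos (by linarith) hd
  have hθ1 : θ ≤ 1 / 2 := by rw [hθ, div_le_iff₀ hd]; linarith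
  have hB0 : 0 < B := by linarith
  refine ⟨(1 - β) / 2 / ((16 * B / d) ^ (4 * θ) * Real.exp 1), div_pos (by linarith)
    (by positivity), fun q b G ρ hq hb hb1 hsum hG hGF hGb hρ hGβ => ?_⟩
  have hq0 : 0 < q := by linarith
  set X := 16 * (B * q ^ 2) / d with hX
  have hXeq : X = 16 * B / d * q ^ 2 := by rw [hX]; ring
  have hX1 : 1 ≤ X := by
    rw [hX, le_div_iff₀ hd]
    nlinarith [one_le_pow₀ hq (n := 2)]
  have hlogX : 0 ≤ Real.log X := Real.log_nonneg hX1
  set m := ⌈4 * Real.log X⌉₊ + 1 with hm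
  have hm1 : 4 * Real.log X ≤ m := by
    rw [hm]; push_cast; linarith [Nat.le_ceil (4 * Real.log X)]
  have hm2 : (m : ℝ) ≤ 4 * Real.log X + 2 := by
    rw [hm]; push_cast; linarith [Nat.ceil_lt_add_one (a := 4 * Real.log X) (by linarith)]
  have h34 : (3 / 4 : ℝ) ^ m ≤ X⁻¹ := by
    have h1 : (3 / 4 : ℝ) ≤ Real.exp (-(1 / 4)) := by
      have := Real.add_one_le_exp (-(1 / 4) : ℝ); linarith
    calc (3 / 4 : ℝ) ^ m ≤ Real.exp (-(1 / 4)) ^ m := pow_le_pow_left₀ (by norm_num) h1 m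
      _ = Real.exp (m * (-(1 / 4))) := (Real.exp_nat_mul _ m).symm
      _ ≤ Real.exp (-Real.log X) := Real.exp_le_exp.mpr (by linarith)
      _ = X⁻¹ := by rw [Real.exp_neg, Real.exp_log (by linarith)]
  have hmain := estermann_lower_bound hb hb1 hsum hd hG hGF hGb hρ hβ hβ1 hGβ (m := m)
    (by omega) (by
      rw [← hX]
      calc X * (3 / 4 : ℝ) ^ m ≤ X * X⁻¹ := by gcongr
        _ = 1 := mul_inv_cancel₀ (by linarith))
  rw [← hθ] at hmain
  have hpow : (1 + θ) ^ m ≤ (16 * B / d) ^ (4 * θ) * Real.exp 1 * q ^ ε := by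
    calc (1 + θ) ^ m ≤ Real.exp θ ^ m :=
          pow_le_pow_left₀ (by linarith) (by linarith [Real.add_one_le_exp θ]) m
      _ = Real.exp (m * θ) := (Real.exp_nat_mul _ m).symm
      _ ≤ Real.exp (Real.log X * (4 * θ) + 1) := Real.exp_le_exp.mpr (by nlinarith)
      _ = X ^ (4 * θ) * Real.exp 1 := by
          rw [Real.exp_add, Real.rpow_def_of_pos (by linarith)]
      _ = (16 * B / d) ^ (4 * θ) * Real.exp 1 * q ^ (8 * θ) := by
          rw [hXeq, Real.mul_rpow (by positivity) (by positivity), ← Real.rpow_natCast,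
            ← Real.rpow_mul hq0.le]
          rw [show ((2 : ℕ) : ℝ) * (4 * θ) = 8 * θ by push_cast; ring]
          ring
      _ ≤ _ := by
          gcongr
  have hpos : 0 < (1 + θ) ^ m := by positivity
  have hρ0 : 0 < ρ := by
    by_contra hcon
    have : ρ * (1 + θ) ^ m ≤ 0 := mul_nonpos_of_nonpos_of_nonneg (not_lt.mp hcon) hpos.le
    linarith
  rw [Real.rpow_neg hq0.le, ← div_eq_mul_inv, div_div, div_le_iff₀ (by positivity)]
  exact hmain.trans (mul_le_mul_of_nonneg_left hpow hρ0.le)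

lemma logPair_convolution_nonneg {a b D E : ℕ → ℂ} (ha : LogPair a D) (hb : LogPair b E)
    (ha1 : a 1 = 1) (hb1 : b 1 = 1) (hD1 : D 1 + E 1 = 0) (hDE : ∀ n, 0 ≤ D n + E n) (n : ℕ) :
    0 ≤ LSeries.convolution a b n := by
  rcases eq_or_ne n 0 with rfl | hn
  · simp
  · exact (ha.convolution hb).nonneg hD1 hDE (by rw [convolution_one, ha1, hb1, one_mul]; simp) n hn

lemma TrivChar.add_nonneg (hΛ : ∀ n, 0 ≤ Λ n) {q : ℕ} {χ : DirichletCharacter ℂ q}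
    (h : TrivChar Λ (χ ^ 2)) (n : ℕ) : 0 ≤ (Λ n : ℂ) + twistBy Λ χ n := by
  obtain ⟨e, he1, he⟩ := h.exists_real n
  by_cases hn : Λ n = 0
  · simp [twistBy, hn]
  rw [twistBy, he hn]
  have : 0 ≤ (1 + e) * Λ n := mul_nonneg (by linarith [(abs_le.mp he1).1]) (hΛ n)
  have h2 : (Λ n : ℂ) + e * Λ n = (((1 + e) * Λ n : ℝ) : ℂ) := by push_cast; ring
  rw [h2]
  exact_mod_cast this

lemma TrivChar.add_add_nonneg (hΛ : ∀ n, 0 ≤ Λ n) {q q' : ℕ} {χ : DirichletCharacter ℂ q}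
    {ψ : DirichletCharacter ℂ q'} (h : TrivChar Λ (χ ^ 2)) (h' : TrivChar Λ (ψ ^ 2)) (n : ℕ) :
    0 ≤ ((Λ n : ℂ) + twistBy Λ χ n) + (twistBy Λ ψ n + twistBy Λ (mulLevel χ ψ) n) := by
  obtain ⟨e, he1, he⟩ := h.exists_real n
  obtain ⟨f, hf1, hf⟩ := h'.exists_real n
  by_cases hn : Λ n = 0
  · simp [twistBy, hn]
  rw [twistBy, twistBy, twistBy, mulLevel_apply, he hn, hf hn]
  have : 0 ≤ (1 + e) * (1 + f) * Λ n := mul_nonneg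
    (mul_nonneg (by linarith [(abs_le.mp he1).1]) (by linarith [(abs_le.mp hf1).1])) (hΛ n)
  have h2 : ((Λ n : ℂ) + e * Λ n) + (f * Λ n + e * f * Λ n) =
      (((1 + e) * (1 + f) * Λ n : ℝ) : ℂ) := by push_cast; ring
  rw [h2]
  exact_mod_cast this

/-- `L(σ, χ) > 0` for real characters and `σ > 1`. -/
lemma NormSystem.re_LSeries_pos (hs : NormSystem r Λ A δ κ) {q : ℕ} {χ : DirichletCharacter ℂ q}
    (h : TrivChar Λ (χ ^ 2)) {σ : ℝ} (hσ : 1 < σ) : 0 < (LSeries (twistBy r χ) σ).re := by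
  have ht := hs.twistPair χ
  have ht0 := hs.twistPair_self
  have hσ' : (1 : ℝ) < (σ : ℂ).re := by simpa
  have hs1 := ht.summable_a hs hσ'
  have hs0 := hs.summable_r hσ'
  have h1 := one_le_re_LSeries (logPair_convolution_nonneg ht0.pair ht.pair ht0.one ht.one
    (by rw [ht0.D_one hs, ht.D_one hs, add_zero]) (h.add_nonneg hs.lam_nonneg))
    (by rw [convolution_one, ht0.one, ht.one, one_mul]) (LSeriesSummable.convolution hs0 hs1)
  rw [LSeries_convolution' hs0 hs1] at h1
  have hzr : 1 ≤ (LSeries (fun n => (r n : ℂ)) σ).re := by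
    rw [LSeries_congr (g := fun n => if n = 0 then 0 else (r n : ℂ)) (fun hn => by simp [hn])]
    refine one_le_re_LSeries (fun n => ?_) (by simp [hs.r_one]) ?_
    · split_ifs
      · rfl
      · exact_mod_cast hs.r_nonneg n
    · exact (LSeriesSummable_congr _ (fun hn => by simp [hn])).mp hs0
  have hzi : (LSeries (fun n => (r n : ℂ)) σ).im = 0 := by
    rw [LSeries, Complex.im_tsum hs0]
    refine (tsum_congr fun n => ?_).trans tsum_zero
    rcases eq_or_ne n 0 with rfl | hn
    · simp
    rw [LSeries.term_of_ne_zero hn, show ((n : ℂ) ^ (σ : ℂ)) = (((n : ℝ) ^ σ : ℝ) : ℂ) by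
      rw [Complex.ofReal_cpow (Nat.cast_nonneg n)]; simp, Complex.div_ofReal_im]
    simp
  rw [Complex.mul_re, hzi, zero_mul, sub_zero] at h1
  by_contra hcon
  nlinarith [not_lt.mp hcon]

end Siegel

section Siegel
open Metric Filter Topology
open scoped ComplexOrder

variable {r Λ : ℕ → ℝ} {A δ κ : ℝ}

lemma mem_ball_bounds {d : ℝ} (hd : 0 < d) {z : ℂ}
    (hz : z ∈ closedBall ((1 + d : ℝ) : ℂ) (2 * d)) :
    1 - d ≤ z.re ∧ ‖z‖ ≤ 1 + 3 * d ∧ ‖z - 1‖ ≤ 3 * d := by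
  rw [mem_closedBall, dist_eq_norm] at hz
  have h1 := (Complex.abs_re_le_norm _).trans hz
  rw [Complex.sub_re, Complex.ofReal_re, abs_le] at h1
  have h3 : ‖z - 1‖ ≤ 3 * d := by
    calc ‖z - 1‖ = ‖(z - ((1 + d : ℝ) : ℂ)) + (d : ℂ)‖ := by congr 1; push_cast; ring
      _ ≤ 2 * d + d := (norm_add_le _ _).trans (add_le_add hz (by
          rw [Complex.norm_real, Real.norm_of_nonneg hd.le]))
      _ = 3 * d := by ring
  refine ⟨by linarith [h1.1], ?_, h3⟩
  calc ‖z‖ = ‖(z - 1) + 1‖ := by rw [sub_add_cancel]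
    _ ≤ 3 * d + 1 := (norm_add_le _ _).trans (by rw [norm_one]; linarith)
    _ = _ := by ring

lemma norm_gfun_le_on_ball {a : ℕ → ℂ} {Q δ : ℝ} (hb : SumBound a 0 Q δ) (hδ : 0 < δ)
    (hδ1 : δ ≤ 1) {z : ℂ} (hz : z ∈ closedBall ((1 + δ / 4 : ℝ) : ℂ) (2 * (δ / 4))) :
    ‖gfun a z‖ ≤ 4 / δ * Q := by
  obtain ⟨h1, h2, -⟩ := mem_ball_bounds (by linarith) hz
  have hQ := hb.nonneg
  refine (norm_gfun_le hb (by linarith)).trans ?_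
  calc ‖z‖ * (Q / (z.re - 1 + δ)) ≤ 2 * (Q / (δ / 2)) := by
        refine mul_le_mul (by linarith) ?_ (div_nonneg hQ (by linarith)) (by norm_num)
        exact div_le_div_of_nonneg_left hQ (by linarith) (by linarith)
    _ = 4 / δ * Q := by field_simp; ring

lemma NormSystem.norm_lfun_le_on_ball (hs : NormSystem r Λ A δ κ) {z : ℂ}
    (hz : z ∈ closedBall ((1 + δ / 4 : ℝ) : ℂ) (2 * (δ / 4))) :
    ‖lfun (fun n => (r n : ℂ)) κ z‖ ≤ 2 * (κ + 2 * A / δ) := by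
  have hδ := hs.δ_pos
  have hδ1 := hs.δ_le
  have hA := hs.one_le
  obtain ⟨h1, h2, h3⟩ := mem_ball_bounds (by linarith) hz
  refine (norm_lfun_le hs.count (by linarith)).trans ?_
  rw [Complex.norm_real, Real.norm_of_nonneg hs.κ_pos.le]
  have h4 : A / (z.re - 1 + δ) ≤ 2 * A / δ := by
    rw [div_le_div_iff₀ (by linarith) hδ]
    nlinarith
  have h5 : 0 ≤ A / (z.re - 1 + δ) := div_nonneg (by linarith) (by linarith)
  have h6 : ‖z - 1‖ * (A / (z.re - 1 + δ)) ≤ 1 * (2 * A / δ) :=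
    mul_le_mul (by linarith) h4 h5 (by norm_num)
  exact mul_le_mul (by linarith) (by linarith)
    (add_nonneg hs.κ_pos.le (mul_nonneg (norm_nonneg _) h5)) (by norm_num)

lemma ball_subset_halfPlane {δ : ℝ} (hδ : 0 < δ) {z : ℂ}
    (hz : z ∈ closedBall ((1 + δ / 4 : ℝ) : ℂ) (2 * (δ / 4))) : 1 - δ < z.re := by
  have := (mem_ball_bounds (by linarith) hz).1
  linarith

/-- Siegel's bound when `ζ L(χ)` is nonnegative at a point close to `1`. -/
lemma NormSystem.siegel_of_nonneg (hs : NormSystem r Λ A δ κ) {ε β : ℝ} (hβ : 1 - δ / 4 / 2 ≤ β)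
    (hβ1 : β < 1) (hε : 8 * ((1 - β) / (δ / 4)) ≤ ε)
    (hβ0 : 0 ≤ (lfun (fun n => (r n : ℂ)) κ β).re) :
    ∃ c : ℝ, 0 < c ∧ ∀ (q : ℕ) [NeZero q] (χ : DirichletCharacter ℂ q), GoodChar r A δ χ →
      TrivChar Λ (χ ^ 2) → 0 ≤ (gfun (twistBy r χ) β).re →
      c * (q : ℝ) ^ (-ε) ≤ ‖gfun (twistBy r χ) 1‖ := by
  have hδ := hs.δ_pos
  have hδ1 := hs.δ_le
  have hA := hs.one_le
  have hκ := hs.κ_pos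
  set B : ℝ := 2 * (κ + 2 * A / δ) * (4 / δ * A) with hB
  have hBd : δ / 4 ≤ B := by
    have h1 : 1 ≤ A / δ := by rw [le_div_iff₀ hδ]; linarith
    have h2 : 4 ≤ 2 * (κ + 2 * A / δ) := by
      have : 2 * A / δ = 2 * (A / δ) := by ring
      rw [this]; nlinarith
    have h3 : 4 ≤ 4 / δ * A := by
      have : 4 / δ * A = 4 * (A / δ) := by ring
      rw [this]; linarith
    rw [hB]; nlinarith
  obtain ⟨c, hc, h⟩ := estermann_uniform (d := δ / 4) (B := B) (ε := ε) (by linarith) hBd hβ hβ1 hε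
  refine ⟨c / κ, div_pos hc hκ, fun q _ χ hχ hχ2 hχβ => ?_⟩
  have hq : (1 : ℝ) ≤ q := by exact_mod_cast NeZero.one_le
  have ht := hs.twistPair χ
  have ht0 := hs.twistPair_self
  have hreal : ∀ σ : ℝ, (gfun (twistBy r χ) σ).im = 0 := fun σ =>
    gfun_im_eq_zero (fun n hn => hs.twistBy_im hχ2 hn) σ
  have key := h q (LSeries.convolution (fun n => (r n : ℂ)) (twistBy r χ))
    (fun s => lfun (fun n => (r n : ℂ)) κ s * gfun (twistBy r χ) s)
    (κ * (gfun (twistBy r χ) 1).re) hq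
    (logPair_convolution_nonneg ht0.pair ht.pair ht0.one ht.one
      (by rw [ht0.D_one hs, ht.D_one hs, add_zero]) (hχ2.add_nonneg hs.lam_nonneg))
    (by rw [convolution_one, ht0.one, ht.one, one_mul])
    (fun s hs1 => LSeriesSummable.convolution (hs.summable_r hs1) (ht.summable_a hs hs1))
    (fun z hz => ((differentiableAt_lfun hs.count hδ1 (ball_subset_halfPlane hδ hz)).mul
      (differentiableAt_gfun hχ.bound hδ1 (ball_subset_halfPlane hδ hz))).differentiableWithinAt)
    (fun s hs1 => by
      rw [LSeries_convolution' (hs.summable_r hs1) (ht.summable_a hs hs1),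
        lfun_eq hs.count hδ hs1 (hs.summable_r hs1),
        gfun_eq hχ.bound hδ hs1 (ht.summable_a hs hs1), mul_assoc])
    (fun z hz => by
      rw [norm_mul]
      have h1 := hs.norm_lfun_le_on_ball hz
      have h2 := norm_gfun_le_on_ball hχ.bound hδ hδ1 hz
      calc _ ≤ 2 * (κ + 2 * A / δ) * (4 / δ * (A * q)) :=
            mul_le_mul h1 h2 (norm_nonneg _) (by positivity)
        _ = B * (q * 1) := by rw [hB]; ring
        _ ≤ B * (q * q) := by gcongr
        _ = B * (q : ℝ) ^ 2 := by ring)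
    (by
      rw [lfun_one]
      have h1 := hreal 1
      rw [Complex.ofReal_one] at h1
      apply Complex.ext <;> simp [h1])
    (by
      rw [Complex.mul_re, hreal β, mul_zero, sub_zero]
      exact mul_nonneg hβ0 hχβ)
  have h3 : c / κ * (q : ℝ) ^ (-ε) ≤ (gfun (twistBy r χ) 1).re := by
    rw [div_mul_eq_mul_div, div_le_iff₀ hκ]; linarith
  exact h3.trans (Complex.re_le_norm _)

/-- Siegel's bound in the presence of a real zero of another `L`-function close to `1`. -/
lemma NormSystem.siegel_of_zero (hs : NormSystem r Λ A δ κ) {ε β : ℝ} (hε0 : 0 < ε) (hε1 : ε ≤ 1)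
    (hβ : 1 - δ / 4 / 2 ≤ β) (hβ1 : β < 1) (hε : 8 * ((1 - β) / (δ / 4)) ≤ ε)
    {p : ℕ} [NeZero p] {ψ : DirichletCharacter ℂ p}
    (hψ : GoodChar r A δ ψ) (hψ2 : TrivChar Λ (ψ ^ 2)) (h0 : gfun (twistBy r ψ) β = 0) :
    ∃ c : ℝ, 0 < c ∧ ∀ (q : ℕ) [NeZero q] (χ : DirichletCharacter ℂ q), GoodChar r A δ χ →
      TrivChar Λ (χ ^ 2) → GoodChar r A δ (mulLevel χ ψ) →
      c * (q : ℝ) ^ (-(2 * ε)) ≤ ‖gfun (twistBy r χ) 1‖ := by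
  have hδ := hs.δ_pos
  have hδ1 := hs.δ_le
  have hA := hs.one_le
  have hκ := hs.κ_pos
  have hp : (1 : ℝ) ≤ p := by exact_mod_cast NeZero.one_le
  set B : ℝ := (2 * (κ + 2 * A / δ) * (4 / δ * A)) * ((4 / δ * (A * p)) * (4 / δ * (A * p))) with hB
  have hBd : δ / 4 ≤ B := by
    have h1 : 1 ≤ A / δ := by rw [le_div_iff₀ hδ]; linarith
    have h2 : 4 ≤ 2 * (κ + 2 * A / δ) := by
      have : 2 * A / δ = 2 * (A / δ) := by ring
      rw [this]; nlinarith
    have h3 : 4 ≤ 4 / δ * A := by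
      have : 4 / δ * A = 4 * (A / δ) := by ring
      rw [this]; linarith
    have h4 : 1 ≤ 4 / δ * (A * p) := by rw [← mul_assoc]; nlinarith
    have h5 : 1 ≤ (4 / δ * (A * p)) * (4 / δ * (A * p)) := one_le_mul_of_one_le_of_one_le h4 h4
    have h6 : 1 ≤ 2 * (κ + 2 * A / δ) * (4 / δ * A) := by nlinarith
    rw [hB]; nlinarith
  obtain ⟨c, hc, h⟩ := estermann_uniform (d := δ / 4) (B := B) (ε := ε) (by linarith) hBd hβ hβ1 hε
  set C : ℝ := κ * ‖gfun (twistBy r ψ) 1‖ * ((κ + 2 * A) * (p : ℝ) ^ ε / (δ * ε)) with hC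
  have hC0 : 0 < C := by
    have := norm_pos_iff.mpr hψ.ne_zero
    positivity
  refine ⟨c / C, div_pos hc hC0, fun q _ χ hχ hχ2 hχψ => ?_⟩
  have hq : (1 : ℝ) ≤ q := by exact_mod_cast NeZero.one_le
  have ht := hs.twistPair χ
  have ht' := hs.twistPair ψ
  have ht2 := hs.twistPair (mulLevel χ ψ)
  have ht0 := hs.twistPair_self
  have hreal : ∀ {k : ℕ} {φ : DirichletCharacter ℂ k}, TrivChar Λ (φ ^ 2) →
      ((gfun (twistBy r φ) 1).re : ℂ) = gfun (twistBy r φ) 1 := fun {k φ} hφ => by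
    have h1 := gfun_im_eq_zero (fun n hn => hs.twistBy_im hφ hn) 1
    rw [Complex.ofReal_one] at h1
    apply Complex.ext <;> simp [h1]
  have hm2 : TrivChar Λ ((mulLevel χ ψ) ^ 2) := fun n hn hne => by
    rw [MulChar.pow_apply' _ two_ne_zero, mulLevel_apply] at hne ⊢
    have h1 := hχ2 n hn
    have h2 := hψ2 n hn
    rw [MulChar.pow_apply' _ two_ne_zero] at h1 h2
    rw [mul_pow] at hne ⊢
    rw [h1 (left_ne_zero_of_mul hne), h2 (right_ne_zero_of_mul hne), one_mul]
  have key := h q (LSeries.convolution (LSeries.convolution (fun n => (r n : ℂ)) (twistBy r χ))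
      (LSeries.convolution (twistBy r ψ) (twistBy r (mulLevel χ ψ))))
    (fun s => (lfun (fun n => (r n : ℂ)) κ s * gfun (twistBy r χ) s) *
      (gfun (twistBy r ψ) s * gfun (twistBy r (mulLevel χ ψ)) s))
    (κ * (gfun (twistBy r χ) 1).re * ((gfun (twistBy r ψ) 1).re *
      (gfun (twistBy r (mulLevel χ ψ)) 1).re)) hq
    (logPair_convolution_nonneg (ht0.pair.convolution ht.pair) (ht'.pair.convolution ht2.pair)
      (by rw [convolution_one, ht0.one, ht.one, one_mul])
      (by rw [convolution_one, ht'.one, ht2.one, one_mul])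
      (by simp only [ht0.D_one hs, ht.D_one hs, ht'.D_one hs, ht2.D_one hs, add_zero])
      (hχ2.add_add_nonneg hs.lam_nonneg hψ2))
    (by simp only [convolution_one, ht0.one, ht.one, ht'.one, ht2.one, one_mul])
    (fun s hs1 => (LSeriesSummable.convolution (hs.summable_r hs1) (ht.summable_a hs hs1)).convolution
      (LSeriesSummable.convolution (ht'.summable_a hs hs1) (ht2.summable_a hs hs1)))
    (fun z hz => (((differentiableAt_lfun hs.count hδ1 (ball_subset_halfPlane hδ hz)).mul
      (differentiableAt_gfun hχ.bound hδ1 (ball_subset_halfPlane hδ hz))).mul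
      ((differentiableAt_gfun hψ.bound hδ1 (ball_subset_halfPlane hδ hz)).mul
      (differentiableAt_gfun hχψ.bound hδ1
        (ball_subset_halfPlane hδ hz)))).differentiableWithinAt)
    (fun s hs1 => by
      rw [LSeries_convolution' (LSeriesSummable.convolution (hs.summable_r hs1)
          (ht.summable_a hs hs1))
          (LSeriesSummable.convolution (ht'.summable_a hs hs1) (ht2.summable_a hs hs1)),
        LSeries_convolution' (hs.summable_r hs1) (ht.summable_a hs hs1),
        LSeries_convolution' (ht'.summable_a hs hs1) (ht2.summable_a hs hs1),
        lfun_eq hs.count hδ hs1 (hs.summable_r hs1),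
        gfun_eq hχ.bound hδ hs1 (ht.summable_a hs hs1),
        gfun_eq hψ.bound hδ hs1 (ht'.summable_a hs hs1),
        gfun_eq hχψ.bound hδ hs1 (ht2.summable_a hs hs1)]
      ring)
    (fun z hz => by
      rw [norm_mul, norm_mul, norm_mul]
      have h1 := hs.norm_lfun_le_on_ball hz
      have h2 := norm_gfun_le_on_ball hχ.bound hδ hδ1 hz
      have h3 := norm_gfun_le_on_ball hψ.bound hδ hδ1 hz
      have h4 := norm_gfun_le_on_ball hχψ.bound hδ hδ1 hz
      calc _ ≤ (2 * (κ + 2 * A / δ) * (4 / δ * (A * q))) *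
              ((4 / δ * (A * p)) * (4 / δ * (A * (q * p : ℕ)))) := by gcongr
        _ = B * (q : ℝ) ^ 2 := by rw [hB]; push_cast; ring)
    (by
      rw [lfun_one]
      push_cast
      rw [hreal hχ2, hreal hψ2, hreal hm2])
    (by simp [h0])
  have hint := hs.interpolate ht2 (c := 0) (by simp; linarith) (by positivity) hχψ.bound hε0.le hε1
  have h5 : ‖gfun (twistBy r (mulLevel χ ψ)) 1‖ ≤
      (κ + 2 * A) * (p : ℝ) ^ ε / (δ * ε) * (q : ℝ) ^ ε := by
    refine (norm_gfun_le hint (by simp; positivity)).trans (le_of_eq ?_)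
    push_cast
    rw [Real.mul_rpow (by positivity) (by positivity)]
    simp
    ring
  have h6 : c * (q : ℝ) ^ (-ε) ≤ C * (q : ℝ) ^ ε * ‖gfun (twistBy r χ) 1‖ := by
    refine key.trans ((le_abs_self _).trans ?_)
    rw [abs_mul, abs_mul, abs_mul, abs_of_pos hκ]
    calc κ * |(gfun (twistBy r χ) 1).re| * (|(gfun (twistBy r ψ) 1).re| *
          |(gfun (twistBy r (mulLevel χ ψ)) 1).re|)
        ≤ κ * ‖gfun (twistBy r χ) 1‖ * (‖gfun (twistBy r ψ) 1‖ *
          ((κ + 2 * A) * (p : ℝ) ^ ε / (δ * ε) * (q : ℝ) ^ ε)) := by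
          gcongr
          · exact Complex.abs_re_le_norm _
          · exact Complex.abs_re_le_norm _
          · exact (Complex.abs_re_le_norm _).trans h5
      _ = _ := by rw [hC]; ring
  have hqε : (0 : ℝ) < (q : ℝ) ^ ε := by positivity
  have h7 : (q : ℝ) ^ (-(2 * ε)) * (q : ℝ) ^ ε = (q : ℝ) ^ (-ε) := by
    rw [← Real.rpow_add (by linarith)]; congr 1; ring
  rw [div_mul_eq_mul_div, div_le_iff₀ hC0]
  rw [← h7] at h6
  refine le_of_mul_le_mul_right ?_ hqε
  linarith

/-- **Siegel's theorem** for the values at `1` of the `L`-functions of real characters. -/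
theorem CharSystem.siegel (hs : CharSystem r Λ A δ κ) {ε : ℝ} (hε : 0 < ε) :
    ∃ c : ℝ, 0 < c ∧ ∀ (q : ℕ) [NeZero q] (χ : DirichletCharacter ℂ q), GoodChar r A δ χ →
      TrivChar Λ (χ ^ 2) → c * (q : ℝ) ^ (-ε) ≤ ‖gfun (twistBy r χ) 1‖ := by
  have hN := hs.toNormSystem
  have hδ := hN.δ_pos
  have hδ1 := hN.δ_le
  set ε' := min (ε / 2) 1 with hε'
  have hε'0 : 0 < ε' := lt_min (by linarith) one_pos
  have hmono : ∀ (q : ℕ) [NeZero q] {t : ℝ}, t ≤ ε → (q : ℝ) ^ (-ε) ≤ (q : ℝ) ^ (-t) :=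
    fun q _ t ht => Real.rpow_le_rpow_of_exponent_le (by exact_mod_cast NeZero.one_le)
      (by linarith)
  have hε'1 : ε' ≤ ε := (min_le_left _ _).trans (by linarith)
  have hε'2 : 2 * ε' ≤ ε := by linarith [min_le_left (ε / 2) 1]
  have hcont : ContinuousAt (fun β : ℝ => (lfun (fun n => (r n : ℂ)) κ β).re) 1 := by
    have h1 : ContinuousAt (lfun (fun n => (r n : ℂ)) κ) ((1 : ℝ) : ℂ) :=
      (differentiableAt_lfun hN.count hδ1 (by simp; linarith)).continuousAt
    exact Complex.continuous_re.continuousAt.comp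
      (h1.comp (f := fun β : ℝ => (β : ℂ)) Complex.continuous_ofReal.continuousAt)
  have hpos : 0 < (lfun (fun n => (r n : ℂ)) κ (1 : ℝ)).re := by
    rw [Complex.ofReal_one, lfun_one]; exact hN.κ_pos
  obtain ⟨η₀, hη₀, hη₀'⟩ := Metric.eventually_nhds_iff.mp (hcont.eventually (lt_mem_nhds hpos))
  set η := min (η₀ / 2) (min (δ / 8) (δ * ε' / 32)) with hη
  have hη0 : 0 < η := lt_min (by linarith) (lt_min (by linarith) (by positivity))
  have hη1 : η ≤ η₀ / 2 := min_le_left _ _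
  have hη2 : η ≤ δ / 8 := (min_le_right _ _).trans (min_le_left _ _)
  have hη3 : η ≤ δ * ε' / 32 := (min_le_right _ _).trans (min_le_right _ _)
  have hlpos : ∀ β : ℝ, 1 - η ≤ β → β < 1 → 0 ≤ (lfun (fun n => (r n : ℂ)) κ β).re := by
    intro β h1 h2
    refine (hη₀' ?_).le
    rw [Real.dist_eq, abs_lt]
    constructor <;> linarith
  have hβε : ∀ β : ℝ, 1 - η ≤ β → 8 * ((1 - β) / (δ / 4)) ≤ ε' := by
    intro β h1
    rw [← mul_div_assoc, div_le_iff₀ (by linarith)]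
    linarith
  by_cases hex : ∃ (p : ℕ) (_ : NeZero p) (ψ : DirichletCharacter ℂ p) (β : ℝ),
      GoodChar r A δ ψ ∧ TrivChar Λ (ψ ^ 2) ∧ 1 - η ≤ β ∧ β < 1 ∧ gfun (twistBy r ψ) β = 0
  · obtain ⟨p, _, ψ, β, hψ, hψ2, h1, h2, h0⟩ := hex
    obtain ⟨c₁, hc₁, H₁⟩ := hN.siegel_of_nonneg (by linarith) h2 (hβε β h1) (hlpos β h1 h2)
    obtain ⟨c₂, hc₂, H₂⟩ := hN.siegel_of_zero hε'0 (min_le_right _ _) (by linarith) h2 (hβε β h1)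
      hψ hψ2 h0
    refine ⟨min c₁ c₂, lt_min hc₁ hc₂, fun q _ χ hχ hχ2 => ?_⟩
    rcases hs.dichotomy (q * p) (mulLevel χ ψ) with hT | hG
    · refine le_trans ?_ (H₁ q χ hχ hχ2 ?_)
      · exact mul_le_mul (min_le_left _ _) (hmono q hε'1) (by positivity) hc₁.le
      · rw [hN.zero_transfer hχ.bound hψ.bound hψ2 hT (by simp; linarith) h0]
        simp
    · refine le_trans ?_ (H₂ q χ hχ hχ2 hG)
      exact mul_le_mul (min_le_right _ _) (hmono q hε'2) (by positivity) hc₂.le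
  · push Not at hex
    have h1 : 1 - η ≤ 1 - η := le_rfl
    obtain ⟨c₁, hc₁, H₁⟩ := hN.siegel_of_nonneg (β := 1 - η) (by linarith) (by linarith)
      (hβε _ h1) (hlpos _ h1 (by linarith))
    refine ⟨c₁, hc₁, fun q _ χ hχ hχ2 => le_trans ?_ (H₁ q χ hχ hχ2 ?_)⟩
    · exact mul_le_mul le_rfl (hmono q hε'1) (by positivity) hc₁.le
    by_contra hcon
    have hc : ContinuousOn (fun β : ℝ => (gfun (twistBy r χ) β).re) (Set.Icc (1 - η) 2) := by
      intro β hβ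
      have h2 : ContinuousAt (gfun (twistBy r χ)) (β : ℂ) :=
        (differentiableAt_gfun hχ.bound hδ1 (by simp; linarith [hβ.1])).continuousAt
      exact (Complex.continuous_re.continuousAt.comp
        (h2.comp (f := fun β : ℝ => (β : ℂ))
          Complex.continuous_ofReal.continuousAt)).continuousWithinAt
    have hgt : ∀ σ : ℝ, 1 < σ → 0 < (gfun (twistBy r χ) σ).re := fun σ hσ => by
      have hσ' : (1 : ℝ) < (σ : ℂ).re := by simpa
      rw [gfun_eq hχ.bound hδ hσ' ((hN.twistPair χ).summable_a hN hσ')]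
      exact hN.re_LSeries_pos hχ2 hσ
    obtain ⟨β, hβ, hβ0⟩ := intermediate_value_Icc (by linarith : 1 - η ≤ 2) hc
      ⟨(not_le.mp hcon).le, (hgt 2 (by norm_num)).le⟩
    have hzero : gfun (twistBy r χ) β = 0 :=
      Complex.ext hβ0 (gfun_im_eq_zero (fun n hn => hN.twistBy_im hχ2 hn) β)
    rcases lt_trichotomy β 1 with hlt | heq | hlt
    · exact hex q inferInstance χ β hχ hχ2 hβ.1 hlt hzero
    · rw [heq, Complex.ofReal_one] at hzero
      exact hχ.ne_zero hzero
    · exact (hgt β hlt).ne' hβ0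

end Siegel

section LData
open Metric Filter Topology

variable {r Λ : ℕ → ℝ} {A δ κ : ℝ}

/-- An analytic function `F` on `Re s > 1 - δ` of moderate growth, whose logarithmic derivative
is given by the Dirichlet series with coefficients `-D`, up to an explicit polar part `P`. -/
structure LData (δ Q : ℝ) (F P : ℂ → ℂ) (D : ℕ → ℂ) : Prop where
  diff : ∀ s : ℂ, 1 - δ < s.re → DifferentiableAt ℂ F s
  bound : ∀ s : ℂ, 1 - δ / 2 ≤ s.re → s.re ≤ 3 → ‖F s‖ ≤ Q * (|s.im| + 2) ^ 2
  lower : ∀ s : ℂ, 1 < s.re → s.re ≤ 2 → (s.re - 1) ^ 2 ≤ Q * ‖F s‖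
  ne_zero : ∀ s : ℂ, 1 < s.re → F s ≠ 0
  logDeriv_eq : ∀ s : ℂ, 1 < s.re → logDeriv F s = P s - LSeries D s

lemma norm_le_of_re_mem {s : ℂ} (h1 : 0 ≤ s.re) (h2 : s.re ≤ 3) : ‖s‖ ≤ |s.im| + 3 := by
  refine (Complex.norm_le_abs_re_add_abs_im s).trans ?_
  rw [abs_of_nonneg h1]; linarith

lemma NormSystem.lData_gfun (hs : NormSystem r Λ A δ κ) {q : ℕ} [NeZero q]
    {χ : DirichletCharacter ℂ q} (hb : SumBound (twistBy r χ) 0 (A * q) δ) :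
    LData δ (10 * (κ + A) * q / δ) (gfun (twistBy r χ)) 0 (twistBy Λ χ) := by
  have hδ := hs.δ_pos
  have hδ1 := hs.δ_le
  have hA := hs.one_le
  have hκ := hs.κ_pos
  have hq : (1 : ℝ) ≤ q := by exact_mod_cast NeZero.one_le
  have ht := hs.twistPair χ
  refine ⟨fun s h => differentiableAt_gfun hb hδ1 h, fun s h1 h2 => ?_, fun s h1 h2 => ?_,
    fun s h1 => by
      rw [gfun_eq hb hδ h1 (ht.summable_a hs h1)]
      exact ht.LSeries_ne_zero hs h1, fun s h1 => ?_⟩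
  · refine (norm_gfun_le hb (by linarith)).trans ?_
    have h3 : A * q / (s.re - 1 + δ) ≤ 2 * ((κ + A) * q / δ) := by
      rw [div_le_iff₀ (by linarith)]
      have : A * q ≤ 2 * ((κ + A) * q / δ) * (δ / 2) := by
        rw [show 2 * ((κ + A) * q / δ) * (δ / 2) = (κ + A) * q by field_simp]
        exact mul_le_mul_of_nonneg_right (by linarith) (by linarith)
      refine this.trans (mul_le_mul_of_nonneg_left (by linarith) (by positivity))
    have h4 := norm_le_of_re_mem (s := s) (by linarith) h2
    have hX : 0 ≤ (κ + A) * q / δ := by positivity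
    calc ‖s‖ * (A * q / (s.re - 1 + δ)) ≤ (|s.im| + 3) * (2 * ((κ + A) * q / δ)) :=
          mul_le_mul h4 h3 (div_nonneg (by positivity) (by linarith)) (by positivity)
      _ = ((κ + A) * q / δ) * (2 * (|s.im| + 3)) := by ring
      _ ≤ ((κ + A) * q / δ) * (10 * (|s.im| + 2) ^ 2) := by
          refine mul_le_mul_of_nonneg_left ?_ hX
          nlinarith [abs_nonneg s.im]
      _ = _ := by ring
  · have h3 := ht.one_le_norm_mul hs h1
    rw [gfun_eq hb hδ h1 (ht.summable_a hs h1)]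
    rw [← mul_div_assoc, le_div_iff₀ (by linarith), one_mul] at h3
    have h4 : (κ + A) * 2 ≤ 10 * (κ + A) * q / δ := by
      rw [le_div_iff₀ hδ]
      have : (κ + A) * 2 * δ ≤ (κ + A) * 2 * 1 := by gcongr
      nlinarith
    have hn := norm_nonneg (LSeries (twistBy r χ) s)
    calc (s.re - 1) ^ 2 ≤ s.re - 1 := by nlinarith
      _ ≤ ‖LSeries (twistBy r χ) s‖ * ((κ + A) * 2) :=
          h3.trans (by gcongr)
      _ ≤ _ := by rw [mul_comm]; gcongr
  · have hev : gfun (twistBy r χ) =ᶠ[𝓝 s] LSeries (twistBy r χ) := by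
      filter_upwards [(isOpen_lt continuous_const Complex.continuous_re).mem_nhds h1] with w hw
      exact gfun_eq hb hδ hw (ht.summable_a hs hw)
    rw [logDeriv_apply, hev.deriv_eq, hev.eq_of_nhds, (ht.hasDerivAt hs h1).deriv]
    have := ht.LSeries_ne_zero hs h1
    rw [Pi.zero_apply]
    field_simp
    ring

lemma TwistPair.lData_lfun {a D : ℕ → ℂ} (hs : NormSystem r Λ A δ κ) (ht : TwistPair Λ a D)
    {q : ℝ} (hq : 1 ≤ q) {c : ℂ} (hc : ‖c‖ ≤ κ + A) (hb : SumBound a c (A * q) δ) :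
    LData δ (10 * (κ + A) * q / δ) (lfun a c) (fun s => 1 / (s - 1)) D := by
  have hδ := hs.δ_pos
  have hδ1 := hs.δ_le
  have hA := hs.one_le
  have hκ := hs.κ_pos
  refine ⟨fun s h => differentiableAt_lfun hb hδ1 h, fun s h1 h2 => ?_, fun s h1 h2 => ?_,
    fun s h1 => ht.lfun_ne_zero hs hb hδ h1, fun s h1 => ht.logDeriv_lfun hs hb hδ h1⟩
  · refine (norm_lfun_le hb (by linarith)).trans ?_
    have h3 : A * q / (s.re - 1 + δ) ≤ 2 * ((κ + A) * q / δ) := by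
      rw [div_le_iff₀ (by linarith)]
      have : A * q ≤ 2 * ((κ + A) * q / δ) * (δ / 2) := by
        rw [show 2 * ((κ + A) * q / δ) * (δ / 2) = (κ + A) * q by field_simp]
        exact mul_le_mul_of_nonneg_right (by linarith) (by linarith)
      refine this.trans (mul_le_mul_of_nonneg_left (by linarith) (by positivity))
    have h4 := norm_le_of_re_mem (s := s) (by linarith) h2
    have h5 : ‖s - 1‖ ≤ |s.im| + 2 := by
      refine (Complex.norm_le_abs_re_add_abs_im _).trans ?_
      have : |(s - 1).re| ≤ 2 := by
        rw [abs_le, Complex.sub_re, Complex.one_re]; constructor <;> linarith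
      simp only [Complex.sub_im, Complex.one_im, sub_zero]
      linarith
    have hX : 0 ≤ (κ + A) * q / δ := by positivity
    have h6 : κ + A ≤ (κ + A) * q / δ := by
      rw [le_div_iff₀ hδ]
      exact mul_le_mul_of_nonneg_left (by linarith) (by linarith)
    have him := abs_nonneg s.im
    calc ‖s‖ * (‖c‖ + ‖s - 1‖ * (A * q / (s.re - 1 + δ)))
        ≤ (|s.im| + 3) * ((κ + A) * q / δ + (|s.im| + 2) * (2 * ((κ + A) * q / δ))) := by
          refine mul_le_mul h4 (add_le_add (hc.trans h6) ?_) ?_ (by positivity)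
          · exact mul_le_mul h5 h3 (div_nonneg (by positivity) (by linarith)) (by positivity)
          · exact add_nonneg (norm_nonneg _)
              (mul_nonneg (norm_nonneg _) (div_nonneg (by positivity) (by linarith)))
      _ = ((κ + A) * q / δ) * ((|s.im| + 3) * (2 * |s.im| + 5)) := by ring
      _ ≤ ((κ + A) * q / δ) * (10 * (|s.im| + 2) ^ 2) := by
          refine mul_le_mul_of_nonneg_left ?_ hX
          nlinarith
      _ = _ := by ring
  · have h3 := ht.one_le_norm_mul hs h1
    rw [lfun_eq hb hδ h1 (ht.summable_a hs h1), norm_mul]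
    rw [← mul_div_assoc, le_div_iff₀ (by linarith), one_mul] at h3
    have h4 : (κ + A) * 2 ≤ 10 * (κ + A) * q / δ := by
      rw [le_div_iff₀ hδ]
      have : (κ + A) * 2 * δ ≤ (κ + A) * 2 * 1 := by gcongr
      nlinarith
    have hn := norm_nonneg (LSeries a s)
    have h5 : s.re - 1 ≤ ‖s - 1‖ := by
      have := Complex.re_le_norm (s - 1); simpa using this
    have h6 : s.re - 1 ≤ 10 * (κ + A) * q / δ * ‖LSeries a s‖ :=
      calc s.re - 1 ≤ ‖LSeries a s‖ * ((κ + A) * 2) := h3.trans (by gcongr)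
      _ ≤ _ := by rw [mul_comm]; gcongr
    calc (s.re - 1) ^ 2 = (s.re - 1) * (s.re - 1) := sq _
      _ ≤ ‖s - 1‖ * (10 * (κ + A) * q / δ * ‖LSeries a s‖) :=
          mul_le_mul h5 h6 (by linarith) (norm_nonneg _)
      _ = _ := by ring

end LData

section ZeroFree
open Metric Filter Topology

variable {r Λ : ℕ → ℝ} {A δ κ : ℝ}

lemma LData.ball_facts {Q : ℝ} {F P : ℂ → ℂ} {D : ℕ → ℂ} (h : LData δ Q F P D) (hδ : 0 < δ)
    (hδ1 : δ ≤ 1) (hQ : 1 ≤ Q) {s : ℂ} (h1 : 1 < s.re) (h2 : s.re ≤ 2) :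
    0 < 2 * Real.log (Q * (|s.im| + 3) / (s.re - 1)) ∧
    DifferentiableOn ℂ F (closedBall s (δ / 2)) ∧
    ∀ z ∈ ball s (δ / 2),
      ‖F z‖ ≤ Real.exp (2 * Real.log (Q * (|s.im| + 3) / (s.re - 1))) * ‖F s‖ := by
  have him := abs_nonneg s.im
  have hre : ∀ z ∈ closedBall s (δ / 2), 1 - δ / 2 < z.re ∧ z.re ≤ 3 ∧ |z.im| ≤ |s.im| + 1 := by
    intro z hz
    rw [mem_closedBall, dist_eq_norm] at hz
    have h3 := (Complex.abs_re_le_norm (z - s)).trans hz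
    have h4 := (Complex.abs_im_le_norm (z - s)).trans hz
    rw [Complex.sub_re, abs_le] at h3
    rw [Complex.sub_im] at h4
    have h5 : |z.im| ≤ |z.im - s.im| + |s.im| := by
      simpa using abs_add_le (z.im - s.im) s.im
    refine ⟨by linarith, by linarith, by linarith⟩
  have hX : 1 < Q * (|s.im| + 3) / (s.re - 1) := by
    rw [one_lt_div (by linarith)]
    nlinarith
  refine ⟨by have := Real.log_pos hX; linarith, fun z hz =>
    (h.diff z (by have := (hre z hz).1; linarith)).differentiableWithinAt, fun z hz => ?_⟩
  obtain ⟨h3, h4, h5⟩ := hre z (ball_subset_closedBall hz)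
  have hl := h.lower s h1 h2
  have hs : 0 < s.re - 1 := by linarith
  rw [two_mul, Real.exp_add, Real.exp_log (by linarith)]
  calc ‖F z‖ ≤ Q * (|z.im| + 2) ^ 2 := h.bound z h3.le h4
    _ ≤ Q * (|s.im| + 3) ^ 2 := by
        have : |z.im| + 2 ≤ |s.im| + 3 := by linarith
        gcongr
    _ = Q * (|s.im| + 3) ^ 2 / (s.re - 1) ^ 2 * (s.re - 1) ^ 2 := by field_simp
    _ ≤ Q * (|s.im| + 3) ^ 2 / (s.re - 1) ^ 2 * (Q * ‖F s‖) :=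
        mul_le_mul_of_nonneg_left hl (by positivity)
    _ = _ := by field_simp

lemma LData.re_ge {Q : ℝ} {F P : ℂ → ℂ} {D : ℕ → ℂ} (h : LData δ Q F P D) (hδ : 0 < δ)
    (hδ1 : δ ≤ 1) (hQ : 1 ≤ Q) {s : ℂ} (h1 : 1 < s.re) (h2 : s.re ≤ 2) :
    -(16 / δ * Real.log (Q * (|s.im| + 3) / (s.re - 1))) ≤ (P s - LSeries D s).re := by
  obtain ⟨hB, hd, hM⟩ := h.ball_facts hδ hδ1 hQ h1 h2
  rw [← h.logDeriv_eq s h1]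
  refine le_trans (le_of_eq ?_) (re_logDeriv_ge (R' := δ / 4) (by linarith) (by linarith) hB hd
    (h.ne_zero s h1) hM fun z _ hz0 => ?_)
  · field_simp; ring
  · by_contra hc
    exact h.ne_zero z (by linarith [not_le.1 hc]) hz0

lemma LData.re_ge_of_zero {Q : ℝ} {F P : ℂ → ℂ} {D : ℕ → ℂ} (h : LData δ Q F P D) (hδ : 0 < δ)
    (hδ1 : δ ≤ 1) (hQ : 1 ≤ Q) {s ρ : ℂ} (h1 : 1 < s.re) (h2 : s.re ≤ 2) (hρ : F ρ = 0)
    (him : ρ.im = s.im) (hclose : s.re - ρ.re ≤ δ / 8) :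
    15 / 16 / (s.re - ρ.re) - 16 / δ * Real.log (Q * (|s.im| + 3) / (s.re - 1)) ≤
      (P s - LSeries D s).re := by
  obtain ⟨hB, hd, hM⟩ := h.ball_facts hδ hδ1 hQ h1 h2
  have hρ1 : ρ.re ≤ 1 := by
    by_contra hc
    exact h.ne_zero ρ (not_le.1 hc) hρ
  have heq : s - ρ = ((s.re - ρ.re : ℝ) : ℂ) := by
    apply Complex.ext
    · simp
    · simp [him]
  have hn : ‖s - ρ‖ = s.re - ρ.re := by
    rw [heq, Complex.norm_real, Real.norm_of_nonneg (by linarith)]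
  have hmem : ρ ∈ ball s (δ / 2) := by
    rw [mem_ball, dist_comm, dist_eq_norm, hn]; linarith
  rw [← h.logDeriv_eq s h1]
  have := re_logDeriv_ge_of_zero (R' := δ / 4) (by linarith) (by linarith) hB hd
    (h.ne_zero s h1) hM (fun z _ hz0 => by
      by_contra hc
      exact h.ne_zero z (by linarith [not_le.1 hc]) hz0) hmem hρ
  refine le_trans ?_ this
  have hinv : (s - ρ)⁻¹.re = (s.re - ρ.re)⁻¹ := by
    rw [heq, ← Complex.ofReal_inv, Complex.ofReal_re]
  rw [hinv, hn]
  have hx : 0 < s.re - ρ.re := by linarith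
  have hsq : (s.re - ρ.re) ^ 2 / (δ / 2) ^ 2 ≤ 1 / 16 := by
    rw [div_le_iff₀ (by positivity)]
    nlinarith
  have h3 : (s.re - ρ.re)⁻¹ * (15 / 16) ≤
      (s.re - ρ.re)⁻¹ * (1 - (s.re - ρ.re) ^ 2 / (δ / 2) ^ 2) :=
    mul_le_mul_of_nonneg_left (by linarith) (inv_nonneg.2 hx.le)
  have h4 : 2 * (2 * Real.log (Q * (|s.im| + 3) / (s.re - 1))) / (δ / 4) =
      16 / δ * Real.log (Q * (|s.im| + 3) / (s.re - 1)) := by field_simp; ring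
  rw [h4, show 15 / 16 / (s.re - ρ.re) = (s.re - ρ.re)⁻¹ * (15 / 16) by field_simp]
  linarith

lemma three_four_one_re {u v : ℂ} (hu : u = 0 ∨ ‖u‖ = 1) (hv : ‖v‖ = 1) :
    0 ≤ 3 + 4 * (u * v).re + (u ^ 2 * v ^ 2).re := by
  rcases hu with rfl | hu
  · norm_num
  · rw [← mul_pow]
    have h1 : ‖u * v‖ = 1 := by rw [norm_mul, hu, hv, one_mul]
    generalize u * v = w at h1 ⊢
    have h2 : w.re * w.re + w.im * w.im = 1 := by
      rw [← Complex.normSq_apply, Complex.normSq_eq_norm_sq, h1, one_pow]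
    rw [sq, Complex.mul_re]
    nlinarith [sq_nonneg (1 + w.re)]

lemma NormSystem.three_four_one (hs : NormSystem r Λ A δ κ) {q : ℕ} [NeZero q]
    (χ : DirichletCharacter ℂ q) {σ : ℝ} (hσ : 1 < σ) (t : ℝ) :
    0 ≤ 3 * (LSeries (fun n => (Λ n : ℂ)) σ).re +
      4 * (LSeries (twistBy Λ χ) (σ + t * Complex.I)).re +
      (LSeries (twistBy Λ (χ ^ 2)) (σ + 2 * t * Complex.I)).re := by
  have h0 : LSeriesSummable (fun n => (Λ n : ℂ)) (σ : ℂ) := hs.summable_lam (by simpa using hσ)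
  have h1 : LSeriesSummable (twistBy Λ χ) (σ + t * Complex.I) :=
    (hs.twistPair χ).summable_D hs (by simpa using hσ)
  have h2 : LSeriesSummable (twistBy Λ (χ ^ 2)) (σ + 2 * t * Complex.I) :=
    (hs.twistPair (χ ^ 2)).summable_D hs (by simpa using hσ)
  have e0 := (Complex.hasSum_re h0.hasSum).mul_left 3
  have e1 := (Complex.hasSum_re h1.hasSum).mul_left 4
  have e2 := Complex.hasSum_re h2.hasSum
  have e := (e0.add e1).add e2
  refine e.nonneg fun n => ?_
  rcases eq_or_ne n 0 with rfl | hn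
  · simp [LSeries.term_zero]
  have hn0 : (n : ℂ) ≠ 0 := by exact_mod_cast hn
  set v : ℂ := (n : ℂ) ^ (-(t * Complex.I)) with hv
  have hv1 : ‖v‖ = 1 := by
    rw [hv, Complex.norm_natCast_cpow_of_pos (Nat.pos_of_ne_zero hn)]
    simp
  have hx : (n : ℂ) ^ (-(σ : ℂ)) = (((n : ℝ) ^ (-σ) : ℝ) : ℂ) := by
    rw [Complex.ofReal_cpow (by positivity)]; simp
  have t0 : LSeries.term (fun n => (Λ n : ℂ)) (σ : ℂ) n = ((Λ n * (n : ℝ) ^ (-σ) : ℝ) : ℂ) := by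
    rw [LSeries.term_of_ne_zero hn, div_eq_mul_inv, ← Complex.cpow_neg, hx]; push_cast; ring
  have t1 : LSeries.term (twistBy Λ χ) (σ + t * Complex.I) n =
      ((Λ n * (n : ℝ) ^ (-σ) : ℝ) : ℂ) * (χ n * v) := by
    rw [LSeries.term_of_ne_zero hn, div_eq_mul_inv, ← Complex.cpow_neg, neg_add,
      Complex.cpow_add _ _ hn0, hx, hv, twistBy]; push_cast; ring
  have t2 : LSeries.term (twistBy Λ (χ ^ 2)) (σ + 2 * t * Complex.I) n =
      ((Λ n * (n : ℝ) ^ (-σ) : ℝ) : ℂ) * (χ n ^ 2 * v ^ 2) := by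
    rw [LSeries.term_of_ne_zero hn, div_eq_mul_inv, ← Complex.cpow_neg, neg_add,
      Complex.cpow_add _ _ hn0, hx, hv, twistBy, ← Complex.cpow_nat_mul,
      MulChar.pow_apply' _ two_ne_zero]
    push_cast
    ring_nf
  rw [t0, t1, t2, Complex.re_ofReal_mul, Complex.re_ofReal_mul, Complex.ofReal_re]
  have hχ : χ n = 0 ∨ ‖χ n‖ = 1 := by
    by_cases hu : IsUnit (n : ZMod q)
    · right
      obtain ⟨u, hu⟩ := hu
      rw [← hu]; exact χ.unit_norm_eq_one u
    · left; exact χ.map_nonunit hu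
  have h3 := three_four_one_re hχ hv1
  have h4 : 0 ≤ Λ n * (n : ℝ) ^ (-σ) := mul_nonneg (hs.lam_nonneg n) (by positivity)
  have := mul_nonneg h4 h3
  linarith

lemma exists_gap_of_inequality {C₁ : ℝ} (hC : 0 < C₁) (hδ : 0 < δ) (hδ1 : δ ≤ 1) :
    ∃ c : ℝ, 0 < c ∧ ∀ L β : ℝ, 1 ≤ L → β ≤ 1 →
      (∀ σ : ℝ, 1 < σ → σ ≤ 2 → σ - β ≤ δ / 8 →
        15 / 4 / (σ - β) ≤ 3 / (σ - 1) + C₁ * (L + Real.log (1 / (σ - 1)))) →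
      c / L ≤ 1 - β := by
  set b : ℝ := min (1 / (8 * C₁)) (δ / 16) with hb
  have hb0 : 0 < b := lt_min (by positivity) (by positivity)
  have hb1 : b ≤ 1 / (8 * C₁) := min_le_left _ _
  have hb2 : b ≤ δ / 16 := min_le_right _ _
  rw [le_div_iff₀ (by positivity)] at hb1
  have hbb : b ^ 2 ≤ b := by nlinarith
  refine ⟨b ^ 2 / 14, by positivity, fun L β hL hβ h => ?_⟩
  by_contra hc
  push Not at hc
  have hL0 : 0 < L := by linarith
  have hdiv : ∀ y : ℝ, 0 ≤ y → y / L ≤ y := fun y hy => div_le_self hy hL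
  have ha : b ^ 2 / L ≤ δ / 16 := (hdiv _ (by positivity)).trans (by linarith)
  have ha0 : 0 < b ^ 2 / L := by positivity
  have h14 : b ^ 2 / 14 / L = b ^ 2 / L / 14 := by ring
  have h1 := h (1 + b ^ 2 / L) (by linarith) (by linarith) (by linarith)
  rw [add_sub_cancel_left] at h1
  have hlog : Real.log (1 / (b ^ 2 / L)) ≤ L + 2 / b := by
    rw [show 1 / (b ^ 2 / L) = L * (b⁻¹) ^ 2 by field_simp, Real.log_mul hL0.ne' (by positivity),
      Real.log_pow]
    have := Real.log_le_self hL0.le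
    have h3 := Real.log_le_self (x := b⁻¹) (by positivity)
    push_cast
    rw [div_eq_mul_inv]
    linarith
  have hx0 : 0 < 1 + b ^ 2 / L - β := by linarith
  have hlt : 1 + b ^ 2 / L - β < 15 / 14 * (b ^ 2 / L) := by linarith
  have h5 : 7 / 2 / (b ^ 2 / L) < 15 / 4 / (1 + b ^ 2 / L - β) := by
    rw [div_lt_div_iff₀ ha0 hx0]; linarith
  have h6 : C₁ * (L + Real.log (1 / (b ^ 2 / L))) ≤ 1 / 2 / (b ^ 2 / L) := by
    refine (mul_le_mul_of_nonneg_left (add_le_add_right hlog L) hC.le).trans ?_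
    rw [show 1 / 2 / (b ^ 2 / L) = L * (1 / 2 / b ^ 2) by field_simp]
    have h7 : C₁ * (2 + 2 / b) ≤ 1 / 2 / b ^ 2 := by
      rw [le_div_iff₀ (by positivity)]
      have : C₁ * (2 + 2 / b) * b ^ 2 = 2 * (C₁ * b ^ 2) + 2 * (b * C₁) := by field_simp
      rw [this]
      nlinarith
    calc C₁ * (L + (L + 2 / b)) ≤ C₁ * (L + (L + L * (2 / b))) := by
          have : 2 / b ≤ L * (2 / b) := le_mul_of_one_le_left (by positivity) hL
          gcongr
      _ = L * (C₁ * (2 + 2 / b)) := by ring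
      _ ≤ _ := mul_le_mul_of_nonneg_left h7 hL0.le
  have h8 : 3 / (b ^ 2 / L) + 1 / 2 / (b ^ 2 / L) = 7 / 2 / (b ^ 2 / L) := by ring
  linarith

/-- The classical `3-4-1` argument, in the form used for all zero-free regions below. -/
lemma NormSystem.zero_free_of_lData (hs : NormSystem r Λ A δ κ) {C₀ C₂ : ℝ} (hC₀ : 0 ≤ C₀)
    (hC₂ : 0 ≤ C₂) (hΛ : ∀ σ : ℝ, 1 < σ → σ ≤ 2 →
      (LSeries (fun n => (Λ n : ℂ)) σ).re ≤ 1 / (σ - 1) + C₀) :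
    ∃ c : ℝ, 0 < c ∧ ∀ (q : ℕ) [NeZero q] (χ : DirichletCharacter ℂ q) (Q L : ℝ)
      (F₁ F₂ P₁ P₂ : ℂ → ℂ) (ρ : ℂ), 1 ≤ Q → 1 ≤ L →
      LData δ Q F₁ P₁ (twistBy Λ χ) → LData δ Q F₂ P₂ (twistBy Λ (χ ^ 2)) → F₁ ρ = 0 →
      Real.log (Q * (2 * |ρ.im| + 3)) ≤ C₂ * L →
      (∀ σ : ℝ, 1 < σ → σ ≤ 2 → 4 * (P₁ (σ + ρ.im * Complex.I)).re +
        (P₂ (σ + 2 * ρ.im * Complex.I)).re ≤ C₂ * L) →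
      c / L ≤ 1 - ρ.re := by
  have hδ := hs.δ_pos
  have hδ1 := hs.δ_le
  obtain ⟨c, hc, h⟩ := exists_gap_of_inequality
    (C₁ := C₂ + 3 * C₀ + 80 / δ * (C₂ + 1)) (by positivity) hδ hδ1
  refine ⟨c, hc, fun q _ χ Q L F₁ F₂ P₁ P₂ ρ hQ hL h1 h2 hρ hlog hP => ?_⟩
  have hρ1 : ρ.re ≤ 1 := by
    by_contra hc
    exact h1.ne_zero ρ (not_le.1 hc) hρ
  refine h L ρ.re hL hρ1 fun σ hσ1 hσ2 hclose => ?_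
  have e0 := hΛ σ hσ1 hσ2
  have e341 := hs.three_four_one χ hσ1 ρ.im
  have eP := hP σ hσ1 hσ2
  have him := abs_nonneg ρ.im
  have e1 := h1.re_ge_of_zero hδ hδ1 hQ (s := σ + ρ.im * Complex.I) (ρ := ρ) (by simpa using hσ1)
    (by simpa using hσ2) hρ (by simp) (by simpa using hclose)
  have e2 := h2.re_ge hδ hδ1 hQ (s := σ + 2 * ρ.im * Complex.I) (by simpa using hσ1)
    (by simpa using hσ2)
  simp only [Complex.sub_re, Complex.add_re, Complex.add_im, Complex.mul_re, Complex.mul_im,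
    Complex.ofReal_re, Complex.ofReal_im, Complex.I_re, Complex.I_im, mul_zero, mul_one, zero_mul,
    sub_zero, add_zero, zero_add, sub_self, Complex.re_ofNat, Complex.im_ofNat] at e1 e2
  have hpos : 0 < σ - 1 := by linarith
  have hl : ∀ y : ℝ, 0 ≤ y → y ≤ 2 * |ρ.im| →
      16 / δ * Real.log (Q * (y + 3) / (σ - 1)) ≤
        16 / δ * (C₂ * L + Real.log (1 / (σ - 1))) := by
    intro y hy0 hy
    refine mul_le_mul_of_nonneg_left ?_ (by positivity)
    rw [div_eq_mul_one_div, Real.log_mul (by positivity) (by positivity)]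
    have : Real.log (Q * (y + 3)) ≤ Real.log (Q * (2 * |ρ.im| + 3)) := by
      apply Real.log_le_log (by positivity); gcongr
    linarith
  have l1 := hl |ρ.im| him (by linarith)
  have l2 := hl |2 * ρ.im| (abs_nonneg _) (by rw [abs_mul, abs_two])
  have hlog0 : 0 ≤ Real.log (1 / (σ - 1)) := Real.log_nonneg (by rw [le_div_iff₀ hpos]; linarith)
  set ℓ := Real.log (1 / (σ - 1))
  have hC2L : C₂ * L ≤ C₂ * (L + ℓ) := by gcongr; linarith
  have hC0L : 3 * C₀ ≤ 3 * C₀ * (L + ℓ) := le_mul_of_one_le_right (by positivity) (by linarith)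
  have hδL : 80 / δ * (C₂ * L + ℓ) ≤ 80 / δ * (C₂ + 1) * (L + ℓ) := by
    rw [mul_assoc]
    refine mul_le_mul_of_nonneg_left ?_ (by positivity)
    nlinarith
  have hdd : 16 / δ * (C₂ * L + ℓ) = 80 / δ * (C₂ * L + ℓ) / 5 := by ring
  have h15 : 15 / 4 / (σ - ρ.re) = 4 * (15 / 16 / (σ - ρ.re)) := by ring
  have h3 : 3 / (σ - 1) = 3 * (1 / (σ - 1)) := by ring
  rw [h15, h3]
  have hexp : (C₂ + 3 * C₀ + 80 / δ * (C₂ + 1)) * (L + ℓ) =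
    C₂ * (L + ℓ) + 3 * C₀ * (L + ℓ) + 80 / δ * (C₂ + 1) * (L + ℓ) := by ring
  rw [hexp]
  linarith

end ZeroFree

section ZeroFreeRegion
open Metric Filter Topology

variable {r Λ : ℕ → ℝ} {A δ κ : ℝ}

lemma NormSystem.exists_lam_le (hs : NormSystem r Λ A δ κ) :
    ∃ C₀ : ℝ, 0 ≤ C₀ ∧ ∀ σ : ℝ, 1 < σ → σ ≤ 2 →
      (LSeries (fun n => (Λ n : ℂ)) σ).re ≤ 1 / (σ - 1) + C₀ := by
  have hδ := hs.δ_pos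
  set F := lfun (fun n => (r n : ℂ)) κ with hF
  have hd : ∀ s : ℂ, 1 - δ < s.re → DifferentiableAt ℂ F s := fun s h =>
    differentiableAt_lfun hs.count hs.δ_le h
  have hne : ∀ σ ∈ Set.Icc (1 : ℝ) 2, F σ ≠ 0 := by
    intro σ hσ
    rcases hσ.1.eq_or_lt with h | h
    · rw [← h, hF, Complex.ofReal_one, lfun_one]
      exact_mod_cast hs.κ_pos.ne'
    · exact hs.twistPair_self.lfun_ne_zero hs hs.count hδ (by simpa using h)
  have hopen : IsOpen {s : ℂ | 1 - δ < s.re} := isOpen_lt continuous_const Complex.continuous_re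
  have hc : ContinuousOn (fun σ : ℝ => logDeriv F σ) (Set.Icc 1 2) := by
    intro σ hσ
    have hmem : 1 - δ < (σ : ℂ).re := by simp; linarith [hσ.1]
    have han : AnalyticAt ℂ F σ :=
      DifferentiableOn.analyticAt (s := {s : ℂ | 1 - δ < s.re})
        (fun s h => (hd s h).differentiableWithinAt) (hopen.mem_nhds hmem)
    have h1 : ContinuousAt (fun s : ℂ => deriv F s / F s) (σ : ℂ) :=
      han.deriv.continuousAt.div han.continuousAt (hne σ hσ)
    exact (ContinuousAt.comp (f := fun σ : ℝ => (σ : ℂ)) h1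
      Complex.continuous_ofReal.continuousAt).continuousWithinAt
  obtain ⟨C, hC⟩ := isCompact_Icc.exists_bound_of_continuousOn hc
  refine ⟨max C 0, le_max_right _ _, fun σ h1 h2 => ?_⟩
  have h3 := hC σ ⟨h1.le, h2⟩
  rw [hs.twistPair_self.logDeriv_lfun hs hs.count hδ (by simpa using h1)] at h3
  have h4 := (Complex.abs_re_le_norm _).trans h3
  rw [abs_le, Complex.sub_re] at h4
  have h5 : (1 / ((σ : ℂ) - 1)).re = 1 / (σ - 1) := by
    rw [← Complex.ofReal_one, ← Complex.ofReal_sub, ← Complex.ofReal_div, Complex.ofReal_re]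
  rw [h5] at h4
  linarith [h4.1, le_max_left C 0]

lemma NormSystem.exists_zero_dist (hs : NormSystem r Λ A δ κ) :
    ∃ d : ℝ, 0 < d ∧ ∀ ρ, lfun (fun n => (r n : ℂ)) κ ρ = 0 → d ≤ ‖ρ - 1‖ := by
  have hδ := hs.δ_pos
  have hc : ContinuousAt (lfun (fun n => (r n : ℂ)) κ) 1 :=
    (differentiableAt_lfun hs.count hs.δ_le (by simp; linarith)).continuousAt
  have hne : lfun (fun n => (r n : ℂ)) κ 1 ≠ 0 := by
    rw [lfun_one]; exact_mod_cast hs.κ_pos.ne'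
  obtain ⟨d, hd, h⟩ := Metric.eventually_nhds_iff.1 (hc.eventually_ne hne)
  refine ⟨d, hd, fun ρ hρ => ?_⟩
  by_contra hlt
  exact h (by rwa [dist_eq_norm, ← not_le]) hρ

/-- Zeros of the `L`-function of a quadratic character stay away from `1`. -/
lemma CharSystem.exists_zero_dist (hs : CharSystem r Λ A δ κ) {ε : ℝ} (hε : 0 < ε) (hε1 : ε ≤ 1) :
    ∃ d : ℝ, 0 < d ∧ ∀ (q : ℕ) [NeZero q] (χ : DirichletCharacter ℂ q), GoodChar r A δ χ →
      TrivChar Λ (χ ^ 2) → ∀ ρ, gfun (twistBy r χ) ρ = 0 → d * (q : ℝ) ^ (-ε) ≤ ‖ρ - 1‖ := by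
  have hN := hs.toNormSystem
  have hδ := hN.δ_pos
  have hδ1 := hN.δ_le
  have hA := hN.one_le
  have hκ := hN.κ_pos
  obtain ⟨c, hc, hsie⟩ := hs.siegel (half_pos hε)
  set δ' := δ * (ε / 2) with hδ'
  have hδ'0 : 0 < δ' := by positivity
  have hδ'1 : δ' ≤ 1 := by nlinarith
  set M := 4 / δ' * (κ + 2 * A) with hM
  have hM0 : 0 < M := by positivity
  refine ⟨min (δ' / 4) (c * (δ' / 4) / (2 * M)), by positivity, fun q _ χ hg ht ρ hρ => ?_⟩
  have hq : (1 : ℝ) ≤ q := by exact_mod_cast NeZero.one_le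
  have hq0 : (0 : ℝ) < q := by linarith
  have hb := hN.interpolate (hN.twistPair χ) (by simpa using (by linarith : (0 : ℝ) ≤ A))
    (by positivity) hg.bound (half_pos hε).le (by linarith : ε / 2 ≤ 1)
  rw [← hδ'] at hb
  by_contra hlt
  push Not at hlt
  have hqe : (q : ℝ) ^ (-ε) ≤ 1 := Real.rpow_le_one_of_one_le_of_nonpos hq (by linarith)
  have hqe0 : 0 < (q : ℝ) ^ (-ε) := by positivity
  have hd1 : ‖ρ - 1‖ < δ' / 4 := by
    refine hlt.trans_le ?_
    calc _ ≤ δ' / 4 * 1 := mul_le_mul (min_le_left _ _) hqe hqe0.le (by positivity)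
      _ = _ := mul_one _
  have hsub : ∀ z ∈ ball (1 : ℂ) (δ' / 4),
      z ∈ closedBall ((1 + δ' / 4 : ℝ) : ℂ) (2 * (δ' / 4)) := by
    intro z hz
    rw [mem_ball, dist_eq_norm] at hz
    rw [mem_closedBall, dist_eq_norm]
    calc ‖z - ((1 + δ' / 4 : ℝ) : ℂ)‖ = ‖(z - 1) - ((δ' / 4 : ℝ) : ℂ)‖ := by
          congr 1; push_cast; ring
      _ ≤ ‖z - 1‖ + ‖((δ' / 4 : ℝ) : ℂ)‖ := norm_sub_le _ _
      _ ≤ _ := by rw [Complex.norm_real, Real.norm_of_nonneg (by positivity)]; linarith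
  have hbd : ∀ z ∈ ball (1 : ℂ) (δ' / 4), ‖gfun (twistBy r χ) z‖ ≤ M * (q : ℝ) ^ (ε / 2) := by
    intro z hz
    refine (norm_gfun_le_on_ball hb hδ'0 hδ'1 (hsub z hz)).trans (le_of_eq ?_)
    rw [hM]; ring
  have hmaps : Set.MapsTo (gfun (twistBy r χ)) (ball 1 (δ' / 4))
      (closedBall (gfun (twistBy r χ) 1) (2 * (M * (q : ℝ) ^ (ε / 2)))) := by
    intro z hz
    rw [mem_closedBall, dist_eq_norm]
    refine (norm_sub_le _ _).trans ?_
    have := hbd z hz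
    have := hbd 1 (mem_ball_self (by positivity))
    linarith
  have hmem : ρ ∈ ball (1 : ℂ) (δ' / 4) := by rwa [mem_ball, dist_eq_norm]
  have hdist := Complex.dist_le_div_mul_dist_of_mapsTo_ball (fun z hz =>
    (differentiableAt_gfun hb hδ'1
      (ball_subset_halfPlane hδ'0 (hsub z hz))).differentiableWithinAt) hmaps hmem
  rw [hρ, dist_zero_left, dist_eq_norm] at hdist
  have h1 := (hsie q χ hg ht).trans hdist
  have h2 : 0 < 2 * (M * (q : ℝ) ^ (ε / 2)) / (δ' / 4) := by positivity
  have h3 := h1.trans_lt (mul_lt_mul_of_pos_left (hlt.trans_le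
    (mul_le_mul_of_nonneg_right (min_le_right _ _) hqe0.le)) h2)
  have hqq : (q : ℝ) ^ (ε / 2) * (q : ℝ) ^ (-ε) = (q : ℝ) ^ (-(ε / 2)) := by
    rw [← Real.rpow_add hq0]; congr 1; ring
  have h4 : 2 * (M * (q : ℝ) ^ (ε / 2)) / (δ' / 4) *
      (c * (δ' / 4) / (2 * M) * (q : ℝ) ^ (-ε)) = c * (q : ℝ) ^ (-(ε / 2)) := by
    rw [← hqq]; field_simp
  rw [h4] at h3
  exact lt_irrefl _ h3

lemma norm_one_div_le_of_re {s : ℂ} (h : 1 < s.re) : ‖1 / (s - 1)‖ ≤ 1 / (s.re - 1) := by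
  rw [norm_div, norm_one]
  refine one_div_le_one_div_of_le (by linarith) ?_
  simpa using Complex.re_le_norm (s - 1)

lemma re_one_div_le_of_im {σ t d : ℝ} (hd : 0 < d) (h : d ≤ |t|) :
    (1 / ((σ + t * Complex.I : ℂ) - 1)).re ≤ 1 / d := by
  refine (Complex.re_le_norm _).trans ?_
  rw [norm_div, norm_one]
  refine one_div_le_one_div_of_le hd (h.trans ?_)
  simpa using Complex.abs_im_le_norm ((σ + t * Complex.I : ℂ) - 1)

lemma re_or_im_ge {ρ : ℂ} {d : ℝ} (h : d ≤ ‖ρ - 1‖) (hρ : ρ.re ≤ 1) :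
    d / 2 ≤ 1 - ρ.re ∨ d / 2 ≤ |ρ.im| := by
  by_contra hc
  push Not at hc
  have := Complex.norm_le_abs_re_add_abs_im (ρ - 1)
  rw [Complex.sub_re, Complex.sub_im, Complex.one_re, Complex.one_im, sub_zero,
    abs_of_nonpos (by linarith)] at this
  linarith [hc.1, hc.2]

/-- The logarithm of the conductor is controlled by `q ^ ε + log T`. -/
lemma log_conductor_le {B ε T q : ℝ} (hB : 1 ≤ B) (hε : 0 < ε) (hT : 3 ≤ T) (hq : 1 ≤ q) :
    Real.log (B * q * (2 * (T + 1) + 3)) ≤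
      (Real.log B + 1 / ε + 3) * (q ^ ε + Real.log T) := by
  have h1 : 2 * (T + 1) + 3 ≤ T ^ 3 := by nlinarith [mul_self_nonneg (T - 3)]
  have hT0 : 0 < Real.log T := Real.log_pos (by linarith)
  have hq0 : 0 < q := by linarith
  have hqe : 1 ≤ q ^ ε := Real.one_le_rpow hq hε.le
  have hlB : 0 ≤ Real.log B := Real.log_nonneg hB
  rw [Real.log_mul (by positivity) (by positivity), Real.log_mul (by positivity) (by positivity)]
  have h2 : Real.log (2 * (T + 1) + 3) ≤ 3 * Real.log T := by
    have := Real.log_le_log (by positivity) h1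
    rwa [Real.log_pow] at this
  have h3 : Real.log q ≤ q ^ ε / ε := Real.log_le_rpow_div hq0.le hε
  have h4 : Real.log B ≤ Real.log B * (q ^ ε + Real.log T) :=
    le_mul_of_one_le_right hlB (by linarith)
  have h5 : q ^ ε / ε ≤ 1 / ε * (q ^ ε + Real.log T) := by
    rw [div_eq_mul_one_div, mul_comm]
    exact mul_le_mul_of_nonneg_left (by linarith) (by positivity)
  linarith

lemma NormSystem.exists_zero_free (hs : NormSystem r Λ A δ κ) :
    ∃ c : ℝ, 0 < c ∧ ∀ T : ℝ, 3 ≤ T → ∀ ρ, lfun (fun n => (r n : ℂ)) κ ρ = 0 →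
      |ρ.im| ≤ T + 1 → c / (1 + Real.log T) ≤ 1 - ρ.re := by
  have hδ := hs.δ_pos
  have hδ1 := hs.δ_le
  have hA := hs.one_le
  have hκ := hs.κ_pos
  obtain ⟨C₀, hC₀, hΛ⟩ := hs.exists_lam_le
  obtain ⟨d, hd, hdist⟩ := hs.exists_zero_dist
  set B := 10 * (κ + A) / δ with hB
  have hB1 : 1 ≤ B := by rw [hB, le_div_iff₀ hδ]; linarith
  have hlB : 0 ≤ Real.log B := Real.log_nonneg hB1
  set C₂ := Real.log B + 1 / 1 + 3 + 10 / d with hC₂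
  obtain ⟨c, hc, h⟩ := hs.zero_free_of_lData hC₀ (by positivity : 0 ≤ C₂) hΛ
  have hone : ∀ f : ℕ → ℝ, twistBy f (1 : DirichletCharacter ℂ 1) = fun n => (f n : ℂ) := by
    intro f; ext n
    rw [twistBy, MulChar.one_apply (isUnit_of_subsingleton _), one_mul]
  refine ⟨min c (d / 2), by positivity, fun T hT ρ hρ him => ?_⟩
  have hT0 : 0 < Real.log T := Real.log_pos (by linarith)
  have hρ1 : ρ.re ≤ 1 := by
    by_contra hc
    exact hs.twistPair_self.lfun_ne_zero hs hs.count hδ (not_le.1 hc) hρ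
  rcases re_or_im_ge (hdist ρ hρ) hρ1 with h1 | h1
  · refine le_trans ?_ h1
    refine (div_le_self (by positivity) (by linarith)).trans (min_le_right _ _)
  · have hl := hs.twistPair_self.lData_lfun hs (le_refl (1 : ℝ)) (c := κ)
      (by rw [Complex.norm_real, Real.norm_of_nonneg hκ.le]; linarith)
      (by rw [mul_one]; exact hs.count)
    have hlc := log_conductor_le hB1 one_pos hT le_rfl
    rw [Real.one_rpow] at hlc
    have hL : 0 ≤ 10 / d * (1 + Real.log T) := by positivity
    have key := h 1 1 B (1 + Real.log T) (lfun (fun n => (r n : ℂ)) κ)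
      (lfun (fun n => (r n : ℂ)) κ) (fun s => 1 / (s - 1)) (fun s => 1 / (s - 1)) ρ hB1
      (by linarith)
      (by rw [hone]; convert hl using 1; rw [hB]; ring)
      (by rw [one_pow, hone]; convert hl using 1; rw [hB]; ring) hρ ?_ fun σ _ _ => ?_
    · exact (div_le_div_of_nonneg_right (min_le_left _ _) (by linarith)).trans key
    · refine (Real.log_le_log (by positivity) ?_).trans (hlc.trans ?_)
      · rw [mul_one]; gcongr
      · rw [hC₂]; linarith
    · have e1 := re_one_div_le_of_im (σ := σ) (half_pos hd) h1
      have e2 := re_one_div_le_of_im (σ := σ) (t := 2 * ρ.im) (half_pos hd)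
        (by rw [abs_mul, abs_two]; linarith [abs_nonneg ρ.im])
      push_cast at e2
      have e3 : 1 / (d / 2) = 2 / d := by field_simp
      have e4 : 10 / d = 5 * (2 / d) := by ring
      have e5 : 0 ≤ (Real.log B + 1 / 1 + 3) * (1 + Real.log T) := by positivity
      have e6 : 10 / d ≤ 10 / d * (1 + Real.log T) :=
        le_mul_of_one_le_right (by positivity) (by linarith)
      rw [hC₂]
      linarith

lemma CharSystem.exists_zero_free (hs : CharSystem r Λ A δ κ) {ε : ℝ} (hε : 0 < ε) (hε1 : ε ≤ 1) :
    ∃ c : ℝ, 0 < c ∧ ∀ (q : ℕ) [NeZero q] (χ : DirichletCharacter ℂ q), GoodChar r A δ χ →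
      ∀ T : ℝ, 3 ≤ T → ∀ ρ, gfun (twistBy r χ) ρ = 0 →
      |ρ.im| ≤ T + 1 → c / ((q : ℝ) ^ ε + Real.log T) ≤ 1 - ρ.re := by
  have hN := hs.toNormSystem
  have hδ := hN.δ_pos
  have hδ1 := hN.δ_le
  have hA := hN.one_le
  have hκ := hN.κ_pos
  obtain ⟨C₀, hC₀, hΛ⟩ := hN.exists_lam_le
  obtain ⟨d, hd, hdist⟩ := hs.exists_zero_dist hε hε1
  set B := 10 * (κ + A) / δ with hB
  have hB1 : 1 ≤ B := by rw [hB, le_div_iff₀ hδ]; linarith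
  have hlB : 0 ≤ Real.log B := Real.log_nonneg hB1
  set C₂ := Real.log B + 1 / ε + 3 + 2 / d with hC₂
  obtain ⟨c, hc, h⟩ := hN.zero_free_of_lData hC₀ (by positivity : 0 ≤ C₂) hΛ
  refine ⟨min c (d / 2), by positivity, fun q _ χ hg T hT ρ hρ him => ?_⟩
  have hq : (1 : ℝ) ≤ q := by exact_mod_cast NeZero.one_le
  have hq0 : (0 : ℝ) < q := by linarith
  have hqe : 1 ≤ (q : ℝ) ^ ε := Real.one_le_rpow hq hε.le
  have hT0 : 0 < Real.log T := Real.log_pos (by linarith)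
  have hl := hN.lData_gfun hg.bound
  have hQ : 10 * (κ + A) * q / δ = B * q := by rw [hB]; ring
  rw [hQ] at hl
  have hBq : 1 ≤ B * q := by nlinarith
  have hρ1 : ρ.re ≤ 1 := by
    by_contra hc
    exact hl.ne_zero ρ (not_le.1 hc) hρ
  have hlc := log_conductor_le hB1 hε hT hq
  have hlc' : Real.log (B * q * (2 * |ρ.im| + 3)) ≤ C₂ * ((q : ℝ) ^ ε + Real.log T) := by
    refine (Real.log_le_log (by positivity) ?_).trans (hlc.trans ?_)
    · gcongr
    · rw [hC₂]
      refine mul_le_mul_of_nonneg_right ?_ (by linarith)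
      have : 0 ≤ 2 / d := by positivity
      linarith
  have hfin : c / ((q : ℝ) ^ ε + Real.log T) ≤ 1 - ρ.re →
      min c (d / 2) / ((q : ℝ) ^ ε + Real.log T) ≤ 1 - ρ.re := fun key =>
    (div_le_div_of_nonneg_right (min_le_left _ _) (by linarith)).trans key
  have hC2L : 0 ≤ C₂ * ((q : ℝ) ^ ε + Real.log T) := by positivity
  rcases hs.dichotomy q (χ ^ 2) with ht | hg2
  · rcases re_or_im_ge (hdist q χ hg ht ρ hρ) hρ1 with h1 | h1
    · refine le_trans ?_ h1
      rw [Real.rpow_neg hq0.le, ← div_eq_mul_inv, div_div, mul_comm, ← div_div]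
      exact div_le_div₀ (by positivity) (min_le_right _ _) (by positivity) (by linarith)
    · obtain ⟨c₂, hc₂, hb₂⟩ := hN.twist q (χ ^ 2)
      have hl₂ := (hN.twistPair (χ ^ 2)).lData_lfun hN hq (hc₂.trans (by linarith)) hb₂
      rw [hQ] at hl₂
      refine hfin (h q χ (B * q) _ _ _ _ _ ρ hBq (by linarith) hl hl₂ hρ hlc' fun σ _ _ => ?_)
      have e2 := re_one_div_le_of_im (σ := σ) (t := 2 * ρ.im) (d := d * (q : ℝ) ^ (-ε) / 2)
        (by positivity) (by rw [abs_mul, abs_two]; linarith [abs_nonneg ρ.im])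
      push_cast at e2
      rw [Pi.zero_apply, Complex.zero_re, mul_zero, zero_add]
      refine e2.trans ?_
      have e3 : 1 / (d * (q : ℝ) ^ (-ε) / 2) = 2 / d * (q : ℝ) ^ ε := by
        rw [Real.rpow_neg hq0.le]; field_simp
      rw [e3, hC₂]
      refine mul_le_mul ?_ (by linarith) (by positivity) (by positivity)
      have : 0 ≤ 1 / ε := by positivity
      linarith
  · have hl₂ := hN.lData_gfun hg2.bound
    rw [hQ] at hl₂
    refine hfin (h q χ (B * q) _ _ _ _ _ ρ hBq (by linarith) hl hl₂ hρ hlc' fun σ _ _ => ?_)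
    simpa using hC2L

end ZeroFreeRegion

section Region
open Metric Filter Topology

variable {r Λ : ℕ → ℝ} {A δ κ : ℝ}

lemma LData.logDeriv_bound (hs : NormSystem r Λ A δ κ) {Q C₀ T w : ℝ} {F P : ℂ → ℂ} {D : ℕ → ℂ}
    (h : LData δ Q F P D) (hD : ∀ n, n ≠ 0 → ‖D n‖ ≤ Λ n) (hQ : 1 ≤ Q) (hC₀ : 0 ≤ C₀)
    (hΛ : ∀ σ : ℝ, 1 < σ → σ ≤ 2 → (LSeries (fun n => (Λ n : ℂ)) σ).re ≤ 1 / (σ - 1) + C₀)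
    (hP : ∀ s : ℂ, 1 < s.re → ‖P s‖ ≤ 1 / (s.re - 1)) (hw : 0 < w) (hwδ : 8 * w ≤ δ)
    (hz : ∀ ρ, F ρ = 0 → |ρ.im| ≤ T + 1 → ρ.re ≤ 1 - 3 * w) {s : ℂ} (h1 : 1 - w ≤ s.re)
    (h2 : s.re ≤ 2) (hT : |s.im| ≤ T) :
    F s ≠ 0 ∧ ‖logDeriv F s‖ ≤ 12 / w * Real.log (Q * (T + 3) / w) + 2 / w + C₀ := by
  have hδ := hs.δ_pos
  have hδ1 := hs.δ_le
  have hT0 : 0 ≤ T := (abs_nonneg _).trans hT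
  refine ⟨fun h0 => ?_, ?_⟩
  · have := hz s h0 (by linarith); linarith
  have hlog0 : 0 ≤ Real.log (Q * (T + 3) / w) := by
    apply Real.log_nonneg
    rw [le_div_iff₀ hw]; nlinarith
  rcases le_or_gt (1 + w) s.re with h3 | h3
  · have hs1 : 1 < s.re := by linarith
    rw [h.logDeriv_eq s hs1]
    have e1 := hP s hs1
    have e2 := norm_LSeries_le hD (hs.summable_lam hs1)
    have e3 := hΛ s.re hs1 h2
    have e4 : 1 / (s.re - 1) ≤ 1 / w := one_div_le_one_div_of_le hw (by linarith)
    have e5 := norm_sub_le (P s) (LSeries D s)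
    have e6 : 0 ≤ 12 / w * Real.log (Q * (T + 3) / w) := by positivity
    have e7 : 2 / w = 1 / w + 1 / w := by ring
    linarith
  · set s₀ : ℂ := ((1 + w : ℝ) : ℂ) + s.im * Complex.I with hs₀
    have hre : s₀.re = 1 + w := by simp [hs₀]
    have him : s₀.im = s.im := by simp [hs₀]
    obtain ⟨hB, hd, hM⟩ := h.ball_facts hδ hδ1 hQ (s := s₀) (by rw [hre]; linarith)
      (by rw [hre]; linarith)
    have hsub : ball s₀ (4 * w) ⊆ ball s₀ (δ / 2) := ball_subset_ball (by linarith)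
    have hdist : ‖s - s₀‖ ≤ 4 * w / 2 := by
      have : s - s₀ = ((s.re - (1 + w) : ℝ) : ℂ) := by
        apply Complex.ext
        · simp [hre]
        · simp [him]
      rw [this, Complex.norm_real, Real.norm_eq_abs, abs_le]
      constructor <;> linarith
    have key := norm_logDeriv_le_of_ne_zero (R := 4 * w) (by linarith) hB
      (hd.mono (hsub.trans ball_subset_closedBall)) (fun z hzb h0 => by
        rw [mem_ball, dist_eq_norm] at hzb
        have e1 := (Complex.abs_re_le_norm (z - s₀)).trans_lt hzb
        have e2 := (Complex.abs_im_le_norm (z - s₀)).trans_lt hzb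
        rw [Complex.sub_re, hre, abs_lt] at e1
        rw [Complex.sub_im, him] at e2
        have e3 : |z.im| ≤ |z.im - s.im| + |s.im| := by
          simpa using abs_add_le (z.im - s.im) s.im
        have := hz z h0 (by linarith)
        linarith [e1.1]) (fun z hzb => hM z (hsub hzb)) hdist
    rw [hre, him, add_sub_cancel_left] at key
    refine key.trans ?_
    have e1 : Real.log (Q * (|s.im| + 3) / w) ≤ Real.log (Q * (T + 3) / w) := by
      apply Real.log_le_log (by positivity); gcongr
    have e2 : 24 * (2 * Real.log (Q * (|s.im| + 3) / w)) / (4 * w) =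
        12 / w * Real.log (Q * (|s.im| + 3) / w) := by field_simp; ring
    rw [e2]
    have e3 : 12 / w * Real.log (Q * (|s.im| + 3) / w) ≤ 12 / w * Real.log (Q * (T + 3) / w) :=
      mul_le_mul_of_nonneg_left e1 (by positivity)
    have e4 : 0 ≤ 2 / w := by positivity
    linarith

/-- A zero-free region of width `c / L` yields a bound for the logarithmic derivative of order
`L ^ 2` in a slightly smaller region. -/
lemma NormSystem.exists_logDeriv_bound (hs : NormSystem r Λ A δ κ) {c₀ C₂ : ℝ} (hc₀ : 0 < c₀)
    (hC₂ : 0 ≤ C₂) :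
    ∃ c C : ℝ, 0 < c ∧ c ≤ δ / 8 ∧ 0 < C ∧ ∀ (Q T L : ℝ) (F P : ℂ → ℂ) (D : ℕ → ℂ), 1 ≤ Q →
      1 ≤ L → LData δ Q F P D → (∀ n, n ≠ 0 → ‖D n‖ ≤ Λ n) →
      (∀ s : ℂ, 1 < s.re → ‖P s‖ ≤ 1 / (s.re - 1)) →
      (∀ ρ, F ρ = 0 → |ρ.im| ≤ T + 1 → c₀ / L ≤ 1 - ρ.re) →
      Real.log (Q * (2 * (T + 1) + 3)) ≤ C₂ * L →
      ∀ s : ℂ, 1 - c / L ≤ s.re → s.re ≤ 2 → |s.im| ≤ T →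
        F s ≠ 0 ∧ ‖logDeriv F s‖ ≤ C * L ^ 2 := by
  have hδ := hs.δ_pos
  obtain ⟨C₀, hC₀, hΛ⟩ := hs.exists_lam_le
  set c := min (c₀ / 3) (δ / 8) with hc
  have hcpos : 0 < c := lt_min (by positivity) (by positivity)
  have hc1 : c ≤ c₀ / 3 := min_le_left _ _
  refine ⟨c, 12 / c * (C₂ + 1 + 1 / c) + 2 / c + C₀, hcpos, min_le_right _ _, by positivity,
    fun Q T L F P D hQ hL h hD hP hz hlog s h1 h2 hT => ?_⟩
  have hL0 : 0 < L := by linarith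
  have hT0 : 0 ≤ T := (abs_nonneg _).trans hT
  have hcL : c / L ≤ c := div_le_self hcpos.le hL
  obtain ⟨k1, k2⟩ := h.logDeriv_bound hs hD hQ hC₀ hΛ hP (w := c / L) (T := T) (by positivity)
    (by linarith [min_le_right (c₀ / 3) (δ / 8)]) (fun ρ h0 him => by
      have e1 := hz ρ h0 him
      have e2 : c / L ≤ c₀ / 3 / L := div_le_div_of_nonneg_right hc1 hL0.le
      have e3 : c₀ / 3 / L = c₀ / L / 3 := by ring
      linarith) h1 h2 hT
  refine ⟨k1, k2.trans ?_⟩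
  have hl : Real.log (Q * (T + 3) / (c / L)) ≤ (C₂ + 1 + 1 / c) * L := by
    have e1 : Q * (T + 3) / (c / L) = Q * (T + 3) * (L * (1 / c)) := by field_simp
    rw [e1, Real.log_mul (by positivity) (by positivity),
      Real.log_mul hL0.ne' (one_div_pos.2 hcpos).ne']
    have e2 : Real.log (Q * (T + 3)) ≤ Real.log (Q * (2 * (T + 1) + 3)) := by
      apply Real.log_le_log (by positivity); gcongr; linarith
    have e3 := Real.log_le_self hL0.le
    have e4 := Real.log_le_self (x := 1 / c) (by positivity)
    have e5 : 1 / c ≤ 1 / c * L := le_mul_of_one_le_right (by positivity) hL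
    linarith
  have hinv : ∀ y : ℝ, y / (c / L) = y / c * L := fun y => by field_simp
  rw [hinv 12, hinv 2]
  have f1 : 12 / c * L * Real.log (Q * (T + 3) / (c / L)) ≤
      12 / c * L * ((C₂ + 1 + 1 / c) * L) := mul_le_mul_of_nonneg_left hl (by positivity)
  have f2 : 2 / c * L ≤ 2 / c * L ^ 2 := mul_le_mul_of_nonneg_left (by nlinarith) (by positivity)
  have f3 : C₀ ≤ C₀ * L ^ 2 := le_mul_of_one_le_right hC₀ (by nlinarith)
  have f4 : 12 / c * L * ((C₂ + 1 + 1 / c) * L) = 12 / c * (C₂ + 1 + 1 / c) * L ^ 2 := by ring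
  linarith

theorem NormSystem.exists_region (hs : NormSystem r Λ A δ κ) :
    ∃ c C : ℝ, 0 < c ∧ c ≤ δ / 8 ∧ 0 < C ∧ ∀ T : ℝ, 3 ≤ T → ∀ s : ℂ,
      1 - c / (1 + Real.log T) ≤ s.re → s.re ≤ 2 → |s.im| ≤ T →
      lfun (fun n => (r n : ℂ)) κ s ≠ 0 ∧
      ‖logDeriv (lfun (fun n => (r n : ℂ)) κ) s‖ ≤ C * (1 + Real.log T) ^ 2 := by
  have hδ := hs.δ_pos
  have hδ1 := hs.δ_le
  have hA := hs.one_le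
  have hκ := hs.κ_pos
  obtain ⟨c₀, hc₀, hz⟩ := hs.exists_zero_free
  set B := 10 * (κ + A) / δ with hB
  have hB1 : 1 ≤ B := by rw [hB, le_div_iff₀ hδ]; linarith
  have hlB : 0 ≤ Real.log B := Real.log_nonneg hB1
  obtain ⟨c, C, hc, hcδ, hC, h⟩ := hs.exists_logDeriv_bound hc₀
    (by positivity : 0 ≤ Real.log B + 1 / 1 + 3)
  refine ⟨c, C, hc, hcδ, hC, fun T hT => ?_⟩
  have hT0 : 0 < Real.log T := Real.log_pos (by linarith)
  have hl := hs.twistPair_self.lData_lfun hs (le_refl (1 : ℝ)) (c := κ)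
    (by rw [Complex.norm_real, Real.norm_of_nonneg hκ.le]; linarith)
    (by rw [mul_one]; exact hs.count)
  have hlc := log_conductor_le hB1 one_pos hT le_rfl
  rw [Real.one_rpow] at hlc
  refine h (B * 1) T (1 + Real.log T) _ _ _ (by linarith) (by linarith)
    (by convert hl using 1; rw [hB]; ring) (fun n _ => ?_) (fun s => norm_one_div_le_of_re)
    (hz T hT) hlc
  rw [Complex.norm_real, Real.norm_of_nonneg (hs.lam_nonneg n)]

theorem CharSystem.exists_region (hs : CharSystem r Λ A δ κ) {ε : ℝ} (hε : 0 < ε) (hε1 : ε ≤ 1) :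
    ∃ c C : ℝ, 0 < c ∧ c ≤ δ / 8 ∧ 0 < C ∧ ∀ (q : ℕ) [NeZero q] (χ : DirichletCharacter ℂ q),
      GoodChar r A δ χ → ∀ T : ℝ, 3 ≤ T → ∀ s : ℂ,
      1 - c / ((q : ℝ) ^ ε + Real.log T) ≤ s.re → s.re ≤ 2 → |s.im| ≤ T →
      gfun (twistBy r χ) s ≠ 0 ∧
      ‖logDeriv (gfun (twistBy r χ)) s‖ ≤ C * ((q : ℝ) ^ ε + Real.log T) ^ 2 := by
  have hN := hs.toNormSystem
  have hδ := hN.δ_pos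
  have hδ1 := hN.δ_le
  have hA := hN.one_le
  have hκ := hN.κ_pos
  obtain ⟨c₀, hc₀, hz⟩ := hs.exists_zero_free hε hε1
  set B := 10 * (κ + A) / δ with hB
  have hB1 : 1 ≤ B := by rw [hB, le_div_iff₀ hδ]; linarith
  have hlB : 0 ≤ Real.log B := Real.log_nonneg hB1
  obtain ⟨c, C, hc, hcδ, hC, h⟩ := hN.exists_logDeriv_bound hc₀
    (by positivity : 0 ≤ Real.log B + 1 / ε + 3)
  refine ⟨c, C, hc, hcδ, hC, fun q _ χ hg T hT => ?_⟩
  have hq : (1 : ℝ) ≤ q := by exact_mod_cast NeZero.one_le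
  have hqe : 1 ≤ (q : ℝ) ^ ε := Real.one_le_rpow hq hε.le
  have hT0 : 0 < Real.log T := Real.log_pos (by linarith)
  have hl := hN.lData_gfun hg.bound
  rw [show 10 * (κ + A) * q / δ = B * q by rw [hB]; ring] at hl
  refine h (B * q) T _ _ _ _ (by nlinarith) (by linarith) hl (fun n _ => ?_)
    (fun s h1 => ?_) (hz q χ hg T hT) (log_conductor_le hB1 hε hT hq)
  · exact (hN.twistPair χ).le n
  · rw [Pi.zero_apply, norm_zero]
    exact one_div_nonneg.2 (by linarith)

end Region

section Perron
open Filter Topology MeasureTheory Set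

/-- The kernel `1 / (s (s + 1))` on the vertical line through `σ`. -/
noncomputable def perronKernel (σ t : ℝ) : ℂ :=
  1 / ((σ + t * Complex.I) * (σ + t * Complex.I + 1))

lemma norm_perronKernel_le {σ : ℝ} (hσ : 1 ≤ σ) (t : ℝ) :
    ‖perronKernel σ t‖ ≤ (1 + t ^ 2)⁻¹ := by
  rw [perronKernel, norm_div, norm_one, one_div, norm_mul]
  refine inv_anti₀ (by positivity) ?_
  have h : ∀ y : ℝ, 1 ≤ y → Real.sqrt (1 + t ^ 2) ≤ ‖(y + t * Complex.I : ℂ)‖ := by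
    intro y hy
    rw [Complex.norm_add_mul_I]
    apply Real.sqrt_le_sqrt; nlinarith
  have h2 : (σ + t * Complex.I + 1 : ℂ) = ((σ + 1 : ℝ) + t * Complex.I : ℂ) := by
    push_cast; ring
  rw [h2]
  calc 1 + t ^ 2 = Real.sqrt (1 + t ^ 2) * Real.sqrt (1 + t ^ 2) :=
        (Real.mul_self_sqrt (by positivity)).symm
    _ ≤ _ := mul_le_mul (h σ hσ) (h (σ + 1) (by linarith)) (Real.sqrt_nonneg _) (norm_nonneg _)

lemma line_ne_zero {σ : ℝ} (hσ : 0 < σ) (t : ℝ) : (σ + t * Complex.I : ℂ) ≠ 0 := by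
  intro h
  have := congrArg Complex.re h
  simp at this
  linarith

lemma continuous_perronKernel {σ : ℝ} (hσ : 1 ≤ σ) : Continuous (perronKernel σ) := by
  unfold perronKernel
  refine continuous_const.div (by fun_prop) fun t => mul_ne_zero
    (line_ne_zero (by linarith) t) ?_
  have := line_ne_zero (σ := σ + 1) (by linarith) t
  rwa [show ((σ + 1 : ℝ) + t * Complex.I : ℂ) = σ + t * Complex.I + 1 by push_cast; ring] at this

lemma integrable_perronKernel {σ : ℝ} (hσ : 1 ≤ σ) : Integrable (perronKernel σ) :=
  Integrable.mono' integrable_inv_one_add_sq (continuous_perronKernel hσ).aestronglyMeasurable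
    (Eventually.of_forall (norm_perronKernel_le hσ))

lemma perron_kernel_integral {σ u : ℝ} (hσ : 1 ≤ σ) (hu : 0 < u) :
    (1 / (2 * Real.pi) : ℂ) * ∫ t : ℝ, (u : ℂ) ^ (-(σ + t * Complex.I)) * perronKernel σ t =
      ((max (1 - u) 0 : ℝ) : ℂ) := by
  set f : ℝ → ℂ := fun t => indicator (Ioc 0 1) (fun _ => 1 : ℝ → ℂ) t -
    indicator (Ioc 0 1) (fun t => (t : ℂ) ^ (1 : ℂ) : ℝ → ℂ) t with hf
  have hm : ∀ s : ℂ, 1 ≤ s.re → HasMellin f s (1 / (s * (s + 1))) := by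
    intro s hs
    have h1 := hasMellin_one_Ioc (s := s) (by linarith)
    have h2 := hasMellin_cpow_Ioc 1 (s := s) (by simp; linarith)
    have h3 := hasMellin_sub h1.1 h2.1
    rw [h1.2, h2.2] at h3
    have hs0 : s ≠ 0 := by rintro rfl; simp at hs; linarith
    have hs1 : s + 1 ≠ 0 := by
      intro h; have := congrArg Complex.re h; simp at this; linarith
    have he : 1 / s - 1 / (s + 1) = 1 / (s * (s + 1)) := by
      field_simp
      ring
    rwa [he] at h3
  have hfe : ∀ v : ℝ, 0 < v → f v = ((max (1 - v) 0 : ℝ) : ℂ) := by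
    intro v hv
    simp only [hf, Complex.cpow_one]
    by_cases h : v ≤ 1
    · rw [indicator_of_mem (by exact ⟨hv, h⟩), indicator_of_mem (by exact ⟨hv, h⟩),
        max_eq_left (by linarith)]
      push_cast; rfl
    · rw [indicator_of_notMem (fun h' => h h'.2), indicator_of_notMem (fun h' => h h'.2),
        max_eq_right (by linarith)]
      simp
  have hc : ContinuousAt f u := by
    have : ContinuousAt (fun v : ℝ => ((max (1 - v) 0 : ℝ) : ℂ)) u := by fun_prop
    refine this.congr ?_
    filter_upwards [lt_mem_nhds hu] with v hv
    exact (hfe v hv).symm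
  have hv : Complex.VerticalIntegrable (mellin f) σ := by
    refine (integrable_perronKernel hσ).congr (Eventually.of_forall fun t => ?_)
    exact (hm _ (by simpa using hσ)).2.symm
  have key := mellinInv_mellin_eq σ f hu (hm σ (by simpa using hσ)).1 hv hc
  rw [hfe u hu] at key
  rw [← key, mellinInv, Complex.real_smul]
  congr 1
  · push_cast; rfl
  · congr 1
    ext t
    rw [smul_eq_mul, (hm _ (by simpa using hσ)).2, perronKernel]

/-- **Perron's formula** for the Riesz means of a Dirichlet series. -/
theorem perron_formula {a : ℕ → ℂ} {σ x : ℝ} (hσ : 1 ≤ σ) (hx : 0 < x)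
    (ha : LSeriesSummable a σ) :
    ∑ n ∈ Finset.Icc 1 ⌊x⌋₊, a n * ((x : ℂ) - n) = (1 / (2 * Real.pi) : ℂ) *
      ∫ t : ℝ, LSeries a (σ + t * Complex.I) *
        ((x : ℂ) ^ ((σ : ℂ) + t * Complex.I + 1) * perronKernel σ t) := by
  have hx0 : (x : ℂ) ≠ 0 := by exact_mod_cast hx.ne'
  set G : ℕ → ℝ → ℂ := fun n t => LSeries.term a (σ + t * Complex.I) n *
    ((x : ℂ) ^ ((σ : ℂ) + t * Complex.I + 1) * perronKernel σ t) with hG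
  have hnx : ∀ t : ℝ, ‖(x : ℂ) ^ ((σ : ℂ) + t * Complex.I + 1)‖ = x ^ (σ + 1) := by
    intro t
    rw [Complex.norm_cpow_eq_rpow_re_of_pos hx]; simp
  have hnt : ∀ n (t : ℝ), ‖LSeries.term a (σ + t * Complex.I) n‖ = ‖LSeries.term a σ n‖ := by
    intro n t
    rw [LSeries.norm_term_eq, LSeries.norm_term_eq]; simp
  have hcx : Continuous fun t : ℝ => (x : ℂ) ^ ((σ : ℂ) + t * Complex.I + 1) :=
    Continuous.const_cpow (by fun_prop) (Or.inl hx0)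
  have hct : ∀ n, Continuous fun t : ℝ => LSeries.term a (σ + t * Complex.I) n := by
    intro n
    rcases eq_or_ne n 0 with rfl | hn
    · simpa [LSeries.term_zero] using continuous_const
    · simp only [LSeries.term_of_ne_zero hn]
      have hn' : (n : ℂ) ≠ 0 := by exact_mod_cast hn
      refine continuous_const.div (Continuous.const_cpow (by fun_prop) (Or.inl hn')) fun t => ?_
      simp [Complex.cpow_eq_zero_iff, hn']
  have hGn : ∀ n t, ‖G n t‖ = ‖LSeries.term a σ n‖ * (x ^ (σ + 1) * ‖perronKernel σ t‖) := by
    intro n t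
    rw [hG, norm_mul, norm_mul, hnx, hnt]
  have hGc : ∀ n, Continuous (G n) := fun n =>
    (hct n).mul (hcx.mul (continuous_perronKernel hσ))
  have hGi : ∀ n, Integrable (G n) := by
    intro n
    refine Integrable.mono' (((integrable_perronKernel hσ).norm.const_mul (x ^ (σ + 1))).const_mul
      ‖LSeries.term a σ n‖) (hGc n).aestronglyMeasurable (Eventually.of_forall fun t => ?_)
    rw [hGn]
  have hsum : Summable fun n => ∫ t, ‖G n t‖ := by
    simp_rw [hGn, integral_const_mul]
    exact ha.norm.mul_right _
  have key := hasSum_integral_of_summable_integral_norm hGi hsum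
  have hint : (∫ t, ∑' n, G n t) = ∫ t : ℝ, LSeries a (σ + t * Complex.I) *
        ((x : ℂ) ^ ((σ : ℂ) + t * Complex.I + 1) * perronKernel σ t) := by
    congr 1; ext t
    rw [hG, tsum_mul_right, LSeries]
  rw [← hint, ← key.tsum_eq, ← tsum_mul_left]
  have hterm : ∀ n, (1 / (2 * Real.pi) : ℂ) * ∫ t, G n t =
      if n ∈ Finset.Icc 1 ⌊x⌋₊ then a n * ((x : ℂ) - n) else 0 := by
    intro n
    rcases eq_or_ne n 0 with rfl | hn
    · simp [hG, LSeries.term_zero]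
    have hn0 : (0 : ℝ) < n := by exact_mod_cast Nat.pos_of_ne_zero hn
    have hu : 0 < (n : ℝ) / x := by positivity
    have h1 := perron_kernel_integral hσ hu
    have h2 : ∀ t, G n t = a n * x *
        ((((n : ℝ) / x : ℝ) : ℂ) ^ (-(σ + t * Complex.I)) * perronKernel σ t) := by
      intro t
      simp only [hG]
      rw [LSeries.term_of_ne_zero hn, Complex.cpow_add _ _ hx0, Complex.cpow_one]
      have h3 : (((n : ℝ) / x : ℝ) : ℂ) ^ (-(σ + t * Complex.I)) =
          (x : ℂ) ^ ((σ : ℂ) + t * Complex.I) / (n : ℂ) ^ ((σ : ℂ) + t * Complex.I) := by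
        rw [Complex.ofReal_div, Complex.div_cpow_ofReal_nonneg hn0.le hx.le, Complex.cpow_neg,
          Complex.cpow_neg, Complex.ofReal_natCast, inv_div_inv]
      rw [h3]
      ring
    simp_rw [h2, integral_const_mul]
    rw [mul_left_comm, h1]
    by_cases hle : n ≤ ⌊x⌋₊
    · rw [if_pos (Finset.mem_Icc.2 ⟨Nat.pos_of_ne_zero hn, hle⟩)]
      have : (n : ℝ) ≤ x := (Nat.le_floor_iff hx.le).1 hle
      rw [max_eq_left (by rw [sub_nonneg, div_le_one hx]; exact this)]
      push_cast
      field_simp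
    · rw [if_neg (fun h => hle (Finset.mem_Icc.1 h).2)]
      have : x < n := (Nat.floor_lt hx.le).1 (not_le.1 hle)
      rw [max_eq_right (by rw [sub_nonpos, one_le_div hx]; exact this.le)]
      simp
  simp_rw [hterm]
  rw [tsum_eq_sum (s := Finset.Icc 1 ⌊x⌋₊) fun n hn => if_neg hn]
  exact Finset.sum_congr rfl fun n hn => (if_pos hn).symm

end Perron

section Contour
open Filter Topology MeasureTheory Set

lemma integral_compl_inv_one_add_sq_le {T : ℝ} (hT : 0 < T) :
    ∫ t in (Ioc (-T) T)ᶜ, (1 + t ^ 2)⁻¹ ≤ 2 / T := by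
  have h1 := integral_add_compl (measurableSet_Ioc (a := -T) (b := T))
    (integrable_inv_one_add_sq)
  rw [integral_univ_inv_one_add_sq, ← intervalIntegral.integral_of_le (by linarith),
    integral_inv_one_add_sq, Real.arctan_neg] at h1
  have h2 := Real.arctan_inv_of_pos hT
  have h3 : Real.arctan T⁻¹ ≤ T⁻¹ := by
    have := Real.le_tan (Real.arctan_nonneg.2 (inv_nonneg.2 hT.le)) (Real.arctan_lt_pi_div_two T⁻¹)
    rwa [Real.tan_arctan] at this
  rw [div_eq_mul_inv]
  linarith

/-- Shifting the contour in Perron's formula. -/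
lemma norm_riesz_le {a : ℕ → ℂ} {F : ℂ → ℂ} {σ x w T B Z : ℝ} (hσ : 1 < σ) (hσ2 : σ ≤ 2)
    (hx : 1 ≤ x) (hw : 0 < w) (hw2 : w ≤ 1 / 2) (hT : 1 ≤ T) (ha : LSeriesSummable a σ)
    (hd : ∀ s : ℂ, 1 - w ≤ s.re → s.re ≤ σ → |s.im| ≤ T → DifferentiableAt ℂ F s)
    (hB : ∀ s : ℂ, 1 - w ≤ s.re → s.re ≤ σ → |s.im| ≤ T → ‖F s‖ ≤ B)
    (hF : ∀ t : ℝ, F (σ + t * Complex.I) = LSeries a (σ + t * Complex.I))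
    (hZ : ∀ t : ℝ, ‖LSeries a (σ + t * Complex.I)‖ ≤ Z) :
    ‖∑ n ∈ Finset.Icc 1 ⌊x⌋₊, a n * ((x : ℂ) - n)‖ ≤
      4 * (T * B * x ^ (2 - w)) + 4 * (B * x ^ (σ + 1) / T ^ 2) + 2 * (Z * x ^ (σ + 1) / T) := by
  have hx0 : 0 < x := by linarith
  have hxc : (x : ℂ) ≠ 0 := by exact_mod_cast hx0.ne'
  have hT0 : 0 < T := by linarith
  have hB0 : 0 ≤ B := (norm_nonneg _).trans (hB σ (by simp; linarith) (by simp) (by simp; linarith))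
  have hZ0 : 0 ≤ Z := (norm_nonneg _).trans (hZ 0)
  set f : ℂ → ℂ := fun s => F s * ((x : ℂ) ^ (s + 1) * (1 / (s * (s + 1)))) with hf
  have hne : ∀ s : ℂ, 1 - w ≤ s.re → s ≠ 0 ∧ s + 1 ≠ 0 := by
    intro s hs
    constructor
    · rintro rfl; simp at hs; linarith
    · intro h
      have := congrArg Complex.re h
      simp at this; linarith
  have hdf : ∀ s : ℂ, 1 - w ≤ s.re → s.re ≤ σ → |s.im| ≤ T → DifferentiableAt ℂ f s := by
    intro s h1 h2 h3
    obtain ⟨h4, h5⟩ := hne s h1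
    have e1 : DifferentiableAt ℂ (fun s : ℂ => (x : ℂ) ^ (s + 1)) s :=
      DifferentiableAt.const_cpow (by fun_prop) (Or.inl hxc)
    have e2 : DifferentiableAt ℂ (fun s : ℂ => 1 / (s * (s + 1))) s :=
      (differentiableAt_const _).div (by fun_prop) (mul_ne_zero h4 h5)
    exact (hd s h1 h2 h3).mul (e1.mul e2)
  have hnx : ∀ s : ℂ, ‖(x : ℂ) ^ (s + 1)‖ = x ^ (s.re + 1) := fun s => by
    rw [Complex.norm_cpow_eq_rpow_re_of_pos hx0]; simp
  have hkl : ∀ s : ℂ, 1 - w ≤ s.re → ‖1 / (s * (s + 1))‖ ≤ 2 := by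
    intro s hs
    rw [norm_div, norm_one, norm_mul, div_le_iff₀ (mul_pos (norm_pos_iff.2 (hne s hs).1)
      (norm_pos_iff.2 (hne s hs).2))]
    have e1 : 1 / 2 ≤ ‖s‖ := le_trans (by linarith) (Complex.re_le_norm s)
    have e2 : 1 ≤ ‖s + 1‖ := le_trans (by simp; linarith) (Complex.re_le_norm (s + 1))
    nlinarith
  have hkh : ∀ s : ℂ, |s.im| = T → ‖1 / (s * (s + 1))‖ ≤ 1 / T ^ 2 := by
    intro s hs
    rw [norm_div, norm_one, norm_mul]
    refine one_div_le_one_div_of_le (by positivity) ?_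
    have e1 : T ≤ ‖s‖ := hs ▸ Complex.abs_im_le_norm s
    have e2 : T ≤ ‖s + 1‖ := by simpa [hs] using Complex.abs_im_le_norm (s + 1)
    nlinarith
  -- the four sides of the rectangle
  have hrect := Complex.integral_boundary_rect_eq_zero_of_differentiableOn f
    (⟨1 - w, -T⟩ : ℂ) (⟨σ, T⟩ : ℂ) (by
      intro s hs
      rw [Complex.mem_reProdIm, uIcc_of_le (by dsimp only; linarith),
        uIcc_of_le (by dsimp only; linarith)] at hs
      exact (hdf s hs.1.1 hs.1.2 (abs_le.2 hs.2)).differentiableWithinAt)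
  dsimp only at hrect
  have hhor : ∀ y : ℝ, |y| = T → ‖∫ u in (1 - w)..σ, f (u + y * Complex.I)‖ ≤
      2 * (B * x ^ (σ + 1) / T ^ 2) := by
    intro y hy
    refine (intervalIntegral.norm_integral_le_of_norm_le_const
      (C := B * x ^ (σ + 1) / T ^ 2) fun u hu => ?_).trans ?_
    · rw [uIoc_of_le (by linarith)] at hu
      have e1 := hB (u + y * Complex.I) (by simpa using hu.1.le) (by simpa using hu.2)
        (by simpa using hy.le)
      have e2 := hkh (u + y * Complex.I) (by simpa using hy)
      have e3 : ‖(x : ℂ) ^ ((u + y * Complex.I : ℂ) + 1)‖ ≤ x ^ (σ + 1) := by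
        rw [hnx]
        exact Real.rpow_le_rpow_of_exponent_le hx (by simpa using hu.2)
      simp only [hf]
      rw [norm_mul, norm_mul]
      calc _ ≤ B * (x ^ (σ + 1) * (1 / T ^ 2)) := by gcongr
        _ = _ := by ring
    · rw [abs_of_nonneg (by linarith), mul_comm]
      exact mul_le_mul_of_nonneg_right (by linarith) (by positivity)
  have hleft : ‖∫ y in (-T)..T, f (((1 - w : ℝ) : ℂ) + y * Complex.I)‖ ≤
      4 * (T * B * x ^ (2 - w)) := by
    refine (intervalIntegral.norm_integral_le_of_norm_le_const
      (C := B * (x ^ (2 - w) * 2)) fun y hy => ?_).trans ?_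
    · rw [uIoc_of_le (by linarith)] at hy
      have e1 := hB (((1 - w : ℝ) : ℂ) + y * Complex.I) (by simp) (by simp; linarith)
        (by simpa using abs_le.2 ⟨hy.1.le, hy.2⟩)
      have e2 := hkl (((1 - w : ℝ) : ℂ) + y * Complex.I) (by simp)
      have e3 : ‖(x : ℂ) ^ ((((1 - w : ℝ) : ℂ) + y * Complex.I : ℂ) + 1)‖ = x ^ (2 - w) := by
        rw [hnx]; congr 1; simp; ring
      simp only [hf]
      rw [norm_mul, norm_mul, e3]
      gcongr
    · rw [abs_of_nonneg (by linarith)]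
      apply le_of_eq; ring
  set J : ℂ := ∫ y in (-T)..T, f ((σ : ℂ) + y * Complex.I) with hJ
  have hJb : ‖J‖ ≤ 4 * (T * B * x ^ (2 - w)) + 4 * (B * x ^ (σ + 1) / T ^ 2) := by
    have h1 := hhor (-T) (by rw [abs_neg, abs_of_pos hT0])
    have h2 := hhor T (abs_of_pos hT0)
    simp only [smul_eq_mul] at hrect
    have h3 : Complex.I * J = Complex.I * (∫ y in (-T)..T, f (((1 - w : ℝ) : ℂ) + y * Complex.I))
        - (∫ u in (1 - w)..σ, f (u + (-T : ℝ) * Complex.I))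
        + ∫ u in (1 - w)..σ, f (u + (T : ℝ) * Complex.I) := by
      rw [hJ]; linear_combination hrect
    have h4 : ‖J‖ = ‖Complex.I * J‖ := by rw [norm_mul, Complex.norm_I, one_mul]
    rw [h4, h3]
    refine (norm_add_le _ _).trans ((add_le_add (norm_sub_le _ _) le_rfl).trans ?_)
    rw [norm_mul, Complex.norm_I, one_mul]
    linarith
  rw [perron_formula hσ.le hx0 ha]
  set g : ℝ → ℂ := fun t => LSeries a (σ + t * Complex.I) *
        ((x : ℂ) ^ ((σ : ℂ) + t * Complex.I + 1) * perronKernel σ t) with hg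
  have hgf : ∀ t : ℝ, g t = f ((σ : ℂ) + t * Complex.I) := fun t => by
    simp only [hg, hf, hF, perronKernel]
  have hgb : ∀ t, ‖g t‖ ≤ Z * x ^ (σ + 1) * (1 + t ^ 2)⁻¹ := by
    intro t
    rw [hg, norm_mul, norm_mul, hnx, mul_assoc]
    have e1 := hZ t
    have e2 := norm_perronKernel_le hσ.le t
    have e3 : x ^ (((σ : ℂ) + t * Complex.I).re + 1) = x ^ (σ + 1) := by simp
    rw [e3]
    gcongr
  have hpi : ‖(1 / (2 * Real.pi) : ℂ)‖ ≤ 1 := by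
    rw [norm_div, norm_mul, Complex.norm_real, Real.norm_of_nonneg Real.pi_pos.le, norm_one,
      Complex.norm_ofNat, div_le_one (by positivity)]
    linarith [Real.pi_gt_three]
  rw [norm_mul]
  refine (mul_le_of_le_one_left (norm_nonneg _) hpi).trans ?_
  by_cases hgi : Integrable g
  · rw [← integral_add_compl (measurableSet_Ioc (a := -T) (b := T)) hgi]
    have e1 : ∫ t in Ioc (-T) T, g t = J := by
      rw [← intervalIntegral.integral_of_le (by linarith), hJ]
      simp only [hgf]
    have e2 : ‖∫ t in (Ioc (-T) T)ᶜ, g t‖ ≤ 2 * (Z * x ^ (σ + 1) / T) := by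
      refine (norm_integral_le_of_norm_le ((integrable_inv_one_add_sq.const_mul _).integrableOn)
        (Eventually.of_forall hgb)).trans ?_
      rw [integral_const_mul]
      calc _ ≤ Z * x ^ (σ + 1) * (2 / T) :=
            mul_le_mul_of_nonneg_left (integral_compl_inv_one_add_sq_le hT0) (by positivity)
        _ = _ := by ring
    rw [e1]
    exact (norm_add_le _ _).trans (add_le_add hJb e2)
  · rw [integral_undef hgi, norm_zero]
    positivity

/-- Removing the Riesz weights. -/
lemma norm_sum_le_of_riesz {a : ℕ → ℂ} {x h S₁ S₂ : ℝ} (hx : 0 ≤ x) (hh : 0 < h)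
    (h1 : ‖∑ n ∈ Finset.Icc 1 ⌊x⌋₊, a n * ((x : ℂ) - n)‖ ≤ S₁)
    (h2 : ‖∑ n ∈ Finset.Icc 1 ⌊x + h⌋₊, a n * (((x + h : ℝ) : ℂ) - n)‖ ≤ S₂) :
    ‖∑ n ∈ Finset.Icc 1 ⌊x⌋₊, a n‖ ≤
      (S₁ + S₂) / h + ∑ n ∈ Finset.Ioc ⌊x⌋₊ ⌊x + h⌋₊, ‖a n‖ := by
  have hfl : ⌊x⌋₊ ≤ ⌊x + h⌋₊ := Nat.floor_le_floor (by linarith)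
  have hIcc : ∀ N, Finset.Icc 1 N = Finset.Ioc 0 N := fun N => rfl
  rw [hIcc] at h1 h2 ⊢
  have hsplit := Finset.sum_Ioc_consecutive (fun n => a n * (((x + h : ℝ) : ℂ) - n))
    (Nat.zero_le ⌊x⌋₊) hfl
  have hid : (h : ℂ) * ∑ n ∈ Finset.Ioc 0 ⌊x⌋₊, a n =
      ∑ n ∈ Finset.Ioc 0 ⌊x + h⌋₊, a n * (((x + h : ℝ) : ℂ) - n) -
      ∑ n ∈ Finset.Ioc 0 ⌊x⌋₊, a n * ((x : ℂ) - n) -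
      ∑ n ∈ Finset.Ioc ⌊x⌋₊ ⌊x + h⌋₊, a n * (((x + h : ℝ) : ℂ) - n) := by
    rw [← hsplit, Finset.mul_sum]
    have : ∑ n ∈ Finset.Ioc 0 ⌊x⌋₊, (h : ℂ) * a n =
        ∑ n ∈ Finset.Ioc 0 ⌊x⌋₊, a n * (((x + h : ℝ) : ℂ) - n) -
          ∑ n ∈ Finset.Ioc 0 ⌊x⌋₊, a n * ((x : ℂ) - n) := by
      rw [← Finset.sum_sub_distrib]
      refine Finset.sum_congr rfl fun n _ => ?_
      push_cast; ring
    rw [this]; ring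
  have h3 : ‖∑ n ∈ Finset.Ioc ⌊x⌋₊ ⌊x + h⌋₊, a n * (((x + h : ℝ) : ℂ) - n)‖ ≤
      h * ∑ n ∈ Finset.Ioc ⌊x⌋₊ ⌊x + h⌋₊, ‖a n‖ := by
    refine (norm_sum_le _ _).trans ?_
    rw [Finset.mul_sum]
    refine Finset.sum_le_sum fun n hn => ?_
    rw [Finset.mem_Ioc] at hn
    have e1 : x < n := (Nat.floor_lt hx).1 hn.1
    have e2 : (n : ℝ) ≤ x + h := (Nat.le_floor_iff (by linarith)).1 hn.2
    rw [norm_mul, mul_comm]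
    refine mul_le_mul_of_nonneg_right ?_ (norm_nonneg _)
    rw [← Complex.ofReal_natCast, ← Complex.ofReal_sub, Complex.norm_real,
      Real.norm_of_nonneg (by linarith)]
    linarith
  have h4 : h * ‖∑ n ∈ Finset.Ioc 0 ⌊x⌋₊, a n‖ ≤
      S₁ + S₂ + h * ∑ n ∈ Finset.Ioc ⌊x⌋₊ ⌊x + h⌋₊, ‖a n‖ := by
    have : h * ‖∑ n ∈ Finset.Ioc 0 ⌊x⌋₊, a n‖ = ‖(h : ℂ) * ∑ n ∈ Finset.Ioc 0 ⌊x⌋₊, a n‖ := by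
      rw [norm_mul, Complex.norm_real, Real.norm_of_nonneg hh.le]
    rw [this, hid]
    refine (norm_sub_le _ _).trans ((add_le_add (norm_sub_le _ _) h3).trans ?_)
    linarith
  rw [← sub_nonneg]
  have h5 : (S₁ + S₂) / h + ∑ n ∈ Finset.Ioc ⌊x⌋₊ ⌊x + h⌋₊, ‖a n‖ -
      ‖∑ n ∈ Finset.Ioc 0 ⌊x⌋₊, a n‖ = (S₁ + S₂ + h * ∑ n ∈ Finset.Ioc ⌊x⌋₊ ⌊x + h⌋₊, ‖a n‖ -
      h * ‖∑ n ∈ Finset.Ioc 0 ⌊x⌋₊, a n‖) / h := by field_simp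
  rw [h5]
  exact div_nonneg (by linarith) hh.le

end Contour

section Unsmoothing

variable {r Λ : ℕ → ℝ} {A δ κ : ℝ}

lemma sq_mul_exp_neg_le {β u : ℝ} (hβ : 0 < β) (hu : 0 ≤ u) :
    u ^ 2 * Real.exp (-β * u) ≤ 16 / β ^ 2 * Real.exp (-(β / 2) * u) := by
  have h1 : β * u / 4 ≤ Real.exp (β * u / 4) := by linarith [Real.add_one_le_exp (β * u / 4)]
  have h2 : (β * u / 4) ^ 2 ≤ Real.exp (β * u / 2) := by
    calc (β * u / 4) ^ 2 ≤ Real.exp (β * u / 4) ^ 2 := by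
          have := mul_nonneg hβ.le hu
          gcongr
      _ = _ := by rw [← Real.exp_nat_mul]; congr 1; push_cast; ring
  have h3 : u ^ 2 ≤ 16 / β ^ 2 * Real.exp (β * u / 2) := by
    have : u ^ 2 = 16 / β ^ 2 * (β * u / 4) ^ 2 := by field_simp; norm_num
    rw [this]
    gcongr
  calc _ ≤ 16 / β ^ 2 * Real.exp (β * u / 2) * Real.exp (-β * u) := by gcongr
    _ = _ := by rw [mul_assoc, ← Real.exp_add]; congr 2; ring

/-- The short sums of coefficients dominated by `Λ + r`. -/
lemma NormSystem.sum_Ioc_le (hs : NormSystem r Λ A δ κ) {a : ℕ → ℂ} {D x h : ℝ} (hD : 0 ≤ D)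
    (hx : 1 ≤ Real.log x) (hx0 : 0 < x) (hh : 0 ≤ h) (hhx : h ≤ x)
    (ha : ∀ n, ‖a n‖ ≤ D * (Λ n + r n)) :
    ∑ n ∈ Finset.Ioc ⌊x⌋₊ ⌊x + h⌋₊, ‖a n‖ ≤
      3 * D * Real.log x * (κ * h + 3 * A * x ^ (1 - δ)) := by
  have hδ := hs.δ_pos
  have hδ1 := hs.δ_le
  have hA := hs.one_le
  have hx1 : 1 ≤ x := by
    by_contra hc
    have := Real.log_nonpos hx0.le (by linarith)
    linarith
  have hterm : ∀ n ∈ Finset.Ioc ⌊x⌋₊ ⌊x + h⌋₊, ‖a n‖ ≤ 3 * D * Real.log x * r n := by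
    intro n hn
    rw [Finset.mem_Ioc] at hn
    have hn0 : n ≠ 0 := by omega
    have hn1 : (n : ℝ) ≤ 2 * x := by
      have := (Nat.le_floor_iff (by linarith)).1 hn.2
      linarith
    have hlog : Real.log n ≤ Real.log x + 1 := by
      calc Real.log n ≤ Real.log (2 * x) :=
            Real.log_le_log (by exact_mod_cast Nat.pos_of_ne_zero hn0) hn1
        _ = Real.log 2 + Real.log x := Real.log_mul two_ne_zero hx0.ne'
        _ ≤ _ := by linarith [Real.log_two_lt_d9]
    have h1 : Λ n + r n ≤ 3 * Real.log x * r n := by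
      have := hs.lam_le hn0
      nlinarith [hs.r_nonneg n, mul_le_mul_of_nonneg_left hlog (hs.r_nonneg n)]
    calc ‖a n‖ ≤ D * (Λ n + r n) := ha n
      _ ≤ D * (3 * Real.log x * r n) := mul_le_mul_of_nonneg_left h1 hD
      _ = _ := by ring
  refine (Finset.sum_le_sum hterm).trans ?_
  rw [← Finset.mul_sum]
  refine mul_le_mul_of_nonneg_left ?_ (by positivity)
  have hle : ⌊x⌋₊ ≤ ⌊x + h⌋₊ := Nat.floor_le_floor (by linarith)
  have hsplit : ∑ n ∈ Finset.Icc 1 ⌊x + h⌋₊, r n =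
      ∑ n ∈ Finset.Icc 1 ⌊x⌋₊, r n + ∑ n ∈ Finset.Ioc ⌊x⌋₊ ⌊x + h⌋₊, r n := by
    have e : ∀ N, Finset.Icc 1 N = Finset.Ioc 0 N := fun N => by ext; simp; omega
    rw [e, e]
    exact (Finset.sum_Ioc_consecutive r (Nat.zero_le _) hle).symm
  have hcount : ∀ y, 1 ≤ y → |∑ n ∈ Finset.Icc 1 ⌊y⌋₊, r n - κ * y| ≤ A * y ^ (1 - δ) := by
    intro y hy
    have h1 := hs.count y hy
    have h3 : summatory (fun n => (r n : ℂ)) y - κ * y =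
        ((∑ n ∈ Finset.Icc 1 ⌊y⌋₊, r n - κ * y : ℝ) : ℂ) := by simp [summatory]
    rwa [h3, Complex.norm_real, Real.norm_eq_abs] at h1
  have h1 := abs_le.1 (hcount x hx1)
  have h2 := abs_le.1 (hcount (x + h) (by linarith))
  have h3 : (x + h) ^ (1 - δ) ≤ 2 * x ^ (1 - δ) := by
    calc (x + h) ^ (1 - δ) ≤ (2 * x) ^ (1 - δ) :=
          Real.rpow_le_rpow (by linarith) (by linarith) (by linarith)
      _ = 2 ^ (1 - δ) * x ^ (1 - δ) := Real.mul_rpow (by norm_num) hx0.le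
      _ ≤ 2 ^ (1 : ℝ) * x ^ (1 - δ) := by
          gcongr
          · norm_num
          · linarith
      _ = _ := by norm_num
  have h4 := mul_le_mul_of_nonneg_left h3 (by linarith : 0 ≤ A)
  linarith [h1.1, h2.2]

/-- The smoothed sums of coefficients whose `L`-function continues to a zero-free region. -/
lemma NormSystem.exists_norm_riesz_le (hs : NormSystem r Λ A δ κ) {c C D : ℝ} (hc : 0 < c)
    (hc1 : c ≤ 1 / 2) (hC : 0 ≤ C) (hD : 0 ≤ D) :
    ∃ E : ℝ, 0 ≤ E ∧ ∀ (x u : ℝ), 0 < x → 1 ≤ u → Real.log x = u ^ 2 → ∀ (a : ℕ → ℂ) (F : ℂ → ℂ),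
      (∀ n, ‖a n‖ ≤ D * (Λ n + r n)) →
      (∀ s : ℂ, 1 < s.re → F s = LSeries a s) →
      (∀ T, 3 ≤ T → Real.log T ≤ 3 * u → ∀ s : ℂ, 1 - c / u ≤ s.re → s.re ≤ 2 → |s.im| ≤ T →
        DifferentiableAt ℂ F s ∧ ‖F s‖ ≤ C * T * u ^ 2) →
      ∀ y, x ≤ y → y ≤ 2 * x →
      ‖∑ n ∈ Finset.Icc 1 ⌊y⌋₊, a n * ((y : ℂ) - n)‖ ≤
        E * (x ^ 2 * Real.exp (-(c / 6) * u)) := by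
  obtain ⟨C₀, hC₀, hlam⟩ := hs.exists_lam_le
  have hA := hs.one_le
  have hκ := hs.κ_pos
  set Z₀ := D * (1 + C₀ + 2 * (κ + A)) with hZ₀
  have hZ₀0 : 0 ≤ Z₀ := by positivity
  set E₀ := 16 * C * Real.exp 4 + 32 * C * Real.exp 1 + 16 * Z₀ * Real.exp 1 with hE₀
  have hE₀0 : 0 ≤ E₀ := by positivity
  refine ⟨E₀ * (16 / (c / 3) ^ 2), by positivity, ?_⟩
  intro x u hx0 hu hlog a F ha hF hreg y hxy hy
  have hu0 : 0 < u := by linarith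
  have hu2 : 1 ≤ u ^ 2 := one_le_pow₀ hu
  have hx1 : 1 ≤ x := by
    by_contra hc
    have := Real.log_nonpos hx0.le (by linarith)
    linarith
  have hxe : x = Real.exp (u ^ 2) := by rw [← hlog, Real.exp_log hx0]
  set α := c / 3 with hα
  set T := Real.exp (α * u + 2) with hT
  have hT3 : 3 ≤ T := by
    have : 3 ≤ Real.exp 2 := by linarith [Real.add_one_le_exp (2 : ℝ)]
    exact this.trans (Real.exp_le_exp.2 (by have : 0 ≤ α * u := by positivity
                                            linarith))
  have hTlog : Real.log T ≤ 3 * u := by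
    rw [hT, Real.log_exp]
    have : α * u ≤ 1 * u := by gcongr; linarith
    linarith
  set σ := 1 + 1 / u ^ 2 with hσ
  have hσ1 : 1 < σ := by rw [hσ]; linarith [show 0 < 1 / u ^ 2 by positivity]
  have hσ2 : σ ≤ 2 := by
    have : 1 / u ^ 2 ≤ 1 := by rw [div_le_one (by positivity)]; exact hu2
    linarith
  have hw : c / u ≤ 1 / 2 := by
    calc c / u ≤ c / 1 := by gcongr
      _ ≤ _ := by simpa using hc1
  have hLr : ∀ s : ℂ, 1 < s.re → LSeriesSummable (fun n => (D : ℂ) * ((Λ n : ℂ) + r n)) s := by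
    intro s h
    have := ((hs.summable_lam h).add (hs.summable_r h)).smul (D : ℂ)
    exact this
  have hsuma : ∀ s : ℂ, 1 < s.re → LSeriesSummable a s := by
    intro s h
    refine Summable.of_norm_bounded (hLr s h).norm fun n => LSeries.norm_term_le s ?_
    refine (ha n).trans (le_of_eq ?_)
    rw [← Complex.ofReal_add, ← Complex.ofReal_mul, Complex.norm_real, Real.norm_of_nonneg]
    exact mul_nonneg hD (add_nonneg (hs.lam_nonneg n) (hs.r_nonneg n))
  have hZ : ∀ t : ℝ, ‖LSeries a (σ + t * Complex.I)‖ ≤ Z₀ * u ^ 2 := by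
    intro t
    have hre : ((σ : ℂ) + t * Complex.I).re = σ := by simp
    have h1 := norm_LSeries_le (a := a) (b := fun n => D * (Λ n + r n))
      (s := σ + t * Complex.I) (fun n _ => ha n) (by
        simpa using hLr (σ + t * Complex.I) (by rw [hre]; exact hσ1))
    refine h1.trans ?_
    rw [hre]
    have h2 : LSeries (fun n => ((D * (Λ n + r n) : ℝ) : ℂ)) σ =
        D * (LSeries (fun n => (Λ n : ℂ)) σ + LSeries (fun n => (r n : ℂ)) σ) := by
      have hσ' : 1 < (σ : ℂ).re := by simpa using hσ1
      rw [← LSeries_add (hs.summable_lam hσ') (hs.summable_r hσ'), ← LSeries_smul]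
      congr 1
      ext n
      simp
    rw [h2, Complex.re_ofReal_mul, Complex.add_re]
    have h3 := hlam σ hσ1 hσ2
    have h4 := hs.zeta_le hσ1
    have h5 : σ - 1 = 1 / u ^ 2 := by rw [hσ]; ring
    rw [h5] at h3 h4
    have h6 : 1 / (1 / u ^ 2) = u ^ 2 := by field_simp
    have h7 : (κ + A) * σ / (1 / u ^ 2) = (κ + A) * σ * u ^ 2 := by field_simp
    rw [h6] at h3
    rw [h7] at h4
    rw [hZ₀, mul_assoc]
    refine mul_le_mul_of_nonneg_left ?_ hD
    have h8 : (κ + A) * σ * u ^ 2 ≤ (κ + A) * 2 * u ^ 2 := by gcongr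
    nlinarith
  have key := norm_riesz_le (a := a) (F := F) (x := y) (w := c / u) (T := T)
    (B := C * T * u ^ 2) (Z := Z₀ * u ^ 2) hσ1 hσ2 (hx1.trans hxy) (by positivity) hw
    (by linarith) (hsuma σ (by simpa using hσ1))
    (fun s h1 h2 h3 => (hreg T hT3 hTlog s h1 (h2.trans hσ2) h3).1)
    (fun s h1 h2 h3 => (hreg T hT3 hTlog s h1 (h2.trans hσ2) h3).2)
    (fun t => hF _ (by simpa using hσ1)) hZ
  refine key.trans ?_
  have hy0 : 0 < y := hx0.trans_le hxy
  have hTpos : 0 < T := by linarith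
  have p1 : y ^ (2 - c / u) ≤ 4 * x ^ 2 * Real.exp (-c * u) := by
    calc y ^ (2 - c / u) ≤ (2 * x) ^ (2 - c / u) :=
          Real.rpow_le_rpow hy0.le hy (by linarith)
      _ = 2 ^ (2 - c / u) * x ^ (2 - c / u) := Real.mul_rpow (by norm_num) hx0.le
      _ ≤ 2 ^ (2 : ℝ) * x ^ (2 - c / u) := by
          gcongr
          · norm_num
          · linarith [show 0 < c / u by positivity]
      _ = 4 * (x ^ 2 * Real.exp (-c * u)) := by
          congr 1
          · norm_num
          · rw [hxe, ← Real.exp_mul, ← Real.exp_nat_mul, ← Real.exp_add]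
            congr 1
            field_simp
            push_cast
            ring
      _ = _ := by ring
  have p2 : y ^ (σ + 1) ≤ 8 * x ^ 2 * Real.exp 1 := by
    calc y ^ (σ + 1) ≤ (2 * x) ^ (σ + 1) := Real.rpow_le_rpow hy0.le hy (by linarith)
      _ = 2 ^ (σ + 1) * x ^ (σ + 1) := Real.mul_rpow (by norm_num) hx0.le
      _ ≤ 2 ^ (3 : ℝ) * x ^ (σ + 1) := by
          gcongr
          · norm_num
          · linarith
      _ = 8 * (x ^ 2 * Real.exp 1) := by
          congr 1
          · norm_num
          · rw [hxe, ← Real.exp_mul, ← Real.exp_nat_mul, ← Real.exp_add]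
            congr 1
            rw [hσ]
            field_simp
            push_cast
            ring
      _ = _ := by ring
  have hTinv : 1 / T ≤ Real.exp (-α * u) := by
    rw [hT, one_div, ← Real.exp_neg]
    exact Real.exp_le_exp.2 (by linarith)
  have q1 : 4 * (T * (C * T * u ^ 2) * y ^ (2 - c / u)) ≤
      16 * C * Real.exp 4 * (u ^ 2 * Real.exp (-α * u)) * x ^ 2 := by
    have e1 : T * T * Real.exp (-c * u) = Real.exp 4 * Real.exp (-α * u) := by
      rw [hT, ← Real.exp_add, ← Real.exp_add, ← Real.exp_add]
      congr 1
      rw [hα]; ring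
    calc _ ≤ 4 * (T * (C * T * u ^ 2) * (4 * x ^ 2 * Real.exp (-c * u))) := by gcongr
      _ = 16 * C * u ^ 2 * x ^ 2 * (T * T * Real.exp (-c * u)) := by ring
      _ = _ := by rw [e1]; ring
  have q2 : 4 * ((C * T * u ^ 2) * y ^ (σ + 1) / T ^ 2) ≤
      32 * C * Real.exp 1 * (u ^ 2 * Real.exp (-α * u)) * x ^ 2 := by
    calc _ ≤ 4 * ((C * T * u ^ 2) * (8 * x ^ 2 * Real.exp 1) / T ^ 2) := by gcongr
      _ = 32 * C * Real.exp 1 * (u ^ 2 * (1 / T)) * x ^ 2 := by field_simp; ring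
      _ ≤ _ := by gcongr
  have q3 : 2 * (Z₀ * u ^ 2 * y ^ (σ + 1) / T) ≤
      16 * Z₀ * Real.exp 1 * (u ^ 2 * Real.exp (-α * u)) * x ^ 2 := by
    calc _ ≤ 2 * (Z₀ * u ^ 2 * (8 * x ^ 2 * Real.exp 1) / T) := by gcongr
      _ = 16 * Z₀ * Real.exp 1 * (u ^ 2 * (1 / T)) * x ^ 2 := by field_simp; ring
      _ ≤ _ := by gcongr
  have h9 := sq_mul_exp_neg_le (β := α) (u := u) (by positivity) hu0.le
  calc _ ≤ E₀ * (u ^ 2 * Real.exp (-α * u)) * x ^ 2 := by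
        refine (add_le_add (add_le_add q1 q2) q3).trans (le_of_eq ?_)
        rw [hE₀]; ring
    _ ≤ E₀ * (16 / α ^ 2 * Real.exp (-(α / 2) * u)) * x ^ 2 := by gcongr
    _ = _ := by
      rw [show α / 2 = c / 6 by rw [hα]; ring]; ring

/-- Sums of coefficients whose `L`-function continues to a zero-free region. -/
theorem NormSystem.exists_norm_sum_le (hs : NormSystem r Λ A δ κ) {c C D : ℝ} (hc : 0 < c)
    (hc1 : c ≤ δ / 2) (hC : 0 ≤ C) (hD : 0 ≤ D) :
    ∃ E : ℝ, 0 ≤ E ∧ ∀ (x u : ℝ), 0 < x → 1 ≤ u → Real.log x = u ^ 2 → ∀ (a : ℕ → ℂ) (F : ℂ → ℂ),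
      (∀ n, ‖a n‖ ≤ D * (Λ n + r n)) →
      (∀ s : ℂ, 1 < s.re → F s = LSeries a s) →
      (∀ T, 3 ≤ T → Real.log T ≤ 3 * u → ∀ s : ℂ, 1 - c / u ≤ s.re → s.re ≤ 2 → |s.im| ≤ T →
        DifferentiableAt ℂ F s ∧ ‖F s‖ ≤ C * T * u ^ 2) →
      ‖∑ n ∈ Finset.Icc 1 ⌊x⌋₊, a n‖ ≤ E * (x * Real.exp (-(c / 24) * u)) := by
  have hδ := hs.δ_pos
  have hδ1 := hs.δ_le
  have hA := hs.one_le
  have hκ := hs.κ_pos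
  obtain ⟨E₁, hE₁, hriesz⟩ := hs.exists_norm_riesz_le hc (by linarith) hC hD
  refine ⟨2 * E₁ + 3 * D * (κ + 3 * A) * (16 / (c / 12) ^ 2), by positivity, ?_⟩
  intro x u hx0 hu hlog a F ha hF hreg
  have hu0 : 0 < u := by linarith
  have hu2 : 1 ≤ u ^ 2 := one_le_pow₀ hu
  set β := c / 12 with hβ
  have hβ0 : 0 < β := by positivity
  set h := x * Real.exp (-β * u) with hh
  have hh0 : 0 < h := by positivity
  have hhx : h ≤ x := by
    rw [hh]
    refine mul_le_of_le_one_right hx0.le (Real.exp_le_one_iff.2 ?_)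
    have : 0 ≤ β * u := by positivity
    linarith
  have hr := hriesz x u hx0 hu hlog a F ha hF hreg
  have h1 := hr x le_rfl (by linarith)
  have h2 := hr (x + h) (by linarith) (by linarith)
  refine (norm_sum_le_of_riesz hx0.le hh0 h1 h2).trans ?_
  have h3 := hs.sum_Ioc_le hD (by rw [hlog]; exact hu2) hx0 hh0.le hhx ha
  have h4 : x ^ (1 - δ) ≤ h := by
    have hxe : x = Real.exp (u ^ 2) := by rw [← hlog, Real.exp_log hx0]
    rw [hh, hxe, ← Real.exp_mul, ← Real.exp_add]
    refine Real.exp_le_exp.2 ?_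
    have : β * u ≤ δ * u ^ 2 := by
      have h5 : β * u ≤ δ * u := by gcongr; linarith
      nlinarith
    nlinarith
  have h5 : (E₁ * (x ^ 2 * Real.exp (-(c / 6) * u)) + E₁ * (x ^ 2 * Real.exp (-(c / 6) * u))) / h
      = 2 * E₁ * h := by
    have : x ^ 2 * Real.exp (-(c / 6) * u) = h * h := by
      rw [hh, show -(c / 6) * u = -β * u + -β * u by rw [hβ]; ring, Real.exp_add]; ring
    rw [this]; field_simp; ring
  have h6 := sq_mul_exp_neg_le hβ0 hu0.le
  have h7 : h ≤ x * Real.exp (-(β / 2) * u) := by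
    rw [hh]
    gcongr
    linarith
  have h8 : 3 * D * Real.log x * (κ * h + 3 * A * x ^ (1 - δ)) ≤
      3 * D * (κ + 3 * A) * (16 / β ^ 2) * (x * Real.exp (-(β / 2) * u)) := by
    calc _ ≤ 3 * D * u ^ 2 * (κ * h + 3 * A * h) := by rw [hlog]; gcongr
      _ = 3 * D * (κ + 3 * A) * x * (u ^ 2 * Real.exp (-β * u)) := by rw [hh]; ring
      _ ≤ 3 * D * (κ + 3 * A) * x * (16 / β ^ 2 * Real.exp (-(β / 2) * u)) := by gcongr
      _ = _ := by ring
  rw [h5, show c / 24 = β / 2 by rw [hβ]; ring]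
  have h9 : 2 * E₁ * h ≤ 2 * E₁ * (x * Real.exp (-(β / 2) * u)) := by gcongr
  linarith [h3.trans h8]

end Unsmoothing

section SiegelWalfisz

variable {r Λ : ℕ → ℝ} {A δ κ : ℝ}

lemma LData.differentiableAt_logDeriv {Q : ℝ} {F P : ℂ → ℂ} {D : ℕ → ℂ} (h : LData δ Q F P D)
    {s : ℂ} (hs : 1 - δ < s.re) (h0 : F s ≠ 0) : DifferentiableAt ℂ (logDeriv F) s := by
  have han : AnalyticAt ℂ F s := by
    refine DifferentiableOn.analyticAt (s := {z : ℂ | 1 - δ < z.re})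
      (fun z hz => (h.diff z hz).differentiableWithinAt) ?_
    exact (isOpen_lt continuous_const Complex.continuous_re).mem_nhds hs
  exact (han.deriv.div han h0).differentiableAt

/-- The Siegel–Walfisz bound for the characters without a main term. -/
theorem CharSystem.exists_good_bound (hs : CharSystem r Λ A δ κ) {m : ℝ} (hm : 1 ≤ m) :
    ∃ C E : ℝ, 0 < C ∧ 0 ≤ E ∧ ∀ (x u : ℝ), 0 < x → 1 ≤ u → Real.log x = u ^ 2 →
      ∀ (q : ℕ) [NeZero q] (χ : DirichletCharacter ℂ q), (q : ℝ) ≤ (u ^ 2) ^ m →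
      GoodChar r A δ χ →
      ‖∑ n ∈ Finset.Icc 1 ⌊x⌋₊, twistBy Λ χ n‖ ≤ E * (x * Real.exp (-C * u)) := by
  have hN := hs.toNormSystem
  have hδ := hN.δ_pos
  have hδ1 := hN.δ_le
  set ε := 1 / (2 * m) with hε
  have hε0 : 0 < ε := by positivity
  have hε1 : ε ≤ 1 := by rw [hε, div_le_one (by positivity)]; linarith
  obtain ⟨c, C, hc, hcδ, hC, hreg⟩ := hs.exists_region hε0 hε1
  obtain ⟨E, hE, hsum⟩ := hN.exists_norm_sum_le (c := c / 4) (C := C * 16) (D := 1)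
    (by positivity) (by linarith) (by positivity) zero_le_one
  refine ⟨c / 4 / 24, E, by positivity, hE, ?_⟩
  intro x u hx hu hlog q _ χ hq hχ
  have hu0 : 0 < u := by linarith
  have hqε : (q : ℝ) ^ ε ≤ u := by
    calc (q : ℝ) ^ ε ≤ ((u ^ 2) ^ m) ^ ε := Real.rpow_le_rpow (by positivity) hq hε0.le
      _ = u := by
        rw [← Real.rpow_natCast, ← Real.rpow_mul hu0.le, ← Real.rpow_mul hu0.le]
        have : ((2 : ℕ) : ℝ) * m * ε = 1 := by rw [hε]; push_cast; field_simp
        rw [this, Real.rpow_one]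
  have hL := hN.lData_gfun hχ.bound
  refine hsum x u hx hu hlog _ (fun s => -logDeriv (gfun (twistBy r χ)) s) ?_ ?_ ?_
  · intro n
    rw [one_mul]
    exact ((hN.twistPair χ).le n).trans (by linarith [hN.r_nonneg n])
  · intro s h
    simp [hL.logDeriv_eq s h]
  · intro T hT hTu s h1 h2 h3
    have hlT : 0 < Real.log T := Real.log_pos (by linarith)
    have hL0 : 0 < (q : ℝ) ^ ε + Real.log T := by positivity
    have hL4 : (q : ℝ) ^ ε + Real.log T ≤ 4 * u := by linarith
    have hle : c / 4 / u ≤ c / ((q : ℝ) ^ ε + Real.log T) := by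
      rw [div_div]
      gcongr
    obtain ⟨h4, h5⟩ := hreg q χ hχ T hT s (by linarith) h2 h3
    have h6 : c / 4 / u ≤ δ / 32 := by
      calc c / 4 / u ≤ c / 4 / 1 := by gcongr
        _ ≤ _ := by linarith
    refine ⟨(hL.differentiableAt_logDeriv (by linarith) h4).neg, ?_⟩
    rw [norm_neg]
    calc _ ≤ C * (4 * u) ^ 2 := h5.trans (by gcongr)
      _ = C * 16 * 1 * u ^ 2 := by ring
      _ ≤ C * 16 * T * u ^ 2 := by gcongr; linarith

/-- The prime number theorem for `Λ`. -/
theorem NormSystem.exists_pnt (hN : NormSystem r Λ A δ κ) :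
    ∃ C E : ℝ, 0 < C ∧ C ≤ 1 / 2 ∧ 0 ≤ E ∧ ∀ (x u : ℝ), 0 < x → 1 ≤ u → Real.log x = u ^ 2 →
      ‖∑ n ∈ Finset.Icc 1 ⌊x⌋₊, (Λ n : ℂ) - x‖ ≤ E * (x * Real.exp (-C * u)) := by
  have hδ := hN.δ_pos
  have hδ1 := hN.δ_le
  have hκ := hN.κ_pos
  have hA := hN.one_le
  obtain ⟨c, C, hc, hcδ, hC, hreg⟩ := hN.exists_region
  obtain ⟨E, hE, hsum⟩ := hN.exists_norm_sum_le (c := c / 4)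
    (C := C * 16 + 1 + 4 * A / (κ * δ)) (D := 1 + 1 / κ)
    (by positivity) (by linarith) (by positivity) (by positivity)
  refine ⟨c / 4 / 24, E + A / κ, by positivity, by linarith, by positivity, ?_⟩
  intro x u hx hu hlog
  have hu0 : 0 < u := by linarith
  have hu2 : 1 ≤ u ^ 2 := one_le_pow₀ hu
  have hx1 : 1 ≤ x := by
    by_contra hc
    have := Real.log_nonpos hx.le (by linarith)
    linarith
  have hL := hN.twistPair_self.lData_lfun hN (q := 1) le_rfl (c := κ)
    (by rw [Complex.norm_real, Real.norm_of_nonneg hκ.le]; linarith) (by simpa using hN.count)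
  have hκc : (κ : ℂ) ≠ 0 := by exact_mod_cast hκ.ne'
  have main := hsum x u hx hu hlog (fun n => (Λ n : ℂ) - (r n : ℂ) / κ)
    (fun s => -logDeriv (lfun (fun n => (r n : ℂ)) κ) s - 1 -
      s / κ * restInt (fun n => (r n : ℂ)) κ s) ?_ ?_ ?_
  · have h1 := hN.count x hx1
    have h2 : ∑ n ∈ Finset.Icc 1 ⌊x⌋₊, (Λ n : ℂ) - x =
        ∑ n ∈ Finset.Icc 1 ⌊x⌋₊, ((Λ n : ℂ) - (r n : ℂ) / κ) +
          (summatory (fun n => (r n : ℂ)) x - κ * x) / κ := by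
      rw [summatory, Finset.sum_sub_distrib, ← Finset.sum_div]
      field_simp
      ring
    have h3 : ‖(summatory (fun n => (r n : ℂ)) x - κ * x) / κ‖ ≤
        A / κ * (x * Real.exp (-(c / 4 / 24) * u)) := by
      rw [norm_div, Complex.norm_real, Real.norm_of_nonneg hκ.le]
      have h4 : x ^ (1 - δ) ≤ x * Real.exp (-(c / 4 / 24) * u) := by
        have hxe : x = Real.exp (u ^ 2) := by rw [← hlog, Real.exp_log hx]
        rw [hxe, ← Real.exp_mul, ← Real.exp_add]
        refine Real.exp_le_exp.2 ?_
        have : c / 4 / 24 * u ≤ δ * u ^ 2 := by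
          have h5 : c / 4 / 24 * u ≤ δ * u := by gcongr; linarith
          nlinarith
        nlinarith
      calc _ ≤ A * x ^ (1 - δ) / κ := by gcongr
        _ = A / κ * x ^ (1 - δ) := by ring
        _ ≤ _ := by gcongr
    rw [h2]
    refine (norm_add_le _ _).trans ?_
    linarith
  · intro n
    refine (norm_sub_le _ _).trans ?_
    rw [norm_div, Complex.norm_real, Complex.norm_real, Complex.norm_real,
      Real.norm_of_nonneg (hN.lam_nonneg n), Real.norm_of_nonneg (hN.r_nonneg n),
      Real.norm_of_nonneg hκ.le]
    have h1 : 0 ≤ 1 / κ * Λ n := mul_nonneg (by positivity) (hN.lam_nonneg n)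
    have h2 := hN.r_nonneg n
    have h3 : r n / κ = 1 / κ * r n := by ring
    rw [h3]
    nlinarith
  · intro s h
    have hs1 : s - 1 ≠ 0 := by
      intro h0
      have := congrArg Complex.re h0
      simp at this
      linarith
    have e : (fun n => (Λ n : ℂ) - (r n : ℂ) / κ) =
        (fun n => (Λ n : ℂ)) - (1 / κ : ℂ) • (fun n => (r n : ℂ)) := by
      ext n; simp; ring
    rw [e, LSeries_sub (hN.summable_lam h) ((hN.summable_r h).smul _), LSeries_smul,
      LSeries_eq_restInt hN.count hδ h (hN.summable_r h), hL.logDeriv_eq s h]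
    field_simp
    ring
  · intro T hT hTu s h1 h2 h3
    have hlT : 0 < Real.log T := Real.log_pos (by linarith)
    have hL4 : 1 + Real.log T ≤ 4 * u := by linarith
    have hle : c / 4 / u ≤ c / (1 + Real.log T) := by
      rw [div_div]
      gcongr
    obtain ⟨h4, h5⟩ := hreg T hT s (by linarith) h2 h3
    have h6 : c / 4 / u ≤ δ / 32 := by
      calc c / 4 / u ≤ c / 4 / 1 := by gcongr
        _ ≤ _ := by linarith
    have hre : 1 - δ < s.re := by linarith
    constructor
    · have := hL.differentiableAt_logDeriv hre h4
      have := differentiableAt_restInt hN.count hδ1 hre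
      fun_prop
    · have h7 : ‖logDeriv (lfun (fun n => (r n : ℂ)) κ) s‖ ≤ C * 16 * T * u ^ 2 := by
        calc _ ≤ C * (4 * u) ^ 2 := h5.trans (by gcongr)
          _ = C * 16 * 1 * u ^ 2 := by ring
          _ ≤ C * 16 * T * u ^ 2 := by gcongr; linarith
      have h8 : ‖restInt (fun n => (r n : ℂ)) κ s‖ ≤ A / (δ / 2) := by
        refine (norm_restInt_le hN.count hre).trans ?_
        gcongr
        linarith
      have h9 : ‖s‖ ≤ 2 * T := by
        refine (norm_le_of_re_mem (by linarith) (by linarith)).trans ?_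
        linarith
      have h10 : ‖s / κ * restInt (fun n => (r n : ℂ)) κ s‖ ≤ 4 * A / (κ * δ) * T * u ^ 2 := by
        rw [norm_mul, norm_div, Complex.norm_real, Real.norm_of_nonneg hκ.le]
        calc _ ≤ 2 * T / κ * (A / (δ / 2)) := by gcongr
          _ = 4 * A / (κ * δ) * T * 1 := by field_simp; ring
          _ ≤ _ := by gcongr
      have h11 : (1 : ℝ) ≤ 1 * T * u ^ 2 := by nlinarith
      refine (norm_sub_le _ _).trans ?_
      refine (add_le_add_left (norm_sub_le _ _) _).trans ?_
      rw [norm_neg, norm_one]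
      linarith

/-- The Siegel–Walfisz bound for the characters with a main term. -/
theorem NormSystem.exists_triv_bound (hN : NormSystem r Λ A δ κ) {m : ℝ} (hm : 1 ≤ m) :
    ∃ C E : ℝ, 0 < C ∧ 0 ≤ E ∧ ∀ (x u : ℝ), 0 < x → 1 ≤ u → Real.log x = u ^ 2 →
      ∀ (q : ℕ) [NeZero q] (χ : DirichletCharacter ℂ q), (q : ℝ) ≤ (u ^ 2) ^ m →
      TrivChar Λ χ →
      ‖∑ n ∈ Finset.Icc 1 ⌊x⌋₊, twistBy Λ χ n - x‖ ≤ E * (x * Real.exp (-C * u)) := by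
  have hA := hN.one_le
  obtain ⟨C, E, hC, hC2, hE, hpnt⟩ := hN.exists_pnt
  refine ⟨C, E + 2 * A * m * 65536, hC, by positivity, ?_⟩
  intro x u hx hu hlog q _ χ hq hχ
  have hu0 : 0 < u := by linarith
  have hu2 : 1 ≤ u ^ 2 := one_le_pow₀ hu
  have hx1 : 1 ≤ x := by
    by_contra hc
    have := Real.log_nonpos hx.le (by linarith)
    linarith
  have h1 : ∑ n ∈ Finset.Icc 1 ⌊x⌋₊, twistBy Λ χ n = ∑ n ∈ Finset.Icc 1 ⌊x⌋₊, (Λ n : ℂ) -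
      ((∑ n ∈ Finset.Icc 1 ⌊x⌋₊ with ¬ n.Coprime q, Λ n : ℝ) : ℂ) := by
    rw [Complex.ofReal_sum, Finset.sum_filter, ← Finset.sum_sub_distrib]
    refine Finset.sum_congr rfl fun n _ => ?_
    split_ifs with h
    · have h0 : χ n ≠ 0 := by
        have hu : IsUnit ((n : ZMod q)) := (ZMod.isUnit_iff_coprime n q).2 h
        exact (hu.map χ).ne_zero
      rcases eq_or_ne (Λ n) 0 with h2 | h2
      · simp [twistBy, h2]
      · simp [twistBy, hχ n h2 h0]
    · rw [twistBy, dirichletCharacter_natCast_eq_zero χ h]; simp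
  have h2 := hN.bad q (NeZero.ne q) ⌊x⌋₊
  have h3 : 0 ≤ ∑ n ∈ Finset.Icc 1 ⌊x⌋₊ with ¬ n.Coprime q, Λ n :=
    Finset.sum_nonneg fun n _ => hN.lam_nonneg n
  have h4 : (Nat.log 2 ⌊x⌋₊ : ℝ) ≤ 2 * u ^ 2 := by
    have hfl : ⌊x⌋₊ ≠ 0 := (Nat.floor_pos.2 hx1).ne'
    have : (2 : ℝ) ^ Nat.log 2 ⌊x⌋₊ ≤ x := by
      have := Nat.pow_log_le_self 2 hfl
      exact (by exact_mod_cast this : (2 : ℝ) ^ Nat.log 2 ⌊x⌋₊ ≤ ⌊x⌋₊).trans (Nat.floor_le hx.le)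
    have h5 := Real.log_le_log (by positivity) this
    rw [Real.log_pow, hlog] at h5
    have h6 := Real.log_two_gt_d9
    nlinarith [(Nat.cast_nonneg (Nat.log 2 ⌊x⌋₊) : (0 : ℝ) ≤ _)]
  have hq0 : (0 : ℝ) < q := by exact_mod_cast Nat.pos_of_ne_zero (NeZero.ne q)
  have h5 : Real.log q ≤ m * u ^ 2 := by
    calc Real.log q ≤ Real.log ((u ^ 2) ^ m) := Real.log_le_log hq0 hq
      _ = m * Real.log (u ^ 2) := Real.log_rpow (by positivity) m
      _ ≤ m * u ^ 2 := by
        gcongr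
        linarith [Real.log_le_sub_one_of_pos (by positivity : 0 < u ^ 2)]
  have hlq : 0 ≤ Real.log q := Real.log_nonneg (by
    exact_mod_cast Nat.one_le_iff_ne_zero.2 (NeZero.ne q))
  have h6 : u ^ 2 * u ^ 2 ≤ 65536 * (x * Real.exp (-C * u)) := by
    have h7 := sq_mul_exp_neg_le (β := 1 / 4) (u := u) (by norm_num) hu0.le
    have h8 : u ^ 2 ≤ 256 * Real.exp (u / 8) := by
      have := mul_le_mul_of_nonneg_right h7 (Real.exp_pos (u / 4)).le
      rw [mul_assoc, ← Real.exp_add, mul_assoc, ← Real.exp_add] at this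
      ring_nf at this ⊢
      simpa using this
    calc u ^ 2 * u ^ 2 ≤ (256 * Real.exp (u / 8)) * (256 * Real.exp (u / 8)) := by gcongr
      _ = 65536 * Real.exp (u / 4) := by
        rw [show u / 4 = u / 8 + u / 8 by ring, Real.exp_add]; ring
      _ ≤ _ := by
        rw [show x = Real.exp (u ^ 2) by rw [← hlog, Real.exp_log hx], ← Real.exp_add]
        gcongr
        nlinarith
  rw [h1, sub_right_comm]
  refine (norm_sub_le _ _).trans ?_
  rw [Complex.norm_real, Real.norm_of_nonneg h3]
  have h7 : (Nat.log 2 ⌊x⌋₊ : ℝ) * (A * Real.log q) ≤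
      2 * A * m * 65536 * (x * Real.exp (-C * u)) := by
    calc _ ≤ 2 * u ^ 2 * (A * (m * u ^ 2)) := by gcongr
      _ = 2 * A * m * (u ^ 2 * u ^ 2) := by ring
      _ ≤ 2 * A * m * (65536 * (x * Real.exp (-C * u))) := by gcongr
      _ = _ := by ring
  linarith [hpnt x u hx hu hlog, h2.trans h7]

end SiegelWalfisz

section Density
open Filter Topology

variable {r Λ : ℕ → ℝ} {A δ κ : ℝ}

/-- The logarithmic derivative near a zero of order `m`. -/
lemma exists_tendsto_mul_logDeriv {f : ℂ → ℂ} {z₀ : ℂ} (hf : AnalyticAt ℂ f z₀)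
    (hf0 : ¬ ∀ᶠ z in 𝓝 z₀, f z = 0) :
    ∃ m : ℕ, Tendsto (fun z => (z - z₀) * logDeriv f z) (𝓝[≠] z₀) (𝓝 m) ∧
      (m = 1 → f z₀ = 0 ∧ deriv f z₀ ≠ 0) ∧ (f z₀ ≠ 0 → m = 0) := by
  obtain ⟨g, hg, hg0, hfg⟩ := (hf.analyticOrderAt_ne_top).1
    (fun h => hf0 (analyticOrderAt_eq_top.1 h))
  set m := analyticOrderNatAt f z₀ with hm
  refine ⟨m, ?_, fun h1 => ?_, fun h1 => ?_⟩
  · have hlim : Tendsto (fun z => (m : ℂ) + (z - z₀) * logDeriv g z) (𝓝[≠] z₀) (𝓝 m) := by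
      have hc : ContinuousAt (fun z => (m : ℂ) + (z - z₀) * logDeriv g z) z₀ := by
        have : ContinuousAt (logDeriv g) z₀ := (hg.deriv.div hg hg0).continuousAt
        fun_prop
      have := hc.tendsto
      simp only [sub_self, zero_mul, add_zero] at this
      exact this.mono_left nhdsWithin_le_nhds
    refine hlim.congr' ?_
    have e1 := (eventually_eventually_nhds.2 hfg)
    have e2 := hg.eventually_analyticAt
    have e3 := hg.continuousAt.eventually_ne hg0
    filter_upwards [nhdsWithin_le_nhds e1, nhdsWithin_le_nhds e2, nhdsWithin_le_nhds e3,
      self_mem_nhdsWithin] with z h1 h2 h3 h4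
    have h5 : z - z₀ ≠ 0 := sub_ne_zero.2 h4
    have h6 : logDeriv f z = logDeriv (fun z => (z - z₀) ^ m * g z) z := by
      have h7 : f =ᶠ[𝓝 z] fun z => (z - z₀) ^ m * g z := h1
      rw [logDeriv_apply, logDeriv_apply, h7.deriv_eq, h7.eq_of_nhds]
    rw [h6, logDeriv_mul (f := fun z => (z - z₀) ^ m) z (pow_ne_zero _ h5) h3 (by fun_prop)
      h2.differentiableAt, logDeriv_fun_pow (by fun_prop)]
    have h8 : logDeriv (fun z => z - z₀) z = 1 / (z - z₀) := by simp [logDeriv_apply]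
    rw [h8]
    field_simp
  · rw [h1] at hfg
    have h7 : f =ᶠ[𝓝 z₀] fun z => (z - z₀) ^ 1 * g z := hfg
    refine ⟨by rw [h7.eq_of_nhds]; simp, ?_⟩
    have h8 : HasDerivAt (fun z => (z - z₀) ^ 1 * g z) (g z₀) z₀ := by
      have := ((hasDerivAt_id z₀).sub_const z₀).mul hg.differentiableAt.hasDerivAt
      simp only [id, sub_self, zero_mul, one_mul, add_zero] at this
      simp only [pow_one]
      exact this
    rw [h7.deriv_eq, h8.deriv]
    exact hg0
  · by_contra h2
    refine h1 ?_
    rw [hfg.self_of_nhds]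
    simp [h2]

lemma tendsto_ofReal_nhdsGT_one : Tendsto (fun σ : ℝ => (σ : ℂ)) (𝓝[>] 1) (𝓝[≠] 1) := by
  refine tendsto_nhdsWithin_iff.2 ⟨?_, ?_⟩
  · have := (Complex.continuous_ofReal.tendsto (1 : ℝ))
    simp only [Complex.ofReal_one] at this
    exact this.mono_left nhdsWithin_le_nhds
  · filter_upwards [self_mem_nhdsWithin] with σ hσ
    have : (1 : ℝ) < σ := hσ
    simp only [Set.mem_compl_iff, Set.mem_singleton_iff]
    exact_mod_cast this.ne'

/-- The density of primes weighted by a twist is an integer. -/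
lemma TwistPair.exists_density {a D : ℕ → ℂ} {c : ℂ} {Q : ℝ} (h : NormSystem r Λ A δ κ)
    (ht : TwistPair Λ a D) (hb : SumBound a c Q δ) :
    ∃ e : ℤ, Tendsto (fun σ : ℝ => ((σ : ℂ) - 1) * LSeries D σ) (𝓝[>] 1) (𝓝 e) ∧ e ≤ 1 ∧
      (e = 0 → c = 0 ∧ gfun a 1 ≠ 0) ∧ (c ≠ 0 → e = 1) := by
  have hδ := h.δ_pos
  have hδ1 := h.δ_le
  have han : AnalyticAt ℂ (lfun a c) 1 := by
    refine DifferentiableOn.analyticAt (s := {z : ℂ | 1 - δ < z.re})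
      (fun z hz => (differentiableAt_lfun hb hδ1 hz).differentiableWithinAt) ?_
    exact (isOpen_lt continuous_const Complex.continuous_re).mem_nhds (by simpa using hδ)
  have hne : ¬ ∀ᶠ z in 𝓝 (1 : ℂ), lfun a c z = 0 := by
    intro h0
    have h1 := (tendsto_ofReal_nhdsGT_one.mono_right nhdsWithin_le_nhds).eventually h0
    obtain ⟨σ, h2, h3⟩ := (h1.and self_mem_nhdsWithin).exists
    exact ht.lfun_ne_zero h hb hδ (by simpa using h3) h2
  obtain ⟨m, hm, hm1, hm0⟩ := exists_tendsto_mul_logDeriv han hne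
  refine ⟨1 - m, ?_, by linarith [Int.natCast_nonneg m], fun h0 => ?_, fun hc => ?_⟩
  · have h1 := (tendsto_const_nhds (x := (1 : ℂ))).sub (hm.comp tendsto_ofReal_nhdsGT_one)
    push_cast
    refine h1.congr' ?_
    filter_upwards [self_mem_nhdsWithin] with σ hσ
    have hσ1 : 1 < (σ : ℂ).re := by simpa using hσ
    have h2 : (σ : ℂ) - 1 ≠ 0 := by
      have : (1 : ℝ) < σ := hσ
      exact sub_ne_zero.2 (by exact_mod_cast this.ne')
    rw [Function.comp_apply, ht.logDeriv_lfun h hb hδ hσ1]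
    field_simp
    ring
  · obtain ⟨h2, h3⟩ := hm1 (by linarith)
    rw [lfun_one] at h2
    subst h2
    refine ⟨rfl, ?_⟩
    have h4 : HasDerivAt (fun s => (s - 1) * gfun a s) (gfun a 1) 1 := by
      have := ((hasDerivAt_id (1 : ℂ)).sub_const 1).mul
        (differentiableAt_gfun hb hδ1 (s := 1) (by simpa using hδ)).hasDerivAt
      simp only [id, sub_self, zero_mul, one_mul, add_zero] at this
      exact this
    rwa [show lfun a 0 = fun s => (s - 1) * gfun a s from funext (lfun_zero_eq a),
      h4.deriv] at h3
  · rw [hm0 (by rwa [lfun_one])]; simp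

end Density

section Dichotomy
open Filter Topology

variable {r Λ : ℕ → ℝ} {A δ κ : ℝ}

lemma tendsto_mul_of_norm_le {f : ℝ → ℂ} {B : ℝ} (hf : ∀ σ, 1 < σ → σ ≤ 2 → ‖f σ‖ ≤ B) :
    Tendsto (fun σ : ℝ => ((σ : ℂ) - 1) * f σ) (𝓝[>] 1) (𝓝 0) := by
  have h1 : Tendsto (fun σ : ℝ => (σ - 1) * B) (𝓝[>] 1) (𝓝 0) := by
    have : ContinuousAt (fun σ : ℝ => (σ - 1) * B) 1 := by fun_prop
    have := this.tendsto
    simp only [sub_self, zero_mul] at this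
    exact this.mono_left nhdsWithin_le_nhds
  refine squeeze_zero_norm' ?_ h1
  have h2 : ∀ᶠ σ : ℝ in 𝓝[>] 1, σ ≤ 2 := nhdsWithin_le_nhds (eventually_le_nhds (by norm_num))
  filter_upwards [self_mem_nhdsWithin, h2] with σ h3 h4
  have h3 : 1 < σ := h3
  rw [norm_mul, ← Complex.ofReal_one, ← Complex.ofReal_sub, Complex.norm_real,
    Real.norm_of_nonneg (by linarith)]
  exact mul_le_mul_of_nonneg_left (hf σ h3 h4) (by linarith)

lemma norm_LSeries_le_of_summable_one {f : ℕ → ℂ} (hf : LSeriesSummable f 1) {σ : ℝ}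
    (hσ : 1 < σ) : ‖LSeries f σ‖ ≤ ∑' n, ‖LSeries.term f 1 n‖ := by
  refine tsum_of_norm_bounded hf.norm.hasSum fun n => ?_
  exact LSeries.norm_term_le_of_re_le_re f (by simpa using hσ.le) n

lemma re_LSeries_ofReal_nonneg {f : ℕ → ℂ} {σ : ℝ} (hf : LSeriesSummable f σ)
    (h0 : ∀ n, n ≠ 0 → 0 ≤ (f n).re) : 0 ≤ (LSeries f σ).re := by
  rw [LSeries, Complex.re_tsum hf]
  refine tsum_nonneg fun n => ?_
  rcases eq_or_ne n 0 with rfl | hn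
  · simp
  rw [LSeries.term_of_ne_zero hn, ← Complex.ofReal_natCast,
    ← Complex.ofReal_cpow (Nat.cast_nonneg n), Complex.div_ofReal_re]
  exact div_nonneg (h0 n hn) (Real.rpow_nonneg (Nat.cast_nonneg n) σ)

/-- If the characters in `X` are trivial on the support of `Λ` and account for all of the density
of the class of `1`, then the `L`-functions of the other characters do not vanish at `1`. -/
theorem NormSystem.goodChar_of_density (hN : NormSystem r Λ A δ κ) {q : ℕ} [NeZero q]
    {X : Finset (DirichletCharacter ℂ q)} (hX : ∀ χ ∈ X, TrivChar Λ χ) {g : ℕ} (hg : 0 < g)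
    (hcard : g * X.card = q.totient)
    (hW : Tendsto (fun σ : ℝ => ((σ : ℂ) - 1) *
      LSeries (fun n => if (n : ZMod q) = 1 then (Λ n : ℂ) else 0) σ) (𝓝[>] 1) (𝓝 (1 / g)))
    {χ : DirichletCharacter ℂ q} (hχ : χ ∉ X) : GoodChar r A δ χ := by
  choose c hc hb using fun χ : DirichletCharacter ℂ q => hN.twist q χ
  choose e he1 he2 he3 he4 using fun χ : DirichletCharacter ℂ q =>
    (hN.twistPair χ).exists_density hN (hb χ)
  obtain ⟨e₀, h1, -, -, h4⟩ := hN.twistPair_self.exists_density hN hN.count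
  have he₀ : e₀ = 1 := h4 (by exact_mod_cast hN.κ_pos.ne')
  rw [he₀, Int.cast_one] at h1
  set W : ℕ → ℂ := fun n => if (n : ZMod q) = 1 then (Λ n : ℂ) else 0 with hWdef
  have hWs : ∀ σ : ℝ, 1 < σ → LSeriesSummable W σ := fun σ hσ =>
    summable_of_norm_le (b := Λ) (fun n _ => by
      simp only [hWdef]
      split_ifs
      · simp [abs_of_nonneg (hN.lam_nonneg n)]
      · simpa using hN.lam_nonneg n) (hN.summable_lam (by simpa using hσ))
  have hDs : ∀ (χ : DirichletCharacter ℂ q) (σ : ℝ), 1 < σ → LSeriesSummable (twistBy Λ χ) σ :=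
    fun χ σ hσ => (hN.twistPair χ).summable_D hN (by simpa using hσ)
  have hΛs : ∀ σ : ℝ, 1 < σ → LSeriesSummable (fun n => (Λ n : ℂ)) σ :=
    fun σ hσ => hN.summable_lam (by simpa using hσ)
  have hone : ∀ χ ∈ X, e χ = 1 := by
    intro χ hχ
    set E : ℕ → ℂ := fun n => if n.Coprime q then 0 else (Λ n : ℂ) with hE
    have hEs : LSeriesSummable E 1 := by
      refine hN.summable_of_not_coprime (NeZero.ne q) (B := 1) (fun n => ?_) (fun n hn => ?_)
        (by simp)
      · simp only [hE]
        split_ifs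
        · simpa using hN.lam_nonneg n
        · simp [abs_of_nonneg (hN.lam_nonneg n)]
      · simp [hE, hn]
    have h5 := tendsto_mul_of_norm_le (f := fun σ => LSeries E σ)
      (fun σ hσ _ => norm_LSeries_le_of_summable_one hEs hσ)
    have h6 := h1.sub h5
    rw [sub_zero] at h6
    have h7 : Tendsto (fun σ : ℝ => ((σ : ℂ) - 1) * LSeries (twistBy Λ χ) σ) (𝓝[>] 1) (𝓝 1) := by
      refine h6.congr' ?_
      filter_upwards [self_mem_nhdsWithin] with σ hσ
      rw [← mul_sub]
      congr 1
      have hEσ : LSeriesSummable E σ :=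
        hEs.of_re_le_re (by simpa using (show (1 : ℝ) < σ from hσ).le)
      rw [← LSeries_sub (hΛs σ hσ) hEσ]
      refine LSeries_congr (fun {n} hn => ?_) _
      simp only [Pi.sub_apply, hE, twistBy]
      split_ifs with h
      · have h0 : χ n ≠ 0 := (((ZMod.isUnit_iff_coprime n q).2 h).map χ).ne_zero
        rcases eq_or_ne (Λ n) 0 with h2 | h2
        · simp [h2]
        · simp [hX χ hχ n h2 h0]
      · rw [dirichletCharacter_natCast_eq_zero χ h]; simp
    have h8 := tendsto_nhds_unique (he1 χ) h7
    exact_mod_cast h8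
  have hsum : ∑ χ : DirichletCharacter ℂ q, e χ = X.card := by
    have h5 := tendsto_finsetSum Finset.univ fun χ _ => he1 χ
    have h6 := hW.const_mul (q.totient : ℂ)
    have h7 : (fun σ : ℝ => ∑ χ : DirichletCharacter ℂ q, ((σ : ℂ) - 1) * LSeries (twistBy Λ χ) σ)
        =ᶠ[𝓝[>] 1] fun σ : ℝ => (q.totient : ℂ) * (((σ : ℂ) - 1) * LSeries W σ) := by
      filter_upwards [self_mem_nhdsWithin] with σ hσ
      rw [← Finset.mul_sum, mul_left_comm, ← LSeries_smul, ← LSeries_sum fun χ _ => hDs χ σ hσ]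
      congr 1
      refine LSeries_congr (fun {n} hn => ?_) _
      simp only [Finset.sum_apply, twistBy, ← Finset.sum_mul, Pi.smul_apply, smul_eq_mul, hWdef]
      rw [DirichletCharacter.sum_characters_eq]
      split_ifs <;> simp
    have h8 := tendsto_nhds_unique (h5.congr' h7) h6
    have h9 : (q.totient : ℂ) * (1 / g) = X.card := by
      rw [← hcard]
      have : (g : ℂ) ≠ 0 := by exact_mod_cast hg.ne'
      push_cast
      field_simp
    rw [h9] at h8
    exact_mod_cast h8
  have hnonneg : ∀ χ, 0 ≤ e χ := by
    intro χ
    have h5 := (h1.add (he1 χ)).sub (hW.const_mul 2)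
    have h6 := (Complex.continuous_re.tendsto _).comp h5
    have h7 := ge_of_tendsto h6 (b := 0) (by
      filter_upwards [self_mem_nhdsWithin] with σ hσ
      have hσ' : 1 < σ := hσ
      have h8 : (((σ : ℂ) - 1) * LSeries (fun n => (Λ n : ℂ)) σ +
          ((σ : ℂ) - 1) * LSeries (twistBy Λ χ) σ - 2 * (((σ : ℂ) - 1) * LSeries W σ)) =
          ((σ - 1 : ℝ) : ℂ) * LSeries ((fun n => (Λ n : ℂ)) + twistBy Λ χ - (2 : ℂ) • W) σ := by
        rw [LSeries_sub ((hΛs σ hσ).add (hDs χ σ hσ)) ((hWs σ hσ).smul _),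
          LSeries_add (hΛs σ hσ) (hDs χ σ hσ), LSeries_smul]
        push_cast
        ring
      rw [Function.comp_apply, h8, Complex.re_ofReal_mul]
      refine mul_nonneg (by linarith) (re_LSeries_ofReal_nonneg
        (((hΛs σ hσ).add (hDs χ σ hσ)).sub ((hWs σ hσ).smul _)) fun n _ => ?_)
      simp only [Pi.sub_apply, Pi.add_apply, Pi.smul_apply, smul_eq_mul, hWdef, twistBy]
      split_ifs with hn
      · rw [hn, map_one]
        simp
        linarith
      · have h9 : -1 ≤ (χ n).re := by
          have := (abs_le.1 ((Complex.abs_re_le_norm (χ n)).trans (χ.norm_le_one n))).1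
          exact this
        simp
        nlinarith [hN.lam_nonneg n])
    have h8 : ((1 : ℂ) + (e χ : ℂ) - 2 * (1 / g)).re = 1 + (e χ : ℝ) - 2 * (1 / g) := by
      have : ((1 : ℂ) + (e χ : ℂ) - 2 * (1 / g)) = ((1 + (e χ : ℝ) - 2 * (1 / g) : ℝ) : ℂ) := by
        push_cast; ring
      rw [this, Complex.ofReal_re]
    rw [h8] at h7
    have h9 : (0 : ℝ) < 1 / g := by positivity
    have : (-1 : ℝ) < e χ := by linarith
    have : -1 < e χ := by exact_mod_cast this
    omega
  have hzero : e χ = 0 := by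
    have h5 := Finset.sum_add_sum_compl X e
    rw [hsum, Finset.sum_congr rfl hone] at h5
    have h6 : ∑ χ ∈ Xᶜ, e χ = 0 := by simpa using h5
    exact (Finset.sum_eq_zero_iff_of_nonneg fun χ _ => hnonneg χ).1 h6 χ (by simpa using hχ)
  obtain ⟨h5, h6⟩ := he3 χ hzero
  have h7 := hb χ
  rw [h5] at h7
  exact ⟨h7, h6⟩

end Dichotomy

section Thin
open Module
variable {K : Type*} [Field K] [NumberField K]

lemma exists_prime_of_idealLambda_ne_zero {n : ℕ} (h : idealLambda K n ≠ 0) :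
    ∃ (P : Ideal (𝓞 K)) (m : ℕ), P.IsPrime ∧ P ≠ ⊥ ∧ m ≠ 0 ∧ absNorm P ^ m = n := by
  obtain ⟨I, hI, hI0⟩ := Finset.exists_ne_zero_of_sum_ne_zero h
  rw [mem_idealsNormEq] at hI
  rw [LambdaK, ite_ne_right_iff] at hI0
  obtain ⟨⟨P, m, hP, hP0, hm, rfl⟩, -⟩ := hI0
  exact ⟨P, m, hP, hP0, by omega, by rw [← hI, map_pow]⟩

lemma isPrimePow_absNorm {P : Ideal (𝓞 K)} (hP : P.IsPrime) (hP0 : P ≠ ⊥) :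
    IsPrimePow (absNorm P) := by
  have : P.IsMaximal := hP.isMaximal hP0
  let _ := Ideal.Quotient.field P
  let _ := Fintype.ofFinite (𝓞 K ⧸ P)
  have := Fintype.isPrimePow_card_of_field (α := 𝓞 K ⧸ P)
  rwa [← Nat.card_eq_fintype_card] at this

lemma isPrimePow_of_idealLambda_ne_zero {n : ℕ} (h : idealLambda K n ≠ 0) : IsPrimePow n := by
  obtain ⟨P, m, hP, hP0, hm, rfl⟩ := exists_prime_of_idealLambda_ne_zero h
  exact (isPrimePow_absNorm hP hP0).pow hm

lemma idealLambda_prime {p : ℕ} (hp : p.Prime) :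
    idealLambda K p = (idealsNormEq K p).card * Real.log p := by
  rw [idealLambda, ← nsmul_eq_mul]
  refine Finset.sum_eq_card_nsmul fun I hI => ?_
  rw [mem_idealsNormEq] at hI
  have h1 : I.IsPrime := Ideal.isPrime_of_irreducible_absNorm (by rw [hI]; exact hp)
  have h2 : I ≠ ⊥ := by
    rintro rfl
    exact hp.ne_zero (by simpa using hI.symm)
  rw [← pow_one I, LambdaK_prime_pow h1 h2 one_ne_zero, hI]

lemma exists_sq_mul_cube {n : ℕ} (h : IsPrimePow n) (hn : ¬ n.Prime) :
    ∃ a b : ℕ, a ^ 2 * b ^ 3 = n := by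
  obtain ⟨p, k, hp, hk, rfl⟩ := h
  have hp : p.Prime := hp.nat_prime
  have hk1 : k ≠ 1 := by
    rintro rfl
    exact hn (by simpa using hp)
  obtain ⟨i, rfl | rfl⟩ := Nat.even_or_odd' k
  · exact ⟨p ^ i, 1, by ring⟩
  · obtain ⟨j, rfl⟩ : ∃ j, i = j + 1 := ⟨i - 1, by omega⟩
    exact ⟨p ^ j, p, by ring⟩

lemma idealLambda_le_rpow :
    ∃ C : ℝ, 0 ≤ C ∧ ∀ n : ℕ, idealLambda K n ≤ C * (n : ℝ) ^ (1 / 4 : ℝ) := by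
  refine ⟨64 * finrank ℚ K / Real.log 2, by positivity, fun n => ?_⟩
  by_cases hn : idealLambda K n = 0
  · rw [hn]
    positivity
  have h2 : 2 ≤ n := (isPrimePow_of_idealLambda_ne_zero hn).two_le
  have h1 := sum_idealLambda_not_coprime (K := K) (q := n) (by omega) n
  have h3 : idealLambda K n ≤ ∑ m ∈ Finset.Icc 1 n with ¬ m.Coprime n, idealLambda K m := by
    refine Finset.single_le_sum (f := idealLambda K) (fun i _ => idealLambda_nonneg i) ?_
    simp
    omega
  have h4 : (Nat.log 2 n : ℝ) ≤ Real.log n / Real.log 2 := by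
    have := Real.natLog_le_logb n 2
    rwa [Real.logb] at this
  have h5 : Real.log n ≤ 8 * (n : ℝ) ^ (1 / 8 : ℝ) := by
    have := Real.log_le_rpow_div (Nat.cast_nonneg n) (show (0 : ℝ) < 1 / 8 by norm_num)
    linarith
  have h6 : (0 : ℝ) ≤ Real.log n := Real.log_natCast_nonneg n
  have h7 : (n : ℝ) ^ (1 / 4 : ℝ) = (n : ℝ) ^ (1 / 8 : ℝ) * (n : ℝ) ^ (1 / 8 : ℝ) := by
    rw [← Real.rpow_add (by positivity)]
    norm_num
  have hl : 0 < Real.log 2 := Real.log_pos (by norm_num)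
  calc idealLambda K n ≤ _ := h3.trans h1
    _ ≤ (8 * (n : ℝ) ^ (1 / 8 : ℝ) / Real.log 2) * (finrank ℚ K * (8 * (n : ℝ) ^ (1 / 8 : ℝ))) := by
        gcongr
        exact h4.trans (by gcongr)
    _ = _ := by
        rw [h7]
        ring

/-- The prime powers that are not primes contribute a convergent series at `1`. -/
lemma summable_idealLambda_not_prime :
    LSeriesSummable (fun n => if n.Prime then 0 else (idealLambda K n : ℂ)) 1 := by
  obtain ⟨C, hC, hle⟩ := idealLambda_le_rpow (K := K)
  let g : ℕ × ℕ → ℝ := fun z => C * ((z.1 : ℝ) ^ (-(3 / 2) : ℝ) * (z.2 : ℝ) ^ (-(9 / 4) : ℝ))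
  have hg : Summable g := by
    have ha : Summable fun n : ℕ => (n : ℝ) ^ (-(3 / 2) : ℝ) :=
      Real.summable_nat_rpow.2 (by norm_num)
    have hb : Summable fun n : ℕ => (n : ℝ) ^ (-(9 / 4) : ℝ) :=
      Real.summable_nat_rpow.2 (by norm_num)
    exact (ha.mul_of_nonneg hb (fun n => Real.rpow_nonneg n.cast_nonneg _)
      (fun n => Real.rpow_nonneg n.cast_nonneg _)).mul_left C
  let S : Set ℕ := {n | IsPrimePow n ∧ ¬ n.Prime}
  have hS : ∀ n : S, ∃ z : ℕ × ℕ, z.1 ^ 2 * z.2 ^ 3 = (n : ℕ) := fun n => by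
    obtain ⟨a, b, h⟩ := exists_sq_mul_cube n.2.1 n.2.2
    exact ⟨(a, b), h⟩
  choose z hz using hS
  have hinj : Function.Injective z := fun m n h => Subtype.ext (by rw [← hz m, ← hz n, h])
  have h1 : Summable fun n : S => g (z n) := hg.comp_injective hinj
  unfold LSeriesSummable
  rw [← Function.Injective.summable_iff (Subtype.val_injective (p := (· ∈ S)))]
  · refine Summable.of_norm_bounded h1 fun n => ?_
    have hn0 : (n : ℕ) ≠ 0 := n.2.1.ne_zero
    have hn : (0 : ℝ) < (n : ℕ) := by positivity
    rw [Function.comp_apply, LSeries.norm_term_eq, if_neg hn0, if_neg n.2.2, Complex.norm_real,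
      Real.norm_of_nonneg (idealLambda_nonneg _), Complex.one_re, Real.rpow_one]
    have ha : (0 : ℝ) ≤ (z n).1 := by positivity
    have hb : (0 : ℝ) ≤ (z n).2 := by positivity
    have h2 : g (z n) = C * ((n : ℕ) : ℝ) ^ (-(3 / 4) : ℝ) := by
      simp only [g]
      rw [← hz n]
      push_cast
      rw [Real.mul_rpow (by positivity) (by positivity), ← Real.rpow_natCast, ← Real.rpow_natCast,
        ← Real.rpow_mul ha, ← Real.rpow_mul hb]
      norm_num
    rw [h2, div_le_iff₀ hn, mul_assoc, ← Real.rpow_add_one hn.ne']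
    have h3 := hle n
    rwa [show (1 / 4 : ℝ) = -(3 / 4) + 1 by norm_num] at h3
  · intro n hn
    rw [Subtype.range_coe_subtype] at hn
    rw [LSeries.term_def]
    split_ifs with h0 hp
    · rfl
    · simp
    · have : idealLambda K n = 0 := by
        by_contra h3
        exact hn ⟨isPrimePow_of_idealLambda_ne_zero h3, hp⟩
      simp [this]

end Thin

section Split
open scoped Pointwise
variable {K L : Type*} [Field K] [Field L] [NumberField L]

lemma natCast_zmod_eq_one_of_absNorm {q : ℕ} [NeZero q] {ζ : 𝓞 L} (hζ : IsPrimitiveRoot ζ q)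
    {P : Ideal (𝓞 L)} (hP : P.IsPrime) (hP0 : P ≠ ⊥) (hq : (absNorm P).Coprime q) :
    ((absNorm P : ℕ) : ZMod q) = 1 := by
  have : P.IsMaximal := hP.isMaximal hP0
  let _ := Ideal.Quotient.field P
  have hP1 : absNorm P ≠ 1 := absNorm_eq_one_iff.not.2 hP.ne_top
  have h1 := hζ.idealQuotient_mk hP1 hq
  have h2 : (Ideal.Quotient.mk P ζ) ^ (Nat.card (𝓞 L ⧸ P) - 1) = 1 := by
    let _ := Fintype.ofFinite (𝓞 L ⧸ P)
    rw [Nat.card_eq_fintype_card]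
    exact FiniteField.pow_card_sub_one_eq_one _ (h1.ne_zero (NeZero.ne q))
  have h3 : q ∣ absNorm P - 1 := h1.dvd_of_pow_eq_one _ h2
  have h4 : 1 ≤ absNorm P := by linarith [absNorm_prime_two_le hP hP0]
  have h5 := (ZMod.natCast_eq_zero_iff _ _).2 h3
  rw [Nat.cast_sub h4, Nat.cast_one] at h5
  exact sub_eq_zero.1 h5

variable [Algebra K L]

lemma eq_one_of_smul_eq {q : ℕ} [NeZero q] {ζ : 𝓞 L} (hζ : IsPrimitiveRoot ζ q)
    (hgen : ∀ σ : Gal(L/K), σ • ζ = ζ → σ = 1) {p : ℕ} (hp : p.Prime) (hpq : (p : ZMod q) = 1)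
    {P : Ideal (𝓞 L)} (hP : P.IsPrime) (hP0 : P ≠ ⊥) (hpP : (p : 𝓞 L) ∈ P)
    {σ : Gal(L/K)} (hσ : σ • P = P) : σ = 1 := by
  have : P.IsMaximal := hP.isMaximal hP0
  let _ := Ideal.Quotient.field P
  have : Fact p.Prime := ⟨hp⟩
  have hP1 : absNorm P ≠ 1 := absNorm_eq_one_iff.not.2 hP.ne_top
  have hch : CharP (𝓞 L ⧸ P) p := by
    refine (CharP.charP_iff_prime_eq_zero hp).2 ?_
    rw [← map_natCast (Ideal.Quotient.mk P)]
    exact Ideal.Quotient.eq_zero_iff_mem.2 hpP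
  have hcop : (absNorm P).Coprime q := by
    by_contra h
    have h1 := natCast_mem_of_not_coprime hP hP0 h
    have h2 : p.Coprime q := (ZMod.isUnit_iff_coprime p q).1 (hpq ▸ isUnit_one)
    have h3 : IsCoprime (p : 𝓞 L) (q : 𝓞 L) := by
      simpa using (Nat.isCoprime_iff_coprime.2 h2).map (Int.castRingHom (𝓞 L))
    obtain ⟨a, b, hab⟩ := h3
    exact hP.ne_top ((Ideal.eq_top_iff_one P).2
      (hab ▸ P.add_mem (P.mul_mem_left a hpP) (P.mul_mem_left b h1)))
  have h1 := hζ.idealQuotient_mk hP1 hcop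
  have h2 : (Ideal.Quotient.mk P ζ) ^ p = Ideal.Quotient.mk P ζ := by
    have : q ∣ p - 1 := by
      rw [← ZMod.natCast_eq_zero_iff, Nat.cast_sub hp.one_le, hpq]
      simp
    obtain ⟨k, hk⟩ := this
    rw [show p = q * k + 1 by have := hp.one_le; omega, pow_succ, pow_mul, h1.pow_eq_one]
    simp
  rw [← Subfield.mem_bot_iff_pow_eq_self, mem_bot_iff_intCast p] at h2
  obtain ⟨z, hz⟩ := h2
  have h3 : ζ - z ∈ P := by
    rw [← Ideal.Quotient.eq_zero_iff_mem]
    simp [hz]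
  have h4 : σ • ζ - z ∈ P := by
    have := Ideal.smul_mem_pointwise_smul σ _ P h3
    rw [hσ] at this
    rwa [smul_sub, show σ • (z : 𝓞 L) = z from
      map_intCast (MulSemiringAction.toRingHom _ (𝓞 L) σ) z] at this
  have h5 : σ • ζ - ζ ∈ P := by
    have := P.sub_mem h4 h3
    simpa using this
  have hpr : IsPrimitiveRoot (σ • ζ) q := by
    exact hζ.map_of_injective (f := MulSemiringAction.toRingEquiv _ (𝓞 L) σ) (RingEquiv.injective _)
  refine hgen σ ?_
  obtain ⟨i, hi, hi2⟩ := hζ.eq_pow_of_pow_eq_one hpr.pow_eq_one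
  have h6 : (Ideal.Quotient.mk P ζ) ^ i = Ideal.Quotient.mk P ζ := by
    rw [← map_pow, hi2]
    exact Ideal.Quotient.eq.2 h5
  rcases (Nat.one_le_iff_ne_zero.2 (NeZero.ne q)).eq_or_lt with hq | hq
  · subst hq
    rw [IsPrimitiveRoot.one_right_iff] at hζ
    simp [hζ]
  · have h7 : i = 1 := h1.pow_inj hi hq (by rw [h6, pow_one])
    rw [← hi2, h7, pow_one]

variable [NumberField K] [IsGalois K L]

/-- A prime ideal of prime norm `p ≡ 1 mod q` splits completely. -/
lemma primesOver_of_absNorm_eq {q : ℕ} [NeZero q] {ζ : 𝓞 L} (hζ : IsPrimitiveRoot ζ q)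
    (hgen : ∀ σ : Gal(L/K), σ • ζ = ζ → σ = 1) {p : ℕ} (hp : p.Prime) (hpq : (p : ZMod q) = 1)
    {Q : Ideal (𝓞 K)} (hQ : absNorm Q = p) :
    (primesOver Q (𝓞 L)).ncard = Nat.card Gal(L/K) ∧
      ∀ P ∈ primesOver Q (𝓞 L), absNorm P = p := by
  have hQp : Q.IsPrime := Ideal.isPrime_of_irreducible_absNorm (by rw [hQ]; exact hp)
  have hQ0 : Q ≠ ⊥ := by
    rintro rfl
    exact hp.ne_zero (by simpa using hQ.symm)
  have hQm : Q.IsMaximal := hQp.isMaximal hQ0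
  have hid := ncard_primesOver_mul_ramificationIdxIn_mul_inertiaDegIn Q (𝓞 L) Gal(L/K)
  have hfin : (primesOver Q (𝓞 L)).Finite := Algebra.QuasiFinite.finite_primesOver Q
  have hmem : ∀ P ∈ primesOver Q (𝓞 L), (p : 𝓞 L) ∈ P := by
    rintro P ⟨hP, hPQ⟩
    have h1 : (p : 𝓞 K) ∈ Q := hQ ▸ Ideal.absNorm_mem Q
    have h2 := (Ideal.mem_of_liesOver P Q _).1 h1
    simpa using h2
  have hbot : ∀ P ∈ primesOver Q (𝓞 L), P ≠ ⊥ := by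
    rintro P ⟨hP, hPQ⟩
    exact Ideal.ne_bot_of_liesOver_of_ne_bot hQ0 P
  have hle : Nat.card Gal(L/K) ≤ (primesOver Q (𝓞 L)).ncard := by
    obtain ⟨P⟩ : Nonempty (primesOver Q (𝓞 L)) := inferInstance
    have : Finite (primesOver Q (𝓞 L)) := hfin
    rw [← Nat.card_coe_set_eq]
    refine Nat.card_le_card_of_injective 
      (fun σ : Gal(L/K) => primesOver.mk Q (σ • P.1)) fun σ τ h => ?_
    have h1 : (τ⁻¹ * σ) • P.1 = P.1 := by
      rw [mul_smul, show σ • P.1 = τ • P.1 from congrArg Subtype.val h, inv_smul_smul]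
    have h2 := eq_one_of_smul_eq hζ hgen hp hpq P.2.1 (hbot P P.2) (hmem P P.2) h1
    exact (inv_mul_eq_one.1 h2).symm
  have hpos : 0 < Nat.card Gal(L/K) := Nat.card_pos
  have hef : ramificationIdxIn Q (𝓞 L) * inertiaDegIn Q (𝓞 L) = 1 := by
    have h1 : ramificationIdxIn Q (𝓞 L) * inertiaDegIn Q (𝓞 L) ≠ 0 := by
      intro h
      rw [h] at hid
      omega
    by_contra h2
    have h3 : 2 ≤ ramificationIdxIn Q (𝓞 L) * inertiaDegIn Q (𝓞 L) := by omega
    nlinarith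
  refine ⟨by rw [hef, mul_one] at hid; exact hid, fun P hP => ?_⟩
  obtain ⟨hPp, hPQ⟩ := hP
  have hPm : P.IsMaximal := hPp.isMaximal (hbot P ⟨hPp, hPQ⟩)
  rw [Ideal.absNorm_eq_pow_inertiaDeg'_of_liesOver P Q hQp hQ0, Ideal.inertiaDeg'_eq_inertiaDeg,
    ← Ideal.inertiaDegIn_eq_inertiaDeg Q P Gal(L/K), Nat.eq_one_of_mul_eq_one_left hef, hQ, pow_one]

/-- The ideals of prime norm `p ∤ q` of an extension generated by a primitive `q`-th root of
unity. -/
lemma card_idealsNormEq_prime {q : ℕ} [NeZero q] {ζ : 𝓞 L} (hζ : IsPrimitiveRoot ζ q)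
    (hgen : ∀ σ : Gal(L/K), σ • ζ = ζ → σ = 1) {p : ℕ} (hp : p.Prime) (hpq : p.Coprime q) :
    (idealsNormEq L p).card =
      if (p : ZMod q) = 1 then Nat.card Gal(L/K) * (idealsNormEq K p).card else 0 := by
  have hprime : ∀ P ∈ idealsNormEq L p, P.IsPrime ∧ P ≠ ⊥ := by
    intro P hP
    rw [mem_idealsNormEq] at hP
    refine ⟨Ideal.isPrime_of_irreducible_absNorm (by rw [hP]; exact hp), ?_⟩
    rintro rfl
    exact hp.ne_zero (by simpa using hP.symm)
  split_ifs with h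
  · rw [Finset.card_eq_sum_card_fiberwise (f := fun P => P.under (𝓞 K)) (t := idealsNormEq K p)]
    · rw [mul_comm, ← smul_eq_mul]
      refine Finset.sum_eq_card_nsmul fun Q hQ => ?_
      rw [mem_idealsNormEq] at hQ
      obtain ⟨h1, h2⟩ := primesOver_of_absNorm_eq (L := L) hζ hgen hp h hQ
      rw [← h1, ← Set.ncard_coe_finset]
      congr 1
      ext P
      rw [Finset.mem_coe, Finset.mem_filter]
      constructor
      · rintro ⟨h3, h4⟩
        exact ⟨(hprime P h3).1, ⟨h4.symm⟩⟩
      · intro h3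
        exact ⟨mem_idealsNormEq.2 (h2 P h3), h3.2.over.symm⟩
    · intro P hP
      obtain ⟨h1, h2⟩ := hprime P hP
      have h3 : absNorm P = p := mem_idealsNormEq.1 hP
      simp only [Finset.mem_coe, mem_idealsNormEq]
      have hQ0 : P.under (𝓞 K) ≠ ⊥ := Ideal.under_ne_bot _ h2
      have h4 := Ideal.absNorm_eq_pow_inertiaDeg'_of_liesOver P (P.under (𝓞 K)) inferInstance hQ0
      rw [h3] at h4
      exact (hp.pow_eq_iff.1 h4.symm).1
  · rw [Finset.card_eq_zero, Finset.eq_empty_iff_forall_notMem]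
    intro P hP
    obtain ⟨h1, h2⟩ := hprime P hP
    rw [mem_idealsNormEq] at hP
    have := natCast_zmod_eq_one_of_absNorm hζ h1 h2 (hP ▸ hpq)
    rw [hP] at this
    exact h this

end Split

section Cyclotomic
open Filter Topology
variable {K L : Type*} [Field K] [NumberField K] [Field L] [NumberField L] [Algebra K L]
  [IsGalois K L]

/-- The von Mangoldt functions of `K` and of an extension generated by a primitive `q`-th root
of unity agree, in the residue class `1 mod q`, up to a convergent series. -/
lemma summable_idealLambda_sub {q : ℕ} [NeZero q] {ζ : 𝓞 L} (hζ : IsPrimitiveRoot ζ q)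
    (hgen : ∀ σ : Gal(L/K), σ • ζ = ζ → σ = 1) :
    LSeriesSummable (fun n => (idealLambda L n : ℂ) -
      Nat.card Gal(L/K) * (if (n : ZMod q) = 1 then (idealLambda K n : ℂ) else 0)) 1 := by
  set g := Nat.card Gal(L/K) with hg
  have h1 := (summable_idealLambda_not_prime (K := L)).norm
  have h2 := (summable_idealLambda_not_prime (K := K)).norm.mul_left (g : ℝ)
  refine Summable.of_norm_bounded_eventually_nat (h1.add h2) ?_
  filter_upwards [eventually_gt_atTop q] with n hn
  have hn0 : n ≠ 0 := by omega
  simp only [LSeries.norm_term_eq, if_neg hn0, Complex.one_re, Real.rpow_one]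
  rw [← mul_div_assoc, ← add_div]
  refine div_le_div_of_nonneg_right ?_ (Nat.cast_nonneg n)
  by_cases hp : n.Prime
  · have hc : n.Coprime q := hp.coprime_iff_not_dvd.2 fun h =>
      absurd (Nat.le_of_dvd (NeZero.pos q) h) (by omega)
    rw [idealLambda_prime hp, idealLambda_prime hp, card_idealsNormEq_prime hζ hgen hp hc]
    simp only [if_pos hp]
    rw [← hg]
    split_ifs
    · push_cast
      simp [mul_assoc]
    · simp
  · simp only [if_neg hp]
    refine (norm_sub_le _ _).trans ?_
    rw [norm_mul, Complex.norm_natCast]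
    gcongr
    split_ifs <;> simp

lemma tendsto_residue_class_one {q : ℕ} [NeZero q] {ζ : 𝓞 L} (hζ : IsPrimitiveRoot ζ q)
    (hgen : ∀ σ : Gal(L/K), σ • ζ = ζ → σ = 1) :
    Tendsto (fun σ : ℝ => ((σ : ℂ) - 1) *
      LSeries (fun n => if (n : ZMod q) = 1 then (idealLambda K n : ℂ) else 0) σ)
      (𝓝[>] 1) (𝓝 (1 / Nat.card Gal(L/K))) := by
  have hsum := summable_idealLambda_sub hζ hgen
  set g := Nat.card Gal(L/K) with hg
  have hg0 : (g : ℂ) ≠ 0 := by exact_mod_cast (Nat.card_pos (α := Gal(L/K))).ne'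
  set w : ℕ → ℂ := fun n => if (n : ZMod q) = 1 then (idealLambda K n : ℂ) else 0 with hw
  obtain ⟨A, δ, κ, hK⟩ := exists_normSystem K
  obtain ⟨A', δ', κ', hL⟩ := exists_normSystem L
  obtain ⟨e, he, -, -, h4⟩ := hL.twistPair_self.exists_density hL hL.count
  have he1 : e = 1 := h4 (by exact_mod_cast hL.κ_pos.ne')
  rw [he1, Int.cast_one] at he
  have h0 := tendsto_mul_of_norm_le fun σ h _ => norm_LSeries_le_of_summable_one hsum (σ := σ) h
  have h5 := (he.sub h0).div_const (g : ℂ)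
  rw [sub_zero] at h5
  refine h5.congr' ?_
  filter_upwards [self_mem_nhdsWithin] with σ hσ
  have hσ' : 1 < (σ : ℂ).re := by simpa using hσ
  have hwS : LSeriesSummable w σ := by
    refine summable_of_norm_le (fun n _ => ?_) (hK.summable_lam hσ')
    simp only [hw]
    split_ifs
    · simp [abs_of_nonneg (idealLambda_nonneg n)]
    · simpa using idealLambda_nonneg n
  have h6 : LSeries (fun n => (idealLambda L n : ℂ) - g * w n) σ =
      LSeries (fun n => (idealLambda L n : ℂ)) σ - g * LSeries w σ := by
    have := LSeries_sub (hL.summable_lam hσ') (hwS.smul (g : ℂ))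
    rw [LSeries_smul] at this
    simpa [Pi.sub_def] using this
  rw [h6]
  field_simp
  ring

/-- The Frobenius element at a prime not dividing `q`. -/
lemma exists_autToPow_eq {q : ℕ} [NeZero q] {μ : L} (hμ : IsPrimitiveRoot μ q)
    {Q : Ideal (𝓞 K)} (hQ : Q.IsPrime) (hQ0 : Q ≠ ⊥) (hq : (absNorm Q).Coprime q) :
    ∃ σ : Gal(L/K), (hμ.autToPow K σ : ZMod q) = (absNorm Q : ℕ) := by
  obtain ⟨P⟩ : Nonempty (primesOver Q (𝓞 L)) := inferInstance
  obtain ⟨P, hP, hPQ⟩ := P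
  have hP0 : P ≠ ⊥ := Ideal.ne_bot_of_liesOver_of_ne_bot hQ0 P
  have hPm : P.IsMaximal := hP.isMaximal hP0
  obtain ⟨σ, hσ⟩ := IsArithFrobAt.exists_of_isInvariant (𝓞 K) Gal(L/K) P
  have hζ := hμ.toInteger_isPrimitiveRoot
  have hqP : (q : 𝓞 L) ∉ P := by
    intro h
    have h1 : (q : 𝓞 K) ∈ Q := by
      rw [Ideal.mem_of_liesOver P Q]
      simpa using h
    have h2 : ((absNorm Q : ℕ) : 𝓞 K) ∈ Q := Ideal.absNorm_mem Q
    have h3 : IsCoprime ((absNorm Q : ℕ) : 𝓞 K) (q : 𝓞 K) := by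
      simpa using (Nat.isCoprime_iff_coprime.2 hq).map (Int.castRingHom (𝓞 K))
    obtain ⟨a, b, hab⟩ := h3
    exact hQ.ne_top ((Ideal.eq_top_iff_one Q).2
      (hab ▸ Q.add_mem (Q.mul_mem_left a h2) (Q.mul_mem_left b h1)))
  have h1 : σ • hμ.toInteger = hμ.toInteger ^ absNorm Q := by
    have := AlgHom.IsArithFrobAt.apply_of_pow_eq_one hσ hζ.pow_eq_one hqP
    rwa [← hPQ.over] at this
  have h2 : σ μ = μ ^ absNorm Q := by
    have := congrArg (algebraMap (𝓞 L) L) h1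
    rw [map_pow] at this
    exact this
  refine ⟨σ, ?_⟩
  rw [← hμ.autToPow_spec K σ, (hμ.isOfFinOrder (NeZero.ne q)).pow_eq_pow_iff_modEq,
    ← hμ.eq_orderOf, ← ZMod.natCast_eq_natCast_iff, ZMod.natCast_zmod_val] at h2
  exact h2

/-- The annihilator of a subgroup `H` of `(ℤ/qℤ)ˣ` has index `|H|` in the character group. -/
lemma card_mul_card_annihilator {q : ℕ} [NeZero q] (H : Subgroup (ZMod q)ˣ) :
    Nat.card H * (Finset.univ.filter fun χ : DirichletCharacter ℂ q =>
      ∀ a ∈ H, χ (a : ZMod q) = 1).card = q.totient := by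
  have h1 : ∀ χ : DirichletCharacter ℂ q, ∑ h : H, χ ((h : (ZMod q)ˣ) : ZMod q) =
      if ∀ a ∈ H, χ (a : ZMod q) = 1 then (Nat.card H : ℂ) else 0 := by
    intro χ
    have := sum_hom_units ((χ.toMonoidHom.comp (Units.coeHom (ZMod q))).comp H.subtype)
    rw [← Nat.card_eq_fintype_card, Nat.cast_ite, Nat.cast_zero] at this
    refine this.trans (if_congr ?_ rfl rfl)
    rw [MonoidHom.ext_iff]
    exact ⟨fun h a ha => h ⟨a, ha⟩, fun h a => h a a.2⟩
  have h2 : ∑ χ : DirichletCharacter ℂ q, ∑ h : H, χ ((h : (ZMod q)ˣ) : ZMod q) = q.totient := by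
    rw [Finset.sum_comm, Finset.sum_eq_single (1 : H)]
    · rw [DirichletCharacter.sum_characters_eq, if_pos (by simp)]
    · intro h _ h1
      rw [DirichletCharacter.sum_characters_eq, if_neg]
      intro h2
      exact h1 (Subtype.ext (Units.ext h2))
    · simp
  rw [Finset.sum_congr rfl fun χ _ => h1 χ, ← Finset.sum_filter, Finset.sum_const,
    nsmul_eq_mul, mul_comm] at h2
  exact_mod_cast h2

/-- A character trivial on the norms of the primes not dividing `q` is trivial on the support of
the von Mangoldt function. -/
lemma trivChar_of_forall_autToPow {q : ℕ} [NeZero q] {μ : L} (hμ : IsPrimitiveRoot μ q)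
    {χ : DirichletCharacter ℂ q} (hχ : ∀ a ∈ (hμ.autToPow K).range, χ (a : ZMod q) = 1) :
    TrivChar (idealLambda K) χ := by
  intro n hn hχn
  obtain ⟨P, m, hP, hP0, hm, rfl⟩ := exists_prime_of_idealLambda_ne_zero hn
  have hc : (absNorm P).Coprime q := by
    by_contra h
    refine hχn ?_
    rw [Nat.cast_pow, map_pow, dirichletCharacter_natCast_eq_zero χ h, zero_pow hm]
  obtain ⟨σ, hσ⟩ := exists_autToPow_eq hμ hP hP0 hc
  rw [Nat.cast_pow, map_pow, ← hσ, hχ _ ⟨σ, rfl⟩, one_pow]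

end Cyclotomic

section Dichotomy
variable (K : Type*) [Field K] [NumberField K]

lemma Gq_eq (q : ℕ) [NeZero q] :
    Gq K q = ((IsCyclotomicExtension.zeta_spec q K (CyclotomicField q K)).autToPow K).range := by
  rw [Gq, dif_pos (NeZero.pos q)]

lemma trivChar_of_forall_Gq {q : ℕ} [NeZero q] {χ : DirichletCharacter ℂ q}
    (hχ : ∀ a ∈ Gq K q, χ (a : ZMod q) = 1) : TrivChar (idealLambda K) χ := by
  have : IsGalois K (CyclotomicField q K) := IsCyclotomicExtension.isGalois {q} K _
  rw [Gq_eq] at hχ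
  exact trivChar_of_forall_autToPow _ hχ

lemma goodChar_of_not_forall_Gq {A δ κ : ℝ}
    (hN : NormSystem (fun n => (idealCount K n : ℝ)) (idealLambda K) A δ κ)
    {q : ℕ} [NeZero q] {χ : DirichletCharacter ℂ q}
    (hχ : ¬ ∀ a ∈ Gq K q, χ (a : ZMod q) = 1) :
    GoodChar (fun n => (idealCount K n : ℝ)) A δ χ := by
  have : IsGalois K (CyclotomicField q K) := IsCyclotomicExtension.isGalois {q} K _
  have hμ := IsCyclotomicExtension.zeta_spec q K (CyclotomicField q K)
  have hinj := hμ.autToPow_injective K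
  have hcard : Nat.card Gal(CyclotomicField q K/K) = Nat.card (Gq K q) := by
    rw [Gq_eq]
    exact Nat.card_congr (MonoidHom.ofInjective hinj).toEquiv
  have hgen : ∀ σ : Gal(CyclotomicField q K/K), σ • hμ.toInteger = hμ.toInteger → σ = 1 := by
    intro σ h
    have h1 : σ (IsCyclotomicExtension.zeta q K (CyclotomicField q K)) =
        IsCyclotomicExtension.zeta q K (CyclotomicField q K) :=
      congrArg (algebraMap (𝓞 (CyclotomicField q K)) (CyclotomicField q K)) h
    refine AlgEquiv.coe_toAlgHom_injective ((hμ.powerBasis K).algHom_ext ?_)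
    rw [IsPrimitiveRoot.powerBasis_gen]
    simpa using h1
  refine hN.goodChar_of_density (X := Finset.univ.filter fun χ : DirichletCharacter ℂ q =>
      ∀ a ∈ Gq K q, χ (a : ZMod q) = 1) (fun χ h => trivChar_of_forall_Gq K (by simpa using h))
    (g := Nat.card (Gq K q)) Nat.card_pos (card_mul_card_annihilator _) ?_ (by simpa using hχ)
  rw [← hcard]
  exact tendsto_residue_class_one hμ.toInteger_isPrimitiveRoot hgen

/-- The norm system of a number field satisfies the dichotomy between trivial and good
characters. -/
theorem NormSystem.charSystem {A δ κ : ℝ}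
    (hN : NormSystem (fun n => (idealCount K n : ℝ)) (idealLambda K) A δ κ) :
    CharSystem (fun n => (idealCount K n : ℝ)) (idealLambda K) A δ κ := by
  refine ⟨hN, fun q _ χ => ?_⟩
  by_cases h : ∀ a ∈ Gq K q, χ (a : ZMod q) = 1
  · exact Or.inl (trivChar_of_forall_Gq K h)
  · exact Or.inr (goodChar_of_not_forall_Gq K hN h)

end Dichotomy

/-- **Small moduli bound (Lemma 3).**
For fixed `M > 0` there is `C > 0` (depending on `K` and `M`) such that for all `x ≥ 2`,
all `1 ≤ q ≤ (log x)^{M+1}` and all Dirichlet characters `χ` mod `q`,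
`|ψ'_K(x, χ∘N)| ≪ x exp(−C √(log x))`, the implied constant depending only on `K` and `M`. -/
theorem psiKChi'_bound_small_moduli (K : Type*) [Field K] [NumberField K] [IsGalois ℚ K]
    (M : ℝ) (hM : 0 < M) :
    ∃ C : ℝ, 0 < C ∧ ∃ c : ℝ, 0 < c ∧ ∀ x : ℝ, 2 ≤ x → ∀ q : ℕ, 1 ≤ q →
      (q : ℝ) ≤ Real.log x ^ (M + 1) → ∀ χ : DirichletCharacter ℂ q,
        ‖psiKChi' K x χ‖ ≤ c * (x * Real.exp (-C * Real.sqrt (Real.log x))) := by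
  obtain ⟨A, δ, κ, hN⟩ := exists_normSystem K
  have hs : CharSystem (fun n => (idealCount K n : ℝ)) (idealLambda K) A δ κ :=
    hN.charSystem K
  obtain ⟨C₁, E₁, hC₁, hE₁, hgood⟩ := hs.exists_good_bound (m := M + 1) (by linarith)
  obtain ⟨C₂, E₂, hC₂, hE₂, htriv⟩ := hN.exists_triv_bound (m := M + 1) (by linarith)
  refine ⟨min C₁ C₂, lt_min hC₁ hC₂, max E₁ E₂ + 1, by positivity, fun x hx q hq hqx χ => ?_⟩
  have : NeZero q := ⟨by omega⟩
  have hx0 : 0 < x := by linarith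
  have hlog0 : 0 < Real.log x := Real.log_pos (by linarith)
  have hlog : 1 ≤ Real.log x := by
    by_contra h
    have h1 := Real.rpow_lt_one hlog0.le (not_le.1 h) (show 0 < M + 1 by linarith)
    have h2 : (1 : ℝ) ≤ q := by exact_mod_cast hq
    linarith
  set u := Real.sqrt (Real.log x) with hu
  have hu1 : 1 ≤ u := Real.one_le_sqrt.2 hlog
  have hu2 : Real.log x = u ^ 2 := (Real.sq_sqrt hlog0.le).symm
  rw [hu2] at hqx
  have hsum : psiKChi K x χ = ∑ n ∈ Finset.Icc 1 ⌊x⌋₊, twistBy (idealLambda K) χ n :=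
    psiKChi_eq_sum hx0.le χ
  have key : ∀ {E C : ℝ}, 0 ≤ E → min C₁ C₂ ≤ C → E ≤ max E₁ E₂ →
      E * (x * Real.exp (-C * u)) ≤
        (max E₁ E₂ + 1) * (x * Real.exp (-(min C₁ C₂) * u)) := by
    intro E C hE hC hE'
    gcongr
    linarith
  rw [psiKChi', hsum]
  split_ifs with h
  · exact (htriv x u hx0 hu1 hu2 q χ hqx (trivChar_of_forall_Gq K h)).trans
      (key hE₂ (min_le_right _ _) (le_max_right _ _))
  · exact (hgood x u hx0 hu1 hu2 q χ hqx (goodChar_of_not_forall_Gq K hN h)).trans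
      (key hE₁ (min_le_left _ _) (le_max_left _ _))
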